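/- Let n ≥ 2 be an integer, let Γ ∈ 𝒰, and let K be a homogeneous Calderón–Zygmund kernel on ℝ^n. Suppose 2 ≤ r < ∞ and 2(n+1)/(n−1) < p < ∞. Then there exist constants 𝒞 ≥ 1 and C, depending only on n, Γ, K, p, r, such that for all integers l ≥ 1, m, and k with |k − m| ≤ 𝒞, and every Schwartz function f on ℝ^n, one has ‖𝓗_{j,l}P_{k−j_*}f‖_{W_{r,p}(j∈S_{l,m})} ≤ C · 2^{−n(m+l)/p} ‖f‖_{L^p(ℝ^n)}, where 𝓗_{j,l}P_{k−j_*}f(u,x) := χ(u) H_{l+j_*}^{(2^j u)}(P_{k−j_*}f)(x), and C is independent of k, m, l. -/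

import Mathlib

open MeasureTheory Filter Set
open scoped ENNReal NNReal FourierTransform Topology

noncomputable section

/-- `ℝⁿ` as a Euclidean space. -/
abbrev Rn (n : ℕ) := EuclideanSpace ℝ (Fin n)

/-- The class `𝒰` of phase functions: `Γ` is continuous on `[0,∞)`, smooth on `(0,∞)`,
`Γ(0) = 0`, `Γ′ > 0` on `(0,∞)`, with the bounds `c_{1,j} ≤ |s^j Γ^{(j)}(s)/Γ(s)|` for
`j = 1, 2` and `|s^j Γ^{(j)}(s)/Γ(s)| ≤ c_{2,j}` for all `j ≥ 1`. -/
structure IsGammaU (Γ : ℝ → ℝ) : Prop where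
  continuousOn : ContinuousOn Γ (Set.Ici 0)
  smooth : ContDiffOn ℝ (⊤ : ℕ∞) Γ (Set.Ioi 0)
  map_zero : Γ 0 = 0
  deriv_pos : ∀ s > (0 : ℝ), 0 < deriv Γ s
  lower : ∀ j ∈ ({1, 2} : Set ℕ), ∃ c > (0 : ℝ), ∀ s > (0 : ℝ),
    c ≤ |s ^ j * iteratedDeriv j Γ s / Γ s|
  upper : ∀ j : ℕ, 1 ≤ j → ∃ c > (0 : ℝ), ∀ s > (0 : ℝ),
    |s ^ j * iteratedDeriv j Γ s / Γ s| ≤ c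

/-- `K` is a homogeneous Calderón–Zygmund kernel on `ℝⁿ`: `K(t) = Ω(t)/‖t‖ⁿ` with `Ω` smooth
away from the origin, homogeneous of degree `0`, and of mean value zero on the unit sphere. -/
def IsHomCZKernel (n : ℕ) (K : Rn n → ℝ) : Prop :=
  ∃ Ω : Rn n → ℝ,
    ContDiffOn ℝ (⊤ : ℕ∞) Ω {x : Rn n | x ≠ 0} ∧
    (∀ c : ℝ, 0 < c → ∀ t : Rn n, Ω (c • t) = Ω t) ∧
    (∫ θ : Metric.sphere (0 : Rn n) 1, Ω θ ∂((volume : Measure (Rn n)).toSphere) = 0) ∧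
    (∀ t : Rn n, t ≠ 0 → K t = Ω t / ‖t‖ ^ n)

/-- The `r`-variation of a family `(a_u)_{u ∈ 𝒦}`. -/
def variation {ι : Type*} [LinearOrder ι] (r : ℝ) (𝒦 : Set ι) (a : ι → ℂ) : ℝ≥0∞ :=
  ⨆ (J : ℕ) (u : Fin (J + 1) → ι) (_ : StrictMono u) (_ : ∀ i, u i ∈ 𝒦),
    (∑ i : Fin J, (‖a (u i.succ) - a (u i.castSucc)‖₊ : ℝ≥0∞) ^ r) ^ (1 / r)

/-- The `λ`-jump counting function of a family `(a_u)_{u ∈ 𝒦}`. -/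
def jumpCount {ι : Type*} [LinearOrder ι] (lam : ℝ) (𝒦 : Set ι) (a : ι → ℂ) : ℝ≥0∞ :=
  ⨆ (J : ℕ) (s : Fin J → ι) (t : Fin J → ι) (_ : ∀ i, s i ∈ 𝒦) (_ : ∀ i, t i ∈ 𝒦)
    (_ : ∀ i, s i < t i) (_ : ∀ i j : Fin J, i < j → t i < s j)
    (_ : ∀ i, lam < ‖a (t i) - a (s i)‖), (J : ℝ≥0∞)

/-- The `L^p` norm of an `ℝ≥0∞`-valued function. -/
def lpNormENN {α : Type*} [MeasurableSpace α] (p : ℝ) (g : α → ℝ≥0∞) (μ : Measure α) : ℝ≥0∞ :=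
  (∫⁻ x, g x ^ p ∂μ) ^ (1 / p)

/-- The fixed Littlewood–Paley cutoff `ψ : ℝ → [0,1]`, supported in `{1/2 ≤ |s| ≤ 2}`,
with `∑_{l ∈ ℤ} ψ(2^{-l} s) = 1` for `s ≠ 0`. -/
def IsLPCutoff (ψ : ℝ → ℝ) : Prop :=
  ContDiff ℝ (⊤ : ℕ∞) ψ ∧ (∀ s, ψ s ∈ Set.Icc (0 : ℝ) 1) ∧
    (∀ s, ψ s ≠ 0 → |s| ∈ Set.Icc (1/2 : ℝ) 2) ∧
    (∀ s : ℝ, s ≠ 0 → HasSum (fun l : ℤ => ψ ((2 : ℝ) ^ (-l) * s)) 1)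

/-- `k_* = sup{ m ∈ ℤ : 2^k Γ(2^m) ≤ 1 }`. -/
def kstar (Γ : ℝ → ℝ) (k : ℤ) : ℤ :=
  sSup {m : ℤ | (2 : ℝ) ^ k * Γ ((2 : ℝ) ^ m) ≤ 1}

/-- The localized modulated integral `H_l^{(u)} f(x) = ∫ f(x−t) e^{iuΓ(|t|)} ψ_l(t) K(t) dt`. -/
def Hloc {n : ℕ} (Γ : ℝ → ℝ) (K : Rn n → ℝ) (ψ : ℝ → ℝ) (u : ℝ) (l : ℤ)
    (f : Rn n → ℂ) (x : Rn n) : ℂ :=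
  ∫ t : Rn n, f (x - t) * Complex.exp (Complex.I * Complex.ofReal (u * Γ ‖t‖)) *
    Complex.ofReal (ψ ((2 : ℝ) ^ (-l) * ‖t‖) * K t)

/-- The fixed cutoff `χ : ℝ → [0,1]`, supported in `[1/2, 4]` and equal to `1` on `[1,2]`. -/
def IsChiCutoff (χ : ℝ → ℝ) : Prop :=
  ContDiff ℝ (⊤ : ℕ∞) χ ∧ (∀ u, χ u ∈ Set.Icc (0 : ℝ) 1) ∧
    (∀ u, χ u ≠ 0 → u ∈ Set.Icc (1/2 : ℝ) 4) ∧ (∀ u ∈ Set.Icc (1 : ℝ) 2, χ u = 1)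

/-- The Littlewood–Paley piece `Δ_i g` (`i ≥ 0`) on `ℝ`. -/
def deltaHigh (ψ : ℝ → ℝ) (i : ℕ) (g : ℝ → ℂ) : ℝ → ℂ :=
  𝓕⁻ fun τ : ℝ => Complex.ofReal (ψ ((2 : ℝ) ^ (-(i : ℤ)) * |τ|)) * 𝓕 g τ

/-- The low-frequency piece `Δ_{-1} g` on `ℝ`. -/
def deltaLow (ψ : ℝ → ℝ) (g : ℝ → ℂ) : ℝ → ℂ :=
  𝓕⁻ fun τ : ℝ => Complex.ofReal (1 - ∑' i : ℕ, ψ ((2 : ℝ) ^ (-(i : ℤ)) * |τ|)) * 𝓕 g τ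

/-- The Besov norm `‖g‖_{B_{r,1}^{1/r}(ℝ)} = ‖Δ_{-1}g‖_{L^r} + ∑_{i≥0} 2^{i/r} ‖Δ_i g‖_{L^r}`. -/
def besovNorm (ψ : ℝ → ℝ) (r : ℝ) (g : ℝ → ℂ) : ℝ≥0∞ :=
  eLpNorm (deltaLow ψ g) (ENNReal.ofReal r) volume +
    ∑' i : ℕ, ENNReal.ofReal ((2 : ℝ) ^ ((i : ℝ) / r)) *
      eLpNorm (deltaHigh ψ i g) (ENNReal.ofReal r) volume

/-- The Littlewood–Paley projection `P_j` on `ℝⁿ`, `(P_j f)^(ξ) = ψ(2^{-j}|ξ|) f̂(ξ)`. -/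
def LPproj {n : ℕ} (ψ : ℝ → ℝ) (j : ℤ) (f : Rn n → ℂ) : Rn n → ℂ :=
  𝓕⁻ fun ξ : Rn n => Complex.ofReal (ψ ((2 : ℝ) ^ (-j) * ‖ξ‖)) * 𝓕 f ξ

/-- The index set `S_{l,m} = { j ∈ ℤ : 2^{m+l} ≤ Γ(2^{l+j_*})/Γ(2^{j_*}) < 2^{m+l+1} }`. -/
def Slm (Γ : ℝ → ℝ) (l m : ℤ) : Set ℤ :=
  {j : ℤ | (2 : ℝ) ^ (m + l) ≤ Γ ((2 : ℝ) ^ (l + kstar Γ j)) / Γ ((2 : ℝ) ^ (kstar Γ j)) ∧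
    Γ ((2 : ℝ) ^ (l + kstar Γ j)) / Γ ((2 : ℝ) ^ (kstar Γ j)) < (2 : ℝ) ^ (m + l + 1)}

open scoped SchwartzMap ComplexConjugate Real
set_option linter.unusedSectionVars false
open Finset (sum_congr measurable_fun_sum sum_le_sum mul_sum sum_mul)
open ENNReal (tsum_le_tsum tsum_mul_left tsum_mul_right zero_rpow_of_pos rpow_one ofReal ofReal_mul ofReal_ne_top ofReal_le_ofReal mul_ne_top rpow_le_rpow mul_rpow_of_nonneg rpow_mul ofReal_toReal ofReal_one toReal_nonneg ofReal_pow rpow_ne_top_of_nonneg ofReal_add ofReal_rpow_of_pos toReal_ofReal rpow_add_of_nonneg ofReal_rpow_of_nonneg ofReal_ofNat toReal_pos)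
open Real (fourier_eq' fourierInv_eq' norm_eq_abs pi_gt_three cos sin norm_of_nonneg rpow_natCast pi_pos)
open Function (comp_def uncurry)
open EuclideanSpace (single)
open SchwartzMap (fourier_coe fourierInv_coe)
open Complex (norm_real norm_exp_ofReal_mul_I real_smul exp_add I exp)
open Metric (sphere closedBall)

/-- The function `g` vanishes outside the annulus `1/2 ≤ ‖t‖ ≤ 2`. -/
abbrev AnnulusSupported {n : ℕ} (g : Rn n → ℂ) : Prop := ∀ t, g t ≠ 0 → 1 / 2 ≤ ‖t‖ ∧ ‖t‖ ≤ 2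

/-- The function `g` vanishes outside the annulus `lam/2 ≤ ‖ξ‖ ≤ 2 lam`. -/
abbrev DyadicSupported {n : ℕ} (lam : ℝ) (g : Rn n → ℂ) : Prop := ∀ ξ, g ξ ≠ 0 → lam / 2 ≤ ‖ξ‖ ∧ ‖ξ‖ ≤ 2 * lam

section Plancherel
variable {V : Type*} [NormedAddCommGroup V] [InnerProductSpace ℝ V] [FiniteDimensional ℝ V]
  [MeasurableSpace V] [BorelSpace V]

theorem continuous_fourier_of_integrable {f : V → ℂ} (hf : Integrable f) : Continuous (𝓕 f) :=
  VectorFourier.fourierIntegral_continuous Real.continuous_fourierChar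
      (by exact continuous_inner) hf

theorem fourier_toLp_ae_eq {f : V → ℂ} (hf : Integrable f) (hf2 : MemLp f 2) :
    ((𝓕 (hf2.toLp f) : Lp ℂ 2 (volume : Measure V)) : V → ℂ) =ᵐ[volume] 𝓕 f := by
  apply ae_eq_of_integral_contDiff_smul_eq
  · exact (Lp.memLp _).locallyIntegrable (by norm_num)
  · exact (continuous_fourier_of_integrable hf).locallyIntegrable
  intro g hg hgc
  set G : 𝓢(V, ℂ) := (hgc.comp_left (g := ((↑) : ℝ → ℂ)) (by simp)).toSchwartzMap
    (by exact (Complex.ofRealCLM.contDiff.comp hg)) with hG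
  have hGa : ∀ x, G x = (g x : ℂ) := fun x => rfl
  have h1 := congrArg (fun T : TemperedDistribution V ℂ => T G)
    (Lp.fourier_toTemperedDistribution_eq (hf2.toLp f))
  simp only [TemperedDistribution.fourier_apply, Lp.toTemperedDistribution_apply] at h1
  have h2 : ∫ x, (𝓕 G) x • (hf2.toLp f : V → ℂ) x = ∫ x, (𝓕 G) x • f x := by
    apply integral_congr_ae
    filter_upwards [hf2.coeFn_toLp] with x hx
    rw [hx]
  rw [h2] at h1
  have h3 : ∫ x, (𝓕 (G : V → ℂ)) x • f x = ∫ x, G x • 𝓕 f x := by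
    simpa using! (VectorFourier.integral_fourierIntegral_smul_eq_flip (L := innerₗ V)
      (μ := volume) (ν := volume)
      Real.continuous_fourierChar continuous_inner G.integrable hf)
  rw [fourier_coe] at h1
  rw [h3] at h1
  calc ∫ x, g x • ((𝓕 (hf2.toLp f) : Lp ℂ 2 (volume : Measure V)) : V → ℂ) x
      = ∫ x, G x • ((𝓕 (hf2.toLp f) : Lp ℂ 2 (volume : Measure V)) : V → ℂ) x := by
        simp [hGa]
    _ = _ := h1.symm
    _ = _ := by simp [hGa]

theorem eLpNorm_fourier_two {f : V → ℂ} (hf : Integrable f) (hf2 : MemLp f 2) :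
    eLpNorm (𝓕 f) 2 volume = eLpNorm f 2 volume := by
  rw [← eLpNorm_congr_ae (fourier_toLp_ae_eq hf hf2), ← eLpNorm_congr_ae hf2.coeFn_toLp,
    ← Lp.enorm_def, ← Lp.enorm_def, enorm_eq_iff_norm_eq, Lp.norm_fourier_eq]

theorem lintegral_enorm_sq_eq {α : Type*} [MeasurableSpace α] {μ : Measure α} (f : α → ℂ) :
    ∫⁻ x, ‖f x‖ₑ ^ 2 ∂μ = eLpNorm f 2 μ ^ 2 := by
  rw [eLpNorm_eq_lintegral_rpow_enorm_toReal (by norm_num) (by norm_num)]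
  rw [← ENNReal.rpow_natCast, ← rpow_mul]
  simp

theorem memLp_two_of_lintegral {α : Type*} [MeasurableSpace α] {μ : Measure α} {f : α → ℂ}
    (hf : AEStronglyMeasurable f μ) (h : ∫⁻ x, ‖f x‖ₑ ^ 2 ∂μ < ∞) : MemLp f 2 μ := by
  refine ⟨hf, ?_⟩
  rw [lintegral_enorm_sq_eq] at h
  by_contra hc
  simp only [not_lt, top_le_iff] at hc
  simp [hc] at h

theorem lintegral_fourier_sq_eq {f : V → ℂ} (hf : Integrable f) (h : ∫⁻ x, ‖f x‖ₑ ^ 2 ≠ ∞) :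
    ∫⁻ ξ, ‖𝓕 f ξ‖ₑ ^ 2 = ∫⁻ x, ‖f x‖ₑ ^ 2 := by
  have hf2 := memLp_two_of_lintegral hf.1 h.lt_top
  rw [lintegral_enorm_sq_eq, lintegral_enorm_sq_eq, eLpNorm_fourier_two hf hf2]

/-- Plancherel inequality for integrable functions. -/
theorem lintegral_fourier_sq_le {f : V → ℂ} (hf : Integrable f) :
    ∫⁻ ξ, ‖𝓕 f ξ‖ₑ ^ 2 ≤ ∫⁻ x, ‖f x‖ₑ ^ 2 := by
  by_cases h : ∫⁻ x, ‖f x‖ₑ ^ 2 = ∞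
  · simp [h]
  · exact (lintegral_fourier_sq_eq hf h).le

theorem lintegral_fourierInv_sq_le {f : V → ℂ} (hf : Integrable f) :
    ∫⁻ ξ, ‖𝓕⁻ f ξ‖ₑ ^ 2 ≤ ∫⁻ x, ‖f x‖ₑ ^ 2 := by
  have := lintegral_fourier_sq_le hf
  rw [← lintegral_neg_eq_self] at this
  simpa [Real.fourierInv_eq_fourier_neg] using this
end Plancherel

section Polar
variable {n : ℕ} [Fact (2 ≤ n)]

instance Rn.instNontrivial : Nontrivial (Rn n) := by
  have : 2 ≤ n := Fact.out
  have : Nonempty (Fin n) := ⟨⟨0, by omega⟩⟩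
  infer_instance

/-- Surface measure on the unit sphere of `ℝⁿ`. -/
abbrev sph (n : ℕ) : Measure (sphere (0 : Rn n) 1) := (volume : Measure (Rn n)).toSphere

theorem two_le_dim : (2 : ℝ) ≤ n := by exact_mod_cast (Fact.out : 2 ≤ n)

theorem one_lt_of_exponent_lt {P : ℝ} (hP : ((n : ℝ) + 1) / (n - 1) < P) : 1 < P := by
  have hn := two_le_dim (n := n)
  exact lt_of_le_of_lt (by rw [le_div_iff₀ (by linarith)]; linarith) hP

theorem lintegral_volumeIoiPow (k : ℕ) {g : ℝ → ℝ≥0∞} (hg : Measurable g) :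
    ∫⁻ ρ, g ρ ∂(Measure.volumeIoiPow k) = ∫⁻ ρ in Ioi (0 : ℝ), ofReal (ρ ^ k) * g ρ := by
  unfold Measure.volumeIoiPow
  rw [lintegral_withDensity_eq_lintegral_mul _ (by fun_prop) (by fun_prop)]
  exact lintegral_subtype_comap measurableSet_Ioi (fun ρ : ℝ => ofReal (ρ ^ k) * g ρ)

theorem homeomorphUnitSphereProd_smul (x : ({(0)}ᶜ : Set (Rn n))) : ((homeomorphUnitSphereProd (Rn n) x).2 : ℝ) •
    ((homeomorphUnitSphereProd (Rn n) x).1 : Rn n) = x := by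
  have := norm_ne_zero_iff.2 x.2
  simp [homeomorphUnitSphereProd, smul_smul, this]

theorem MeasureTheory.Integrable.sphere_prod {F : Rn n → ℂ} (hF : Integrable F) :
    Integrable (fun q : sphere (0 : Rn n) 1 × Ioi (0 : ℝ) => F ((q.2 : ℝ) • (q.1 : Rn n)))
      ((sph n).prod (.volumeIoiPow (Module.finrank ℝ (Rn n) - 1))) := by
  have h := (volume : Measure (Rn n)).measurePreserving_homeomorphUnitSphereProd.integrable_comp_emb
    (Homeomorph.measurableEmbedding _) (g := fun q => F ((q.2 : ℝ) • (q.1 : Rn n)))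
  simp only [homeomorphUnitSphereProd_smul, comp_def] at h
  refine h.1 ?_
  simpa [comp_def] using (integrableOn_iff_comap_subtypeVal (f := F) (measurableSet_singleton 0).compl).1 hF.integrableOn

theorem lintegral_polar {F : Rn n → ℝ≥0∞} (hF : Measurable F) :
    ∫⁻ x, F x = ∫⁻ ω, (∫⁻ ρ in Ioi (0 : ℝ), ofReal (ρ ^ (n - 1)) * F (ρ • (ω : Rn n)))
      ∂(sph n) := by
  have h0 : ∫⁻ x, F x = ∫⁻ x : ({(0)}ᶜ : Set (Rn n)), F x.1 ∂((volume : Measure (Rn n)).comap (↑)) := by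
    rw [lintegral_subtype_comap (measurableSet_singleton _).compl, restrict_compl_singleton]
  rw [h0]
  have h1 := ((volume : Measure (Rn n)).measurePreserving_homeomorphUnitSphereProd).lintegral_comp_emb
    (Homeomorph.measurableEmbedding _) (fun q => F ((q.2 : ℝ) • (q.1 : Rn n)))
  simp only [homeomorphUnitSphereProd_smul] at h1
  rw [h1, lintegral_prod _ (by fun_prop)]
  refine lintegral_congr fun ω => ?_
  rw [finrank_euclideanSpace_fin]
  exact lintegral_volumeIoiPow (n - 1) (g := fun ρ => F (ρ • (ω : Rn n))) (by fun_prop)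

theorem lintegral_polar_swap {F : Rn n → ℝ≥0∞} (hF : Measurable F) :
    ∫⁻ x, F x = ∫⁻ ρ in Ioi (0 : ℝ), ofReal (ρ ^ (n - 1)) * ∫⁻ ω, F (ρ • (ω : Rn n)) ∂(sph n) := by
  rw [lintegral_polar hF, lintegral_lintegral_swap (by fun_prop)]
  refine lintegral_congr fun ρ => ?_
  rw [lintegral_const_mul _ (by fun_prop)]

theorem integral_polar {F : Rn n → ℂ} (hF : Integrable F) :
    ∫ x, F x = ∫ ρ in Ioi (0 : ℝ), ((ρ ^ (n - 1) : ℝ) : ℂ) * ∫ ω, F (ρ • (ω : Rn n)) ∂(sph n) := by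
  have h0 : ∫ x, F x = ∫ x : ({(0)}ᶜ : Set (Rn n)), F x.1 ∂((volume : Measure (Rn n)).comap (↑)) := by
    rw [integral_subtype_comap (measurableSet_singleton _).compl, restrict_compl_singleton]
  have h1 := ((volume : Measure (Rn n)).measurePreserving_homeomorphUnitSphereProd).integral_comp
    (Homeomorph.measurableEmbedding _) (fun q => F ((q.2 : ℝ) • (q.1 : Rn n)))
  simp only [homeomorphUnitSphereProd_smul] at h1
  rw [h0, h1, integral_prod_symm _ hF.sphere_prod]
  simp only [finrank_euclideanSpace_fin, Measure.volumeIoiPow, ofReal]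
  rw [integral_withDensity_eq_integral_smul (by fun_prop),
    integral_subtype_comap measurableSet_Ioi fun a : ℝ ↦
      Real.toNNReal (a ^ (n - 1)) • ∫ ω, F (a • (ω : Rn n)) ∂(sph n)]
  refine setIntegral_congr_fun measurableSet_Ioi fun x hx ↦ ?_
  rw [NNReal.smul_def, Real.coe_toNNReal _ (pow_nonneg (le_of_lt hx) _), real_smul]
end Polar

section CauchySchwarz
variable {α : Type*} [MeasurableSpace α] {μ : Measure α}

theorem lintegral_mul_sq_le {f g : α → ℝ≥0∞} (hf : AEMeasurable f μ) (hg : AEMeasurable g μ) :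
    (∫⁻ x, f x * g x ∂μ) ^ 2 ≤ (∫⁻ x, f x ^ 2 ∂μ) * ∫⁻ x, g x ^ 2 ∂μ := by
  have h := ENNReal.lintegral_mul_le_Lp_mul_Lq μ
    (show Real.HolderConjugate 2 2 by constructor <;> norm_num) hf hg
  have h2 := pow_le_pow_left₀ zero_le h 2
  refine h2.trans (le_of_eq ?_)
  rw [mul_pow]
  simp only [← ENNReal.rpow_natCast, ← rpow_mul]
  norm_num

/-- Cauchy–Schwarz with a weight: `|∫ a b|² ≤ (∫ |a|) (∫ |a| |b|²)`. -/
theorem lintegral_mul_sq_le_weight {f g : α → ℝ≥0∞} (hf : AEMeasurable f μ)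
    (hg : AEMeasurable g μ) :
    (∫⁻ x, f x * g x ∂μ) ^ 2 ≤ (∫⁻ x, f x ∂μ) * ∫⁻ x, f x * g x ^ 2 ∂μ := by
  have h := lintegral_mul_sq_le (μ := μ) (f := fun x => f x ^ (1 / 2 : ℝ))
    (g := fun x => f x ^ (1 / 2 : ℝ) * g x) (hf.pow_const _) ((hf.pow_const _).mul hg)
  have e1 : ∀ x : ℝ≥0∞, x ^ (1 / 2 : ℝ) * x ^ (1 / 2 : ℝ) = x := fun x => by
    rw [← rpow_add_of_nonneg _ _ (by norm_num) (by norm_num)]; norm_num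
  have e2 : ∀ x : ℝ≥0∞, (x ^ (1 / 2 : ℝ)) ^ 2 = x := fun x => by rw [sq, e1]
  simpa only [← mul_assoc, e1, mul_pow, e2] using h

theorem lintegral_comp_smul_eq {E : Type*} [NormedAddCommGroup E] [NormedSpace ℝ E]
    [FiniteDimensional ℝ E] [MeasurableSpace E] [BorelSpace E] (ν : Measure E)
    [ν.IsAddHaarMeasure] (f : E → ℝ≥0∞) {r : ℝ} (hr : r ≠ 0) :
    ∫⁻ x, f (r • x) ∂ν = ofReal |(r ^ Module.finrank ℝ E)⁻¹| * ∫⁻ x, f x ∂ν := by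
  rw [← smul_eq_mul, ← lintegral_smul_measure, ← Measure.map_addHaar_smul ν hr]
  exact ((Homeomorph.smulOfNeZero r hr).measurableEmbedding.lintegral_map f).symm
theorem lintegral_ofReal_mul (c : ℝ) (f : α → ℝ≥0∞) : ∫⁻ x, ofReal c * f x ∂μ = ofReal c * ∫⁻ x, f x ∂μ :=
  lintegral_const_mul' _ _ ofReal_ne_top

end CauchySchwarz

theorem lintegral_phase_sq_eq {γ γ' : ℝ → ℝ} (hγ : ∀ ρ > 0, HasDerivAt γ (γ' ρ) ρ)
    (hpos : ∀ ρ > 0, 0 < γ' ρ) {q : ℝ → ℂ} (hq : IntegrableOn q (Ioi 0))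
    (hfin : ∫⁻ ρ in Ioi (0 : ℝ), ‖q ρ‖ₑ ^ 2 * ofReal (1 / γ' ρ) ≠ ∞) :
    ∫⁻ u : ℝ, ‖∫ ρ in Ioi (0 : ℝ), exp (I * ((u * γ ρ : ℝ) : ℂ)) * q ρ‖ₑ ^ 2 = ofReal (2 * π) *
        ∫⁻ ρ in Ioi (0 : ℝ), ‖q ρ‖ₑ ^ 2 * ofReal (1 / γ' ρ) := by
  have hmono : StrictMonoOn γ (Ioi 0) := by
    apply strictMonoOn_of_deriv_pos (convex_Ioi 0)
    · exact fun x hx => (hγ x hx).continuousAt.continuousWithinAt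
    · intro x hx
      rw [interior_Ioi] at hx
      rw [(hγ x hx).deriv]; exact hpos x hx
  have hinj := hmono.injOn
  have hder : ∀ x ∈ Ioi (0 : ℝ), HasDerivWithinAt γ (γ' x) (Ioi 0) x := fun x hx =>
    (hγ x hx).hasDerivWithinAt
  set s := γ '' Ioi 0 with hs
  have hsm : MeasurableSet s :=
    measurable_image_of_fderivWithin measurableSet_Ioi
      (fun x hx => (hder x hx).hasFDerivWithinAt) hinj
  set inv := Function.invFunOn γ (Ioi 0) with hinv
  have hleft : ∀ ρ ∈ Ioi (0 : ℝ), inv (γ ρ) = ρ := fun ρ hρ => hinj.leftInvOn_invFunOn hρ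
  set g : ℝ → ℂ := fun v => q (inv v) / γ' (inv v) with hg
  have hgρ : ∀ ρ ∈ Ioi (0 : ℝ), |γ' ρ| • g (γ ρ) = q ρ := by
    intro ρ hρ
    have := (hpos ρ hρ)
    have h' : (γ' ρ : ℂ) ≠ 0 := by exact_mod_cast this.ne'
    simp only [hg, hleft ρ hρ, abs_of_pos this, real_smul]
    field_simp
  have hgi : IntegrableOn g s := by
    rw [hs, integrableOn_image_iff_integrableOn_abs_deriv_smul measurableSet_Ioi hder hinj]
    exact hq.congr_fun (fun ρ hρ => (hgρ ρ hρ).symm) measurableSet_Ioi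
  set G := s.indicator g
  have hG : Integrable G := (integrable_indicator_iff hsm).2 hgi
  have key : ∀ u : ℝ, ∫ ρ in Ioi (0 : ℝ), exp (I * ((u * γ ρ : ℝ) : ℂ)) * q ρ
      = 𝓕 G ((-(1 / (2 * π))) • u) := by
    intro u
    have h1 := integral_image_eq_integral_abs_deriv_smul measurableSet_Ioi hder hinj
      (fun v => exp (I * ((u * v : ℝ) : ℂ)) * g v)
    rw [fourier_eq']
    have h2 : (fun v : ℝ => exp (((-2 * π * inner ℝ v ((-(1 / (2 * π))) • u) : ℝ) : ℂ)
        * I) • G v) = s.indicator (fun v => exp (I * ((u * v : ℝ) : ℂ)) * g v) := by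
      ext v
      by_cases hv : v ∈ s
      · simp only [G, indicator_of_mem hv, smul_eq_mul]
        congr 2
        rw [mul_comm]; congr 2
        simp; field_simp
      · simp [G, indicator_of_notMem hv]
    rw [h2, integral_indicator hsm, h1]
    refine setIntegral_congr_fun measurableSet_Ioi fun ρ hρ => ?_
    rw [← hgρ ρ hρ, real_smul, real_smul]
    ring
  simp only [key]
  rw [lintegral_comp_smul_eq volume (fun u => ‖𝓕 G u‖ₑ ^ 2) (neg_ne_zero.2 (by
    have := pi_pos; positivity))]
  have hc : |((-(1 / (2 * π))) ^ Module.finrank ℝ ℝ)⁻¹| = 2 * π := by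
    simp only [Module.finrank_self, pow_one]
    rw [inv_neg, abs_neg, one_div, inv_inv, abs_of_pos (by positivity)]
  rw [hc]
  congr 1
  suffices hsuff : ∫⁻ v, ‖G v‖ₑ ^ 2 = ∫⁻ ρ in Ioi (0 : ℝ), ‖q ρ‖ₑ ^ 2 * ofReal (1 / γ' ρ) by
    rw [← hsuff] at hfin ⊢
    exact lintegral_fourier_sq_eq hG hfin
  have h3 : (fun v => ‖G v‖ₑ ^ 2) = s.indicator (fun v => ‖g v‖ₑ ^ 2) := by
    ext v
    by_cases hv : v ∈ s <;> simp [G, hv]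
  rw [h3, lintegral_indicator hsm,
    lintegral_image_eq_lintegral_abs_deriv_mul measurableSet_Ioi hder hinj]
  refine setLIntegral_congr_fun measurableSet_Ioi fun ρ hρ => ?_
  have hp := hpos ρ hρ
  conv_rhs => rw [← hgρ ρ hρ]
  rw [enorm_smul, Real.enorm_abs, mul_pow, Real.enorm_eq_ofReal hp.le, abs_of_pos hp,
    mul_right_comm, one_div, ENNReal.ofReal_inv_of_pos hp, sq (ofReal _), mul_assoc (ofReal _),
    ENNReal.mul_inv_cancel (by simpa using hp) (by simp), mul_one]

theorem lintegral_phase_sq_le {γ γ' : ℝ → ℝ} (hγ : ∀ ρ > 0, HasDerivAt γ (γ' ρ) ρ)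
    (hpos : ∀ ρ > 0, 0 < γ' ρ) {q : ℝ → ℂ} (hq : IntegrableOn q (Ioi 0)) :
    ∫⁻ u : ℝ, ‖∫ ρ in Ioi (0 : ℝ), exp (I * ((u * γ ρ : ℝ) : ℂ)) * q ρ‖ₑ ^ 2 ≤ ofReal (2 * π) *
        ∫⁻ ρ in Ioi (0 : ℝ), ‖q ρ‖ₑ ^ 2 * ofReal (1 / γ' ρ) := by
  by_cases h : ∫⁻ ρ in Ioi (0 : ℝ), ‖q ρ‖ₑ ^ 2 * ofReal (1 / γ' ρ) = ∞
  · rw [h, ENNReal.mul_top (by simp [pi_pos])]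
    exact le_top
  · exact (lintegral_phase_sq_eq hγ hpos hq h).le

section Radial
variable {n : ℕ} [Fact (2 ≤ n)]

theorem integrable_volumeIoiPow_iff {k : ℕ} {H : ℝ → ℂ}
    (hH : Integrable (fun ρ : Ioi (0 : ℝ) => H ρ) (Measure.volumeIoiPow k)) :
    IntegrableOn (fun ρ : ℝ => ((ρ ^ k : ℝ) : ℂ) * H ρ) (Ioi 0) := by
  unfold Measure.volumeIoiPow at hH
  rw [integrable_withDensity_iff_integrable_smul' (by fun_prop) (by simp)] at hH
  rw [integrableOn_iff_comap_subtypeVal measurableSet_Ioi]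
  refine hH.congr (.of_forall ?_)
  rintro ⟨x, hx : 0 < x⟩
  simp only [Function.comp]
  rw [toReal_ofReal (by positivity), real_smul]

theorem integrableOn_polar {F : Rn n → ℂ} (hF : Integrable F) :
    IntegrableOn (fun ρ : ℝ => ((ρ ^ (n - 1) : ℝ) : ℂ) * ∫ ω, F (ρ • (ω : Rn n)) ∂(sph n))
      (Ioi 0) := by
  have h3 := hF.sphere_prod
  rw [finrank_euclideanSpace_fin] at h3
  exact integrable_volumeIoiPow_iff (H := fun ρ => ∫ ω, F (ρ • (ω : Rn n)) ∂(sph n))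
    h3.integral_prod_right

theorem integral_radial_phase {γ : ℝ → ℝ} (hγm : Measurable γ) {h : Rn n → ℂ} (hh : Integrable h)
    (u : ℝ) : ∫ t, exp (I * ((u * γ ‖t‖ : ℝ) : ℂ)) * h t =
      ∫ ρ in Ioi (0 : ℝ), exp (I * ((u * γ ρ : ℝ) : ℂ)) *
        (((ρ ^ (n - 1) : ℝ) : ℂ) * ∫ ω, h (ρ • (ω : Rn n)) ∂(sph n)) := by
  rw [integral_polar]
  · refine setIntegral_congr_fun measurableSet_Ioi fun ρ (hρ : 0 < ρ) => ?_
    simp only [norm_smul, norm_eq_of_mem_sphere, mul_one, norm_eq_abs, abs_of_pos hρ]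
    rw [integral_const_mul]
    ring
  · refine hh.bdd_mul (c := 1) ?_ (.of_forall fun t => ?_)
    · exact (by fun_prop : Measurable _).aestronglyMeasurable
    · rw [mul_comm, norm_exp_ofReal_mul_I]

/-- Plancherel in the radial variable. -/
theorem lintegral_radial_phase_sq_le {γ γ' : ℝ → ℝ} (hγ : ∀ ρ > 0, HasDerivAt γ (γ' ρ) ρ)
    (hpos : ∀ ρ > 0, 0 < γ' ρ) (hγm : Measurable γ) {h : Rn n → ℂ} (hh : Integrable h) :
    ∫⁻ u : ℝ, ‖∫ t, exp (I * ((u * γ ‖t‖ : ℝ) : ℂ)) * h t‖ₑ ^ 2 ≤ ofReal (2 * π) *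
        ∫⁻ ρ in Ioi (0 : ℝ), ‖((ρ ^ (n - 1) : ℝ) : ℂ) * ∫ ω, h (ρ • (ω : Rn n)) ∂(sph n)‖ₑ ^ 2 *
          ofReal (1 / γ' ρ) := by
  simp only [integral_radial_phase hγm hh]
  exact lintegral_phase_sq_le hγ hpos (integrableOn_polar hh)

theorem integrable_sph_of_continuous {f : Rn n → ℂ} (hf : Continuous f) :
    Integrable (fun ω : sphere (0 : Rn n) 1 => f ω) (sph n) := by
  have hc : Continuous (fun ω : sphere (0 : Rn n) 1 => f ω) := hf.comp continuous_subtype_val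
  exact hc.integrable_of_hasCompactSupport (HasCompactSupport.of_compactSpace _)

theorem integral_sph_eq_ball {f : Rn n → ℂ} (hf : Continuous f) :
    ∫ ω, f ω ∂(sph n) = n * ∫ x in Metric.ball (0 : Rn n) 1, f (‖x‖⁻¹ • x) := by
  have hn : 2 ≤ n := Fact.out
  obtain ⟨C, hC⟩ := (isCompact_closedBall (0 : Rn n) 1).exists_bound_of_continuousOn hf.continuousOn
  have hmeas : Measurable fun x : Rn n => f (‖x‖⁻¹ • x) := hf.measurable.comp (by fun_prop)
  rw [← integral_indicator Metric.isOpen_ball.measurableSet, integral_polar]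
  · have h1 : ∀ ρ ∈ Ioi (0 : ℝ), ((ρ ^ (n - 1) : ℝ) : ℂ) *
        ∫ ω, (Metric.ball (0 : Rn n) 1).indicator (fun x => f (‖x‖⁻¹ • x)) (ρ • (ω : Rn n)) ∂(sph n)
        = (Iio (1 : ℝ)).indicator (fun ρ => ((ρ ^ (n - 1) : ℝ) : ℂ) * ∫ ω, f ω ∂(sph n)) ρ := by
      intro ρ (hρ : 0 < ρ)
      have hnorm : ∀ ω : sphere (0 : Rn n) 1, ‖ρ • (ω : Rn n)‖ = ρ := fun ω => by
        simp [norm_smul, abs_of_pos hρ]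
      by_cases h : ρ < 1
      · rw [indicator_of_mem (by exact h)]
        congr 2
        ext ω
        rw [indicator_of_mem (by simpa [hnorm] using h), hnorm, smul_smul, inv_mul_cancel₀ hρ.ne',
          one_smul]
      · rw [indicator_of_notMem (by exact h)]
        simp [indicator, hnorm, h]
    rw [setIntegral_congr_fun measurableSet_Ioi h1, setIntegral_indicator measurableSet_Iio,
      integral_mul_const, integral_complex_ofReal, Ioi_inter_Iio, ← integral_Ioc_eq_integral_Ioo,
      ← intervalIntegral.integral_of_le zero_le_one, integral_pow]
    have : ((n - 1 : ℕ) : ℝ) + 1 = n := by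
      rw [Nat.cast_sub (by omega)]; simp
    rw [this, Nat.sub_add_cancel (by omega)]
    simp [show n ≠ 0 by omega]
  · rw [integrable_indicator_iff Metric.isOpen_ball.measurableSet]
    refine Measure.integrableOn_of_bounded (M := C) (by exact measure_ball_lt_top.ne) hmeas.aestronglyMeasurable
      (.of_forall fun x => hC _ ?_)
    simp only [Metric.mem_closedBall, dist_zero_right, norm_smul, norm_inv, norm_norm]
    exact inv_mul_le_one

theorem integral_sph_comp_isometry {f : Rn n → ℂ} (hf : Continuous f) (L : Rn n ≃ₗᵢ[ℝ] Rn n) :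
    ∫ ω, f (L ω) ∂(sph n) = ∫ ω, f ω ∂(sph n) := by
  rw [integral_sph_eq_ball hf, integral_sph_eq_ball (f := fun x => f (L x)) (by fun_prop)]
  congr 1
  have h := L.measurePreserving.setIntegral_preimage_emb
    L.toHomeomorph.measurableEmbedding (fun x => f (‖x‖⁻¹ • x)) (Metric.ball 0 1)
  rw [← h]
  have : L ⁻¹' Metric.ball 0 1 = Metric.ball 0 1 := by ext x; simp
  rw [this]
  simp

theorem integral_sph_norm_eq {x y : Rn n} (h : ‖x‖ = ‖y‖) {g : ℝ → ℂ} (hg : Continuous g) :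
    ∫ ω, g (inner ℝ x (ω : Rn n)) ∂(sph n) = ∫ ω, g (inner ℝ y (ω : Rn n)) ∂(sph n) := by
  set L := (ℝ ∙ (x - y))ᗮ.reflection
  have hL : L x = y := Submodule.reflection_sub h
  rw [← hL, ← integral_sph_comp_isometry (f := fun w => g (inner ℝ (L x) w)) (by fun_prop) L]
  simp

/-- Reflection invariance in a coordinate plane. -/
theorem integral_sph_plane {i j : Fin n} (hij : i ≠ j) (F : ℝ × ℝ → ℂ) (hF : Continuous F) (θ : ℝ) :
    ∫ ω, F ((ω : Rn n) i, (ω : Rn n) j) ∂(sph n) =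
      ∫ ω, F (cos θ * (ω : Rn n) i + sin θ * (ω : Rn n) j,
        sin θ * (ω : Rn n) i - cos θ * (ω : Rn n) j) ∂(sph n) := by
  set v : Rn n := cos (θ / 2) • single j 1 - sin (θ / 2) • single i 1
  set L := (ℝ ∙ v)ᗮ.reflection
  have hv : ‖v‖ = 1 := by
    have : ‖v‖ ^ 2 = 1 := by
      rw [← real_inner_self_eq_norm_sq]
      simp only [v, inner_sub_left, inner_sub_right, inner_smul_left, inner_smul_right,
        EuclideanSpace.inner_single_left]
      simp [hij, hij.symm]
      nlinarith [Real.sin_sq_add_cos_sq (θ / 2)]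
    nlinarith [norm_nonneg v]
  have hL : ∀ x, L x = x - (2 * inner ℝ v x) • v := by
    intro x
    simp only [L]
    rw [Submodule.reflection_orthogonal_apply, Submodule.reflection_singleton_apply]
    simp only [hv, one_pow, RCLike.ofReal_real_eq_id, id, div_one]
    module
  rw [← integral_sph_comp_isometry (f := fun w => F (w i, w j)) (by fun_prop) L]
  have e2 : sin θ = 2 * sin (θ / 2) * cos (θ / 2) := by
    rw [← Real.sin_two_mul]; ring_nf
  have e3 := Real.sin_sq_add_cos_sq (θ / 2)
  congr 1
  ext ω
  have hin : inner ℝ v (ω : Rn n) = cos (θ / 2) * ω.1 j - sin (θ / 2) * ω.1 i := by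
    simp [v, inner_sub_left, inner_smul_left, EuclideanSpace.inner_single_left]
  have vi : v i = - sin (θ / 2) := by simp [v, hij]
  have vj : v j = cos (θ / 2) := by simp [v, hij.symm]
  congr 1
  simp only [hL, PiLp.sub_apply, PiLp.smul_apply, hin, vi, vj, smul_eq_mul]
  have e4 : cos θ = 2 * cos (θ / 2) ^ 2 - 1 := by rw [← Real.cos_two_mul]; ring_nf
  rw [Prod.mk.injEq, e4, e2]
  constructor
  · linear_combination (-2 * ω.1 i) * e3
  · ring

theorem abs_coord_sph_le (ω : sphere (0 : Rn n) 1) (i : Fin n) : |ω.1 i| ≤ 1 := by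
  have := PiLp.norm_apply_le ω.1 i
  simpa using this

theorem integrable_sph_real {f : Rn n → ℝ} (hf : Continuous f) :
    Integrable (fun ω : sphere (0 : Rn n) 1 => f ω) (sph n) := by
  have hc : Continuous (fun ω : sphere (0 : Rn n) 1 => f ω) := hf.comp continuous_subtype_val
  exact hc.integrable_of_hasCompactSupport (HasCompactSupport.of_compactSpace _)

theorem integral_sph_coord_sq {i j : Fin n} (hij : i ≠ j) (ρ : ℝ) :
    ρ * ∫ ω, (ω : Rn n) j ^ 2 * cos (ρ * (ω : Rn n) i) ∂(sph n) =
      ∫ ω, (ω : Rn n) i * sin (ρ * (ω : Rn n) i) ∂(sph n) := by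
  set Φ : ℝ → sphere (0 : Rn n) 1 → ℝ := fun θ ω =>
    (sin θ * ω.1 i - cos θ * ω.1 j) *
      sin (ρ * (cos θ * ω.1 i + sin θ * ω.1 j)) with hΦ
  set Φ' : ℝ → sphere (0 : Rn n) 1 → ℝ := fun θ ω =>
    (cos θ * ω.1 i + sin θ * ω.1 j) *
      sin (ρ * (cos θ * ω.1 i + sin θ * ω.1 j)) +
    (sin θ * ω.1 i - cos θ * ω.1 j) *
      (cos (ρ * (cos θ * ω.1 i + sin θ * ω.1 j)) *
        (ρ * (-sin θ * ω.1 i + cos θ * ω.1 j))) with hΦ'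
  have hconst : ∀ θ, ∫ ω, Φ θ ω ∂(sph n) = ∫ ω, Φ 0 ω ∂(sph n) := by
    intro θ
    have h := fun θ => integral_sph_plane hij
      (fun p => ((p.2 * sin (ρ * p.1) : ℝ) : ℂ)) (by fun_prop) θ
    have h2 := (h θ).symm.trans (h 0)
    rw [integral_complex_ofReal, integral_complex_ofReal] at h2
    exact_mod_cast h2
  have hd := hasDerivAt_integral_of_dominated_loc_of_deriv_le (μ := sph n) (F := Φ) (F' := Φ')
    (x₀ := 0) (s := univ) (bound := fun _ => 2 + 2 * (|ρ| * 2)) univ_mem ?_ ?_ ?_ ?_ ?_ ?_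
  · have h0 : HasDerivAt (fun θ => ∫ ω, Φ θ ω ∂(sph n)) 0 0 := by
      simp only [hconst]; exact hasDerivAt_const _ _
    have h1 := hd.2.unique h0
    simp only [hΦ', Real.cos_zero, Real.sin_zero, one_mul, zero_mul, add_zero, zero_sub,
      neg_zero, zero_add] at h1
    rw [integral_add (integrable_sph_real (f := fun w => w i * sin (ρ * w i)) (by fun_prop))
      (integrable_sph_real (f := fun w => -w j * (cos (ρ * w i) * (ρ * w j))) (by fun_prop))] at h1
    have h3 : ∫ ω, -(ω : Rn n) j * (cos (ρ * (ω : Rn n) i) * (ρ * (ω : Rn n) j)) ∂(sph n)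
        = - (ρ * ∫ ω, (ω : Rn n) j ^ 2 * cos (ρ * (ω : Rn n) i) ∂(sph n)) := by
      rw [← integral_const_mul, ← integral_neg]
      congr 1; ext ω; ring
    linarith
  · exact .of_forall fun θ => (integrable_sph_real (f := fun w =>
      (sin θ * w i - cos θ * w j) *
      sin (ρ * (cos θ * w i + sin θ * w j))) (by fun_prop)).aestronglyMeasurable
  · exact integrable_sph_real (f := fun w =>
      (sin 0 * w i - cos 0 * w j) *
      sin (ρ * (cos 0 * w i + sin 0 * w j))) (by fun_prop)
  · exact (integrable_sph_real (f := fun w =>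
      (cos 0 * w i + sin 0 * w j) *
      sin (ρ * (cos 0 * w i + sin 0 * w j)) +
    (sin 0 * w i - cos 0 * w j) * (cos (ρ * (cos 0 * w i + sin 0 * w j)) *
        (ρ * (-sin 0 * w i + cos 0 * w j)))) (by fun_prop)).aestronglyMeasurable
  · refine .of_forall fun ω θ _ => ?_
    have hi := abs_coord_sph_le ω i
    have hj := abs_coord_sph_le ω j
    have b : ∀ a x c y : ℝ, |a| ≤ 1 → |x| ≤ 1 → |c| ≤ 1 → |y| ≤ 1 → |a * x + c * y| ≤ 2 := by
      intro a x c y h1 h2 h3 h4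
      calc |a * x + c * y| ≤ |a| * |x| + |c| * |y| := by
            rw [← abs_mul, ← abs_mul]; exact abs_add_le _ _
        _ ≤ 1 * 1 + 1 * 1 := by gcongr
        _ = 2 := by norm_num
    have hs := Real.abs_sin_le_one θ
    have hc := Real.abs_cos_le_one θ
    have b1 := b _ _ _ _ hc hi hs hj
    have b2 : |sin θ * ω.1 i - cos θ * ω.1 j| ≤ 2 := by
      have := b _ _ (-cos θ) _ hs hi (by rwa [abs_neg]) hj
      rwa [neg_mul, ← sub_eq_add_neg] at this
    have b3 := b _ _ _ _ (by rwa [abs_neg] : |-sin θ| ≤ 1) hi hc hj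
    rw [norm_eq_abs]
    refine (abs_add_le _ _).trans ?_
    rw [abs_mul, abs_mul, abs_mul, abs_mul]
    have e1 := Real.abs_sin_le_one (ρ * (cos θ * ω.1 i + sin θ * ω.1 j))
    have e2 := Real.abs_cos_le_one (ρ * (cos θ * ω.1 i + sin θ * ω.1 j))
    calc _ ≤ 2 * 1 + 2 * (1 * (|ρ| * 2)) := by gcongr
      _ = _ := by ring
  · exact integrable_const _
  · refine .of_forall fun ω θ _ => ?_
    have d1 : HasDerivAt (fun θ => cos θ * ω.1 i + sin θ * ω.1 j)
        (-sin θ * ω.1 i + cos θ * ω.1 j) θ :=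
      ((Real.hasDerivAt_cos θ).mul_const _).add ((Real.hasDerivAt_sin θ).mul_const _)
    have d2 : HasDerivAt (fun θ => sin θ * ω.1 i - cos θ * ω.1 j)
        (cos θ * ω.1 i - -sin θ * ω.1 j) θ :=
      ((Real.hasDerivAt_sin θ).mul_const _).sub ((Real.hasDerivAt_cos θ).mul_const _)
    refine (d2.mul ((d1.const_mul ρ).sin)).congr_deriv ?_
    simp only [Φ']
    ring

theorem hasDerivAt_integral_sph {G G' : Rn n → ℝ → ℝ} (hG : ∀ ρ, Continuous fun w => G w ρ)
    (hG' : ∀ ρ, Continuous fun w => G' w ρ) (hd : ∀ w ρ, HasDerivAt (G w) (G' w ρ) ρ) {B : ℝ}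
    (hB : ∀ w ρ, ‖w‖ = 1 → |G' w ρ| ≤ B) (ρ : ℝ) :
    HasDerivAt (fun ρ => ∫ ω, G (ω : Rn n) ρ ∂(sph n)) (∫ ω, G' (ω : Rn n) ρ ∂(sph n)) ρ := by
  refine (hasDerivAt_integral_of_dominated_loc_of_deriv_le (μ := sph n)
    (F := fun ρ (ω : sphere (0 : Rn n) 1) => G ω ρ)
    (F' := fun ρ (ω : sphere (0 : Rn n) 1) => G' ω ρ)
    (x₀ := ρ) (s := univ) (bound := fun _ => B) univ_mem ?_ ?_ ?_ ?_ ?_ ?_).2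
  · exact .of_forall fun ρ => (integrable_sph_real (hG ρ)).aestronglyMeasurable
  · exact integrable_sph_real (hG ρ)
  · exact (integrable_sph_real (hG' ρ)).aestronglyMeasurable
  · exact .of_forall fun ω θ _ => hB ω θ (by simp)
  · exact integrable_const _
  · exact .of_forall fun ω θ _ => hd ω θ

/-- Decay of the zeroth Fourier moment of the sphere. -/
theorem exists_sphere_moment_decay (i : Fin n) : ∃ C : ℝ, 0 < C ∧ ∀ ρ > 0,
    (∫ ω, cos (ρ * (ω : Rn n) i) ∂(sph n)) ^ 2 * ρ ^ (n - 1) ≤ C := by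
  have hn : 2 ≤ n := Fact.out
  set d : ℝ := n - 1 with hd
  have hd1 : 1 ≤ d := by
    have : (2 : ℝ) ≤ n := by exact_mod_cast hn
    linarith
  have hdc : ((n - 1 : ℕ) : ℝ) = d := by rw [Nat.cast_sub (by omega)]; simp [hd]
  set m0 : ℝ → ℝ := fun ρ => ∫ ω, cos (ρ * (ω : Rn n) i) ∂(sph n) with hm0
  set m1 : ℝ → ℝ := fun ρ => ∫ ω, (ω : Rn n) i * sin (ρ * (ω : Rn n) i) ∂(sph n) with hm1
  have bnd : ∀ w : Rn n, ‖w‖ = 1 → |w i| ≤ 1 := fun w hw => by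
    have := PiLp.norm_apply_le w i
    rw [hw] at this; exact this
  have D0 : ∀ ρ, HasDerivAt m0 (-m1 ρ) ρ := by
    intro ρ
    have := hasDerivAt_integral_sph (n := n) (G := fun w ρ => cos (ρ * w i))
      (G' := fun w ρ => -(w i * sin (ρ * w i))) (fun _ => by fun_prop) (fun _ => by fun_prop)
      (fun w ρ => by
        refine ((hasDerivAt_id ρ).mul_const (w i)).cos.congr_deriv ?_
        simp only [id]; ring) (B := 1) (fun w ρ hw => by
        rw [abs_neg, abs_mul]
        exact mul_le_one₀ (bnd w hw) (abs_nonneg _) (Real.abs_sin_le_one _)) ρ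
    rwa [integral_neg] at this
  have D1 : ∀ ρ > 0, HasDerivAt m1 (m0 ρ - d * m1 ρ / ρ) ρ := by
    intro ρ hρ
    have h := hasDerivAt_integral_sph (n := n) (G := fun w ρ => w i * sin (ρ * w i))
      (G' := fun w ρ => w i ^ 2 * cos (ρ * w i)) (fun _ => by fun_prop) (fun _ => by fun_prop)
      (fun w ρ => by
        refine ((((hasDerivAt_id ρ).mul_const (w i)).sin).const_mul (w i)).congr_deriv ?_
        simp only [id]; ring) (B := 1) (fun w ρ hw => by
        rw [abs_mul, abs_pow]
        exact mul_le_one₀ (pow_le_one₀ (abs_nonneg _) (bnd w hw)) (abs_nonneg _)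
          (Real.abs_cos_le_one _)) ρ
    refine h.congr_deriv ?_
    have hsum : m0 ρ = ∑ j : Fin n, ∫ ω, (ω : Rn n) j ^ 2 * cos (ρ * (ω : Rn n) i) ∂(sph n) := by
      rw [← integral_finsetSum _ (fun j _ => integrable_sph_real
        (f := fun w => w j ^ 2 * cos (ρ * w i)) (by fun_prop))]
      simp only [hm0]
      congr 1; ext ω
      rw [← sum_mul]
      have : ∑ j : Fin n, (ω : Rn n) j ^ 2 = 1 := by
        rw [← EuclideanSpace.real_norm_sq_eq]; simp
      rw [this, one_mul]
    rw [← Finset.add_sum_erase _ _ (Finset.mem_univ i)] at hsum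
    have : ∀ j ∈ Finset.univ.erase i, ∫ ω, (ω : Rn n) j ^ 2 * cos (ρ * (ω : Rn n) i) ∂(sph n)
        = m1 ρ / ρ := by
      intro j hj
      rw [eq_div_iff hρ.ne', mul_comm]
      exact integral_sph_coord_sq (Finset.ne_of_mem_erase hj).symm ρ
    rw [sum_congr rfl this, Finset.sum_const, Finset.card_erase_of_mem (Finset.mem_univ i),
      Finset.card_univ, Fintype.card_fin, nsmul_eq_mul, hdc] at hsum
    rw [hsum]; ring
  set En : ℝ → ℝ := fun ρ => ρ ^ (n - 1) * ((m0 ρ ^ 2 + m1 ρ ^ 2) - d * (m0 ρ * m1 ρ) / ρ) with hEn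
  have hlow : ∀ ρ, d ≤ ρ → ρ ^ (n - 1) * (m0 ρ ^ 2 + m1 ρ ^ 2) / 2 ≤ En ρ := by
    intro ρ hρ
    have hρ0 : 0 < ρ := by linarith
    have h1 : d * (m0 ρ * m1 ρ) / ρ ≤ (m0 ρ ^ 2 + m1 ρ ^ 2) / 2 := by
      have h2 : d / ρ ≤ 1 := by rw [div_le_one hρ0]; exact hρ
      have h3 : 0 ≤ d / ρ := by positivity
      have : d * (m0 ρ * m1 ρ) / ρ = d / ρ * (m0 ρ * m1 ρ) := by ring
      rw [this]
      nlinarith [sq_nonneg (m0 ρ - m1 ρ), sq_nonneg (m0 ρ + m1 ρ)]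
    have h4 : 0 ≤ ρ ^ (n - 1) := by positivity
    simp only [hEn]
    nlinarith
  have DE : ∀ ρ > 0, HasDerivAt En (d * ρ ^ (n - 1) / ρ ^ 2 * (m0 ρ * m1 ρ)) ρ := by
    intro ρ hρ
    have hp : HasDerivAt (fun ρ : ℝ => ρ ^ (n - 1)) (d * ρ ^ (n - 1) / ρ) ρ := by
      refine (hasDerivAt_pow (n - 1) ρ).congr_deriv ?_
      rw [hdc]
      obtain ⟨k, hk⟩ : ∃ k, n - 1 = k + 1 := ⟨n - 2, by omega⟩
      rw [hk]; simp only [Nat.add_sub_cancel]; field_simp; ring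
    have hq := (((D0 ρ).pow 2).add ((D1 ρ hρ).pow 2)).sub
      ((((D0 ρ).mul (D1 ρ hρ)).const_mul d).div (hasDerivAt_id ρ) hρ.ne')
    refine (hp.mul hq).congr_deriv ?_
    simp only [Pi.pow_apply, Pi.mul_apply, Pi.add_apply, Pi.sub_apply, Pi.div_apply, id]
    field_simp
    ring_nf
  set W : ℝ → ℝ := fun ρ => En ρ * Real.exp (d / ρ) with hW
  have DW : ∀ ρ > 0, HasDerivAt W ((d * ρ ^ (n - 1) / ρ ^ 2 * (m0 ρ * m1 ρ)) * Real.exp (d / ρ) +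
      En ρ * (Real.exp (d / ρ) * (-d / ρ ^ 2))) ρ := by
    intro ρ hρ
    have : HasDerivAt (fun ρ : ℝ => d / ρ) (-d / ρ ^ 2) ρ := by
      have := ((hasDerivAt_inv hρ.ne').const_mul d)
      exact this.congr_deriv (by ring)
    exact (DE ρ hρ).mul this.exp
  have hanti : AntitoneOn W (Ici d) := by
    apply antitoneOn_of_deriv_nonpos (convex_Ici d)
    · exact fun ρ (hρ : d ≤ ρ) => (DW ρ (by linarith)).continuousAt.continuousWithinAt
    · rw [interior_Ici]
      exact fun ρ (hρ : d < ρ) => (DW ρ (by linarith)).differentiableAt.differentiableWithinAt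
    · rw [interior_Ici]
      intro ρ (hρ : d < ρ)
      have hρ0 : 0 < ρ := by linarith
      rw [(DW ρ hρ0).deriv]
      have h1 := hlow ρ hρ.le
      have h2 : (d * ρ ^ (n - 1) / ρ ^ 2 * (m0 ρ * m1 ρ)) * Real.exp (d / ρ) +
        En ρ * (Real.exp (d / ρ) * (-d / ρ ^ 2)) = d / ρ ^ 2 * Real.exp (d / ρ) *
          (ρ ^ (n - 1) * (m0 ρ * m1 ρ) - En ρ) := by ring
      rw [h2]
      apply mul_nonpos_of_nonneg_of_nonpos (by positivity)
      have h4 : 0 ≤ ρ ^ (n - 1) := by positivity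
      nlinarith [sq_nonneg (m0 ρ - m1 ρ)]
  set S : ℝ := (sph n).real univ
  have hW0 : 0 ≤ W d := by
    have := hlow d le_rfl
    have h0 : 0 ≤ En d := le_trans (by positivity) this
    positivity
  refine ⟨2 * W d + S ^ 2 * d ^ (n - 1) + 1, by positivity, fun ρ hρ => ?_⟩
  rcases le_total d ρ with h | h
  · have h1 := hlow ρ h
    have h2 := hanti (self_mem_Ici) (show ρ ∈ Ici d from h) h
    have h5 : 0 ≤ ρ ^ (n - 1) * m1 ρ ^ 2 := by positivity
    have h7 : 0 ≤ S ^ 2 * d ^ (n - 1) := by positivity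
    have h3 : En ρ ≤ W ρ := by
      have h0 : 0 ≤ En ρ := le_trans (by positivity) h1
      have : 1 ≤ Real.exp (d / ρ) := Real.one_le_exp (by positivity)
      simp only [hW]; nlinarith
    nlinarith
  · have h1 : |m0 ρ| ≤ S := by
      have := norm_integral_le_of_norm_le_const (μ := sph n) (C := 1)
        (f := fun ω : sphere (0 : Rn n) 1 => cos (ρ * ω.1 i))
        (.of_forall fun ω => Real.abs_cos_le_one _)
      rw [one_mul] at this
      exact this
    have h2 : m0 ρ ^ 2 ≤ S ^ 2 := by rw [← sq_abs]; gcongr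
    have : m0 ρ ^ 2 * ρ ^ (n - 1) ≤ S ^ 2 * d ^ (n - 1) := by gcongr
    linarith

/-- The inverse Fourier transform of surface measure. -/
def sphHat (n : ℕ) (x : Rn n) : ℂ :=
  ∫ ω, exp (2 * π * I * (inner ℝ x (ω : Rn n) : ℝ)) ∂(sph n)

theorem exists_sphHat_decay (n : ℕ) [Fact (2 ≤ n)] : ∃ C : ℝ, 0 < C ∧ ∀ x : Rn n,
    ‖sphHat n x‖ ^ 2 * ‖x‖ ^ (n - 1) ≤ C := by
  have hn : 2 ≤ n := Fact.out
  set i : Fin n := ⟨0, by omega⟩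
  obtain ⟨C, hC, h⟩ := exists_sphere_moment_decay (n := n) i
  refine ⟨C, hC, fun x => ?_⟩
  rcases eq_or_ne x 0 with rfl | hx
  · simp [show n - 1 ≠ 0 by omega, hC.le]
  have hx0 : 0 < ‖x‖ := by positivity
  have e1 : sphHat n x = ((∫ ω, cos ((2 * π * ‖x‖) * (ω : Rn n) i) ∂(sph n) : ℝ) : ℂ) := by
    have h1 : sphHat n x = ∫ ω, exp (2 * π * I *
        (inner ℝ (single i ‖x‖) (ω : Rn n) : ℝ)) ∂(sph n) :=
      integral_sph_norm_eq (x := x) (y := single i ‖x‖) (by simp)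
        (g := fun t => exp (2 * π * I * (t : ℂ))) (by fun_prop)
    have h2 : sphHat n x = ∫ ω, exp (2 * π * I *
        (inner ℝ (single i (-‖x‖)) (ω : Rn n) : ℝ)) ∂(sph n) :=
      integral_sph_norm_eq (x := x) (y := single i (-‖x‖)) (by simp)
        (g := fun t => exp (2 * π * I * (t : ℂ))) (by fun_prop)
    have h3 : sphHat n x + sphHat n x = 2 * ((∫ ω, cos ((2 * π * ‖x‖) * (ω : Rn n) i) ∂(sph n) : ℝ) : ℂ) := by
      conv_lhs => rw [h1]
      rw [← h1]
      nth_rw 1 [h1]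
      rw [h2, ← integral_complex_ofReal, ← integral_const_mul, ← integral_add]
      · congr 1; ext ω
        simp only [EuclideanSpace.inner_single_left, Complex.ofReal_cos, Complex.cos]
        rw [mul_div_cancel₀ _ two_ne_zero]
        congr 2
        · simp; ring
        · simp; ring
      · exact integrable_sph_of_continuous (f := fun w => exp (2 * π * I *
          (inner ℝ (single i ‖x‖) w : ℝ))) (by fun_prop)
      · exact integrable_sph_of_continuous (f := fun w => exp (2 * π * I *
          (inner ℝ (single i (-‖x‖)) w : ℝ))) (by fun_prop)
    linear_combination h3 / 2
  have h4 := h (2 * π * ‖x‖) (by positivity)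
  rw [e1, norm_real, norm_eq_abs, sq_abs]
  refine le_trans ?_ h4
  gcongr
  have := pi_gt_three
  nlinarith
end Radial

theorem schwartz_decay {E F : Type*} [NormedAddCommGroup E] [NormedSpace ℝ E] [NormedAddCommGroup F]
    [NormedSpace ℝ F] (f : 𝓢(E, F)) (L : ℕ) :
    ∃ C : ℝ, 0 < C ∧ ∀ x, ‖f x‖ ≤ C * ((1 + ‖x‖) ^ L)⁻¹ := by
  set C := 2 ^ L * ((Finset.Iic (L, 0)).sup fun m => SchwartzMap.seminorm ℝ m.1 m.2) f
  refine ⟨C + 1, ?_, fun x => ?_⟩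
  · have : 0 ≤ C := by positivity
    linarith
  have h := SchwartzMap.one_add_le_sup_seminorm_apply (𝕜 := ℝ) (m := (L, 0)) le_rfl le_rfl f x
  rw [norm_iteratedFDeriv_zero] at h
  rw [← div_eq_mul_inv, le_div_iff₀ (by positivity), mul_comm]
  exact h.trans (by simp [C])

theorem integrable_inv_one_add_pow {E : Type*} [NormedAddCommGroup E] [NormedSpace ℝ E]
    [FiniteDimensional ℝ E] [MeasurableSpace E] [BorelSpace E] (ν : Measure E) [ν.IsAddHaarMeasure]
    {L : ℕ} (hL : Module.finrank ℝ E < L) : Integrable (fun x : E => ((1 + ‖x‖) ^ L)⁻¹) ν := by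
  have h := integrable_one_add_norm (μ := ν) (r := (L : ℝ)) (by exact_mod_cast hL)
  refine h.congr (.of_forall fun x => ?_)
  simp only
  rw [Real.rpow_neg (by positivity), rpow_natCast]

section QuadForm
variable {V : Type*} [NormedAddCommGroup V] [InnerProductSpace ℝ V] [FiniteDimensional ℝ V]
  [MeasurableSpace V] [BorelSpace V]
variable {A : Type*} [MeasurableSpace A] {μ : Measure A} [SFinite μ]

theorem integral_mul_normSq_fourier {c : A → ℂ} (hc : Integrable c μ) {v : A → V}
    (hv : Measurable v) {h : V → ℂ} (hh : Integrable h) :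
    ∫ a, c a * ((‖𝓕 h (v a)‖ ^ 2 : ℝ) : ℂ) ∂μ = ∫ p : V × V, h p.1 * conj (h p.2) *
      ∫ a, c a * exp (2 * π * I * (inner ℝ (p.2 - p.1) (v a) : ℝ)) ∂μ := by
  have hs : Integrable (fun x => conj (h x)) :=
    Complex.conjCLE.toContinuousLinearMap.integrable_comp hh
  have hp : Integrable (fun p : V × V => h p.1 * conj (h p.2)) (volume.prod volume) :=
    hh.mul_prod hs
  have e1 : ∀ a, c a * ((‖𝓕 h (v a)‖ ^ 2 : ℝ) : ℂ) = ∫ p : V × V, c a * (h p.1 * conj (h p.2) *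
      exp (2 * π * I * (inner ℝ (p.2 - p.1) (v a) : ℝ))) := by
    intro a
    rw [integral_const_mul]
    congr 1
    have : ((‖𝓕 h (v a)‖ ^ 2 : ℝ) : ℂ) = 𝓕 h (v a) * conj (𝓕 h (v a)) := by
      rw [Complex.mul_conj, Complex.normSq_eq_norm_sq]
    rw [this, fourier_eq', ← integral_conj, ← integral_prod_mul]
    refine integral_congr_ae (.of_forall fun p => ?_)
    simp only [smul_eq_mul, map_mul, ← Complex.exp_conj, Complex.conj_ofReal, Complex.conj_I,
      inner_sub_left]
    rw [mul_mul_mul_comm, ← exp_add, mul_comm]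
    congr 2
    push_cast
    ring
  simp only [e1]
  rw [integral_integral_swap]
  · refine integral_congr_ae (.of_forall fun p => ?_)
    simp only
    rw [← integral_const_mul]
    congr 1; ext a; ring
  · have hm : Measurable fun q : A × (V × V) =>
        exp (2 * π * I * (inner ℝ (q.2.2 - q.2.1) (v q.1) : ℝ)) := by
      fun_prop
    have h1 := (hc.mul_prod hp)
    refine (h1.mul_bdd (c := 1) hm.aestronglyMeasurable (.of_forall fun q => ?_)).congr
      (.of_forall fun q => ?_)
    · rw [show (2 * π * I * (inner ℝ (q.2.2 - q.2.1) (v q.1) : ℝ) : ℂ) =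
        ((2 * π * (inner ℝ (q.2.2 - q.2.1) (v q.1)) : ℝ) : ℂ) * I by push_cast; ring,
        norm_exp_ofReal_mul_I]
    · simp only [uncurry]; ring
end QuadForm

section Bump
variable {E : Type*} [NormedAddCommGroup E] [InnerProductSpace ℝ E] [FiniteDimensional ℝ E]

theorem exists_schwartz_bump (a b : ℝ) (ha : 0 < a) (hab : a < b) : ∃ Φ : 𝓢(E, ℂ),
    (∀ x, ‖x‖ ≤ a → Φ x = 1) ∧ (∀ x, b ≤ ‖x‖ → Φ x = 0) ∧ (∀ x, ‖Φ x‖ ≤ 1) := by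
  let f : ContDiffBump (0 : E) := ⟨a, b, ha, hab⟩
  have hc : HasCompactSupport fun x => ((f x : ℝ) : ℂ) := by
    have := f.hasCompactSupport
    exact HasCompactSupport.comp_left (g := fun t : ℝ => (t : ℂ)) this Complex.ofReal_zero
  have hd : ContDiff ℝ (⊤ : ℕ∞) fun x => ((f x : ℝ) : ℂ) :=
    Complex.ofRealCLM.contDiff.comp f.contDiff
  refine ⟨hc.toSchwartzMap hd, fun x hx => ?_, fun x hx => ?_, fun x => ?_⟩
  · have := f.one_of_mem_closedBall (x := x) (by simpa using hx)
    simp [this]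
  · have := f.zero_of_le_dist (x := x) (by simpa using hx)
    simp [this]
  · have := f.le_one (x := x)
    have := f.nonneg (x := x)
    simp [abs_of_nonneg, *]
end Bump

section Sph
variable {n : ℕ} [Fact (2 ≤ n)]

theorem continuous_sphHat : Continuous (sphHat n) := by
  unfold sphHat
  refine continuous_of_dominated (bound := fun _ => 1) (fun x => ?_) (fun x => ?_) ?_ ?_
  · fun_prop
  · refine .of_forall fun ω => ?_
    rw [show (2 * π * I * (inner ℝ x (ω : Rn n) : ℝ) : ℂ) =
        ((2 * π * (inner ℝ x (ω : Rn n)) : ℝ) : ℂ) * I by push_cast; ring,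
        norm_exp_ofReal_mul_I]
  · exact integrable_const _
  · exact .of_forall fun ω => by fun_prop

theorem exists_lintegral_sph_kernel_le (n : ℕ) [Fact (2 ≤ n)] : ∃ C : ℝ, 0 < C ∧ ∀ R : ℝ, 1 ≤ R → ∀ η : Rn n,
    ∫⁻ ω, ofReal (R ^ n * ((1 + R * ‖η - (ω : Rn n)‖) ^ (n + 1))⁻¹) ∂sph n ≤ ofReal (C * R) := by
  have hI : Integrable (fun x : Rn n => ((1 + ‖x‖) ^ (n + 1))⁻¹) :=
    integrable_inv_one_add_pow volume (by simp)
  set J := ∫ x : Rn n, ((1 + ‖x‖) ^ (n + 1))⁻¹ with hJ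
  have hJe : ∫⁻ x : Rn n, ofReal ((1 + ‖x‖) ^ (n + 1))⁻¹ = ofReal J :=
    (ofReal_integral_eq_lintegral_ofReal hI (.of_forall fun x => by positivity)).symm
  refine ⟨2 ^ (n + 1) * J + 1, by positivity, fun R hR η => ?_⟩
  have hR0 : 0 < R := by linarith
  set k : Rn n → ℝ≥0∞ := fun x => ofReal (R ^ n * ((1 + R * ‖η - x‖) ^ (n + 1))⁻¹) with hk
  have hkm : Measurable k := by
    refine Continuous.measurable ?_
    refine ENNReal.continuous_ofReal.comp (Continuous.mul continuous_const ?_)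
    exact Continuous.inv₀ (by fun_prop) fun x => by positivity
  have e1 : ∫⁻ x, k x = ofReal J := by
    have h1 := lintegral_sub_left_eq_self (μ := (volume : Measure (Rn n)))
      (fun y => ofReal (R ^ n * ((1 + R * ‖y‖) ^ (n + 1))⁻¹)) η
    simp only [hk]
    rw [h1]
    have h2 := lintegral_comp_smul_eq (volume : Measure (Rn n))
      (fun y => ofReal (R ^ n * ((1 + ‖y‖) ^ (n + 1))⁻¹)) hR0.ne'
    simp only [norm_smul, norm_of_nonneg hR0.le] at h2
    rw [h2]
    simp only [ofReal_mul (pow_nonneg hR0.le n)]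
    rw [lintegral_ofReal_mul, hJe, ← mul_assoc,
      ← ofReal_mul (by positivity), abs_of_pos (by positivity), finrank_euclideanSpace_fin,
      inv_mul_cancel₀ (by positivity), ofReal_one, one_mul]
  have e2 := lintegral_polar_swap hkm
  rw [e1] at e2
  have e3 : ∫⁻ ρ in Icc (1:ℝ) (1 + 1 / R), ofReal (2 ^ (n + 1))⁻¹ *
      (∫⁻ ω, k ω ∂sph n) ≤ ofReal J := by
    rw [e2]
    refine (setLIntegral_mono' measurableSet_Icc fun ρ hρ => ?_).trans
      (lintegral_mono_set fun x hx => lt_of_lt_of_le one_pos hx.1)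
    have h1 : (1:ℝ≥0∞) ≤ ofReal (ρ ^ (n - 1)) := by
      rw [← ofReal_one]
      exact ofReal_le_ofReal (one_le_pow₀ hρ.1)
    refine le_trans ?_ (mul_le_mul' h1 le_rfl)
    rw [one_mul, ← lintegral_ofReal_mul]
    refine lintegral_mono fun ω => ?_
    simp only [hk]
    rw [← ofReal_mul (by positivity)]
    refine ofReal_le_ofReal ?_
    rw [mul_left_comm, ← mul_inv, ← mul_pow]
    refine mul_le_mul_of_nonneg_left ?_ (by positivity)
    refine inv_anti₀ (by positivity) ?_
    refine pow_le_pow_left₀ (by positivity) ?_ _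
    have : ‖η - ρ • (ω : Rn n)‖ ≤ ‖η - (ω : Rn n)‖ + 1 / R := by
      have : η - ρ • (ω : Rn n) = (η - (ω : Rn n)) + (1 - ρ) • (ω : Rn n) := by module
      rw [this]
      refine (norm_add_le _ _).trans (add_le_add le_rfl ?_)
      rw [norm_smul, norm_eq_of_mem_sphere, mul_one, norm_eq_abs, abs_le]
      constructor <;> linarith [hρ.1, hρ.2, one_div_pos.2 hR0]
    have h2 : R * ‖η - ρ • (ω : Rn n)‖ ≤ R * ‖η - (ω : Rn n)‖ + 1 := by
      calc _ ≤ R * (‖η - (ω : Rn n)‖ + 1 / R) := by gcongr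
        _ = _ := by field_simp
    have h3 : 0 ≤ R * ‖η - (ω : Rn n)‖ := by positivity
    linarith
  rw [setLIntegral_const, Real.volume_Icc] at e3
  have e4 : ∫⁻ ω, k ω ∂sph n = ofReal (2 ^ (n + 1) * R) * (ofReal (2 ^ (n + 1))⁻¹ *
      (∫⁻ ω, k ω ∂sph n) * ofReal (1 + 1 / R - 1)) := by
    rw [mul_right_comm, ← ofReal_mul (by positivity), ← mul_assoc,
      ← ofReal_mul (by positivity)]
    rw [show (2 ^ (n + 1) * R * ((2 ^ (n + 1))⁻¹ * (1 + 1 / R - 1)) : ℝ) = 1 by field_simp; ring]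
    simp
  rw [e4]
  refine (mul_le_mul' le_rfl e3).trans ?_
  rw [← ofReal_mul (by positivity)]
  refine ofReal_le_ofReal ?_
  nlinarith
end Sph

theorem exists_lintegral_sph_fourier_le (n : ℕ) [Fact (2 ≤ n)] : ∃ C : ℝ, 0 < C ∧
    ∀ R : ℝ, 1 ≤ R → ∀ h : Rn n → ℂ, Integrable h →
    ∫⁻ ω, ‖𝓕 h (ω : Rn n)‖ₑ ^ 2 ∂sph n ≤ ofReal (C * R) * (∫⁻ x, ‖h x‖ₑ ^ 2) +
      ofReal (C * √(R ^ (n - 1))⁻¹) * (∫⁻ x, ‖h x‖ₑ) ^ 2 := by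
  obtain ⟨Φ, hΦ1, -, hΦ3⟩ := exists_schwartz_bump (E := Rn n) 1 2 one_pos (by norm_num)
  obtain ⟨C1, hC1, hdec⟩ := schwartz_decay (𝓕 Φ) (n + 1)
  obtain ⟨C2, hC2, hker⟩ := exists_lintegral_sph_kernel_le n
  obtain ⟨C3, hC3, hsph⟩ := exists_sphHat_decay n
  refine ⟨C1 * C2 + 2 * √C3, by positivity, fun R hR h hh => ?_⟩
  have hR0 : 0 < R := by linarith
  have hhF := continuous_fourier_of_integrable hh
  have hbd : ∀ ξ, ‖𝓕 h ξ‖ ≤ ∫ x, ‖h x‖ := fun ξ => by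
    rw [Real.fourier_eq]
    refine (norm_integral_le_integral_norm _).trans (le_of_eq ?_)
    simp
  set I1 : ℂ := ∫ ω : sphere (0 : Rn n) 1, (1 : ℂ) * ((‖𝓕 h (ω : Rn n)‖ ^ 2 : ℝ) : ℂ) ∂sph n with hI1
  set I2 : ℂ := ∫ q : sphere (0 : Rn n) 1 × Rn n, (𝓕 Φ : 𝓢(Rn n, ℂ)) q.2 *
    ((‖𝓕 h ((q.1 : Rn n) + R⁻¹ • q.2)‖ ^ 2 : ℝ) : ℂ) ∂(sph n).prod volume with hI2
  have e1 : ∫⁻ ω, ‖𝓕 h (ω : Rn n)‖ₑ ^ 2 ∂sph n = ‖I1‖ₑ := by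
    have : I1 = ((∫ ω : sphere (0 : Rn n) 1, ‖𝓕 h (ω : Rn n)‖ ^ 2 ∂sph n : ℝ) : ℂ) := by
      rw [hI1, ← integral_complex_ofReal]; simp
    have hint : Integrable (fun ω : sphere (0 : Rn n) 1 => ‖𝓕 h (ω : Rn n)‖ ^ 2) (sph n) := by
      refine Integrable.of_bound (C := (∫ x, ‖h x‖) ^ 2) ?_ (.of_forall fun ω => ?_)
      · fun_prop
      · rw [norm_of_nonneg (by positivity)]
        exact pow_le_pow_left₀ (norm_nonneg _) (hbd _) 2
    rw [this, ← ofReal_norm, norm_real, norm_of_nonneg (integral_nonneg fun _ => by positivity),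
      ofReal_integral_eq_lintegral_ofReal hint (.of_forall fun _ => by positivity)]
    refine lintegral_congr fun ω => ?_
    rw [ofReal_pow (norm_nonneg _), ofReal_norm]
  have : SFinite (volume : Measure (Rn n)) := inferInstance
  have : SFinite (sph n) := inferInstance
  have : SFinite ((sph n).prod (volume : Measure (Rn n))) := Measure.prod.instSFinite
  have hA := integral_mul_normSq_fourier (μ := sph n) (c := fun _ => 1) (integrable_const _)
    (v := fun ω => (ω : Rn n)) measurable_subtype_coe hh
  have hc2 : Integrable (fun q : sphere (0 : Rn n) 1 × Rn n => (𝓕 Φ : 𝓢(Rn n, ℂ)) q.2)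
      ((sph n).prod volume) := by
    have := (integrable_const (μ := sph n) (1:ℂ)).mul_prod (SchwartzMap.integrable (𝓕 Φ) (μ := volume))
    simpa using this
  have hB := integral_mul_normSq_fourier (μ := (sph n).prod volume) hc2
    (v := fun q => (q.1 : Rn n) + R⁻¹ • q.2) (by fun_prop) hh
  have hB' : ∀ z : Rn n, ∫ q : sphere (0 : Rn n) 1 × Rn n, (𝓕 Φ : 𝓢(Rn n, ℂ)) q.2 *
      exp (2 * π * I * (inner ℝ z ((q.1 : Rn n) + R⁻¹ • q.2) : ℝ))
        ∂(sph n).prod volume = sphHat n z * Φ (R⁻¹ • z) := by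
    intro z
    have : Φ (R⁻¹ • z) = ∫ u : Rn n, exp (2 * π * I * (inner ℝ z (R⁻¹ • u) : ℝ)) *
        (𝓕 Φ : 𝓢(Rn n, ℂ)) u := by
      have h1 : 𝓕⁻ (𝓕 Φ : 𝓢(Rn n, ℂ)) (R⁻¹ • z) = Φ (R⁻¹ • z) := by
        rw [FourierTransform.fourierInv_fourier_eq]
      rw [← h1, fourierInv_coe, fourierInv_eq']
      refine integral_congr_ae (.of_forall fun u => ?_)
      have : inner ℝ u (R⁻¹ • z) = (inner ℝ z (R⁻¹ • u) : ℝ) := by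
        rw [inner_smul_right, inner_smul_right, real_inner_comm]
      simp only [smul_eq_mul, this]
      congr 2
      push_cast
      ring
    rw [this, sphHat, ← integral_prod_mul]
    refine integral_congr_ae (.of_forall fun q => ?_)
    simp only [inner_add_right]
    rw [← mul_assoc, ← exp_add, mul_comm]
    congr 2
    push_cast; ring
  simp only [hB'] at hB
  have hA' : I1 = ∫ p : Rn n × Rn n, h p.1 * conj (h p.2) * sphHat n (p.2 - p.1) := by
    rw [hI1, hA]
    simp only [one_mul, sphHat]
  have hs : Integrable (fun x => conj (h x)) :=
    Complex.conjCLE.toContinuousLinearMap.integrable_comp hh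
  have hp : Integrable (fun p : Rn n × Rn n => h p.1 * conj (h p.2)) (volume.prod volume) :=
    hh.mul_prod hs
  have hsb : ∀ z, ‖sphHat n z‖ ≤ (sph n).real univ := fun z => by
    unfold sphHat
    refine (norm_integral_le_of_norm_le_const (C := 1) (.of_forall fun ω => ?_)).trans (by simp)
    rw [show (2 * π * I * (inner ℝ z (ω : Rn n) : ℝ) : ℂ) =
        ((2 * π * (inner ℝ z (ω : Rn n)) : ℝ) : ℂ) * I by push_cast; ring,
        norm_exp_ofReal_mul_I]
  have hsc := continuous_sphHat (n := n)
  have hi1 : Integrable (fun p : Rn n × Rn n => h p.1 * conj (h p.2) * sphHat n (p.2 - p.1))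
      (volume.prod volume) :=
    hp.mul_bdd (c := (sph n).real univ) (hsc.comp (by fun_prop)).aestronglyMeasurable
      (.of_forall fun p => hsb _)
  have hΦc : Continuous fun x => Φ x := Φ.continuous
  have hi2 : Integrable (fun p : Rn n × Rn n => h p.1 * conj (h p.2) *
      (sphHat n (p.2 - p.1) * Φ (R⁻¹ • (p.2 - p.1)))) (volume.prod volume) := by
    refine hp.mul_bdd (c := (sph n).real univ * 1) ?_ (.of_forall fun p => ?_)
    · exact ((hsc.comp (by fun_prop)).mul (hΦc.comp (by fun_prop))).aestronglyMeasurable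
    · rw [norm_mul]; gcongr; exacts [hsb _, hΦ3 _]
  have hdiff : ‖I1 - I2‖ₑ ≤ ofReal (2 * √C3 * √(R ^ (n - 1))⁻¹) * (∫⁻ x, ‖h x‖ₑ) ^ 2 := by
    rw [hA', hI2, hB, Measure.volume_eq_prod, ← integral_sub hi1 hi2]
    refine (enorm_integral_le_lintegral_enorm _).trans ?_
    have : ∀ p : Rn n × Rn n, ‖h p.1 * conj (h p.2) * sphHat n (p.2 - p.1) - h p.1 * conj (h p.2) *
      (sphHat n (p.2 - p.1) * Φ (R⁻¹ • (p.2 - p.1)))‖ₑ ≤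
        ofReal (2 * √C3 * √(R ^ (n - 1))⁻¹) * (‖h p.1‖ₑ * ‖h p.2‖ₑ) := by
      intro p
      set z := p.2 - p.1
      rw [show h p.1 * conj (h p.2) * sphHat n z - h p.1 * conj (h p.2) *
        (sphHat n z * Φ (R⁻¹ • z)) = (sphHat n z * (1 - Φ (R⁻¹ • z))) * (h p.1 * conj (h p.2)) by ring,
        enorm_mul, enorm_mul (h p.1)]
      have e : ‖conj (h p.2)‖ₑ = ‖h p.2‖ₑ := by
        rw [← ofReal_norm, ← ofReal_norm, RCLike.norm_conj]
      rw [e]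
      refine mul_le_mul' ?_ le_rfl
      rw [← ofReal_norm]
      refine ofReal_le_ofReal ?_
      rcases le_or_gt ‖z‖ R with hz | hz
      · rw [hΦ1 _ (by rw [norm_smul, norm_inv, norm_of_nonneg hR0.le,
          inv_mul_le_iff₀ hR0, mul_one]; exact hz)]
        simp; positivity
      · rw [norm_mul, mul_comm, mul_assoc]
        refine mul_le_mul ?_ ?_ (norm_nonneg _) (by norm_num)
        · refine (norm_sub_le _ _).trans ?_
          have := hΦ3 (R⁻¹ • z)
          simp; linarith
        · rw [← Real.sqrt_mul hC3.le]
          refine Real.le_sqrt_of_sq_le ?_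
          rw [← div_eq_mul_inv, le_div_iff₀ (by positivity)]
          refine le_trans ?_ (hsph z)
          gcongr
    refine (lintegral_mono this).trans ?_
    rw [lintegral_ofReal_mul, lintegral_prod_mul hh.1.enorm hh.1.enorm, sq]
  have hI2le : ‖I2‖ₑ ≤ ofReal (C1 * C2 * R) * ∫⁻ x, ‖h x‖ₑ ^ 2 := by
    rw [hI2]
    refine (enorm_integral_le_lintegral_enorm _).trans ?_
    have hΦm : Continuous fun u => (𝓕 Φ : 𝓢(Rn n, ℂ)) u := (𝓕 Φ : 𝓢(Rn n, ℂ)).continuous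
    have e2 : ∀ q : sphere (0 : Rn n) 1 × Rn n, ‖(𝓕 Φ : 𝓢(Rn n, ℂ)) q.2 *
        ((‖𝓕 h ((q.1 : Rn n) + R⁻¹ • q.2)‖ ^ 2 : ℝ) : ℂ)‖ₑ =
        ‖(𝓕 Φ : 𝓢(Rn n, ℂ)) q.2‖ₑ * ‖𝓕 h ((q.1 : Rn n) + R⁻¹ • q.2)‖ₑ ^ 2 := by
      intro q
      rw [enorm_mul, ← ofReal_norm ((_ : ℝ) : ℂ), norm_real, norm_of_nonneg (by positivity),
        ofReal_pow (norm_nonneg _), ofReal_norm]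
    simp only [e2]
    rw [lintegral_prod _ (Measurable.aemeasurable ?_)]
    swap
    · have a1 := hΦm.measurable
      have a2 := hhF.measurable
      refine Measurable.fun_mul ?_ (Measurable.pow_const (β := ℝ≥0∞) (γ := ℕ) ?_ _)
      · exact (a1.comp measurable_snd).enorm
      · exact (a2.comp (by fun_prop)).enorm
    have e3 : ∀ ω : sphere (0 : Rn n) 1, ∫⁻ u : Rn n, ‖(𝓕 Φ : 𝓢(Rn n, ℂ)) u‖ₑ *
        ‖𝓕 h ((ω : Rn n) + R⁻¹ • u)‖ₑ ^ 2 ≤ ∫⁻ η : Rn n, ofReal C1 * (ofReal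
          (R ^ n * ((1 + R * ‖η - (ω : Rn n)‖) ^ (n + 1))⁻¹) * ‖𝓕 h η‖ₑ ^ 2) := by
      intro ω
      have h1 := lintegral_comp_smul_eq (volume : Measure (Rn n))
        (fun u => ‖(𝓕 Φ : 𝓢(Rn n, ℂ)) u‖ₑ * ‖𝓕 h ((ω : Rn n) + R⁻¹ • u)‖ₑ ^ 2) hR0.ne'
      rw [abs_of_pos (by positivity), finrank_euclideanSpace_fin] at h1
      have h2 : ∀ X : ℝ≥0∞, X = ofReal (R ^ n) * (ofReal (R ^ n)⁻¹ * X) := fun X => by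
        rw [← mul_assoc, ← ofReal_mul (by positivity), mul_inv_cancel₀ (by positivity)]; simp
      rw [h2 (∫⁻ u : Rn n, ‖(𝓕 Φ : 𝓢(Rn n, ℂ)) u‖ₑ * ‖𝓕 h ((ω : Rn n) + R⁻¹ • u)‖ₑ ^ 2), ← h1,
        ← lintegral_sub_right_eq_self _ (ω : Rn n), ← lintegral_ofReal_mul]
      refine lintegral_mono fun η => ?_
      rw [inv_smul_smul₀ hR0.ne', add_sub_cancel, ← mul_assoc, ← mul_assoc]
      refine mul_le_mul' ?_ le_rfl
      rw [← ofReal_norm, ← ofReal_mul (by positivity), ← ofReal_mul (by positivity)]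
      refine ofReal_le_ofReal ?_
      have := hdec (R • (η - (ω : Rn n)))
      rw [norm_smul, norm_of_nonneg hR0.le] at this
      calc _ ≤ R ^ n * (C1 * ((1 + R * ‖η - (ω : Rn n)‖) ^ (n + 1))⁻¹) := by gcongr
        _ = _ := by ring
    refine (lintegral_mono e3).trans ?_
    rw [lintegral_lintegral_swap]
    · have e4 : ∀ η : Rn n, ∫⁻ ω, ofReal C1 * (ofReal
          (R ^ n * ((1 + R * ‖η - (ω : Rn n)‖) ^ (n + 1))⁻¹) * ‖𝓕 h η‖ₑ ^ 2) ∂sph n ≤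
          ofReal (C1 * C2 * R) * ‖𝓕 h η‖ₑ ^ 2 := by
        intro η
        rw [lintegral_ofReal_mul, lintegral_mul_const' _ _ (by simp),
          ← mul_assoc, mul_assoc C1, ofReal_mul hC1.le]
        exact mul_le_mul' (mul_le_mul' le_rfl (hker R hR η)) le_rfl
      refine (lintegral_mono e4).trans ?_
      rw [lintegral_ofReal_mul]
      exact mul_le_mul' le_rfl (lintegral_fourier_sq_le hh)
    · refine Measurable.aemeasurable ?_
      refine Measurable.const_mul (f := fun q : sphere (0 : Rn n) 1 × Rn n => ofReal
        (R ^ n * ((1 + R * ‖q.2 - (q.1 : Rn n)‖) ^ (n + 1))⁻¹) * ‖𝓕 h q.2‖ₑ ^ 2) ?_ _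
      refine Measurable.fun_mul ?_ ?_
      · refine ENNReal.measurable_ofReal.comp (Measurable.const_mul ?_ _)
        exact Measurable.inv (by fun_prop)
      · exact ((hhF.measurable.comp measurable_snd).enorm).pow_const _
  rw [e1]
  calc ‖I1‖ₑ = ‖I2 + (I1 - I2)‖ₑ := by rw [add_sub_cancel]
    _ ≤ ‖I2‖ₑ + ‖I1 - I2‖ₑ := enorm_add_le _ _
    _ ≤ _ := by
      refine add_le_add (hI2le.trans ?_) (hdiff.trans ?_)
      · refine mul_le_mul' (ofReal_le_ofReal ?_) le_rfl
        have : 0 ≤ √C3 := by positivity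
        nlinarith
      · refine mul_le_mul' (ofReal_le_ofReal ?_) le_rfl
        have : 0 ≤ √(R ^ (n - 1))⁻¹ := by positivity
        have := mul_pos hC1 hC2
        nlinarith

/-- The Fourier extension operator of the unit sphere. -/
def sphExt (n : ℕ) (g : sphere (0 : Rn n) 1 → ℂ) (x : Rn n) : ℂ :=
  ∫ ω, g ω * exp (2 * π * I * (inner ℝ x (ω : Rn n) : ℝ)) ∂sph n

section
variable {n : ℕ} [Fact (2 ≤ n)]

theorem norm_exp_two_pi_inner (x y : Rn n) :
    ‖exp (2 * π * I * (inner ℝ x y : ℝ))‖ = 1 := by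
  rw [show (2 * π * I * (inner ℝ x y : ℝ) : ℂ) =
        ((2 * π * (inner ℝ x y) : ℝ) : ℂ) * I by push_cast; ring,
        norm_exp_ofReal_mul_I]

theorem integrable_of_continuous_sph {g : sphere (0 : Rn n) 1 → ℂ} (hg : Continuous g) :
    Integrable g (sph n) :=
  hg.integrable_of_hasCompactSupport (HasCompactSupport.of_compactSpace g)

theorem continuous_sphExt {g : sphere (0 : Rn n) 1 → ℂ} (hg : Continuous g) :
    Continuous (sphExt n g) := by
  unfold sphExt
  refine continuous_of_dominated (bound := fun ω => ‖g ω‖) (fun x => ?_) (fun x => ?_) ?_ ?_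
  · fun_prop
  · exact .of_forall fun ω => by rw [norm_mul, norm_exp_two_pi_inner, mul_one]
  · exact (integrable_of_continuous_sph hg).norm
  · exact .of_forall fun ω => by fun_prop

theorem norm_sphExt_le (g : sphere (0 : Rn n) 1 → ℂ) (x : Rn n) :
    ‖sphExt n g x‖ ≤ ∫ ω, ‖g ω‖ ∂sph n := by
  refine (norm_integral_le_integral_norm _).trans (le_of_eq ?_)
  simp only [norm_mul, norm_exp_two_pi_inner, mul_one]

end

theorem exists_lintegral_weight_sphExt_le (n : ℕ) [Fact (2 ≤ n)] : ∃ C : ℝ, 0 < C ∧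
    ∀ R : ℝ, 1 ≤ R → ∀ g : sphere (0 : Rn n) 1 → ℂ, Continuous g →
    ∀ w : Rn n → ℝ≥0∞, Measurable w → (∀ x, w x ≤ 1) → ∫⁻ x, w x ≠ ∞ →
    ∫⁻ x, w x * ‖sphExt n g x‖ₑ ^ 2 ≤ (ofReal (C * R) +
      ofReal (C * √(R ^ (n - 1))⁻¹) * ∫⁻ x, w x) * ∫⁻ ω, ‖g ω‖ₑ ^ 2 ∂sph n := by
  obtain ⟨C, hC, hmain⟩ := exists_lintegral_sph_fourier_le n
  refine ⟨C, hC, fun R hR g hg w hw hw1 hwi => ?_⟩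
  have hc := continuous_sphExt hg
  set B := ∫ ω, ‖g ω‖ ∂sph n
  have hB : ∀ x, ‖sphExt n g x‖ ≤ B := norm_sphExt_le g
  have hwt : ∀ x, w x ≠ ∞ := fun x => ((hw1 x).trans_lt ENNReal.one_lt_top).ne
  set h : Rn n → ℂ := fun x => ((w x).toReal : ℂ) * sphExt n g x with hh
  have hwI : Integrable fun x => (w x).toReal := integrable_toReal_of_lintegral_ne_top hw.aemeasurable hwi
  have hhI : Integrable h := by
    refine (hwI.ofReal (𝕜 := ℂ)).mul_bdd (c := B) hc.aestronglyMeasurable (.of_forall hB)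
  have hhe : ∀ x, ‖h x‖ₑ = w x * ‖sphExt n g x‖ₑ := fun x => by
    rw [hh, enorm_mul, ← ofReal_norm ((_ : ℝ) : ℂ), norm_real,
      norm_of_nonneg toReal_nonneg, ofReal_toReal (hwt x)]
  set J := ∫⁻ x, w x * ‖sphExt n g x‖ₑ ^ 2 with hJ
  have hJt : J ≠ ∞ := by
    refine ne_top_of_le_ne_top (b := (∫⁻ x, w x) * ofReal B ^ 2) (mul_ne_top hwi (by simp)) ?_
    rw [← lintegral_mul_const' _ _ (by simp)]
    refine lintegral_mono fun x => mul_le_mul' le_rfl (pow_le_pow_left' ?_ 2)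
    rw [← ofReal_norm]; exact ofReal_le_ofReal (hB x)
  set G := ∫⁻ ω, ‖g ω‖ₑ ^ 2 ∂sph n with hG
  have e1 : J = ‖∫ x, h x * conj (sphExt n g x)‖ₑ := by
    have e2 : ∀ x, h x * conj (sphExt n g x) = (((w x).toReal * ‖sphExt n g x‖ ^ 2 : ℝ) : ℂ) := by
      intro x
      rw [hh, mul_assoc, Complex.mul_conj, Complex.normSq_eq_norm_sq]; push_cast; rfl
    simp only [e2]
    have e3 : Integrable fun x => (w x).toReal * ‖sphExt n g x‖ ^ 2 := by
      refine hwI.mul_bdd (c := B ^ 2) (by fun_prop)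
        (.of_forall fun x => ?_)
      rw [norm_of_nonneg (by positivity)]
      exact pow_le_pow_left₀ (norm_nonneg _) (hB x) 2
    rw [integral_complex_ofReal, ← ofReal_norm, norm_real,
      norm_of_nonneg (integral_nonneg fun _ => by positivity),
      ofReal_integral_eq_lintegral_ofReal e3 (.of_forall fun _ => by positivity)]
    refine lintegral_congr fun x => ?_
    rw [ofReal_mul toReal_nonneg, ofReal_toReal (hwt x), ofReal_pow (norm_nonneg _), ofReal_norm]
  have e2 : ∫ x, h x * conj (sphExt n g x) = ∫ ω, conj (g ω) * 𝓕 h (ω : Rn n) ∂sph n := by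
    have e3 : ∀ x, h x * conj (sphExt n g x) = ∫ ω, h x * (conj (g ω) *
        exp (-(2 * π * I * (inner ℝ x (ω : Rn n) : ℝ)))) ∂sph n := by
      intro x
      rw [integral_const_mul, sphExt, ← integral_conj]
      congr 2; ext ω
      rw [map_mul, ← Complex.exp_conj]
      congr 2
      simp [show (starRingEnd ℂ) 2 = 2 from Complex.conj_ofReal 2]
    simp only [e3]
    rw [integral_integral_swap]
    · refine integral_congr_ae (.of_forall fun ω => ?_)
      simp only [fourier_eq']
      rw [← integral_const_mul]
      congr 1; ext x
      rw [smul_eq_mul, mul_left_comm, mul_comm (h x)]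
      congr 3
      push_cast; ring
    · have hgi : Integrable (fun ω => conj (g ω)) (sph n) :=
        integrable_of_continuous_sph (by fun_prop)
      have h1 := hhI.mul_prod hgi
      refine (h1.mul_bdd (c := 1) (g := fun q : Rn n × sphere (0 : Rn n) 1 =>
        exp (-(2 * π * I * (inner ℝ q.1 (q.2 : Rn n) : ℝ))))
        (by fun_prop)
        (.of_forall fun q => ?_)).congr (.of_forall fun q => ?_)
      · rw [Complex.exp_neg, norm_inv, norm_exp_two_pi_inner, inv_one]
      · simp only [uncurry]; ring
  have e3 : J ^ 2 ≤ G * (ofReal (C * R) * J +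
      ofReal (C * √(R ^ (n - 1))⁻¹) * ((∫⁻ x, w x) * J)) := by
    have hFm := (continuous_fourier_of_integrable hhI)
    calc J ^ 2 ≤ (∫⁻ ω, ‖g ω‖ₑ * ‖𝓕 h (ω : Rn n)‖ₑ ∂sph n) ^ 2 := by
          rw [e1, e2]
          gcongr
          refine (enorm_integral_le_lintegral_enorm _).trans (le_of_eq (lintegral_congr fun ω => ?_))
          rw [enorm_mul]
          congr 1
          rw [← ofReal_norm, ← ofReal_norm, RCLike.norm_conj]
      _ ≤ G * ∫⁻ ω, ‖𝓕 h (ω : Rn n)‖ₑ ^ 2 ∂sph n :=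
          lintegral_mul_sq_le (Continuous.enorm hg).measurable.aemeasurable
            (Continuous.enorm (by fun_prop)).measurable.aemeasurable
      _ ≤ _ := by
          refine mul_le_mul' le_rfl ((hmain R hR h hhI).trans (add_le_add ?_ ?_))
          · refine mul_le_mul' le_rfl (lintegral_mono fun x => ?_)
            simp only [hhe]
            rw [mul_pow, sq (w x), mul_assoc]
            exact mul_le_of_le_one_left' (hw1 x)
          · refine mul_le_mul' le_rfl ?_
            simp only [hhe]
            exact lintegral_mul_sq_le_weight hw.aemeasurable hc.enorm.measurable.aemeasurable
  rcases eq_or_ne J 0 with h0 | h0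
  · rw [h0]; exact zero_le
  · rw [← ENNReal.mul_le_mul_iff_left h0 hJt, ← sq]
    refine e3.trans (le_of_eq ?_)
    ring

/-- The extension operator of the paraboloid, with frequency profile `H`. -/
def quadEvol {n : ℕ} (H : Rn n → ℂ) (τ : ℝ) (x : Rn n) : ℂ :=
  ∫ ζ, exp (I * ((τ * ‖ζ‖ ^ 2 : ℝ) : ℂ)) * (H ζ * exp (2 * π * I * (inner ℝ x ζ : ℝ)))

section
variable {n : ℕ} [Fact (2 ≤ n)]

theorem norm_exp_I_mul_ofReal' (a : ℝ) : ‖exp (I * (a : ℂ))‖ = 1 := by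
  rw [mul_comm, norm_exp_ofReal_mul_I]

theorem continuous_quadEvol {H : Rn n → ℂ} (hH : Integrable H) :
    Continuous fun q : ℝ × Rn n => quadEvol H q.1 q.2 := by
  unfold quadEvol
  refine continuous_of_dominated (bound := fun ω => ‖H ω‖) (fun x => ?_) (fun x => ?_) ?_ ?_
  · have : Continuous fun ζ : Rn n => exp (2 * π * I * (inner ℝ x.2 ζ : ℝ)) := by
      fun_prop
    have h2 : Continuous fun ζ : Rn n => exp (I * ((x.1 * ‖ζ‖ ^ 2 : ℝ) : ℂ)) := by
      fun_prop
    exact h2.aestronglyMeasurable.mul (hH.1.mul this.aestronglyMeasurable)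
  · exact .of_forall fun ω => by
      rw [norm_mul, norm_mul, norm_exp_two_pi_inner, mul_one, norm_exp_I_mul_ofReal', one_mul]
  · exact hH.norm
  · exact .of_forall fun ω => by fun_prop

theorem lintegral_quadEvol_sq_le {H : Rn n → ℂ} (hH : Integrable H) (τ : ℝ) :
    ∫⁻ x, ‖quadEvol H τ x‖ₑ ^ 2 ≤ ∫⁻ ζ, ‖H ζ‖ₑ ^ 2 := by
  set g : Rn n → ℂ := fun ζ => exp (I * ((τ * ‖ζ‖ ^ 2 : ℝ) : ℂ)) * H ζ with hg
  have hge : ∀ ζ, ‖g ζ‖ = ‖H ζ‖ := fun ζ => by rw [hg, norm_mul, norm_exp_I_mul_ofReal', one_mul]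
  have hgi : Integrable g := by
    refine hH.mono ?_ (.of_forall fun ζ => (hge ζ).le)
    have h2 : Continuous fun ζ : Rn n => exp (I * ((τ * ‖ζ‖ ^ 2 : ℝ) : ℂ)) := by
      fun_prop
    exact h2.aestronglyMeasurable.mul hH.1
  have h1 := lintegral_fourierInv_sq_le hgi
  have h2 : ∀ x, quadEvol H τ x = 𝓕⁻ g x := by
    intro x
    rw [fourierInv_eq', quadEvol]
    congr 1; ext ζ
    rw [hg, smul_eq_mul, ← mul_assoc, mul_comm, real_inner_comm]
    congr 2
    push_cast; ring
  simp only [h2]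
  refine h1.trans (le_of_eq (lintegral_congr fun ζ => ?_))
  rw [← ofReal_norm, hge, ofReal_norm]

theorem quadEvol_eq_sphExt (H : Rn n → ℂ) (ρ : ℝ) (x : Rn n) :
    ∫ ω, (H (ρ • (ω : Rn n)) * exp (2 * π * I *
      (inner ℝ x (ρ • (ω : Rn n)) : ℝ))) ∂sph n = sphExt n (fun ω => H (ρ • (ω : Rn n))) (ρ • x) := by
  simp only [sphExt, inner_smul_left, inner_smul_right]
  rfl
end

theorem exists_lintegral_weight_quadEvol_le (n : ℕ) [Fact (2 ≤ n)] : ∃ C : ℝ, 0 < C ∧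
    ∀ R : ℝ, 1 ≤ R → ∀ lam : ℝ, 0 < lam → ∀ H : Rn n → ℂ, Continuous H →
    (∀ ζ, H ζ ≠ 0 → lam / 4 ≤ ‖ζ‖ ∧ ‖ζ‖ ≤ 4 * lam) →
    ∀ w : Rn n → ℝ≥0∞, Measurable w → (∀ x, w x ≤ 1) → ∫⁻ x, w x ≠ ∞ →
    ∫⁻ x, w x * (∫⁻ τ, ‖quadEvol H τ x‖ₑ ^ 2) ≤ ofReal (lam ^ 2)⁻¹ * (ofReal (C * R) +
      ofReal (C * √(R ^ (n - 1))⁻¹ * lam ^ n) * ∫⁻ x, w x) * ∫⁻ ζ, ‖H ζ‖ₑ ^ 2 := by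
  obtain ⟨C, hC, hmain⟩ := exists_lintegral_weight_sphExt_le n
  have hn : 2 ≤ n := Fact.out
  refine ⟨2 * π * 8 * C * 4 ^ n, by positivity, fun R hR lam hlam H hH hsupp w hw hw1 hwi => ?_⟩
  have hHc : HasCompactSupport H := by
    refine HasCompactSupport.of_support_subset_isCompact (isCompact_closedBall (0 : Rn n) (4 * lam)) ?_
    intro ζ hζ
    simpa using (hsupp ζ hζ).2
  have hHi : Integrable H := hH.integrable_of_hasCompactSupport hHc
  set κ := √(R ^ (n - 1))⁻¹ with hκ
  set W := ∫⁻ x, w x with hW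
  have hgc : ∀ ρ : ℝ, Continuous fun ω : sphere (0 : Rn n) 1 => H (ρ • (ω : Rn n)) :=
    fun ρ => by fun_prop
  have hA : ∀ x, ∫⁻ τ, ‖quadEvol H τ x‖ₑ ^ 2 ≤ ofReal (2 * π) *
      ∫⁻ ρ in Ioi (0 : ℝ), ofReal (ρ ^ (2 * (n - 1)) / (2 * ρ)) *
        ‖sphExt n (fun ω => H (ρ • (ω : Rn n))) (ρ • x)‖ₑ ^ 2 := by
    intro x
    have hi : Integrable fun ζ => H ζ * exp (2 * π * I * (inner ℝ x ζ : ℝ)) :=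
      hHi.mul_bdd (c := 1) (by fun_prop)
        (.of_forall fun ζ => (norm_exp_two_pi_inner _ _).le)
    have := lintegral_radial_phase_sq_le (γ := fun ρ => ρ ^ 2) (γ' := fun ρ => 2 * ρ)
      (fun ρ _ => by simpa using hasDerivAt_pow 2 ρ) (fun ρ hρ => by positivity) (by fun_prop) hi
    refine this.trans (mul_le_mul' le_rfl (setLIntegral_mono' measurableSet_Ioi fun ρ hρ => ?_))
    have hρ' : (0:ℝ) < ρ := hρ
    rw [quadEvol_eq_sphExt, enorm_mul, mul_pow, mul_right_comm]
    refine mul_le_mul' (le_of_eq ?_) le_rfl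
    rw [← ofReal_norm, norm_real, norm_of_nonneg (by positivity),
      ← ofReal_pow (by positivity), ← ofReal_mul (by positivity)]
    congr 1
    rw [← pow_mul, mul_comm (n - 1)]; ring
  have hjm : Measurable fun q : Rn n × ℝ => ‖sphExt n (fun ω => H (q.2 • (ω : Rn n))) (q.2 • q.1)‖ₑ ^ 2 := by
    refine Measurable.pow_const (Measurable.enorm ?_) _
    unfold sphExt
    refine StronglyMeasurable.measurable ?_
    refine StronglyMeasurable.integral_prod_right' (f := fun p : (Rn n × ℝ) × sphere (0 : Rn n) 1 =>
      H (p.1.2 • (p.2 : Rn n)) * exp (2 * π * I * (inner ℝ (p.1.2 • p.1.1) (p.2 : Rn n) : ℝ))) ?_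
    exact Continuous.stronglyMeasurable (by fun_prop)
  have hρ : ∀ ρ ∈ Ioi (0:ℝ), ∫⁻ x, w x * (ofReal (ρ ^ (2 * (n - 1)) / (2 * ρ)) *
      ‖sphExt n (fun ω => H (ρ • (ω : Rn n))) (ρ • x)‖ₑ ^ 2) ≤
      (ofReal (8 * (lam ^ 2)⁻¹) * (ofReal (C * R) + ofReal (C * κ * (4 * lam) ^ n) * W)) *
        (ofReal (ρ ^ (n - 1)) * ∫⁻ ω, ‖H (ρ • (ω : Rn n))‖ₑ ^ 2 ∂sph n) := by
    intro ρ hρ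
    have hρ0 : (0:ℝ) < ρ := hρ
    by_cases hr : lam / 4 ≤ ρ ∧ ρ ≤ 4 * lam
    swap
    · have hz : ∀ ω : sphere (0 : Rn n) 1, H (ρ • (ω : Rn n)) = 0 := by
        intro ω
        by_contra h
        have := hsupp _ h
        rw [norm_smul, norm_eq_of_mem_sphere, mul_one, norm_of_nonneg hρ0.le] at this
        exact hr this
      have : ∀ x, sphExt n (fun ω => H (ρ • (ω : Rn n))) x = 0 := by
        intro x; simp [sphExt, hz]
      simp [this]
    have hsc := lintegral_comp_smul_eq (volume : Measure (Rn n)) (fun y => w (ρ⁻¹ • y) *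
      ‖sphExt n (fun ω => H (ρ • (ω : Rn n))) y‖ₑ ^ 2) hρ0.ne'
    simp only [inv_smul_smul₀ hρ0.ne'] at hsc
    have hsw := lintegral_comp_smul_eq (volume : Measure (Rn n)) w (inv_pos.2 hρ0).ne'
    rw [abs_of_pos (by positivity), finrank_euclideanSpace_fin] at hsc hsw
    rw [inv_pow, inv_inv] at hsw
    have hm := hmain R hR _ (hgc ρ) (fun y => w (ρ⁻¹ • y)) (hw.comp (by fun_prop)) (fun y => hw1 _)
      (by rw [hsw]; exact mul_ne_top (by simp) hwi)
    rw [hsw] at hm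
    simp only [mul_left_comm (w _)]
    rw [lintegral_ofReal_mul, hsc]
    refine (mul_le_mul' le_rfl (mul_le_mul' le_rfl hm)).trans ?_
    have e1 : ofReal (ρ ^ (2 * (n - 1)) / (2 * ρ)) * ofReal (ρ ^ n)⁻¹ ≤
        ofReal (8 * (lam ^ 2)⁻¹) * ofReal (ρ ^ (n - 1)) := by
      rw [← ofReal_mul (by positivity), ← ofReal_mul (by positivity)]
      refine ofReal_le_ofReal ?_
      obtain ⟨k, rfl⟩ : ∃ k, n = k + 1 := ⟨n - 1, by omega⟩
      simp only [Nat.add_sub_cancel]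
      have : ρ ^ (2 * k) / (2 * ρ) * (ρ ^ (k + 1))⁻¹ = (1 / 2 * (ρ ^ 2)⁻¹) * ρ ^ k := by
        rw [two_mul, pow_add, pow_succ]; field_simp
      rw [this]
      refine mul_le_mul_of_nonneg_right ?_ (by positivity)
      have : (ρ ^ 2)⁻¹ ≤ ((lam / 4) ^ 2)⁻¹ := by
        refine inv_anti₀ (by positivity) (pow_le_pow_left₀ (by positivity) hr.1 2)
      calc _ ≤ 1 / 2 * ((lam / 4) ^ 2)⁻¹ := by gcongr
        _ = _ := by field_simp; norm_num
    have e2 : (ofReal (C * R) + ofReal (C * κ) * (ofReal (ρ ^ n) * W)) ≤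
        (ofReal (C * R) + ofReal (C * κ * (4 * lam) ^ n) * W) := by
      refine add_le_add le_rfl ?_
      rw [← mul_assoc, ← ofReal_mul (by positivity)]
      refine mul_le_mul' (ofReal_le_ofReal ?_) le_rfl
      have := hr.2
      gcongr
    refine le_trans (le_of_eq ?_) ((mul_le_mul' (mul_le_mul' e1 e2) (le_refl
      (∫⁻ ω, ‖H (ρ • (ω : Rn n))‖ₑ ^ 2 ∂sph n))).trans (le_of_eq ?_)) <;> ring
  calc _ ≤ ∫⁻ x, w x * (ofReal (2 * π) *
      ∫⁻ ρ in Ioi (0 : ℝ), ofReal (ρ ^ (2 * (n - 1)) / (2 * ρ)) *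
        ‖sphExt n (fun ω => H (ρ • (ω : Rn n))) (ρ • x)‖ₑ ^ 2) :=
        lintegral_mono fun x => mul_le_mul' le_rfl (hA x)
    _ = ofReal (2 * π) * ∫⁻ x, ∫⁻ ρ in Ioi (0 : ℝ),
        w x * (ofReal (ρ ^ (2 * (n - 1)) / (2 * ρ)) *
        ‖sphExt n (fun ω => H (ρ • (ω : Rn n))) (ρ • x)‖ₑ ^ 2) := by
        rw [← lintegral_ofReal_mul]
        refine lintegral_congr fun x => ?_
        rw [mul_left_comm, lintegral_const_mul' _ _ ((hw1 x).trans_lt ENNReal.one_lt_top).ne]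
    _ = ofReal (2 * π) * ∫⁻ ρ in Ioi (0 : ℝ), (∫⁻ x,
        w x * (ofReal (ρ ^ (2 * (n - 1)) / (2 * ρ)) *
        ‖sphExt n (fun ω => H (ρ • (ω : Rn n))) (ρ • x)‖ₑ ^ 2)) := by
        rw [lintegral_lintegral_swap]
        refine Measurable.aemeasurable ?_
        refine Measurable.fun_mul (f := fun q : Rn n × ℝ => w q.1) (hw.comp measurable_fst) ?_
        refine Measurable.fun_mul (ENNReal.measurable_ofReal.comp ?_) hjm
        fun_prop
    _ ≤ ofReal (2 * π) * ∫⁻ ρ in Ioi (0 : ℝ),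
      (ofReal (8 * (lam ^ 2)⁻¹) * (ofReal (C * R) + ofReal (C * κ * (4 * lam) ^ n) * W)) *
        (ofReal (ρ ^ (n - 1)) * ∫⁻ ω, ‖H (ρ • (ω : Rn n))‖ₑ ^ 2 ∂sph n) :=
        mul_le_mul' le_rfl (setLIntegral_mono' measurableSet_Ioi hρ)
    _ = ofReal (2 * π) * (ofReal (8 * (lam ^ 2)⁻¹) * (ofReal (C * R) +
        ofReal (C * κ * (4 * lam) ^ n) * W)) * ∫⁻ ζ, ‖H ζ‖ₑ ^ 2 := by
        rw [lintegral_const_mul', ← lintegral_polar_swap ((Continuous.enorm hH).measurable.pow_const 2), mul_assoc]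
        · ring
        refine mul_ne_top ofReal_ne_top ?_
        exact ENNReal.add_ne_top.2 ⟨ofReal_ne_top, mul_ne_top ofReal_ne_top hwi⟩
    _ ≤ _ := by
        refine mul_le_mul' ?_ le_rfl
        rw [ofReal_mul (by norm_num : (0:ℝ) ≤ 8), mul_add, mul_add, mul_add]
        refine add_le_add ?_ ?_
        · rw [← ofReal_mul (by norm_num), ← ofReal_mul (by positivity),
            ← ofReal_mul (by positivity), ← ofReal_mul (by positivity)]
          refine ofReal_le_ofReal ?_
          have h4 : (1:ℝ) ≤ 4 ^ n := one_le_pow₀ (by norm_num)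
          have : 0 ≤ 2 * π * 8 * C * R * (lam ^ 2)⁻¹ := by positivity
          nlinarith
        · rw [← mul_assoc, ← mul_assoc, ← mul_assoc, ← mul_assoc]
          refine le_of_eq (congrArg (· * W) ?_)
          rw [← ofReal_mul (by positivity), ← ofReal_mul (by positivity),
            ← ofReal_mul (by positivity), ← ofReal_mul (by positivity)]
          congr 1
          rw [mul_pow]; ring

section Bumps
variable {E : Type*} [NormedAddCommGroup E] [InnerProductSpace ℝ E] [FiniteDimensional ℝ E]
  [MeasurableSpace E] [BorelSpace E]

theorem integrable_of_supp_ball {b : E → ℂ} (hb : Continuous b) {ρ : ℝ} (hs : ∀ t, b t ≠ 0 → ‖t‖ ≤ ρ) :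
    Integrable b := by
  refine hb.integrable_of_hasCompactSupport ?_
  refine HasCompactSupport.of_support_subset_isCompact (isCompact_closedBall (0 : E) ρ) ?_
  intro ζ hζ
  simpa using hs ζ hζ

theorem eventuallyEq_zero_of_supp_ball {b : E → ℂ} {ρ : ℝ} (hs : ∀ t, b t ≠ 0 → ‖t‖ ≤ ρ) {t : E}
    (ht : ρ < ‖t‖) : b =ᶠ[𝓝 t] 0 := by
  filter_upwards [(isOpen_lt continuous_const continuous_norm).mem_nhds ht] with y hy
  by_contra h
  exact absurd (hs y h) (not_le.2 hy)

theorem fderiv_supp_ball {b : E → ℂ} {ρ : ℝ} (hs : ∀ t, b t ≠ 0 → ‖t‖ ≤ ρ) (v t : E)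
    (h : fderiv ℝ b t v ≠ 0) : ‖t‖ ≤ ρ := by
  by_contra ht
  refine h ?_
  have := (eventuallyEq_zero_of_supp_ball hs (not_le.1 ht)).fderiv_eq (𝕜 := ℝ)
  rw [this]; simp
end Bumps

section Low
variable {n : ℕ}

/-- The oscillatory integral with phase `r‖t‖² - 2πs⟪t,e⟫` and amplitude `b(t) (1-κ⟪t,e⟫)^{-q}`. -/
def chirpInt (b : Rn n → ℂ) (q : ℕ) (e : Rn n) (s r : ℝ) : ℂ :=
  ∫ t, b t * (((1 - r / (π * s) * inner ℝ t e) ^ q : ℝ) : ℂ)⁻¹ *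
    exp (I * ((r * ‖t‖ ^ 2 - 2 * π * s * inner ℝ t e : ℝ) : ℂ))

variable {e : Rn n} {s r : ℝ}

theorem half_le_one_sub (he : ‖e‖ = 1) (hs : 0 < s) (hr : |r| ≤ π / 4 * s) {t : Rn n}
    (ht : ‖t‖ ≤ 2) : 1 / 2 ≤ 1 - r / (π * s) * inner ℝ t e := by
  have h1 : |(inner ℝ t e : ℝ)| ≤ 2 := (abs_real_inner_le_norm t e).trans (by rw [he]; linarith)
  have hps : 0 < π * s := by positivity
  have h2 : |r / (π * s)| ≤ 1 / 4 := by
    rw [abs_div, abs_of_pos hps, div_le_iff₀ hps]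
    linarith
  have h3 : |r / (π * s) * inner ℝ t e| ≤ 1 / 4 * 2 := by
    rw [abs_mul]; gcongr
  linarith [(abs_le.1 h3).2]

theorem norm_chirp_amp_le {b : Rn n → ℂ} (hsupp : ∀ t, b t ≠ 0 → ‖t‖ ≤ 2) (he : ‖e‖ = 1) (hs : 0 < s)
    (hr : |r| ≤ π / 4 * s) (q : ℕ) (t : Rn n) :
    ‖b t * (((1 - r / (π * s) * inner ℝ t e) ^ q : ℝ) : ℂ)⁻¹‖ ≤ 2 ^ q * ‖b t‖ := by
  by_cases h : b t = 0
  · simp [h]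
  have h1 := half_le_one_sub he hs hr (hsupp t h)
  rw [norm_mul, norm_inv, norm_real, norm_pow, norm_of_nonneg (by linarith), mul_comm]
  refine mul_le_mul_of_nonneg_right ?_ (norm_nonneg _)
  rw [← inv_pow]
  refine pow_le_pow_left₀ (inv_nonneg.2 (by linarith)) ?_ q
  rw [inv_le_comm₀ (by linarith) (by norm_num)]
  linarith

theorem integrable_chirp_amp {b : Rn n → ℂ} (hb : Continuous b) (hsupp : ∀ t, b t ≠ 0 → ‖t‖ ≤ 2)
    (he : ‖e‖ = 1) (hs : 0 < s) (hr : |r| ≤ π / 4 * s) (q : ℕ) :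
    Integrable fun t => b t * (((1 - r / (π * s) * inner ℝ t e) ^ q : ℝ) : ℂ)⁻¹ := by
  refine ((integrable_of_supp_ball hb hsupp).norm.const_mul (2 ^ q)).mono' ?_
    (.of_forall (norm_chirp_amp_le hsupp he hs hr q))
  refine Measurable.aestronglyMeasurable (Measurable.fun_mul hb.measurable (Measurable.inv ?_))
  exact Complex.measurable_ofReal.comp (Continuous.measurable (by fun_prop))

theorem integrable_chirp {b : Rn n → ℂ} (hb : Continuous b) (hsupp : ∀ t, b t ≠ 0 → ‖t‖ ≤ 2)
    (he : ‖e‖ = 1) (hs : 0 < s) (hr : |r| ≤ π / 4 * s) (q : ℕ) :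
    Integrable fun t => b t * (((1 - r / (π * s) * inner ℝ t e) ^ q : ℝ) : ℂ)⁻¹ *
      exp (I * ((r * ‖t‖ ^ 2 - 2 * π * s * inner ℝ t e : ℝ) : ℂ)) :=
  (integrable_chirp_amp hb hsupp he hs hr q).mul_bdd (c := 1) (by fun_prop) (.of_forall fun t => by
      rw [mul_comm I, norm_exp_ofReal_mul_I])

theorem chirpInt_parts {b : Rn n → ℂ} (hb : ContDiff ℝ (⊤ : ℕ∞) b) (hsupp : ∀ t, b t ≠ 0 → ‖t‖ ≤ 2)
    (he : ‖e‖ = 1) (hs : 0 < s) (hr : |r| ≤ π / 4 * s) (q : ℕ) :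
    (2 * π * s * I) * chirpInt b q e s r = chirpInt (fun t => fderiv ℝ b t e) (q + 1) e s r +
        ((q + 1) * (r / (π * s)) : ℝ) * chirpInt b (q + 2) e s r := by
  set κ := r / (π * s) with hκ
  set u : Rn n → ℝ := fun t => 1 - κ * inner ℝ t e with hu
  set F : Rn n → ℂ := fun t => b t * ((u t ^ (q + 1) : ℝ) : ℂ)⁻¹ with hF
  set F' : Rn n → ℂ := fun t => fderiv ℝ b t e * ((u t ^ (q + 1) : ℝ) : ℂ)⁻¹ +
    ((q + 1) * κ : ℝ) * (b t * ((u t ^ (q + 2) : ℝ) : ℂ)⁻¹) with hF'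
  set P : Rn n → ℂ := fun t => exp (I * ((r * ‖t‖ ^ 2 - 2 * π * s * inner ℝ t e : ℝ) : ℂ)) with hP
  set P' : Rn n → ℂ := fun t => P t * (I * ((-2 * π * s * u t : ℝ) : ℂ)) with hP'
  have hdb : Continuous fun t => fderiv ℝ b t e :=
    (hb.continuous_fderiv (by simp)).clm_apply continuous_const
  have hue : ∀ t : Rn n, HasLineDerivAt ℝ u (-κ) t e := by
    intro t
    have h1 : HasDerivAt (fun x : ℝ => 1 - κ * (inner ℝ t e + x * 1)) (-κ) 0 := by
      have := ((((hasDerivAt_id (0:ℝ)).mul_const 1).const_add (inner ℝ t e : ℝ)).const_mul κ).const_sub 1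
      refine this.congr_deriv (by ring)
    refine h1.congr_of_eventuallyEq (.of_forall fun x => ?_)
    simp only [hu, inner_add_left, inner_smul_left, real_inner_self_eq_norm_sq, he]
    simp
  have hFd : ∀ t, HasLineDerivAt ℝ F (F' t) t e := by
    intro t
    rcases le_or_gt ‖t‖ 2 with ht | ht
    · have hu0 : 1 / 2 ≤ u t := half_le_one_sub he hs hr ht
      have hune : (u t : ℂ) ≠ 0 := by exact_mod_cast (by linarith : u t ≠ 0)
      have h1 : HasLineDerivAt ℝ b (fderiv ℝ b t e) t e :=
        ((hb.differentiable (by simp)) t).hasFDerivAt.hasLineDerivAt e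
      have h2 : HasDerivAt (fun x : ℝ => ((u (t + x • e) : ℝ) : ℂ)) ((-κ : ℝ) : ℂ) 0 :=
        HasDerivAt.ofReal_comp (hue t)
      have h0 : t + (0:ℝ) • e = t := by simp
      have h3 := (h2.pow (q + 1)).inv (by simpa [h0] using pow_ne_zero (q + 1) hune)
      have h4 := HasDerivAt.mul h1 h3
      refine HasDerivAt.congr_deriv (h4.congr_of_eventuallyEq (.of_forall fun x => ?_)) ?_
      · simp only [hF, Pi.mul_apply, Pi.inv_apply, Pi.pow_apply]; push_cast; rfl
      · simp only [h0, hF', Pi.inv_apply, Pi.pow_apply]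
        push_cast
        field_simp
        ring
    · have hz := eventuallyEq_zero_of_supp_ball hsupp ht
      have h1 : F =ᶠ[𝓝 t] 0 := by
        filter_upwards [hz] with y hy
        simp [hF, hy]
      have h2 : F' t = 0 := by
        have : fderiv ℝ b t e = 0 := by
          by_contra h
          exact absurd (fderiv_supp_ball hsupp e t h) (not_le.2 ht)
        simp [hF', this, hz.eq_of_nhds]
      rw [h2]
      refine HasLineDerivAt.congr_of_eventuallyEq (f := 0) ?_ h1
      exact (hasFDerivAt_const (0:ℂ) t).hasLineDerivAt e
  have hPd : ∀ t, HasLineDerivAt ℝ P (P' t) t e := by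
    intro t
    have h1 : HasDerivAt (fun x : ℝ => r * (‖t‖ ^ 2 + 2 * x * inner ℝ t e + x ^ 2) -
        2 * π * s * (inner ℝ t e + x)) (-2 * π * s * u t) 0 := by
      have := (((((hasDerivAt_id (0:ℝ)).const_mul 2).mul_const (inner ℝ t e : ℝ)).const_add (‖t‖ ^ 2)).add
        (hasDerivAt_pow 2 (0:ℝ))).const_mul r |>.sub (((hasDerivAt_id (0:ℝ)).const_add
          (inner ℝ t e : ℝ)).const_mul (2 * π * s))
      refine this.congr_deriv ?_
      simp only [hu, hκ]
      field_simp
      simp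
      ring
    have h2 := ((HasDerivAt.ofReal_comp h1).const_mul I).cexp
    refine HasDerivAt.congr_deriv (h2.congr_of_eventuallyEq (.of_forall fun x => ?_)) ?_
    · simp only [hP, inner_add_left, inner_smul_left, real_inner_self_eq_norm_sq, he, norm_add_sq_real,
        inner_smul_right, norm_smul, mul_pow]
      have : r * (‖t‖ ^ 2 + 2 * x * inner ℝ t e + x ^ 2) - 2 * π * s * (inner ℝ t e + x) =
          r * (‖t‖ ^ 2 + 2 * (x * inner ℝ t e) + ‖x‖ ^ 2 * 1 ^ 2) -
            2 * π * s * (inner ℝ t e + (starRingEnd ℝ) x * 1 ^ 2) := by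
        rw [conj_trivial, norm_eq_abs, sq_abs]; ring
      rw [this]
    · simp [hP', hP]
  have hds := fderiv_supp_ball hsupp e
  have hI1 := integrable_chirp hdb hds he hs hr (q + 1)
  have hI2 := integrable_chirp hb.continuous hsupp he hs hr (q + 2)
  have hI3 := integrable_chirp hb.continuous hsupp he hs hr (q + 1)
  have hI4 := integrable_chirp hb.continuous hsupp he hs hr q
  have e1 : ∀ t, F' t * P t = (fderiv ℝ b t e * ((u t ^ (q + 1) : ℝ) : ℂ)⁻¹) * P t +
    ((q + 1) * κ : ℝ) * ((b t * ((u t ^ (q + 2) : ℝ) : ℂ)⁻¹) * P t) := fun t => by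
      simp only [hF']; ring
  have e2 : ∀ t, F t * P' t = -(2 * π * s * I) * ((b t * ((u t ^ q : ℝ) : ℂ)⁻¹) * P t) := by
    intro t
    by_cases h : b t = 0
    · simp [hF, h]
    have hu0 : 1 / 2 ≤ u t := half_le_one_sub he hs hr (hsupp t h)
    have hune : (u t : ℂ) ≠ 0 := by exact_mod_cast (by linarith : u t ≠ 0)
    simp only [hF, hP']
    push_cast
    field_simp
    ring
  have key := integral_bilinear_hasLineDerivAt_right_eq_neg_left_of_integrable (μ := volume)
    (f := F) (f' := F') (g := P) (g' := P') (v := e) (B := ContinuousLinearMap.mul ℝ ℂ)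
    (by
      simp only [ContinuousLinearMap.mul_apply', e1]
      exact hI1.add (hI2.const_mul _))
    (by
      simp only [ContinuousLinearMap.mul_apply', e2]
      exact hI4.const_mul _) hI3 (fun t _ => hFd t) (fun t _ => hPd t)
  simp only [ContinuousLinearMap.mul_apply', e1, e2] at key
  rw [integral_const_mul, integral_add hI1 (hI2.const_mul _), integral_const_mul] at key
  unfold chirpInt
  linear_combination -key

theorem exists_chirpInt_le (M : ℕ) : ∀ (b : Rn n → ℂ), ContDiff ℝ (⊤ : ℕ∞) b →
    (∀ t, b t ≠ 0 → ‖t‖ ≤ 2) → ∀ q : ℕ, ∃ C : ℝ, 0 ≤ C ∧ ∀ (e : Rn n) (s r : ℝ), ‖e‖ = 1 → 0 < s →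
      |r| ≤ π / 4 * s → ‖chirpInt b q e s r‖ * s ^ M ≤ C := by
  induction M with
  | zero =>
    intro b hb hsupp q
    refine ⟨2 ^ q * ∫ t, ‖b t‖, by positivity, fun e s r he hs hr => ?_⟩
    rw [pow_zero, mul_one, ← integral_const_mul]
    refine norm_integral_le_of_norm_le ((integrable_of_supp_ball hb.continuous hsupp).norm.const_mul _)
      (.of_forall fun t => ?_)
    rw [norm_mul, mul_comm I, norm_exp_ofReal_mul_I, mul_one]
    exact norm_chirp_amp_le hsupp he hs hr q t
  | succ M ih =>
    intro b hb hsupp q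
    have hdc : ∀ v : Rn n, ContDiff ℝ (⊤ : ℕ∞) fun t => fderiv ℝ b t v := fun v =>
      (hb.fderiv_right (m := (⊤ : ℕ∞)) (by simp)).clm_apply contDiff_const
    have h1 : ∀ i : Fin n, _ := fun i => ih (fun t => fderiv ℝ b t (single i 1))
      (hdc _) (fderiv_supp_ball hsupp _) (q + 1)
    choose C1 hC10 hC1 using h1
    obtain ⟨C2, hC20, hC2⟩ := ih b hb hsupp (q + 2)
    have hC1s : 0 ≤ ∑ i, C1 i := Finset.sum_nonneg fun i _ => hC10 i
    refine ⟨∑ i, C1 i + (q + 1) * C2, by positivity, fun e s r he hs hr => ?_⟩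
    have key := chirpInt_parts hb hsupp he hs hr q
    have hsum : chirpInt (fun t => fderiv ℝ b t e) (q + 1) e s r = ∑ i, ((e i : ℝ) : ℂ) *
        chirpInt (fun t => fderiv ℝ b t (single i 1)) (q + 1) e s r := by
      unfold chirpInt
      simp only [← integral_const_mul]
      rw [← integral_finsetSum]
      · congr 1; ext t
        have : fderiv ℝ b t e = ∑ i, ((e i : ℝ) : ℂ) * fderiv ℝ b t (single i 1) := by
          conv_lhs => rw [← (EuclideanSpace.basisFun (Fin n) ℝ).sum_repr e]
          rw [map_sum]
          refine sum_congr rfl fun i _ => ?_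
          rw [map_smul]
          simp
        rw [this, sum_mul, sum_mul]
        refine sum_congr rfl fun i _ => ?_
        ring
      · intro i _
        exact (integrable_chirp (hdc _).continuous (fderiv_supp_ball hsupp _) he hs hr (q + 1)).const_mul _
    have hn1 : ‖(2 * π * s * I : ℂ)‖ = 2 * π * s := by
      simp [abs_of_pos hs, abs_of_pos pi_pos]
    have hei : ∀ i, |e i| ≤ 1 := fun i => by
      have h := PiLp.norm_apply_le e i
      rw [he] at h
      exact h
    have hκ : |r / (π * s)| ≤ 1 := by
      have hps : 0 < π * s := by positivity
      rw [abs_div, abs_of_pos hps, div_le_iff₀ hps]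
      linarith
    have h3 : 2 * π * s * ‖chirpInt b q e s r‖ ≤
        ∑ i, ‖chirpInt (fun t => fderiv ℝ b t (single i 1)) (q + 1) e s r‖ +
          (q + 1) * ‖chirpInt b (q + 2) e s r‖ := by
      rw [← hn1, ← norm_mul, key, hsum]
      refine (norm_add_le _ _).trans (add_le_add ((norm_sum_le _ _).trans ?_) ?_)
      · refine sum_le_sum fun i _ => ?_
        rw [norm_mul, norm_real]
        exact mul_le_of_le_one_left (norm_nonneg _) (hei i)
      · rw [norm_mul, norm_real, norm_mul]
        refine mul_le_mul_of_nonneg_right ?_ (norm_nonneg _)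
        rw [norm_of_nonneg (by positivity)]
        exact mul_le_of_le_one_right (by positivity) hκ
    have h4 : s * ‖chirpInt b q e s r‖ ≤ 2 * π * s * ‖chirpInt b q e s r‖ := by
      have := pi_gt_three
      refine mul_le_mul_of_nonneg_right ?_ (norm_nonneg _)
      nlinarith
    calc ‖chirpInt b q e s r‖ * s ^ (M + 1) = s * ‖chirpInt b q e s r‖ * s ^ M := by ring
      _ ≤ (∑ i, ‖chirpInt (fun t => fderiv ℝ b t (single i 1)) (q + 1) e s r‖ +
          (q + 1) * ‖chirpInt b (q + 2) e s r‖) * s ^ M := by gcongr; exact h4.trans h3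
      _ = ∑ i, ‖chirpInt (fun t => fderiv ℝ b t (single i 1)) (q + 1) e s r‖ * s ^ M +
          (q + 1) * (‖chirpInt b (q + 2) e s r‖ * s ^ M) := by rw [add_mul, sum_mul]; ring
      _ ≤ _ := by
        refine add_le_add (sum_le_sum fun i _ => hC1 i e s r he hs hr) ?_
        exact mul_le_mul_of_nonneg_left (hC2 e s r he hs hr) (by positivity)
end Low

section Fresnel
variable {n : ℕ}

theorem fourier_gauss_mul (B : 𝓢(Rn n, ℂ)) {z : ℂ} (hz : 0 < z.re) (ξ : Rn n) :
    𝓕 (fun t : Rn n => exp (-z * ‖t‖ ^ 2) * B t) ξ =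
      (π / z) ^ (n / 2 : ℂ) * ∫ η, 𝓕 (⇑B) η * exp (-(π ^ 2 * ‖ξ - η‖ ^ 2) / z) := by
  have hB : ∀ t, B t = ∫ η, 𝓕 (⇑B) η * exp (2 * π * I * (inner ℝ t η : ℝ)) := by
    intro t
    have h1 : 𝓕⁻ (𝓕 (⇑B)) t = B t := by
      rw [Continuous.fourierInv_fourier_eq B.continuous B.integrable]
      rw [← fourier_coe]; exact (𝓕 B).integrable
    rw [← h1, fourierInv_eq']
    congr 1; ext η
    rw [smul_eq_mul, mul_comm, real_inner_comm]
    congr 2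
    push_cast; ring
  have hFB : Integrable (𝓕 (⇑B)) := by rw [← fourier_coe]; exact (𝓕 B).integrable
  have hG : Integrable fun t : Rn n => exp (-z * ‖t‖ ^ 2) := by
    simpa using GaussianFourier.integrable_cexp_neg_mul_sq_norm_add (V := Rn n) hz 0 0
  have hF : Integrable (uncurry fun (t η : Rn n) => exp (-z * ‖t‖ ^ 2) * 𝓕 (⇑B) η *
      (exp (2 * π * I * (inner ℝ t η : ℝ)) *
        exp (-(2 * π * I * (inner ℝ t ξ : ℝ))))) (volume.prod volume) := by
    refine (hG.mul_prod hFB).mul_bdd (c := 1) (by fun_prop)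
      (.of_forall fun q => ?_)
    rw [← exp_add, ← mul_neg_one, show (2 * π * I * (inner ℝ q.1 q.2 : ℝ) +
      2 * π * I * (inner ℝ q.1 ξ : ℝ) * -1 : ℂ) =
      ((2 * π * (inner ℝ q.1 q.2 - inner ℝ q.1 ξ) : ℝ) : ℂ) * I by push_cast; ring,
      norm_exp_ofReal_mul_I]
  rw [fourier_eq']
  calc _ = ∫ t : Rn n, ∫ η : Rn n, exp (-z * ‖t‖ ^ 2) * 𝓕 (⇑B) η *
      (exp (2 * π * I * (inner ℝ t η : ℝ)) * exp (-(2 * π * I * (inner ℝ t ξ : ℝ)))) := by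
        congr 1; ext t
        rw [hB t, smul_eq_mul, ← integral_const_mul, ← integral_const_mul]
        congr 1; ext η
        rw [show ((-2 * π * inner ℝ t ξ : ℝ) : ℂ) * I =
          -(2 * π * I * (inner ℝ t ξ : ℝ)) by push_cast; ring]
        ring
    _ = ∫ η : Rn n, ∫ t : Rn n, exp (-z * ‖t‖ ^ 2) * 𝓕 (⇑B) η *
      (exp (2 * π * I * (inner ℝ t η : ℝ)) *
        exp (-(2 * π * I * (inner ℝ t ξ : ℝ)))) := integral_integral_swap hF
    _ = ∫ η : Rn n, (π / z) ^ (n / 2 : ℂ) * (𝓕 (⇑B) η *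
        exp (-(π ^ 2 * ‖ξ - η‖ ^ 2) / z)) := by
        congr 1; ext η
        have h := GaussianFourier.integral_cexp_neg_mul_sq_norm_add (V := Rn n) hz
          (-2 * π * I) (ξ - η)
        rw [finrank_euclideanSpace_fin] at h
        have e1 : ∀ t : Rn n, exp (-z * ‖t‖ ^ 2) * 𝓕 (⇑B) η * (exp (2 * π * I * (inner ℝ t η : ℝ)) *
            exp (-(2 * π * I * (inner ℝ t ξ : ℝ)))) = 𝓕 (⇑B) η *
            exp (-z * ‖t‖ ^ 2 + -2 * π * I * (inner ℝ (ξ - η) t : ℝ)) := by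
          intro t
          rw [← exp_add, mul_assoc, mul_left_comm, ← exp_add, inner_sub_left,
            real_inner_comm ξ t, real_inner_comm η t]
          congr 2
          push_cast; ring
        simp only [e1]
        rw [integral_const_mul, h]
        rw [show (-2 * π * I) ^ 2 * ‖ξ - η‖ ^ 2 / (4 * z) = -(π ^ 2 * ‖ξ - η‖ ^ 2) / z by
            rw [mul_pow, Complex.I_sq]
            field_simp; ring]
        ring
    _ = _ := integral_const_mul _ _

theorem norm_exp_neg_div_le {z : ℂ} (hz : 0 ≤ z.re) {a : ℝ} (ha : 0 ≤ a) :
    ‖exp (-(a : ℂ) / z)‖ ≤ 1 := by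
  rw [Complex.norm_exp, Real.exp_le_one_iff, neg_div, Complex.neg_re, neg_nonpos, Complex.div_re]
  simp only [Complex.ofReal_re, Complex.ofReal_im, zero_mul, zero_div, add_zero]
  exact div_nonneg (mul_nonneg ha hz) (Complex.normSq_nonneg z)

theorem fourier_chirp_mul (B : 𝓢(Rn n, ℂ)) {r : ℝ} (hr : r ≠ 0) (ξ : Rn n) :
    𝓕 (fun t : Rn n => exp (I * ((r * ‖t‖ ^ 2 : ℝ) : ℂ)) * B t) ξ = (π / (-(I * r))) ^ (n / 2 : ℂ) *
        ∫ η, 𝓕 (⇑B) η * exp (I * ((-(π ^ 2 / r) * ‖ξ - η‖ ^ 2 : ℝ) : ℂ)) := by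
  set z : ℝ → ℂ := fun ε => ε - I * r with hzdef
  have hzre : ∀ ε, (z ε).re = ε := fun ε => by simp [hzdef]
  have hz0 : z 0 ≠ 0 := by simp [hzdef, hr]
  have hzc : Continuous z := by fun_prop
  have hzt : Tendsto z (𝓝[>] 0) (𝓝 (z 0)) := hzc.continuousAt.tendsto.mono_left nhdsWithin_le_nhds
  have hFB : Integrable (𝓕 (⇑B)) := by rw [← fourier_coe]; exact (𝓕 B).integrable
  have hFBc : Continuous (𝓕 (⇑B)) := by rw [← fourier_coe]; exact (𝓕 B).continuous
  have hL : Tendsto (fun ε => 𝓕 (fun t : Rn n => exp (-z ε * ‖t‖ ^ 2) * B t) ξ) (𝓝[>] 0)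
      (𝓝 (𝓕 (fun t : Rn n => exp (-z 0 * ‖t‖ ^ 2) * B t) ξ)) := by
    simp only [fourier_eq']
    refine tendsto_integral_filter_of_dominated_convergence (fun t => ‖B t‖) ?_ ?_ B.integrable.norm ?_
    · refine .of_forall fun ε => Continuous.aestronglyMeasurable ?_
      have := B.continuous
      fun_prop
    · filter_upwards [self_mem_nhdsWithin] with ε hε
      refine .of_forall fun t => ?_
      rw [norm_smul, norm_exp_ofReal_mul_I, one_mul, norm_mul, Complex.norm_exp]
      refine mul_le_of_le_one_left (norm_nonneg _) (Real.exp_le_one_iff.2 ?_)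
      have : (-z ε * ‖t‖ ^ 2 : ℂ).re = -ε * ‖t‖ ^ 2 := by
        rw [← Complex.ofReal_pow, Complex.re_mul_ofReal, Complex.neg_re, hzre]
      rw [this]
      have : 0 < ε := hε
      nlinarith [sq_nonneg ‖t‖]
    · refine .of_forall fun t => ?_
      refine Tendsto.const_smul (Tendsto.mul_const _ ?_) _
      exact (Complex.continuous_exp.tendsto _).comp ((hzt.neg).mul_const _)
  have hR : Tendsto (fun ε => (π / z ε) ^ (n / 2 : ℂ) *
      ∫ η, 𝓕 (⇑B) η * exp (-(π ^ 2 * ‖ξ - η‖ ^ 2) / z ε)) (𝓝[>] 0)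
      (𝓝 ((π / z 0) ^ (n / 2 : ℂ) * ∫ η, 𝓕 (⇑B) η * exp (-(π ^ 2 * ‖ξ - η‖ ^ 2) / z 0))) := by
    refine Tendsto.mul ?_ ?_
    · have h1 : Tendsto (fun ε => (π : ℂ) / z ε) (𝓝[>] 0) (𝓝 (π / z 0)) :=
        Tendsto.div tendsto_const_nhds hzt hz0
      refine (ContinuousAt.tendsto (f := fun w : ℂ => w ^ (n / 2 : ℂ)) ?_).comp h1
      refine continuousAt_cpow_const (Or.inr ?_)
      have : (π : ℂ) / z 0 = ((π / r : ℝ) : ℂ) * I := by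
        have hr' : (r : ℂ) ≠ 0 := by exact_mod_cast hr
        simp only [hzdef]; push_cast
        field_simp
        simp only [zero_sub]
        linear_combination (r : ℂ) * Complex.I_sq
      rw [this]
      simp [hr, Real.pi_ne_zero]
    · refine tendsto_integral_filter_of_dominated_convergence (fun t => ‖𝓕 (⇑B) t‖) ?_ ?_ hFB.norm ?_
      · exact .of_forall fun ε => by fun_prop
      · filter_upwards [self_mem_nhdsWithin] with ε hε
        refine .of_forall fun t => ?_
        rw [norm_mul]
        refine mul_le_of_le_one_right (norm_nonneg _) ?_
        have := norm_exp_neg_div_le (z := z ε) (by rw [hzre]; exact le_of_lt hε)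
          (a := π ^ 2 * ‖ξ - t‖ ^ 2) (by positivity)
        push_cast at this
        exact this
      · refine .of_forall fun t => ?_
        refine Tendsto.const_mul _ ?_
        exact (Complex.continuous_exp.tendsto _).comp (Tendsto.div tendsto_const_nhds hzt hz0)
  have hEq : ∀ᶠ ε in 𝓝[>] (0:ℝ), 𝓕 (fun t : Rn n => exp (-z ε * ‖t‖ ^ 2) * B t) ξ =
      (π / z ε) ^ (n / 2 : ℂ) *
      ∫ η, 𝓕 (⇑B) η * exp (-(π ^ 2 * ‖ξ - η‖ ^ 2) / z ε) := by
    filter_upwards [self_mem_nhdsWithin] with ε hε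
    exact fourier_gauss_mul B (by rw [hzre]; exact hε) ξ
  have h := tendsto_nhds_unique (hL.congr' hEq) hR
  have hz00 : z 0 = -(I * r) := by simp [hzdef]
  rw [hz00] at h
  have e1 : (fun t : Rn n => exp (I * ((r * ‖t‖ ^ 2 : ℝ) : ℂ)) * B t) =
      fun t : Rn n => exp (-(-(I * r)) * ‖t‖ ^ 2) * B t := by
    ext t; congr 2; push_cast; ring
  rw [e1, h]
  congr 2
  funext η
  congr 2
  push_cast
  have hr' : (r : ℂ) ≠ 0 := by exact_mod_cast hr
  field_simp
  linear_combination (‖ξ - η‖ : ℂ) ^ 2 * Complex.I_sq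

theorem norm_fresnel_const {r : ℝ} (hr : r ≠ 0) :
    ‖(π / (-(I * r)) : ℂ) ^ (n / 2 : ℂ)‖ ^ 2 = (π / |r|) ^ n := by
  have h1 : (n / 2 : ℂ) = ((n / 2 : ℝ) : ℂ) := by push_cast; rfl
  have h0 : 0 ≤ π / |r| := by positivity
  rw [h1, Complex.norm_cpow_real, norm_div, norm_neg, norm_mul, Complex.norm_I, one_mul,
    norm_real, norm_real, norm_of_nonneg pi_pos.le, norm_eq_abs,
    ← rpow_natCast, ← Real.rpow_mul h0]
  push_cast
  rw [div_mul_cancel₀ _ two_ne_zero, rpow_natCast]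

theorem integral_chirp_eq_quadEvol [Fact (2 ≤ n)] (B : 𝓢(Rn n, ℂ)) {r : ℝ} (hr : r ≠ 0) {g : Rn n → ℂ}
    (hg : Integrable g) (x : Rn n) :
    ∫ ξ, g ξ * 𝓕 (fun t : Rn n => exp (I * ((r * ‖t‖ ^ 2 : ℝ) : ℂ)) * B t) ξ *
        exp (2 * π * I * (inner ℝ x ξ : ℝ)) =
      (π / (-(I * r))) ^ (n / 2 : ℂ) * ∫ η, 𝓕 (⇑B) η * exp (2 * π * I * (inner ℝ x η : ℝ)) *
          quadEvol (fun ζ => g (ζ + η)) (-(π ^ 2 / r)) x := by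
  have hFB : Integrable (𝓕 (⇑B)) := by rw [← fourier_coe]; exact (𝓕 B).integrable
  have hF : Integrable (uncurry fun (ξ η : Rn n) => g ξ * 𝓕 (⇑B) η *
      (exp (I * ((-(π ^ 2 / r) * ‖ξ - η‖ ^ 2 : ℝ) : ℂ)) *
        exp (2 * π * I * (inner ℝ x ξ : ℝ)))) (volume.prod volume) := by
    refine (hg.mul_prod hFB).mul_bdd (c := 1) (by fun_prop)
      (.of_forall fun q => ?_)
    rw [norm_mul, norm_exp_two_pi_inner, mul_comm I, norm_exp_ofReal_mul_I, one_mul]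
  simp only [fourier_chirp_mul B hr]
  set c := (π / (-(I * r)) : ℂ) ^ (n / 2 : ℂ)
  calc _ = ∫ ξ, c * ∫ η, g ξ * 𝓕 (⇑B) η *
      (exp (I * ((-(π ^ 2 / r) * ‖ξ - η‖ ^ 2 : ℝ) : ℂ)) * exp (2 * π * I * (inner ℝ x ξ : ℝ))) := by
        congr 1; ext ξ
        rw [← integral_const_mul, mul_right_comm, ← integral_const_mul, ← integral_const_mul, ]
        refine integral_congr_ae (.of_forall fun η => ?_)
        simp only
        ring
    _ = c * ∫ η, ∫ ξ, g ξ * 𝓕 (⇑B) η *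
      (exp (I * ((-(π ^ 2 / r) * ‖ξ - η‖ ^ 2 : ℝ) : ℂ)) * exp (2 * π * I * (inner ℝ x ξ : ℝ))) := by
        rw [integral_const_mul, integral_integral_swap hF]
    _ = _ := by
        congr 2; ext η
        rw [quadEvol, ← integral_const_mul]
        rw [← integral_add_right_eq_self _ η]
        congr 1; ext ζ
        rw [add_sub_cancel_right, inner_add_right]
        push_cast
        rw [mul_add, exp_add]
        ring
end Fresnel

theorem lintegral_inversion_le {n : ℕ} (hn : 2 ≤ n) {r0 : ℝ} (hr0 : 0 < r0) (Φ : ℝ → ℝ≥0∞) :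
    ∫⁻ r in {r : ℝ | r0 ≤ |r|}, ofReal ((π / |r|) ^ n) * Φ (-(π ^ 2 / r)) ≤
      ofReal ((π / r0) ^ (n - 2)) * ∫⁻ τ in {τ : ℝ | |τ| ≤ π ^ 2 / r0}, Φ τ := by
  set s : Set ℝ := {r : ℝ | r0 ≤ |r|} with hs
  have hsm : MeasurableSet s := measurableSet_le measurable_const (by fun_prop)
  have hne : ∀ r ∈ s, r ≠ 0 := fun r hr h => by
    rw [hs, mem_ofPred_eq, h, abs_zero] at hr; linarith
  have hder : ∀ r ∈ s, HasDerivWithinAt (fun r : ℝ => -(π ^ 2 / r)) (π ^ 2 / r ^ 2) s r := by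
    intro r hr
    have := (((hasDerivAt_inv (hne r hr)).const_mul (π ^ 2)).neg).hasDerivWithinAt (s := s)
    refine (this.congr_deriv ?_).congr (fun x _ => ?_) ?_
    · ring
    · simp [div_eq_mul_inv]
    · simp [div_eq_mul_inv]
  have hinj : InjOn (fun r : ℝ => -(π ^ 2 / r)) s := by
    intro a ha b hb hab
    have h1 := hne a ha
    have h2 := hne b hb
    simp only [neg_inj] at hab
    rw [div_eq_div_iff h1 h2] at hab
    exact (mul_left_cancel₀ (by positivity) hab).symm
  have hcv := lintegral_image_eq_lintegral_abs_deriv_mul hsm hder hinj Φ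
  have himg : (fun r : ℝ => -(π ^ 2 / r)) '' s ⊆ {τ : ℝ | |τ| ≤ π ^ 2 / r0} := by
    rintro _ ⟨r, hr, rfl⟩
    simp only [mem_ofPred_eq, abs_neg, abs_div, abs_of_nonneg (sq_nonneg π)]
    exact div_le_div_of_nonneg_left (by positivity) hr0 hr
  refine le_trans ?_ (mul_le_mul' le_rfl (lintegral_mono_set himg))
  rw [hcv, ← lintegral_ofReal_mul]
  refine setLIntegral_mono' hsm fun r (hr : r0 ≤ |r|) => ?_
  rw [← mul_assoc]
  refine mul_le_mul' ?_ le_rfl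
  rw [← ofReal_mul (by positivity), abs_of_nonneg (by positivity : 0 ≤ π ^ 2 / r ^ 2)]
  refine ofReal_le_ofReal ?_
  obtain ⟨k, rfl⟩ := Nat.exists_eq_add_of_le hn
  rw [add_tsub_cancel_left, pow_add, mul_comm, div_pow _ |r| 2, sq_abs]
  gcongr

section Chirp
variable {n : ℕ} [Fact (2 ≤ n)]

/-- The Fourier transform of the chirp `e^{ir|t|²} B(t)`. -/
def chirpHat (B : 𝓢(Rn n, ℂ)) (r : ℝ) (ξ : Rn n) : ℂ :=
  𝓕 (fun t : Rn n => exp (I * ((r * ‖t‖ ^ 2 : ℝ) : ℂ)) * B t) ξ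

/-- Convolution with the chirp, on the Fourier side. -/
def chirpConv (B : 𝓢(Rn n, ℂ)) (g : Rn n → ℂ) (r : ℝ) (x : Rn n) : ℂ :=
  ∫ ξ, g ξ * chirpHat B r ξ * exp (2 * π * I * (inner ℝ x ξ : ℝ))

theorem norm_chirpHat_le (B : 𝓢(Rn n, ℂ)) (r : ℝ) (ξ : Rn n) : ‖chirpHat B r ξ‖ ≤ ∫ t, ‖B t‖ := by
  rw [chirpHat, fourier_eq']
  refine norm_integral_le_of_norm_le B.integrable.norm (.of_forall fun t => ?_)
  rw [norm_smul, norm_exp_ofReal_mul_I, one_mul, norm_mul, mul_comm I,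
    norm_exp_ofReal_mul_I, one_mul]

theorem continuous_chirpHat (B : 𝓢(Rn n, ℂ)) :
    Continuous fun q : ℝ × Rn n => chirpHat B q.1 q.2 := by
  simp only [chirpHat, fourier_eq']
  refine continuous_of_dominated (bound := fun t => ‖B t‖) (fun q => ?_) (fun q => ?_)
    B.integrable.norm ?_
  · fun_prop
  · refine .of_forall fun t => ?_
    rw [norm_smul, norm_exp_ofReal_mul_I, one_mul, norm_mul, mul_comm I,
      norm_exp_ofReal_mul_I, one_mul]
  · exact .of_forall fun t => by fun_prop

theorem continuous_chirpHat_right (B : 𝓢(Rn n, ℂ)) (r : ℝ) : Continuous fun ξ => chirpHat B r ξ := by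
  have h := (continuous_chirpHat B).comp (Continuous.prodMk_right (Y := Rn n) r)
  simp only [comp_def] at h
  exact h

theorem continuous_chirpHat_left (B : 𝓢(Rn n, ℂ)) (ξ : Rn n) : Continuous fun r => chirpHat B r ξ := by
  have h := (continuous_chirpHat B).comp (Continuous.prodMk_left (X := ℝ) ξ)
  simp only [comp_def] at h
  exact h

theorem continuous_chirpConv (B : 𝓢(Rn n, ℂ)) {g : Rn n → ℂ} (hg : Integrable g) :
    Continuous fun q : ℝ × Rn n => chirpConv B g q.1 q.2 := by
  have hexp : Continuous fun y : Rn n × Rn n =>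
      exp (2 * π * I * (inner ℝ y.1 y.2 : ℝ)) := by fun_prop
  unfold chirpConv
  refine continuous_of_dominated (bound := fun ξ => ‖g ξ‖ * ∫ t, ‖B t‖) (fun q => ?_) (fun q => ?_)
    (hg.norm.mul_const _) ?_
  · exact (hg.1.mul (continuous_chirpHat_right B q.1).aestronglyMeasurable).mul
      (hexp.comp (Continuous.prodMk_right q.2)).aestronglyMeasurable
  · refine .of_forall fun ξ => ?_
    rw [norm_mul, norm_exp_two_pi_inner, mul_one, norm_mul]
    exact mul_le_mul_of_nonneg_left (norm_chirpHat_le B _ _) (norm_nonneg _)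
  · refine .of_forall fun ξ => ?_
    exact (continuous_const.mul ((continuous_chirpHat_left B ξ).comp continuous_fst)).mul
      (hexp.comp ((Continuous.prodMk_left ξ).comp continuous_snd))

theorem lintegral_chirpConv_sq_le (B : 𝓢(Rn n, ℂ)) {g : Rn n → ℂ} (hg : Integrable g) (r : ℝ) :
    ∫⁻ x, ‖chirpConv B g r x‖ₑ ^ 2 ≤ ∫⁻ ξ, ‖g ξ * chirpHat B r ξ‖ₑ ^ 2 := by
  have h1 : Continuous fun ξ => chirpHat B r ξ := continuous_chirpHat_right B r
  have hi : Integrable fun ξ => g ξ * chirpHat B r ξ :=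
    hg.mul_bdd (c := ∫ t, ‖B t‖) h1.aestronglyMeasurable (.of_forall fun ξ => norm_chirpHat_le B r ξ)
  refine le_trans (le_of_eq (lintegral_congr fun x => ?_)) (lintegral_fourierInv_sq_le hi)
  rw [fourierInv_eq', chirpConv]
  congr 2
  refine integral_congr_ae (.of_forall fun ξ => ?_)
  simp only
  rw [smul_eq_mul, mul_comm, real_inner_comm]
  congr 2
  push_cast; ring

theorem integrable_of_annulus {g : Rn n → ℂ} (hg : Continuous g) {lam : ℝ}
    (hs : DyadicSupported lam g) : Integrable g :=
  integrable_of_supp_ball hg (ρ := 2 * lam) fun t ht => (hs t ht).2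

theorem exists_chirpConv_low_le (B : 𝓢(Rn n, ℂ)) (hB : ∀ t, B t ≠ 0 → ‖t‖ ≤ 2) : ∃ C : ℝ, 0 < C ∧
    ∀ lam : ℝ, 1 / 2 ≤ lam → ∀ g : Rn n → ℂ, Continuous g →
    DyadicSupported lam g →
    ∫⁻ x, (∫⁻ r in {r : ℝ | π / 8 * lam ≤ |r|}ᶜ, ‖chirpConv B g r x‖ₑ ^ 2) ≤
      ofReal (C * (lam ^ n)⁻¹) * ∫⁻ ξ, ‖g ξ‖ₑ ^ 2 := by
  obtain ⟨C, hC, hmain⟩ := exists_chirpInt_le (n + 1) (⇑B) (B.smooth _) hB 0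
  refine ⟨π / 4 * (C + 1) ^ 2 * 2 ^ (2 * n + 2) * 2 ^ (n + 1), by positivity,
    fun lam hlam g hg hs => ?_⟩
  have hpi := pi_pos
  have hl0 : 0 < lam := by linarith
  have hgi := integrable_of_annulus hg hs
  have hcc := continuous_chirpConv B hgi
  have hmeas : Measurable (uncurry fun (x : Rn n) (r : ℝ) => ‖chirpConv B g r x‖ₑ ^ 2) :=
    ((hcc.comp continuous_swap).measurable.enorm.pow_const 2)
  rw [lintegral_lintegral_swap hmeas.aemeasurable]
  set D : ℝ := (C + 1) * (2 / lam) ^ (n + 1) with hD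
  have hpt : ∀ r ∈ {r : ℝ | π / 8 * lam ≤ |r|}ᶜ, ∫⁻ x, ‖chirpConv B g r x‖ₑ ^ 2 ≤
      ofReal (D ^ 2) * ∫⁻ ξ, ‖g ξ‖ₑ ^ 2 := by
    intro r hr
    simp only [mem_compl_iff, mem_ofPred_eq, not_le] at hr
    refine (lintegral_chirpConv_sq_le B hgi r).trans ?_
    rw [← lintegral_ofReal_mul]
    refine lintegral_mono fun ξ => ?_
    by_cases hξ : g ξ = 0
    · simp [hξ]
    have h1 := (hs ξ hξ).1
    have hξ0 : 0 < ‖ξ‖ := by linarith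
    have h2 := hmain (‖ξ‖⁻¹ • ξ) ‖ξ‖ r (by rw [norm_smul, norm_inv, norm_norm, inv_mul_cancel₀ hξ0.ne'])
      hξ0 (by nlinarith)
    have h3 : chirpInt (⇑B) 0 (‖ξ‖⁻¹ • ξ) ‖ξ‖ r = chirpHat B r ξ := by
      rw [chirpInt, chirpHat, fourier_eq']
      congr 1; funext t
      rw [inner_smul_right, pow_zero, Complex.ofReal_one, inv_one, mul_one, smul_eq_mul,
        show 2 * π * ‖ξ‖ * (‖ξ‖⁻¹ * inner ℝ t ξ) = 2 * π * inner ℝ t ξ by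
          field_simp]
      rw [mul_comm (B t), ← mul_assoc, ← exp_add]
      congr 2
      push_cast; ring
    rw [h3] at h2
    have h4 : ‖chirpHat B r ξ‖ ≤ D := by
      rw [← le_div_iff₀ (by positivity)] at h2
      refine h2.trans ?_
      rw [hD, div_eq_mul_inv, ← inv_pow]
      gcongr
      · linarith
      · rw [inv_le_comm₀ hξ0 (by positivity), inv_div]; exact h1
    rw [enorm_mul, mul_pow, mul_comm]
    refine mul_le_mul' ?_ le_rfl
    rw [← ofReal_norm, ← ofReal_pow (norm_nonneg _)]
    exact ofReal_le_ofReal (pow_le_pow_left₀ (norm_nonneg _) h4 2)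
  have hset : MeasurableSet {r : ℝ | π / 8 * lam ≤ |r|}ᶜ :=
    (measurableSet_le measurable_const (by fun_prop)).compl
  refine (setLIntegral_mono' hset hpt).trans ?_
  rw [lintegral_const, Measure.restrict_apply_univ, mul_right_comm]
  refine mul_le_mul' ?_ le_rfl
  have hvol : volume {r : ℝ | π / 8 * lam ≤ |r|}ᶜ = ofReal (π / 4 * lam) := by
    have : {r : ℝ | π / 8 * lam ≤ |r|}ᶜ = Ioo (-(π / 8 * lam)) (π / 8 * lam) := by
      ext r; simp [abs_lt]
    rw [this, Real.volume_Ioo]; congr 1; ring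
  rw [hvol, ← ofReal_mul (by positivity)]
  refine ofReal_le_ofReal ?_
  have h5 : (lam ^ (n + 1))⁻¹ ≤ 2 ^ (n + 1) := by
    rw [← inv_pow]
    refine pow_le_pow_left₀ (by positivity) ?_ _
    rw [inv_le_comm₀ hl0 (by norm_num)]; linarith
  calc D ^ 2 * (π / 4 * lam) = π / 4 * (C + 1) ^ 2 * 2 ^ (2 * n + 2) *
        (lam ^ (n + 1))⁻¹ * (lam ^ n)⁻¹ := by
        rw [hD, div_pow]; field_simp; ring
    _ ≤ π / 4 * (C + 1) ^ 2 * 2 ^ (2 * n + 2) * 2 ^ (n + 1) * (lam ^ n)⁻¹ := by gcongr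

theorem integrable_fourier_schwartz (B : 𝓢(Rn n, ℂ)) : Integrable (𝓕 (⇑B)) := by
  rw [← fourier_coe]; exact (𝓕 B).integrable

theorem continuous_fourier_schwartz (B : 𝓢(Rn n, ℂ)) : Continuous (𝓕 (⇑B)) := by
  rw [← fourier_coe]; exact (𝓕 B).continuous

theorem continuous_quadEvol_translate {g : Rn n → ℂ} (hg : Continuous g) {ρ : ℝ}
    (hs : ∀ ξ, g ξ ≠ 0 → ‖ξ‖ ≤ ρ) :
    Continuous fun q : (ℝ × Rn n) × Rn n => quadEvol (fun ζ => g (ζ + q.2)) q.1.1 q.1.2 := by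
  have hgi := integrable_of_supp_ball hg hs
  have e : ∀ q : (ℝ × Rn n) × Rn n, quadEvol (fun ζ => g (ζ + q.2)) q.1.1 q.1.2 =
      ∫ ξ, exp (I * ((q.1.1 * ‖ξ - q.2‖ ^ 2 : ℝ) : ℂ)) * (g ξ *
        exp (2 * π * I * (inner ℝ q.1.2 (ξ - q.2) : ℝ))) := by
    intro q
    rw [quadEvol, ← integral_sub_right_eq_self _ q.2]
    simp only [sub_add_cancel]
  simp only [e]
  refine continuous_of_dominated (bound := fun ξ => ‖g ξ‖) (fun q => ?_) (fun q => ?_) hgi.norm ?_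
  · fun_prop
  · refine .of_forall fun ξ => ?_
    rw [norm_mul, norm_mul, norm_exp_two_pi_inner, mul_one, norm_exp_I_mul_ofReal', one_mul]
  · exact .of_forall fun ξ => by fun_prop

theorem chirpConv_sq_le (B : 𝓢(Rn n, ℂ)) {g : Rn n → ℂ} (hg : Continuous g) {ρ : ℝ}
    (hs : ∀ ξ, g ξ ≠ 0 → ‖ξ‖ ≤ ρ) {r : ℝ} (hr : r ≠ 0) (x : Rn n) :
    ‖chirpConv B g r x‖ₑ ^ 2 ≤ ofReal ((π / |r|) ^ n) * ((∫⁻ η, ‖𝓕 (⇑B) η‖ₑ) *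
      ∫⁻ η, ‖𝓕 (⇑B) η‖ₑ * ‖quadEvol (fun ζ => g (ζ + η)) (-(π ^ 2 / r)) x‖ₑ ^ 2) := by
  have hgi := integrable_of_supp_ball hg hs
  have hq := continuous_quadEvol_translate hg hs
  have hm : Measurable fun η => ‖quadEvol (fun ζ => g (ζ + η)) (-(π ^ 2 / r)) x‖ₑ := by
    have h := hq.comp (Continuous.prodMk_right (Y := Rn n) (-(π ^ 2 / r), x))
    simp only [comp_def] at h
    exact h.measurable.enorm
  have h1 : chirpConv B g r x = _ := integral_chirp_eq_quadEvol B hr hgi x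
  rw [h1, enorm_mul, mul_pow]
  refine mul_le_mul' ?_ ?_
  · rw [← ofReal_norm, ← ofReal_pow (norm_nonneg _), norm_fresnel_const hr]
  · refine le_trans ?_ (lintegral_mul_sq_le_weight
      (continuous_fourier_schwartz B).measurable.enorm.aemeasurable hm.aemeasurable)
    refine pow_le_pow_left₀ zero_le ?_ 2
    refine (enorm_integral_le_lintegral_enorm _).trans (le_of_eq (lintegral_congr fun η => ?_))
    rw [enorm_mul, enorm_mul, ← ofReal_norm (exp _), norm_exp_two_pi_inner, ofReal_one, mul_one]

/-- High-frequency part of the chirp convolution, reduced to the quadratic evolution. -/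
theorem lintegral_chirpConv_high_le (B : 𝓢(Rn n, ℂ)) {g : Rn n → ℂ} (hg : Continuous g) {ρ : ℝ}
    (hs : ∀ ξ, g ξ ≠ 0 → ‖ξ‖ ≤ ρ) {r0 : ℝ} (hr0 : 0 < r0) {w : Rn n → ℝ≥0∞} (hw : Measurable w) :
    ∫⁻ x, w x * (∫⁻ r in {r : ℝ | r0 ≤ |r|}, ‖chirpConv B g r x‖ₑ ^ 2) ≤
      ofReal ((π / r0) ^ (n - 2)) * (∫⁻ η, ‖𝓕 (⇑B) η‖ₑ) * ∫⁻ η, ‖𝓕 (⇑B) η‖ₑ *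
        ∫⁻ x, w x * ∫⁻ τ in {τ : ℝ | |τ| ≤ π ^ 2 / r0},
          ‖quadEvol (fun ζ => g (ζ + η)) τ x‖ₑ ^ 2 := by
  have hn : 2 ≤ n := Fact.out
  have hq := continuous_quadEvol_translate hg hs
  have hqm : Measurable fun q : (ℝ × Rn n) × Rn n =>
    ‖quadEvol (fun ζ => g (ζ + q.2)) q.1.1 q.1.2‖ₑ ^ 2 := hq.measurable.enorm.pow_const 2
  have hbm : Measurable fun η => ‖𝓕 (⇑B) η‖ₑ := (continuous_fourier_schwartz B).measurable.enorm
  have hbfin : (∫⁻ η, ‖𝓕 (⇑B) η‖ₑ) ≠ ∞ := (integrable_fourier_schwartz B).2.ne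
  set A := ∫⁻ η, ‖𝓕 (⇑B) η‖ₑ with hA
  set T := {τ : ℝ | |τ| ≤ π ^ 2 / r0}
  have hset : MeasurableSet {r : ℝ | r0 ≤ |r|} := measurableSet_le measurable_const (by fun_prop)
  set κ := ofReal ((π / r0) ^ (n - 2)) with hκ
  have hin : ∀ x, ∫⁻ r in {r : ℝ | r0 ≤ |r|}, ‖chirpConv B g r x‖ₑ ^ 2 ≤
      κ * A * ∫⁻ η, ‖𝓕 (⇑B) η‖ₑ * ∫⁻ τ in T, ‖quadEvol (fun ζ => g (ζ + η)) τ x‖ₑ ^ 2 := by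
    intro x
    calc _ ≤ ∫⁻ r in {r : ℝ | r0 ≤ |r|}, ofReal ((π / |r|) ^ n) *
          (fun τ => A * ∫⁻ η, ‖𝓕 (⇑B) η‖ₑ * ‖quadEvol (fun ζ => g (ζ + η)) τ x‖ₑ ^ 2)
            (-(π ^ 2 / r)) := by
          refine setLIntegral_mono' hset fun r (hr : r0 ≤ |r|) => ?_
          exact chirpConv_sq_le B hg hs (abs_pos.1 (hr0.trans_le hr)) x
      _ ≤ κ * ∫⁻ τ in T, A * ∫⁻ η, ‖𝓕 (⇑B) η‖ₑ * ‖quadEvol (fun ζ => g (ζ + η)) τ x‖ₑ ^ 2 :=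
          lintegral_inversion_le hn hr0 _
      _ = _ := by
          rw [lintegral_const_mul' _ _ hbfin, mul_assoc]
          congr 2
          rw [lintegral_lintegral_swap]
          · refine lintegral_congr fun η => ?_
            rw [lintegral_const_mul' _ _ enorm_ne_top]
          · refine Measurable.aemeasurable ?_
            refine Measurable.fun_mul (hbm.comp measurable_snd) ?_
            have h := hqm.comp (by fun_prop : Measurable fun q : ℝ × Rn n => ((q.1, x), q.2))
            simp only [comp_def] at h
            exact h
  calc _ ≤ ∫⁻ x, w x * (κ * A * ∫⁻ η, ‖𝓕 (⇑B) η‖ₑ *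
        ∫⁻ τ in T, ‖quadEvol (fun ζ => g (ζ + η)) τ x‖ₑ ^ 2) :=
        lintegral_mono fun x => mul_le_mul' le_rfl (hin x)
    _ = κ * A * ∫⁻ x, ∫⁻ η, w x * (‖𝓕 (⇑B) η‖ₑ *
        ∫⁻ τ in T, ‖quadEvol (fun ζ => g (ζ + η)) τ x‖ₑ ^ 2) := by
        rw [← lintegral_const_mul' _ _ (mul_ne_top ofReal_ne_top hbfin)]
        refine lintegral_congr fun x => ?_
        rw [mul_left_comm]
        congr 1
        refine (lintegral_const_mul _ ?_).symm
        refine Measurable.fun_mul hbm ?_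
        refine Measurable.lintegral_prod_right' (f := fun q : Rn n × ℝ =>
          ‖quadEvol (fun ζ => g (ζ + q.1)) q.2 x‖ₑ ^ 2) ?_
        have h := hqm.comp (by fun_prop : Measurable fun q : Rn n × ℝ => ((q.2, x), q.1))
        simp only [comp_def] at h
        exact h
    _ = _ := by
        congr 1
        rw [lintegral_lintegral_swap]
        · refine lintegral_congr fun η => ?_
          rw [← lintegral_const_mul' _ _ enorm_ne_top]
          refine lintegral_congr fun x => ?_
          ring
        · refine Measurable.aemeasurable ?_
          refine Measurable.fun_mul (hw.comp measurable_fst) (Measurable.fun_mul (hbm.comp measurable_snd) ?_)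
          refine Measurable.lintegral_prod_right' (f := fun q : (Rn n × Rn n) × ℝ =>
            ‖quadEvol (fun ζ => g (ζ + q.1.2)) q.2 q.1.1‖ₑ ^ 2) ?_
          have h := hqm.comp (by fun_prop : Measurable fun q : (Rn n × Rn n) × ℝ => ((q.2, q.1.1), q.1.2))
          simp only [comp_def] at h
          exact h

theorem lintegral_quadEvol_Icc_le {H : Rn n → ℂ} (hH : Integrable H) {T : ℝ} (hT : 0 ≤ T)
    {w : Rn n → ℝ≥0∞} (hw1 : ∀ x, w x ≤ 1) :
    ∫⁻ x, w x * (∫⁻ τ in {τ : ℝ | |τ| ≤ T}, ‖quadEvol H τ x‖ₑ ^ 2) ≤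
      ofReal (2 * T) * ∫⁻ ζ, ‖H ζ‖ₑ ^ 2 := by
  calc _ ≤ ∫⁻ x, ∫⁻ τ in {τ : ℝ | |τ| ≤ T}, ‖quadEvol H τ x‖ₑ ^ 2 :=
        lintegral_mono fun x => mul_le_of_le_one_left' (hw1 x)
    _ = ∫⁻ τ in {τ : ℝ | |τ| ≤ T}, ∫⁻ x, ‖quadEvol H τ x‖ₑ ^ 2 := by
        refine lintegral_lintegral_swap (Measurable.aemeasurable ?_)
        exact ((continuous_quadEvol hH).comp continuous_swap).measurable.enorm.pow_const 2
    _ ≤ ∫⁻ τ in {τ : ℝ | |τ| ≤ T}, ∫⁻ ζ, ‖H ζ‖ₑ ^ 2 :=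
        lintegral_mono fun τ => lintegral_quadEvol_sq_le hH τ
    _ = _ := by
        rw [lintegral_const, Measure.restrict_apply_univ, mul_comm]
        have : {τ : ℝ | |τ| ≤ T} = Icc (-T) T := by ext τ; simp [abs_le]
        rw [this, Real.volume_Icc]; congr 2; ring

theorem lintegral_one_add_norm_fourier_ne_top (B : 𝓢(Rn n, ℂ)) :
    ∫⁻ η, ‖𝓕 (⇑B) η‖ₑ * ofReal (1 + ‖η‖) ≠ ∞ := by
  have h1 : Integrable fun η => (1 + ‖η‖) * ‖𝓕 (⇑B) η‖ := by
    have h2 := SchwartzMap.integrable_pow_mul (volume : Measure (Rn n)) (𝓕 B) 1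
    have h3 := (SchwartzMap.integrable (μ := (volume : Measure (Rn n))) (𝓕 B)).norm
    rw [← fourier_coe]
    refine (h3.add h2).congr (.of_forall fun η => ?_)
    simp only [Pi.add_apply]
    ring
  refine ne_of_lt (lt_of_le_of_lt (lintegral_mono fun η => ?_) h1.2)
  rw [enorm_mul, enorm_norm, mul_comm, Real.enorm_eq_ofReal (by positivity)]

theorem exists_chirpConv_high_weight_le (B : 𝓢(Rn n, ℂ)) : ∃ C : ℝ, 0 < C ∧
    ∀ lam : ℝ, 1 / 2 ≤ lam → ∀ g : Rn n → ℂ, Continuous g →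
    DyadicSupported lam g → ∀ R : ℝ, 1 ≤ R →
    ∀ w : Rn n → ℝ≥0∞, Measurable w → (∀ x, w x ≤ 1) → ∫⁻ x, w x ≠ ∞ →
    ∫⁻ x, w x * (∫⁻ r in {r : ℝ | π / 8 * lam ≤ |r|}, ‖chirpConv B g r x‖ₑ ^ 2) ≤
      ofReal (C * (lam ^ n)⁻¹) * (ofReal R + ofReal (√(R ^ (n - 1))⁻¹ * lam ^ n) *
        ∫⁻ x, w x) * ∫⁻ ξ, ‖g ξ‖ₑ ^ 2 := by
  obtain ⟨C, hC, hmain⟩ := exists_lintegral_weight_quadEvol_le n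
  have hn : 2 ≤ n := Fact.out
  have hpi := pi_pos
  set A := (∫⁻ η, ‖𝓕 (⇑B) η‖ₑ) with hA
  set A' := (∫⁻ η, ‖𝓕 (⇑B) η‖ₑ * ofReal (1 + ‖η‖)) with hA'
  have hAf : A ≠ ∞ := (integrable_fourier_schwartz B).2.ne
  have hA'f : A' ≠ ∞ := lintegral_one_add_norm_fourier_ne_top B
  set D : ℝ := C + 64 * π with hD
  refine ⟨8 ^ (n - 2) * D * A.toReal * A'.toReal + 1, by positivity, fun lam hlam g hg hs R hR w hw hw1 hwi => ?_⟩
  have hl0 : 0 < lam := by linarith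
  have hgi := integrable_of_annulus hg hs
  set W := ∫⁻ x, w x with hW
  set Y := ofReal R + ofReal (√(R ^ (n - 1))⁻¹ * lam ^ n) * W with hY
  set Q := ∫⁻ ξ, ‖g ξ‖ₑ ^ 2 with hQ
  have hr0 : π ^ 2 / (π / 8 * lam) = 8 * π / lam := by field_simp
  have hη : ∀ η : Rn n, ∫⁻ x, w x * (∫⁻ τ in {τ : ℝ | |τ| ≤ π ^ 2 / (π / 8 * lam)},
      ‖quadEvol (fun ζ => g (ζ + η)) τ x‖ₑ ^ 2) ≤
      ofReal (D * (lam ^ 2)⁻¹) * ofReal (1 + ‖η‖) * Y * Q := by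
    intro η
    have hQη : ∫⁻ ζ, ‖g (ζ + η)‖ₑ ^ 2 = Q := lintegral_add_right_eq_self (fun ζ => ‖g ζ‖ₑ ^ 2) η
    rcases le_or_gt ‖η‖ (lam / 4) with h | h
    · have h1 := hmain R hR lam hl0 (fun ζ => g (ζ + η)) (by fun_prop) (fun ζ hζ => by
        have := hs _ hζ
        have h2 := norm_add_le ζ η
        have h3 := norm_sub_le (ζ + η) η
        rw [add_sub_cancel_right] at h3
        constructor <;> linarith) w hw hw1 hwi
      rw [hQη] at h1
      calc _ ≤ _ := lintegral_mono fun x => mul_le_mul' le_rfl (setLIntegral_le_lintegral _ _)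
        _ ≤ _ := h1
        _ = ofReal (C * (lam ^ 2)⁻¹) * 1 * Y * Q := by
            rw [mul_one, hY, ofReal_mul hC.le, ofReal_mul hC.le, mul_assoc C, ofReal_mul hC.le]
            ring
        _ ≤ _ := by
            gcongr
            · rw [hD]; linarith
            · rw [← ofReal_one]; exact ofReal_le_ofReal (by linarith [norm_nonneg η])
    · have hgη : Integrable fun ζ => g (ζ + η) := hgi.comp_add_right η
      refine (lintegral_quadEvol_Icc_le hgη (by positivity) hw1).trans ?_
      rw [hQη]
      refine mul_le_mul' ?_ le_rfl
      calc _ ≤ ofReal (D * (lam ^ 2)⁻¹) * ofReal (1 + ‖η‖) * ofReal 1 := by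
            rw [ofReal_one, mul_one, ← ofReal_mul (by positivity), hr0]
            refine ofReal_le_ofReal ?_
            have : 2 * (8 * π / lam) = (64 * π * (lam ^ 2)⁻¹) * (lam / 4) := by
              field_simp; ring
            rw [this]
            gcongr
            · rw [hD]; linarith
            · linarith
        _ ≤ _ := by
            gcongr
            exact (ofReal_le_ofReal hR).trans le_self_add
  refine (lintegral_chirpConv_high_le B hg (fun ξ hξ => (hs ξ hξ).2) (by positivity) hw).trans ?_
  have hpr : π / (π / 8 * lam) = 8 / lam := by field_simp
  have hqm : ∫⁻ η, ‖𝓕 (⇑B) η‖ₑ * (ofReal (D * (lam ^ 2)⁻¹) * ofReal (1 + ‖η‖) * Y * Q) =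
      A' * (ofReal (D * (lam ^ 2)⁻¹) * Y * Q) := by
    rw [hA', ← lintegral_mul_const]
    · refine lintegral_congr fun η => ?_
      ring
    · exact Measurable.fun_mul (continuous_fourier_schwartz B).measurable.enorm (by fun_prop)
  calc _ ≤ ofReal ((8 / lam) ^ (n - 2)) * A *
        ∫⁻ η, ‖𝓕 (⇑B) η‖ₑ * (ofReal (D * (lam ^ 2)⁻¹) * ofReal (1 + ‖η‖) * Y * Q) := by
        rw [hpr]
        exact mul_le_mul' le_rfl (lintegral_mono fun η => mul_le_mul' le_rfl (hη η))
    _ = (ofReal ((8 / lam) ^ (n - 2)) * A * A' * ofReal (D * (lam ^ 2)⁻¹)) * Y * Q := by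
        rw [hqm]; ring
    _ ≤ _ := by
        gcongr
        rw [← ofReal_toReal hAf, ← ofReal_toReal hA'f,
          ← ofReal_mul (by positivity), ← ofReal_mul (by positivity),
          ← ofReal_mul (by positivity), toReal_ofReal toReal_nonneg,
          toReal_ofReal toReal_nonneg]
        refine ofReal_le_ofReal ?_
        have : (lam ^ n)⁻¹ = (lam ^ (n - 2))⁻¹ * (lam ^ 2)⁻¹ := by
          rw [← mul_inv, ← pow_add, Nat.sub_add_cancel hn]
        rw [this, div_pow, div_eq_mul_inv]
        have hp : 0 ≤ (lam ^ (n - 2))⁻¹ * (lam ^ 2)⁻¹ := by positivity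
        calc _ = (8 ^ (n - 2) * D * A.toReal * A'.toReal) * ((lam ^ (n - 2))⁻¹ * (lam ^ 2)⁻¹) := by ring
          _ ≤ _ := mul_le_mul_of_nonneg_right (by linarith) hp

theorem exists_chirpConv_high_le (B : 𝓢(Rn n, ℂ)) : ∃ C : ℝ, 0 < C ∧
    ∀ lam : ℝ, 1 / 2 ≤ lam → ∀ g : Rn n → ℂ, Continuous g →
    DyadicSupported lam g →
    ∫⁻ x, (∫⁻ r in {r : ℝ | π / 8 * lam ≤ |r|}, ‖chirpConv B g r x‖ₑ ^ 2) ≤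
      ofReal (C * (lam ^ (n - 1))⁻¹) * ∫⁻ ξ, ‖g ξ‖ₑ ^ 2 := by
  have hn : 2 ≤ n := Fact.out
  set A := (∫⁻ η, ‖𝓕 (⇑B) η‖ₑ) with hA
  have hAf : A ≠ ∞ := (integrable_fourier_schwartz B).2.ne
  refine ⟨8 ^ (n - 2) * (16 * π) * A.toReal ^ 2 + 1, by positivity, fun lam hlam g hg hs => ?_⟩
  have hgi := integrable_of_annulus hg hs
  set Q := ∫⁻ ξ, ‖g ξ‖ₑ ^ 2 with hQ
  have hr0 : π ^ 2 / (π / 8 * lam) = 8 * π / lam := by field_simp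
  have hpr : π / (π / 8 * lam) = 8 / lam := by field_simp
  have hη : ∀ η : Rn n, ∫⁻ x, 1 * (∫⁻ τ in {τ : ℝ | |τ| ≤ π ^ 2 / (π / 8 * lam)},
      ‖quadEvol (fun ζ => g (ζ + η)) τ x‖ₑ ^ 2) ≤ ofReal (16 * π * lam⁻¹) * Q := by
    intro η
    have hQη : ∫⁻ ζ, ‖g (ζ + η)‖ₑ ^ 2 = Q := lintegral_add_right_eq_self (fun ζ => ‖g ζ‖ₑ ^ 2) η
    refine (lintegral_quadEvol_Icc_le (hgi.comp_add_right η) (by positivity) fun _ => le_rfl).trans ?_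
    rw [hQη, hr0]
    refine mul_le_mul' (ofReal_le_ofReal (le_of_eq ?_)) le_rfl
    field_simp; ring
  have h := lintegral_chirpConv_high_le B hg (fun ξ hξ => (hs ξ hξ).2)
    (r0 := π / 8 * lam) (by positivity) (w := fun _ => 1) measurable_const
  simp only [one_mul] at h hη
  refine h.trans ?_
  rw [hpr]
  calc _ ≤ ofReal ((8 / lam) ^ (n - 2)) * A *
        ∫⁻ η, ‖𝓕 (⇑B) η‖ₑ * (ofReal (16 * π * lam⁻¹) * Q) :=
        mul_le_mul' le_rfl (lintegral_mono fun η => mul_le_mul' le_rfl (hη η))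
    _ = (ofReal ((8 / lam) ^ (n - 2)) * A * A * ofReal (16 * π * lam⁻¹)) * Q := by
        rw [lintegral_mul_const _ (continuous_fourier_schwartz B).measurable.enorm]; ring
    _ ≤ _ := by
        gcongr
        rw [← ofReal_toReal hAf, ← ofReal_mul (by positivity), ← ofReal_mul (by positivity),
          ← ofReal_mul (by positivity), toReal_ofReal toReal_nonneg]
        refine ofReal_le_ofReal ?_
        have : (lam ^ (n - 1))⁻¹ = (lam ^ (n - 2))⁻¹ * lam⁻¹ := by
          rw [← mul_inv, ← pow_succ]; congr 2; omega
        rw [this, div_pow, div_eq_mul_inv]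
        have hp : 0 ≤ (lam ^ (n - 2))⁻¹ * lam⁻¹ := by positivity
        calc _ = (8 ^ (n - 2) * (16 * π) * A.toReal ^ 2) * ((lam ^ (n - 2))⁻¹ * lam⁻¹) := by ring
          _ ≤ _ := mul_le_mul_of_nonneg_right (by linarith) hp

/-- Single-scale weighted `L²` estimate for the chirp convolution. -/
theorem exists_chirpConv_weight_le (B : 𝓢(Rn n, ℂ)) (hB : ∀ t, B t ≠ 0 → ‖t‖ ≤ 2) :
    ∃ C : ℝ, 0 < C ∧
    ∀ lam : ℝ, 1 / 2 ≤ lam → ∀ g : Rn n → ℂ, Continuous g →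
    DyadicSupported lam g → ∀ R : ℝ, 1 ≤ R →
    ∀ w : Rn n → ℝ≥0∞, Measurable w → (∀ x, w x ≤ 1) → ∫⁻ x, w x ≠ ∞ →
    ∫⁻ x, w x * (∫⁻ r, ‖chirpConv B g r x‖ₑ ^ 2) ≤ ofReal (C * (lam ^ n)⁻¹) * (ofReal R +
        ofReal (√(R ^ (n - 1))⁻¹ * lam ^ n) * ∫⁻ x, w x) * ∫⁻ ξ, ‖g ξ‖ₑ ^ 2 := by
  obtain ⟨C₁, h₁, low⟩ := exists_chirpConv_low_le B hB
  obtain ⟨C₂, h₂, high⟩ := exists_chirpConv_high_weight_le B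
  refine ⟨C₁ + C₂, by positivity, fun lam hlam g hg hs R hR w hw hw1 hwi => ?_⟩
  have hset : MeasurableSet {r : ℝ | π / 8 * lam ≤ |r|} :=
    measurableSet_le measurable_const (by fun_prop)
  have hc := (continuous_chirpConv B (integrable_of_annulus hg hs))
  have hm : Measurable fun x => ∫⁻ r in {r : ℝ | π / 8 * lam ≤ |r|}, ‖chirpConv B g r x‖ₑ ^ 2 := by
    refine Measurable.lintegral_prod_right' (f := fun q : Rn n × ℝ => ‖chirpConv B g q.2 q.1‖ₑ ^ 2) ?_
    exact (hc.comp continuous_swap).measurable.enorm.pow_const 2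
  have h1R : (1 : ℝ≥0∞) ≤ ofReal R := by
    rw [← ofReal_one]; exact ofReal_le_ofReal hR
  calc _ = ∫⁻ x, (w x * (∫⁻ r in {r : ℝ | π / 8 * lam ≤ |r|}, ‖chirpConv B g r x‖ₑ ^ 2) +
        w x * (∫⁻ r in {r : ℝ | π / 8 * lam ≤ |r|}ᶜ, ‖chirpConv B g r x‖ₑ ^ 2)) := by
        refine lintegral_congr fun x => ?_
        rw [← mul_add, lintegral_add_compl _ hset]
    _ ≤ (∫⁻ x, w x * (∫⁻ r in {r : ℝ | π / 8 * lam ≤ |r|}, ‖chirpConv B g r x‖ₑ ^ 2)) +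
        ∫⁻ x, (∫⁻ r in {r : ℝ | π / 8 * lam ≤ |r|}ᶜ, ‖chirpConv B g r x‖ₑ ^ 2) := by
        rw [lintegral_add_left (Measurable.fun_mul hw hm)]
        exact add_le_add le_rfl (lintegral_mono fun x => mul_le_of_le_one_left' (hw1 x))
    _ ≤ _ := add_le_add (high lam hlam g hg hs R hR w hw hw1 hwi) (low lam hlam g hg hs)
    _ ≤ _ := by
        rw [add_mul C₁, add_comm (C₁ * _), ofReal_add (by positivity) (by positivity), add_mul, add_mul]
        refine add_le_add le_rfl (mul_le_mul' ?_ le_rfl)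
        calc _ = ofReal (C₁ * (lam ^ n)⁻¹) * 1 := (mul_one _).symm
          _ ≤ _ := mul_le_mul' le_rfl (h1R.trans le_self_add)

/-- Unweighted `L²` estimate for the chirp convolution. -/
theorem exists_chirpConv_le (B : 𝓢(Rn n, ℂ)) (hB : ∀ t, B t ≠ 0 → ‖t‖ ≤ 2) :
    ∃ C : ℝ, 0 < C ∧
    ∀ lam : ℝ, 1 / 2 ≤ lam → ∀ g : Rn n → ℂ, Continuous g →
    DyadicSupported lam g →
    ∫⁻ x, (∫⁻ r, ‖chirpConv B g r x‖ₑ ^ 2) ≤ ofReal (C * (lam ^ (n - 1))⁻¹) * ∫⁻ ξ, ‖g ξ‖ₑ ^ 2 := by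
  have hn : 2 ≤ n := Fact.out
  obtain ⟨C₁, h₁, low⟩ := exists_chirpConv_low_le B hB
  obtain ⟨C₂, h₂, high⟩ := exists_chirpConv_high_le B
  refine ⟨2 * C₁ + C₂, by positivity, fun lam hlam g hg hs => ?_⟩
  have hl0 : 0 < lam := by linarith
  have hset : MeasurableSet {r : ℝ | π / 8 * lam ≤ |r|} :=
    measurableSet_le measurable_const (by fun_prop)
  have hc := (continuous_chirpConv B (integrable_of_annulus hg hs))
  have hm : Measurable fun x => ∫⁻ r in {r : ℝ | π / 8 * lam ≤ |r|}, ‖chirpConv B g r x‖ₑ ^ 2 := by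
    refine Measurable.lintegral_prod_right' (f := fun q : Rn n × ℝ => ‖chirpConv B g q.2 q.1‖ₑ ^ 2) ?_
    exact (hc.comp continuous_swap).measurable.enorm.pow_const 2
  calc _ = ∫⁻ x, ((∫⁻ r in {r : ℝ | π / 8 * lam ≤ |r|}, ‖chirpConv B g r x‖ₑ ^ 2) +
        (∫⁻ r in {r : ℝ | π / 8 * lam ≤ |r|}ᶜ, ‖chirpConv B g r x‖ₑ ^ 2)) := by
        refine lintegral_congr fun x => ?_
        rw [lintegral_add_compl _ hset]
    _ = _ := lintegral_add_left hm _
    _ ≤ _ := add_le_add (high lam hlam g hg hs) (low lam hlam g hg hs)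
    _ ≤ _ := by
        rw [← add_mul, ← ofReal_add (by positivity) (by positivity)]
        refine mul_le_mul' (ofReal_le_ofReal ?_) le_rfl
        have h3 : (lam ^ n)⁻¹ ≤ 2 * (lam ^ (n - 1))⁻¹ := by
          have : lam ^ n = lam * lam ^ (n - 1) := by rw [← pow_succ']; congr 1; omega
          rw [this, mul_inv]
          gcongr
          rw [inv_le_comm₀ hl0 (by norm_num)]; linarith
        have := mul_le_mul_of_nonneg_left h3 h₁.le
        linarith

/-- Convolution with an inverse Fourier transform. -/
theorem conv_fourierInv {W g : Rn n → ℂ} (hW : Integrable W) (hg : Integrable g) (x : Rn n) :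
    ∫ t, W t * 𝓕⁻ g (x - t) = 𝓕⁻ (fun ξ => g ξ * 𝓕 W ξ) x := by
  simp only [fourierInv_eq', fourier_eq', smul_eq_mul]
  have hL : ∀ t, W t * ∫ v, exp (((2 * π * inner ℝ v (x - t) : ℝ) : ℂ) * I) * g v =
      ∫ v, W t * (exp (((2 * π * inner ℝ v (x - t) : ℝ) : ℂ) * I) * g v) := fun t =>
    (integral_const_mul _ _).symm
  simp only [hL]
  rw [integral_integral_swap]
  · refine integral_congr_ae (.of_forall fun ξ => ?_)
    simp only
    rw [← integral_const_mul, ← integral_const_mul]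
    refine integral_congr_ae (.of_forall fun t => ?_)
    simp only
    have : exp (((2 * π * inner ℝ ξ (x - t) : ℝ) : ℂ) * I) =
        exp (((2 * π * inner ℝ ξ x : ℝ) : ℂ) * I) *
        exp (((-2 * π * inner ℝ t ξ : ℝ) : ℂ) * I) := by
      rw [← exp_add, inner_sub_right, real_inner_comm t ξ]
      congr 1; push_cast; ring
    rw [this]; ring
  · have h := (hW.mul_prod hg)
    refine (h.bdd_mul (c := 1) (f := fun q : Rn n × Rn n =>
      exp (((2 * π * inner ℝ q.2 (x - q.1) : ℝ) : ℂ) * I)) ?_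
      (.of_forall fun q => ?_)).congr (.of_forall fun q => ?_)
    · fun_prop
    · rw [norm_exp_ofReal_mul_I]
    · simp only [uncurry]; ring

/-- The dilated Littlewood-Paley kernel with symbol `m(ξ / lam)`. -/
def lpKer (m : 𝓢(Rn n, ℂ)) (lam : ℝ) (x : Rn n) : ℂ := ((lam ^ n : ℝ) : ℂ) * 𝓕⁻ (⇑m) (lam • x)

theorem lpKer_eq_fourierInv (m : 𝓢(Rn n, ℂ)) {lam : ℝ} (hl : 0 < lam) :
    lpKer m lam = 𝓕⁻ fun ξ => m (lam⁻¹ • ξ) := by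
  ext x
  rw [lpKer, fourierInv_eq', fourierInv_eq']
  have h := Measure.integral_comp_inv_smul (volume : Measure (Rn n))
    (fun v => exp (((2 * π * inner ℝ v (lam • x) : ℝ) : ℂ) * I) • m v) lam
  rw [finrank_euclideanSpace_fin, abs_of_pos (by positivity : (0:ℝ) < lam ^ n)] at h
  rw [← real_smul, ← h]
  refine integral_congr_ae (.of_forall fun v => ?_)
  simp only [inner_smul_left, inner_smul_right]
  congr 4
  simp only [conj_trivial]
  field_simp

theorem continuous_lpKer (m : 𝓢(Rn n, ℂ)) (lam : ℝ) : Continuous (lpKer m lam) := by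
  unfold lpKer
  have : Continuous (𝓕⁻ (⇑m)) := by
    rw [← fourierInv_coe]; exact (𝓕⁻ m).continuous
  fun_prop

theorem exists_lpKer_decay (m : 𝓢(Rn n, ℂ)) (L : ℕ) : ∃ C : ℝ, 0 < C ∧ ∀ lam : ℝ, 0 < lam → ∀ x,
    ‖lpKer m lam x‖ ≤ C * lam ^ n * ((1 + lam * ‖x‖) ^ L)⁻¹ := by
  obtain ⟨C, hC, h⟩ := schwartz_decay (𝓕⁻ m) L
  refine ⟨C, hC, fun lam hl x => ?_⟩
  rw [lpKer, norm_mul, norm_real, norm_of_nonneg (by positivity)]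
  have := h (lam • x)
  rw [fourierInv_coe, norm_smul, norm_of_nonneg hl.le] at this
  calc _ ≤ lam ^ n * (C * ((1 + lam * ‖x‖) ^ L)⁻¹) := by gcongr
    _ = _ := by ring

theorem integrable_lpKer (m : 𝓢(Rn n, ℂ)) {lam : ℝ} (hl : 0 < lam) : Integrable (lpKer m lam) := by
  unfold lpKer
  refine Integrable.const_mul ?_ _
  have : Integrable (𝓕⁻ (⇑m)) := by
    rw [← fourierInv_coe]; exact (𝓕⁻ m).integrable
  exact this.comp_smul hl.ne'

/-- The spherical piece of the localised kernel. -/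
def spKer (b m : 𝓢(Rn n, ℂ)) (lam ρ : ℝ) (x : Rn n) : ℂ :=
  ((ρ ^ (n - 1) : ℝ) : ℂ) * ∫ ω, b (ρ • (ω : Rn n)) * lpKer m lam (x - ρ • (ω : Rn n)) ∂(sph n)

/-- Convolution with the spherical piece. -/
def spConv (b m : 𝓢(Rn n, ℂ)) (lam : ℝ) (f : Rn n → ℂ) (ρ : ℝ) (x : Rn n) : ℂ :=
  ∫ y, f y * spKer b m lam ρ (x - y)

/-- The radial square function. -/
def sqFn (b m : 𝓢(Rn n, ℂ)) (lam : ℝ) (f : Rn n → ℂ) (x : Rn n) : ℝ≥0∞ :=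
  ∫⁻ ρ in Ioi (0 : ℝ), ‖spConv b m lam f ρ x‖ₑ ^ 2

theorem continuous_spKer (b m : 𝓢(Rn n, ℂ)) (lam : ℝ) :
    Continuous fun q : ℝ × Rn n => spKer b m lam q.1 q.2 := by
  unfold spKer
  have hk := continuous_lpKer m lam
  obtain ⟨C, hC, h⟩ := exists_lpKer_decay m 0
  obtain ⟨D, hD, h'⟩ := schwartz_decay b 0
  refine Continuous.mul (by fun_prop) ?_
  obtain ⟨M, hM⟩ : ∃ M, ∀ x, ‖lpKer m lam x‖ ≤ M := by
    refine ⟨|lam ^ n| * ‖(𝓕⁻ m).toBoundedContinuousFunction‖, fun x => ?_⟩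
    rw [lpKer, norm_mul, norm_real, norm_eq_abs, ← fourierInv_coe]
    exact mul_le_mul_of_nonneg_left
      ((𝓕⁻ m).toBoundedContinuousFunction.norm_coe_le_norm _) (abs_nonneg _)
  refine continuous_of_dominated (bound := fun _ => D * M) (fun x => ?_) (fun x => ?_)
    (integrable_const _) (.of_forall fun ω => by fun_prop)
  · fun_prop
  · refine .of_forall fun ω => ?_
    rw [norm_mul]
    have := h' (x.1 • (ω : Rn n))
    simp only [pow_zero, inv_one, mul_one] at this
    exact mul_le_mul this (hM _) (norm_nonneg _) hD.le

theorem spKer_eq_zero {b : 𝓢(Rn n, ℂ)} (hb : AnnulusSupported b)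
    (m : 𝓢(Rn n, ℂ)) (lam : ℝ) {ρ : ℝ} (hρ : 0 < ρ) (h : ¬ (1 / 2 ≤ ρ ∧ ρ ≤ 2)) (x : Rn n) :
    spKer b m lam ρ x = 0 := by
  have : ∀ ω : sphere (0 : Rn n) 1, b (ρ • (ω : Rn n)) = 0 := fun ω => by
    by_contra h0
    have := hb _ h0
    rw [norm_smul, norm_eq_of_mem_sphere, mul_one, norm_of_nonneg hρ.le] at this
    exact h this
  simp [spKer, this]

theorem spConv_eq_zero {b : 𝓢(Rn n, ℂ)} (hb : AnnulusSupported b)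
    (m : 𝓢(Rn n, ℂ)) (lam : ℝ) (f : Rn n → ℂ) {ρ : ℝ} (hρ : 0 < ρ) (h : ¬ (1 / 2 ≤ ρ ∧ ρ ≤ 2))
    (x : Rn n) : spConv b m lam f ρ x = 0 := by
  simp [spConv, spKer_eq_zero hb m lam hρ h]

/-- Pointwise bound for the spherical kernel away from the support. -/
theorem exists_spKer_le (b m : 𝓢(Rn n, ℂ)) (L : ℕ) : ∃ C : ℝ, 0 < C ∧ ∀ lam : ℝ, 0 < lam →
    ∀ ρ : ℝ, 0 < ρ → ρ ≤ 2 → ∀ x : Rn n,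
    ‖spKer b m lam ρ x‖ ≤ C * lam ^ n * ((1 + lam * max 0 (‖x‖ - 2)) ^ L)⁻¹ := by
  obtain ⟨C, hC, h⟩ := exists_lpKer_decay m L
  obtain ⟨D, hD, h'⟩ := schwartz_decay b 0
  refine ⟨2 ^ (n - 1) * (D * C * (sph n).real univ) + 1, by positivity, fun lam hl ρ hρ hρ2 x => ?_⟩
  set M := lam ^ n * ((1 + lam * max 0 (‖x‖ - 2)) ^ L)⁻¹ with hM
  have hM0 : 0 ≤ M := by positivity
  have hin : ‖∫ ω, b (ρ • (ω : Rn n)) * lpKer m lam (x - ρ • (ω : Rn n)) ∂(sph n)‖ ≤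
      D * C * M * (sph n).real univ := by
    refine norm_integral_le_of_norm_le_const (.of_forall fun ω => ?_)
    have h1 := h' (ρ • (ω : Rn n))
    simp only [pow_zero, inv_one, mul_one] at h1
    rw [norm_mul, mul_assoc D]
    refine mul_le_mul h1 ((h lam hl _).trans ?_) (norm_nonneg _) hD.le
    rw [hM, mul_assoc C]
    have : max 0 (‖x‖ - 2) ≤ ‖x - ρ • (ω : Rn n)‖ := by
      refine max_le (norm_nonneg _) ?_
      have := norm_sub_norm_le x (ρ • (ω : Rn n))
      rw [norm_smul, norm_eq_of_mem_sphere, mul_one, norm_of_nonneg hρ.le] at this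
      linarith
    gcongr
  rw [spKer, norm_mul, norm_real, norm_of_nonneg (by positivity)]
  calc _ ≤ 2 ^ (n - 1) * (D * C * M * (sph n).real univ) := by gcongr
    _ = (2 ^ (n - 1) * (D * C * (sph n).real univ)) * M := by ring
    _ ≤ (2 ^ (n - 1) * (D * C * (sph n).real univ) + 1) * M := by nlinarith
    _ = _ := by rw [hM]; ring

theorem exists_norm_lpKer_le (m : 𝓢(Rn n, ℂ)) (lam : ℝ) : ∃ M : ℝ, 0 < M ∧ ∀ x, ‖lpKer m lam x‖ ≤ M := by
  refine ⟨|lam ^ n| * ‖(𝓕⁻ m).toBoundedContinuousFunction‖ + 1, by positivity, fun x => ?_⟩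
  rw [lpKer, norm_mul, norm_real, norm_eq_abs, ← fourierInv_coe]
  exact (mul_le_mul_of_nonneg_left
    ((𝓕⁻ m).toBoundedContinuousFunction.norm_coe_le_norm _) (abs_nonneg _)).trans (by linarith)

theorem exists_norm_spKer_le (b m : 𝓢(Rn n, ℂ)) {lam : ℝ} (hl : 0 < lam) : ∃ M : ℝ, 0 < M ∧
    ∀ ρ : ℝ, 0 < ρ → ρ ≤ 2 → ∀ x, ‖spKer b m lam ρ x‖ ≤ M := by
  obtain ⟨C, hC, h⟩ := exists_spKer_le b m 0
  exact ⟨C * lam ^ n, by positivity, fun ρ h0 h2 x => by simpa using h lam hl ρ h0 h2 x⟩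

theorem continuous_spKer_right (b m : 𝓢(Rn n, ℂ)) (lam ρ : ℝ) : Continuous (spKer b m lam ρ) := by
  have h := (continuous_spKer b m lam).comp (Continuous.prodMk_right (Y := Rn n) ρ)
  simp only [comp_def] at h
  exact h

/-- The Littlewood-Paley convolution. -/
def lpConv (m : 𝓢(Rn n, ℂ)) (lam : ℝ) (f : Rn n → ℂ) (x : Rn n) : ℂ := ∫ y, f y * lpKer m lam (x - y)

theorem continuous_lpConv (m : 𝓢(Rn n, ℂ)) (lam : ℝ) {f : Rn n → ℂ} (hf : Integrable f) :
    Continuous (lpConv m lam f) := by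
  obtain ⟨M, hM, h⟩ := exists_norm_lpKer_le m lam
  have hk := continuous_lpKer m lam
  refine continuous_of_dominated (bound := fun y => ‖f y‖ * M) (fun x => ?_) (fun x => ?_)
    (hf.norm.mul_const _) (.of_forall fun y => by fun_prop)
  · exact hf.1.mul (by fun_prop)
  · exact .of_forall fun y => by rw [norm_mul]; exact mul_le_mul_of_nonneg_left (h _) (norm_nonneg _)

theorem integrable_lpConv (m : 𝓢(Rn n, ℂ)) {lam : ℝ} (hl : 0 < lam) {f : Rn n → ℂ} (hf : Integrable f) :
    Integrable (lpConv m lam f) :=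
  hf.integrable_convolution (ContinuousLinearMap.mul ℝ ℂ) (integrable_lpKer m hl)

theorem integrable_symbol_mul (m : 𝓢(Rn n, ℂ)) {lam : ℝ} (hl : 0 < lam) :
    Integrable fun ξ => m (lam⁻¹ • ξ) :=
  m.integrable.comp_smul (inv_ne_zero hl.ne')

theorem lpConv_eq_fourierInv (m : 𝓢(Rn n, ℂ)) {lam : ℝ} (hl : 0 < lam) {f : Rn n → ℂ}
    (hf : Integrable f) (x : Rn n) :
    lpConv m lam f x = 𝓕⁻ (fun ξ => m (lam⁻¹ • ξ) * 𝓕 f ξ) x := by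
  rw [lpConv, lpKer_eq_fourierInv m hl, conv_fourierInv hf (integrable_symbol_mul m hl)]

theorem stronglyMeasurable_spConv (b m : 𝓢(Rn n, ℂ)) (lam : ℝ) {f : Rn n → ℂ}
    (hf : Integrable f) : StronglyMeasurable (fun q : ℝ × Rn n => spConv b m lam f q.1 q.2) := by
  obtain ⟨f', hf', he⟩ := hf.1
  have e : ∀ q : ℝ × Rn n, spConv b m lam f q.1 q.2 = ∫ y, f' y * spKer b m lam q.1 (q.2 - y) := by
    intro q
    refine integral_congr_ae ?_
    filter_upwards [he] with y hy
    rw [hy]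
  simp only [e]
  refine StronglyMeasurable.integral_prod_right
    (f := fun (q : ℝ × Rn n) (y : Rn n) => f' y * spKer b m lam q.1 (q.2 - y)) ?_
  refine (hf'.comp_measurable measurable_snd).mul ?_
  have : Continuous fun q : (ℝ × Rn n) × Rn n => spKer b m lam q.1.1 (q.1.2 - q.2) :=
    (continuous_spKer b m lam).comp
      (by fun_prop : Continuous fun q : (ℝ × Rn n) × Rn n => (q.1.1, q.1.2 - q.2))
  exact this.stronglyMeasurable

theorem measurable_sqFn (b m : 𝓢(Rn n, ℂ)) (lam : ℝ) {f : Rn n → ℂ} (hf : Integrable f) :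
    Measurable (sqFn b m lam f) := by
  unfold sqFn
  refine Measurable.lintegral_prod_right' (f := fun q : Rn n × ℝ => ‖spConv b m lam f q.2 q.1‖ₑ ^ 2) ?_
  have h := (stronglyMeasurable_spConv b m lam hf).measurable.comp measurable_swap
  simp only [comp_def, Prod.fst_swap, Prod.snd_swap] at h
  exact h.enorm.pow_const 2

theorem spConv_eq_sphere (b m : 𝓢(Rn n, ℂ)) (lam : ℝ) {f : Rn n → ℂ} (hf : Integrable f)
    (ρ : ℝ) (x : Rn n) : spConv b m lam f ρ x = ((ρ ^ (n - 1) : ℝ) : ℂ) *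
        ∫ ω, b (ρ • (ω : Rn n)) * lpConv m lam f (x - ρ • (ω : Rn n)) ∂(sph n) := by
  simp only [spConv, spKer, lpConv]
  have e : ∀ y, f y * (((ρ ^ (n - 1) : ℝ) : ℂ) * ∫ ω, b (ρ • (ω : Rn n)) *
      lpKer m lam (x - y - ρ • (ω : Rn n)) ∂(sph n)) =
      ((ρ ^ (n - 1) : ℝ) : ℂ) * ∫ ω, f y * (b (ρ • (ω : Rn n)) *
      lpKer m lam (x - y - ρ • (ω : Rn n))) ∂(sph n) := fun y => by
    rw [integral_const_mul]; ring
  simp only [e]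
  rw [integral_const_mul]
  congr 1
  rw [integral_integral_swap]
  · refine integral_congr_ae (.of_forall fun ω => ?_)
    simp only
    rw [← integral_const_mul]
    refine integral_congr_ae (.of_forall fun y => ?_)
    simp only
    rw [show x - y - ρ • (ω : Rn n) = x - ρ • (ω : Rn n) - y by abel]
    ring
  · obtain ⟨M, hM, h⟩ := exists_norm_lpKer_le m lam
    obtain ⟨D, hD, h'⟩ := schwartz_decay b 0
    have hk := continuous_lpKer m lam
    have h1 : Integrable (fun q : Rn n × sphere (0 : Rn n) 1 => f q.1 * (1 : ℂ))
        (volume.prod (sph n)) := hf.mul_prod (integrable_const _)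
    refine (h1.bdd_mul (c := D * M) (f := fun q : Rn n × sphere (0 : Rn n) 1 =>
      b (ρ • (q.2 : Rn n)) * lpKer m lam (x - q.1 - ρ • (q.2 : Rn n))) ?_
      (.of_forall fun q => ?_)).congr (.of_forall fun q => ?_)
    · fun_prop
    · rw [norm_mul]
      have h1 := h' (ρ • (q.2 : Rn n))
      simp only [pow_zero, inv_one, mul_one] at h1
      exact mul_le_mul h1 (h _) (norm_nonneg _) hD.le
    · simp only [uncurry]; ring

theorem sqFn_le_of_bound (b m : 𝓢(Rn n, ℂ)) (hb : AnnulusSupported b)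
    (lam : ℝ) {f : Rn n → ℂ} {x : Rn n} {M : ℝ≥0∞}
    (h : ∀ ρ : ℝ, 1 / 2 ≤ ρ → ρ ≤ 2 → ‖spConv b m lam f ρ x‖ₑ ≤ M) : sqFn b m lam f x ≤ 2 * M ^ 2 := by
  rw [sqFn]
  calc _ ≤ ∫⁻ ρ, (Icc (1 / 2 : ℝ) 2).indicator (fun _ => M ^ 2) ρ := by
        rw [← lintegral_indicator measurableSet_Ioi]
        refine lintegral_mono fun ρ => ?_
        by_cases hρ : 0 < ρ
        · rw [indicator_of_mem (by exact hρ)]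
          by_cases hρ' : 1 / 2 ≤ ρ ∧ ρ ≤ 2
          · rw [indicator_of_mem (by exact hρ')]
            exact pow_le_pow_left₀ zero_le (h ρ hρ'.1 hρ'.2) 2
          · rw [spConv_eq_zero hb m lam f hρ hρ']; simp
        · rw [indicator_of_notMem (by exact hρ)]; exact zero_le
    _ = M ^ 2 * ofReal (2 - 1 / 2) := by
        rw [lintegral_indicator measurableSet_Icc, setLIntegral_const, Real.volume_Icc]
    _ ≤ M ^ 2 * 2 := by
        gcongr
        rw [← ofReal_ofNat]
        exact ofReal_le_ofReal (by norm_num)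
    _ = _ := mul_comm _ _

theorem enorm_spConv_le (b m : 𝓢(Rn n, ℂ)) (lam : ℝ) (f : Rn n → ℂ) (ρ : ℝ) (x : Rn n) :
    ‖spConv b m lam f ρ x‖ₑ ≤ ∫⁻ y, ‖f y‖ₑ * ‖spKer b m lam ρ (x - y)‖ₑ :=
  (enorm_integral_le_lintegral_enorm _).trans (le_of_eq (lintegral_congr fun _ => enorm_mul _ _))

theorem exists_sqFn_bound (b m : 𝓢(Rn n, ℂ)) (hb : AnnulusSupported b)
    {lam : ℝ} (hl : 0 < lam) {f : Rn n → ℂ} (hf : Integrable f) :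
    ∃ M : ℝ≥0∞, M ≠ ∞ ∧ ∀ x, sqFn b m lam f x ≤ M := by
  obtain ⟨M, hM, h⟩ := exists_norm_spKer_le b m hl
  refine ⟨2 * ((∫⁻ y, ‖f y‖ₑ) * ofReal M) ^ 2, ?_, fun x => ?_⟩
  · exact mul_ne_top (by simp) (ENNReal.pow_ne_top (mul_ne_top hf.2.ne ofReal_ne_top))
  · refine sqFn_le_of_bound b m hb lam fun ρ h1 h2 => (enorm_spConv_le _ _ _ _ _ _).trans ?_
    rw [← lintegral_mul_const' _ _ ofReal_ne_top]
    refine lintegral_mono fun y => mul_le_mul' le_rfl ?_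
    rw [← ofReal_norm]
    exact ofReal_le_ofReal (h _ (by linarith) h2 _)

/-- The square function is dominated by the chirp convolution. -/
theorem sqFn_le_chirpConv (b m : 𝓢(Rn n, ℂ)) (hb : AnnulusSupported b)
    {lam : ℝ} (hl : 0 < lam) {f : Rn n → ℂ} (hf : Integrable f) (x : Rn n) :
    sqFn b m lam f x ≤ ∫⁻ r, ‖chirpConv b (fun ξ => m (lam⁻¹ • ξ) * 𝓕 f ξ) r x‖ₑ ^ 2 := by
  have hpi := pi_gt_three
  set q : ℝ → ℂ := fun ρ => spConv b m lam f ρ x with hq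
  have hG := continuous_lpConv m lam hf
  set h : Rn n → ℂ := fun t => b t * lpConv m lam f (x - t) with hh
  have hhi : Integrable h := by
    refine integrable_of_supp_ball (ρ := 2) (by fun_prop) fun t ht => (hb t ?_).2
    exact left_ne_zero_of_mul ht
  have hqe : ∀ ρ, q ρ = ((ρ ^ (n - 1) : ℝ) : ℂ) * ∫ ω, h (ρ • (ω : Rn n)) ∂(sph n) := fun ρ =>
    spConv_eq_sphere b m lam hf ρ x
  have hqi : IntegrableOn q (Ioi 0) := by
    have := integrableOn_polar hhi
    exact this.congr (.of_forall fun ρ => (hqe ρ).symm)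
  have hle : ∀ ρ ∈ Ioi (0 : ℝ), ‖q ρ‖ₑ ^ 2 * ofReal (1 / (2 * ρ)) ≤ ‖q ρ‖ₑ ^ 2 := by
    intro ρ hρ
    by_cases hρ' : 1 / 2 ≤ ρ ∧ ρ ≤ 2
    · refine mul_le_of_le_one_right' ?_
      rw [← ofReal_one]
      refine ofReal_le_ofReal ?_
      rw [div_le_one (by linarith [hρ'.1])]; linarith [hρ'.1]
    · rw [hq]; simp only; rw [spConv_eq_zero hb m lam f hρ hρ']; simp
  have hge : ∀ ρ ∈ Ioi (0 : ℝ), ofReal (1 / 4) * ‖q ρ‖ₑ ^ 2 ≤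
      ‖q ρ‖ₑ ^ 2 * ofReal (1 / (2 * ρ)) := by
    intro ρ hρ
    by_cases hρ' : 1 / 2 ≤ ρ ∧ ρ ≤ 2
    · rw [mul_comm]
      refine mul_le_mul' le_rfl (ofReal_le_ofReal ?_)
      refine one_div_le_one_div_of_le ?_ ?_ <;> linarith [hρ'.1, hρ'.2]
    · rw [hq]; simp only; rw [spConv_eq_zero hb m lam f hρ hρ']; simp
  have hfin : ∫⁻ ρ in Ioi (0 : ℝ), ‖q ρ‖ₑ ^ 2 * ofReal (1 / (2 * ρ)) ≠ ∞ := by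
    obtain ⟨M, hM, h⟩ := exists_sqFn_bound b m hb hl hf
    exact ne_top_of_le_ne_top hM ((setLIntegral_mono' measurableSet_Ioi hle).trans (h x))
  have key := lintegral_phase_sq_eq (γ := fun ρ => ρ ^ 2) (γ' := fun ρ => 2 * ρ)
    (fun ρ _ => by simpa using hasDerivAt_pow 2 ρ) (fun ρ hρ => by positivity) hqi hfin
  have hrad : ∀ u : ℝ, ∫ ρ in Ioi (0 : ℝ), exp (I * ((u * ρ ^ 2 : ℝ) : ℂ)) * q ρ =
      chirpConv b (fun ξ => m (lam⁻¹ • ξ) * 𝓕 f ξ) u x := by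
    intro u
    simp only [hqe]
    rw [← integral_radial_phase (γ := fun ρ => ρ ^ 2) (by fun_prop) hhi u]
    have hW : Integrable fun t => exp (I * ((u * ‖t‖ ^ 2 : ℝ) : ℂ)) * b t := by
      refine b.integrable.bdd_mul (c := 1) (by fun_prop) (.of_forall fun t => ?_)
      rw [norm_exp_I_mul_ofReal']
    have hfc : Continuous (𝓕 f) := continuous_fourier_of_integrable hf
    have hg : Integrable fun ξ => m (lam⁻¹ • ξ) * 𝓕 f ξ := by
      refine (integrable_symbol_mul m hl).mul_bdd (c := ∫ y, ‖f y‖) hfc.aestronglyMeasurable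
        (.of_forall fun ξ => ?_)
      exact VectorFourier.norm_fourierIntegral_le_integral_norm _ _ _ _ _
    have := conv_fourierInv hW hg x
    rw [chirpConv]
    have e2 : 𝓕⁻ (fun ξ => m (lam⁻¹ • ξ) * 𝓕 f ξ) = lpConv m lam f := by
      ext y; exact (lpConv_eq_fourierInv m hl hf y).symm
    rw [e2, fourierInv_eq'] at this
    rw [hh]
    simp only [mul_assoc] at this ⊢
    rw [this]
    refine integral_congr_ae (.of_forall fun ξ => ?_)
    simp only [chirpHat, smul_eq_mul]
    rw [real_inner_comm]
    rw [show ((2 * (π * inner ℝ x ξ) : ℝ) : ℂ) * I = 2 * (π * (I * (inner ℝ x ξ : ℝ))) by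
      push_cast; ring]
    ring
  simp only [hrad] at key
  rw [key]
  calc sqFn b m lam f x = 1 * ∫⁻ ρ in Ioi (0 : ℝ), ‖q ρ‖ₑ ^ 2 := by rw [one_mul]; rfl
    _ ≤ (ofReal (2 * π) * ofReal (1 / 4)) * ∫⁻ ρ in Ioi (0 : ℝ), ‖q ρ‖ₑ ^ 2 := by
        gcongr
        rw [← ofReal_mul (by positivity), ← ofReal_one]
        exact ofReal_le_ofReal (by linarith)
    _ = ofReal (2 * π) * ∫⁻ ρ in Ioi (0 : ℝ), ofReal (1 / 4) * ‖q ρ‖ₑ ^ 2 := by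
        rw [lintegral_ofReal_mul, mul_assoc]
    _ ≤ _ := mul_le_mul' le_rfl (setLIntegral_mono' measurableSet_Ioi hge)

theorem fourier_lpKer (m : 𝓢(Rn n, ℂ)) {lam : ℝ} (hl : 0 < lam) (ξ : Rn n) :
    𝓕 (lpKer m lam) ξ = m (lam⁻¹ • ξ) := by
  have hi := integrable_lpKer m hl
  have hs := integrable_symbol_mul m hl
  rw [lpKer_eq_fourierInv m hl] at hi ⊢
  have h2 : Integrable (𝓕 fun ξ => m (lam⁻¹ • ξ)) := by
    have := hi.comp_neg
    refine this.congr (.of_forall fun x => ?_)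
    simp only [Real.fourierInv_eq_fourier_neg, neg_neg]
  have hc : Continuous fun ξ => m (lam⁻¹ • ξ) := m.continuous.comp (by fun_prop)
  exact congrFun (hc.fourier_fourierInv_eq hs h2) ξ

theorem continuous_symbol_mul_fourier (m : 𝓢(Rn n, ℂ)) (lam : ℝ) {f : Rn n → ℂ} (hf : Integrable f) :
    Continuous fun ξ => m (lam⁻¹ • ξ) * 𝓕 f ξ :=
  (m.continuous.comp (by fun_prop)).mul (continuous_fourier_of_integrable hf)

theorem symbol_annulus {m : 𝓢(Rn n, ℂ)} (hm : AnnulusSupported m) {lam : ℝ}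
    (hl : 0 < lam) (F : Rn n → ℂ) (ξ : Rn n) (h : m (lam⁻¹ • ξ) * F ξ ≠ 0) :
    lam / 2 ≤ ‖ξ‖ ∧ ‖ξ‖ ≤ 2 * lam := by
  have := hm _ (left_ne_zero_of_mul h)
  rw [norm_smul, norm_inv, norm_of_nonneg hl.le, inv_mul_eq_div, le_div_iff₀ hl, div_le_iff₀ hl] at this
  exact ⟨by linarith [this.1], this.2⟩

/-- Single-scale weighted estimate for the square function. -/
theorem exists_lintegral_weight_sqFn_le (b m : 𝓢(Rn n, ℂ)) (hb : AnnulusSupported b)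
    (hm : AnnulusSupported m) (hm1 : ∀ ξ, ‖m ξ‖ ≤ 1) : ∃ C : ℝ, 0 < C ∧
    ∀ lam : ℝ, 1 / 2 ≤ lam → ∀ f : Rn n → ℂ, Integrable f → ∀ R : ℝ, 1 ≤ R →
    ∀ w : Rn n → ℝ≥0∞, Measurable w → (∀ x, w x ≤ 1) → ∫⁻ x, w x ≠ ∞ →
    ∫⁻ x, w x * sqFn b m lam f x ≤ ofReal (C * (lam ^ n)⁻¹) * (ofReal R +
        ofReal (√(R ^ (n - 1))⁻¹ * lam ^ n) * ∫⁻ x, w x) * ∫⁻ x, ‖f x‖ₑ ^ 2 := by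
  obtain ⟨C, hC, h⟩ := exists_chirpConv_weight_le b fun t ht => (hb t ht).2
  refine ⟨C, hC, fun lam hlam f hf R hR w hw hw1 hwi => ?_⟩
  have hl : 0 < lam := by linarith
  calc _ ≤ ∫⁻ x, w x * ∫⁻ r, ‖chirpConv b (fun ξ => m (lam⁻¹ • ξ) * 𝓕 f ξ) r x‖ₑ ^ 2 :=
        lintegral_mono fun x => mul_le_mul' le_rfl (sqFn_le_chirpConv b m hb hl hf x)
    _ ≤ _ := h lam hlam _ (continuous_symbol_mul_fourier m lam hf)
        (symbol_annulus hm hl _) R hR w hw hw1 hwi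
    _ ≤ _ := by
        refine mul_le_mul' le_rfl (le_trans (lintegral_mono fun ξ => ?_) (lintegral_fourier_sq_le hf))
        rw [enorm_mul]
        refine pow_le_pow_left₀ zero_le (mul_le_of_le_one_left' ?_) 2
        rw [← ofReal_norm, ← ofReal_one]
        exact ofReal_le_ofReal (hm1 _)

/-- Single-scale `L²` estimate for the square function. -/
theorem exists_lintegral_sqFn_le (b m : 𝓢(Rn n, ℂ)) (hb : AnnulusSupported b)
    (hm : AnnulusSupported m) : ∃ C : ℝ, 0 < C ∧
    ∀ lam : ℝ, 1 / 2 ≤ lam → ∀ f : Rn n → ℂ, Integrable f →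
    ∫⁻ x, sqFn b m lam f x ≤
      ofReal (C * (lam ^ (n - 1))⁻¹) * ∫⁻ ξ, ‖m (lam⁻¹ • ξ) * 𝓕 f ξ‖ₑ ^ 2 := by
  obtain ⟨C, hC, h⟩ := exists_chirpConv_le b fun t ht => (hb t ht).2
  refine ⟨C, hC, fun lam hlam f hf => ?_⟩
  have hl : 0 < lam := by linarith
  exact (lintegral_mono fun x => sqFn_le_chirpConv b m hb hl hf x).trans
    (h lam hlam _ (continuous_symbol_mul_fourier m lam hf) (symbol_annulus hm hl _))

theorem lpConv_lpKer {m m' : 𝓢(Rn n, ℂ)} (hmm : ∀ ξ, m ξ ≠ 0 → m' ξ = 1) {lam : ℝ} (hl : 0 < lam) :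
    lpConv m lam (lpKer m' lam) = lpKer m lam := by
  ext x
  rw [lpConv_eq_fourierInv m hl (integrable_lpKer m' hl), lpKer_eq_fourierInv m hl]
  refine congrArg (fun F : Rn n → ℂ => (𝓕⁻ F : Rn n → ℂ) x) (funext fun ξ => ?_)
  rw [fourier_lpKer m' hl]
  by_cases h : m (lam⁻¹ • ξ) = 0
  · rw [h, zero_mul]
  · rw [hmm _ h, mul_one]

theorem spKer_reproducing (b : 𝓢(Rn n, ℂ)) {m m' : 𝓢(Rn n, ℂ)} (hmm : ∀ ξ, m ξ ≠ 0 → m' ξ = 1)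
    {lam : ℝ} (hl : 0 < lam) (ρ : ℝ) (x : Rn n) :
    ∫ z, lpKer m' lam z * spKer b m lam ρ (x - z) = spKer b m lam ρ x := by
  have := spConv_eq_sphere b m lam (integrable_lpKer m' hl) ρ x
  rw [lpConv_lpKer hmm hl] at this
  exact this

theorem spConv_reproducing (b : 𝓢(Rn n, ℂ)) {m m' : 𝓢(Rn n, ℂ)} (hmm : ∀ ξ, m ξ ≠ 0 → m' ξ = 1)
    {lam : ℝ} (hl : 0 < lam) {f : Rn n → ℂ} (hf : Integrable f) {ρ : ℝ} (hρ : 0 < ρ) (hρ2 : ρ ≤ 2)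
    (x : Rn n) : ∫ z, lpKer m' lam z * spConv b m lam f ρ (x - z) = spConv b m lam f ρ x := by
  obtain ⟨M, hM, h⟩ := exists_norm_spKer_le b m hl
  have hk := continuous_spKer_right b m lam ρ
  have e : ∀ z, lpKer m' lam z * spConv b m lam f ρ (x - z) =
      ∫ y, lpKer m' lam z * (f y * spKer b m lam ρ (x - z - y)) := fun z => (integral_const_mul _ _).symm
  simp only [e]
  rw [integral_integral_swap]
  · rw [spConv]
    refine integral_congr_ae (.of_forall fun y => ?_)
    simp only
    rw [← spKer_reproducing b hmm hl, ← integral_const_mul]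
    refine integral_congr_ae (.of_forall fun z => ?_)
    simp only
    rw [sub_right_comm]; ring
  · have h1 := (integrable_lpKer m' hl).mul_prod hf
    refine (h1.bdd_mul (c := M) (f := fun q : Rn n × Rn n => spKer b m lam ρ (x - q.1 - q.2)) ?_
      (.of_forall fun q => h _ hρ hρ2 _)).congr (.of_forall fun q => ?_)
    · fun_prop
    · simp only [uncurry]; ring

theorem spConv_lpConv (b : 𝓢(Rn n, ℂ)) {m m' : 𝓢(Rn n, ℂ)} (hmm : ∀ ξ, m ξ ≠ 0 → m' ξ = 1)
    {lam : ℝ} (hl : 0 < lam) {f : Rn n → ℂ} (hf : Integrable f) {ρ : ℝ} (hρ : 0 < ρ) (hρ2 : ρ ≤ 2)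
    (x : Rn n) : spConv b m lam (lpConv m' lam f) ρ x = spConv b m lam f ρ x := by
  obtain ⟨M, hM, h⟩ := exists_norm_spKer_le b m hl
  have hk := continuous_spKer_right b m lam ρ
  rw [spConv]
  have e : ∀ y, lpConv m' lam f y * spKer b m lam ρ (x - y) =
      ∫ z, f z * lpKer m' lam (y - z) * spKer b m lam ρ (x - y) := fun y => (integral_mul_const _ _).symm
  simp only [e]
  rw [integral_integral_swap]
  · rw [spConv]
    refine integral_congr_ae (.of_forall fun z => ?_)
    simp only
    rw [← spKer_reproducing b hmm hl, ← integral_const_mul, ← integral_add_right_eq_self _ z]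
    refine integral_congr_ae (.of_forall fun y => ?_)
    simp only
    rw [add_sub_cancel_right, show x - (y + z) = x - z - y by abel]; ring
  · have h1 := (hf.convolution_integrand (ContinuousLinearMap.mul ℝ ℂ) (integrable_lpKer m' hl))
    simp only [ContinuousLinearMap.mul_apply'] at h1
    refine (h1.bdd_mul (c := M) (f := fun q : Rn n × Rn n => spKer b m lam ρ (x - q.1)) ?_
      (.of_forall fun q => h _ hρ hρ2 _)).congr (.of_forall fun q => ?_)
    · fun_prop
    · simp only [uncurry]; ring

theorem sqFn_lpConv (b : 𝓢(Rn n, ℂ)) (hb : AnnulusSupported b)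
    {m m' : 𝓢(Rn n, ℂ)} (hmm : ∀ ξ, m ξ ≠ 0 → m' ξ = 1)
    {lam : ℝ} (hl : 0 < lam) {f : Rn n → ℂ} (hf : Integrable f) :
    sqFn b m lam (lpConv m' lam f) = sqFn b m lam f := by
  ext x
  refine setLIntegral_congr_fun measurableSet_Ioi fun ρ (hρ : 0 < ρ) => ?_
  by_cases hρ' : 1 / 2 ≤ ρ ∧ ρ ≤ 2
  · rw [spConv_lpConv b hmm hl hf hρ hρ'.2]
  · rw [spConv_eq_zero hb m lam _ hρ hρ', spConv_eq_zero hb m lam _ hρ hρ']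

/-- Reproducing inequality for the square function. -/
theorem sqFn_le_reproducing (b : 𝓢(Rn n, ℂ)) (hb : AnnulusSupported b)
    {m m' : 𝓢(Rn n, ℂ)} (hmm : ∀ ξ, m ξ ≠ 0 → m' ξ = 1)
    {lam : ℝ} (hl : 0 < lam) {f : Rn n → ℂ} (hf : Integrable f) (x : Rn n) :
    sqFn b m lam f x ≤ (∫⁻ z, ‖lpKer m' lam z‖ₑ) *
      ∫⁻ z, ‖lpKer m' lam z‖ₑ * sqFn b m lam f (x - z) := by
  have hsm := (stronglyMeasurable_spConv b m lam hf).measurable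
  have hkm : Measurable fun z => ‖lpKer m' lam z‖ₑ := (continuous_lpKer m' lam).measurable.enorm
  have hm2 : Measurable fun q : ℝ × Rn n => ‖spConv b m lam f q.1 (x - q.2)‖ₑ := by
    have := hsm.comp (by fun_prop : Measurable fun q : ℝ × Rn n => (q.1, x - q.2))
    simp only [comp_def] at this
    exact this.enorm
  have hmain : ∀ ρ ∈ Ioi (0 : ℝ), ‖spConv b m lam f ρ x‖ₑ ^ 2 ≤
      (∫⁻ z, ‖lpKer m' lam z‖ₑ) * ∫⁻ z, ‖lpKer m' lam z‖ₑ * ‖spConv b m lam f ρ (x - z)‖ₑ ^ 2 := by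
    intro ρ hρ
    by_cases hρ' : 1 / 2 ≤ ρ ∧ ρ ≤ 2
    · refine le_trans ?_ (lintegral_mul_sq_le_weight hkm.aemeasurable ?_)
      · refine pow_le_pow_left₀ zero_le ?_ 2
        rw [← spConv_reproducing b hmm hl hf hρ hρ'.2]
        exact (enorm_integral_le_lintegral_enorm _).trans (le_of_eq (lintegral_congr fun _ => enorm_mul _ _))
      · have := hm2.comp (measurable_prodMk_left (x := ρ))
        simp only [comp_def] at this
        exact this.aemeasurable
    · rw [spConv_eq_zero hb m lam _ hρ hρ']; simp
  calc _ ≤ ∫⁻ ρ in Ioi (0 : ℝ), (∫⁻ z, ‖lpKer m' lam z‖ₑ) *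
        ∫⁻ z, ‖lpKer m' lam z‖ₑ * ‖spConv b m lam f ρ (x - z)‖ₑ ^ 2 :=
        setLIntegral_mono' measurableSet_Ioi hmain
    _ = (∫⁻ z, ‖lpKer m' lam z‖ₑ) * ∫⁻ ρ in Ioi (0 : ℝ),
        ∫⁻ z, ‖lpKer m' lam z‖ₑ * ‖spConv b m lam f ρ (x - z)‖ₑ ^ 2 :=
        lintegral_const_mul' _ _ (integrable_lpKer m' hl).2.ne
    _ = _ := by
        congr 1
        rw [lintegral_lintegral_swap]
        · refine lintegral_congr fun z => ?_
          rw [lintegral_const_mul' _ _ enorm_ne_top]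
          rfl
        · exact (Measurable.fun_mul (hkm.comp measurable_snd) (hm2.pow_const 2)).aemeasurable

end Chirp

/-- Bounded overlap of dyadic annuli. -/
theorem tsum_dyadic_le {F : ℤ → ℝ≥0∞} {a : ℝ} (h1 : ∀ s, F s ≤ 1)
    (h2 : ∀ s, F s ≠ 0 → 1 / 2 ≤ (2 : ℝ) ^ s * a ∧ (2 : ℝ) ^ s * a ≤ 2) : ∑' s, F s ≤ 4 := by
  by_cases ha : 0 < a
  · obtain ⟨k, hk1, hk2⟩ := exists_mem_Ico_zpow ha (by norm_num : (1 : ℝ) < 2)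
    have hsupp : ∀ s ∉ Finset.Icc (-k - 2) (-k + 1), F s = 0 := by
      intro s hs
      by_contra h0
      obtain ⟨h3, h4⟩ := h2 s h0
      refine hs (Finset.mem_Icc.2 ⟨?_, ?_⟩)
      · by_contra hlt
        push Not at hlt
        have : (2 : ℝ) ^ s * a < 2 ^ s * 2 ^ (k + 1) := by gcongr
        rw [← zpow_add₀ (by norm_num)] at this
        have h5 : (2 : ℝ) ^ (s + (k + 1)) ≤ 2 ^ (-2 : ℤ) := zpow_le_zpow_right₀ (by norm_num) (by omega)
        norm_num at h5
        linarith
      · by_contra hlt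
        push Not at hlt
        have : (2 : ℝ) ^ s * 2 ^ k ≤ 2 ^ s * a := by gcongr
        rw [← zpow_add₀ (by norm_num)] at this
        have h5 : (2 : ℝ) ^ (2 : ℤ) ≤ 2 ^ (s + k) := zpow_le_zpow_right₀ (by norm_num) (by omega)
        norm_num at h5
        linarith
    rw [tsum_eq_sum hsupp]
    calc _ ≤ ∑ s ∈ Finset.Icc (-k - 2) (-k + 1), (1 : ℝ≥0∞) := sum_le_sum fun s _ => h1 s
      _ = _ := by
        rw [Finset.sum_const, Int.card_Icc, show (-k + 1 + 1 - (-k - 2)).toNat = 4 by omega]; simp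
  · have : ∀ s, F s = 0 := fun s => by
      by_contra h0
      have h3 := (h2 s h0).1
      have : (2 : ℝ) ^ s * a ≤ 0 := mul_nonpos_of_nonneg_of_nonpos (by positivity) (not_lt.1 ha)
      linarith
    simp [this]

section SquareFn
variable {n : ℕ} [Fact (2 ≤ n)]

theorem lintegral_comp_smul_pos (F : Rn n → ℝ≥0∞) {c : ℝ} (hc : 0 < c) :
    ∫⁻ x, F (c • x) = ofReal ((c ^ n)⁻¹) * ∫⁻ x, F x := by
  rw [lintegral_comp_smul_eq _ F hc.ne', finrank_euclideanSpace_fin, abs_of_pos (by positivity)]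

theorem fourier_comp_smul (f : Rn n → ℂ) {c : ℝ} (hc : 0 < c) (ξ : Rn n) :
    𝓕 (fun y => f (c • y)) ξ = (((c ^ n)⁻¹ : ℝ) : ℂ) * 𝓕 f (c⁻¹ • ξ) := by
  rw [fourier_eq', fourier_eq']
  have h := Measure.integral_comp_smul (volume : Measure (Rn n))
    (fun v => exp (((-2 * π * inner ℝ v (c⁻¹ • ξ) : ℝ) : ℂ) * I) • f v) c
  rw [finrank_euclideanSpace_fin, abs_of_pos (by positivity)] at h
  rw [← real_smul, ← h]
  refine integral_congr_ae (.of_forall fun v => ?_)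
  simp only [inner_smul_left, inner_smul_right]
  congr 4
  simp only [conj_trivial]
  field_simp

/-- The square function at scale `2 ^ s`. -/
def sqS (b m : 𝓢(Rn n, ℂ)) (lam : ℝ) (s : ℤ) (f : Rn n → ℂ) (x : Rn n) : ℝ≥0∞ :=
  sqFn b m lam (fun y => f ((2 : ℝ) ^ s • y)) ((2 : ℝ) ^ (-s) • x)

theorem integrable_dil {f : Rn n → ℂ} (hf : Integrable f) (s : ℤ) :
    Integrable fun y => f ((2 : ℝ) ^ s • y) :=
  hf.comp_smul (by positivity)

theorem measurable_sqS (b m : 𝓢(Rn n, ℂ)) (lam : ℝ) (s : ℤ) {f : Rn n → ℂ} (hf : Integrable f) :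
    Measurable (sqS b m lam s f) :=
  (measurable_sqFn b m lam (integrable_dil hf s)).comp (by fun_prop)

theorem sqS_dil (b m : 𝓢(Rn n, ℂ)) (lam : ℝ) (s h : ℤ) (f : Rn n → ℂ) (x : Rn n) :
    sqS b m lam s f ((2 : ℝ) ^ h • x) = sqS b m lam (s - h) (fun y => f ((2 : ℝ) ^ h • y)) x := by
  simp only [sqS, smul_smul]
  rw [← zpow_add₀ (by norm_num), ← zpow_add₀ (by norm_num)]
  congr 2
  · ext y; congr 3; ring
  · congr 1; ring

theorem exists_sqS_bound (b m : 𝓢(Rn n, ℂ)) (hb : AnnulusSupported b)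
    {lam : ℝ} (hl : 0 < lam) (s : ℤ) {f : Rn n → ℂ} (hf : Integrable f) :
    ∃ M : ℝ≥0∞, M ≠ ∞ ∧ ∀ x, sqS b m lam s f x ≤ M := by
  obtain ⟨M, hM, h⟩ := exists_sqFn_bound b m hb hl (integrable_dil hf s)
  exact ⟨M, hM, fun x => h _⟩

/-- Multi-scale `L²` estimate. -/
theorem exists_tsum_lintegral_sqS_le (b m : 𝓢(Rn n, ℂ)) (hb : AnnulusSupported b)
    (hm : AnnulusSupported m) (hm1 : ∀ ξ, ‖m ξ‖ ≤ 1) : ∃ C : ℝ, 0 < C ∧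
    ∀ lam : ℝ, 1 / 2 ≤ lam → ∀ f : Rn n → ℂ, Integrable f →
    ∑' s : ℤ, ∫⁻ x, sqS b m lam s f x ≤ ofReal (C * (lam ^ (n - 1))⁻¹) * ∫⁻ x, ‖f x‖ₑ ^ 2 := by
  obtain ⟨C, hC, h⟩ := exists_lintegral_sqFn_le b m hb hm
  refine ⟨C * 4, by positivity, fun lam hlam f hf => ?_⟩
  have hfc := continuous_fourier_of_integrable hf
  have h1 : ∀ s : ℤ, ∫⁻ x, sqS b m lam s f x ≤ ofReal (C * (lam ^ (n - 1))⁻¹) *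
      ∫⁻ η, ‖m (lam⁻¹ • (2 : ℝ) ^ s • η)‖ₑ ^ 2 * ‖𝓕 f η‖ₑ ^ 2 := by
    intro s
    set c : ℝ := (2 : ℝ) ^ s with hc
    have hc0 : 0 < c := by positivity
    simp only [sqS, zpow_neg, ← hc]
    rw [lintegral_comp_smul_pos (sqFn b m lam fun y => f (c • y)) (inv_pos.2 hc0)]
    refine (mul_le_mul' le_rfl (h lam hlam _ (hf.comp_smul hc0.ne'))).trans (le_of_eq ?_)
    have e : ∀ ξ, ‖m (lam⁻¹ • ξ) * 𝓕 (fun y => f (c • y)) ξ‖ₑ ^ 2 = ofReal ((c ^ n)⁻¹ ^ 2) *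
          (fun η => ‖m (lam⁻¹ • c • η)‖ₑ ^ 2 * ‖𝓕 f η‖ₑ ^ 2) (c⁻¹ • ξ) := by
      intro ξ
      rw [fourier_comp_smul f hc0, enorm_mul, enorm_mul, ← ofReal_norm (((c ^ n)⁻¹ : ℝ) : ℂ),
        norm_real, norm_of_nonneg (by positivity), mul_pow, mul_pow,
        ofReal_pow (by positivity)]
      simp only
      rw [smul_inv_smul₀ hc0.ne']
      ring
    simp only [e]
    rw [lintegral_ofReal_mul,
      lintegral_comp_smul_pos (fun η => ‖m (lam⁻¹ • c • η)‖ₑ ^ 2 * ‖𝓕 f η‖ₑ ^ 2) (inv_pos.2 hc0)]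
    have e2 : ofReal ((c⁻¹ ^ n)⁻¹) * (ofReal ((c ^ n)⁻¹ ^ 2) * ofReal ((c⁻¹ ^ n)⁻¹)) = 1 := by
      rw [← ofReal_mul (by positivity), ← ofReal_mul (by positivity), ← ofReal_one]
      congr 1
      rw [inv_pow, inv_inv]; field_simp
    calc _ = (ofReal ((c⁻¹ ^ n)⁻¹) * (ofReal ((c ^ n)⁻¹ ^ 2) *
        ofReal ((c⁻¹ ^ n)⁻¹))) * (ofReal (C * (lam ^ (n - 1))⁻¹) *
          ∫⁻ η, ‖m (lam⁻¹ • c • η)‖ₑ ^ 2 * ‖𝓕 f η‖ₑ ^ 2) := by ring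
      _ = _ := by rw [e2, one_mul]
  calc _ ≤ ∑' s : ℤ, ofReal (C * (lam ^ (n - 1))⁻¹) *
        ∫⁻ η, ‖m (lam⁻¹ • (2 : ℝ) ^ s • η)‖ₑ ^ 2 * ‖𝓕 f η‖ₑ ^ 2 := tsum_le_tsum h1
    _ = ofReal (C * (lam ^ (n - 1))⁻¹) *
        ∫⁻ η, (∑' s : ℤ, ‖m (lam⁻¹ • (2 : ℝ) ^ s • η)‖ₑ ^ 2) * ‖𝓕 f η‖ₑ ^ 2 := by
        rw [tsum_mul_left, ← lintegral_tsum]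
        · simp only [tsum_mul_right]
        · intro s
          have h1 : Measurable fun η => ‖m (lam⁻¹ • (2 : ℝ) ^ s • η)‖ₑ :=
            (m.continuous.comp (by fun_prop)).measurable.enorm
          exact (Measurable.fun_mul (h1.pow_const 2) (hfc.measurable.enorm.pow_const 2)).aemeasurable
    _ ≤ ofReal (C * (lam ^ (n - 1))⁻¹) * ∫⁻ η, 4 * ‖𝓕 f η‖ₑ ^ 2 := by
        refine mul_le_mul' le_rfl (lintegral_mono fun η => mul_le_mul' ?_ le_rfl)
        refine tsum_dyadic_le (a := lam⁻¹ * ‖η‖) (fun s => ?_) fun s hs => ?_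
        · refine pow_le_one₀ zero_le ?_
          rw [← ofReal_norm, ← ofReal_one]
          exact ofReal_le_ofReal (hm1 _)
        · have : m (lam⁻¹ • (2 : ℝ) ^ s • η) ≠ 0 := fun h0 => hs (by simp [h0])
          have := hm _ this
          rw [norm_smul, norm_smul, norm_of_nonneg (by positivity), norm_of_nonneg (by positivity)] at this
          rwa [mul_left_comm]
    _ ≤ _ := by
        rw [lintegral_const_mul' _ _ (by simp), ← mul_assoc]
        refine mul_le_mul' (le_of_eq ?_) (lintegral_fourier_sq_le hf)
        rw [mul_right_comm C, ofReal_mul (p := C * (lam ^ (n - 1))⁻¹) (by positivity)]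
        simp

theorem lintegral_enorm_sq_le_of_ball {f : Rn n → ℂ} (hf : AEStronglyMeasurable f volume) {d : ℝ} {z : Rn n}
    (h0 : ∀ y, d < ‖y - z‖ → f y = 0) :
    (∫⁻ y, ‖f y‖ₑ) ^ 2 ≤ volume (closedBall (0 : Rn n) d) * ∫⁻ y, ‖f y‖ₑ ^ 2 := by
  have h := lintegral_mul_sq_le (μ := (volume : Measure (Rn n)))
    (f := (closedBall z d).indicator fun _ => 1) (g := fun y => ‖f y‖ₑ)
    ((measurable_const.indicator measurableSet_closedBall).aemeasurable) hf.enorm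
  have e1 : ∀ y, (closedBall z d).indicator (fun _ => (1 : ℝ≥0∞)) y * ‖f y‖ₑ = ‖f y‖ₑ := by
    intro y
    by_cases hy : y ∈ closedBall z d
    · simp [hy]
    · rw [h0 y (by simpa [dist_eq_norm] using hy)]; simp
  have e2 : ∀ y, (closedBall z d).indicator (fun _ => (1 : ℝ≥0∞)) y ^ 2 =
      (closedBall z d).indicator (fun _ => 1) y := by
    intro y
    by_cases hy : y ∈ closedBall z d <;> simp [hy]
  simp only [e1, e2] at h
  rwa [lintegral_indicator_const measurableSet_closedBall, one_mul, Measure.addHaar_closedBall_center] at h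

theorem exists_sqS_far_le (b m : 𝓢(Rn n, ℂ)) (hb : AnnulusSupported b)
    {d : ℝ} (hd : 0 ≤ d) (L : ℕ) : ∃ C : ℝ, 0 < C ∧ ∀ lam : ℝ, 1 / 2 ≤ lam → ∀ s : ℤ, s ≤ 0 →
    ∀ f : Rn n → ℂ, AEStronglyMeasurable f volume → ∀ z : Rn n, (∀ y, d < ‖y - z‖ → f y = 0) →
    ∀ x, 2 * d + 4 ≤ ‖x - z‖ → sqS b m lam s f x ≤
      ofReal (C * (2 : ℝ) ^ s * (lam ^ n)⁻¹ * ((1 + ‖x - z‖) ^ L)⁻¹) * ∫⁻ y, ‖f y‖ₑ ^ 2 := by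
  set L' := 2 * n + L + 1 with hL'
  obtain ⟨C, hC, h⟩ := exists_spKer_le b m L'
  set V := volume (closedBall (0 : Rn n) d) with hV
  have hVt : V ≠ ∞ := measure_closedBall_lt_top.ne
  refine ⟨2 * (C * 4 ^ L') ^ 2 * 2 ^ (n + 2 * L + 2) * (V.toReal + 1), by positivity,
    fun lam hlam s hs f hf z h0 x hx => ?_⟩
  have hl : 0 < lam := by linarith
  set σ : ℝ := (2 : ℝ) ^ s with hσ
  have hσ0 : 0 < σ := by positivity
  have hσ1 : σ ≤ 1 := by
    rw [hσ]; exact zpow_le_one_of_nonpos₀ (by norm_num) hs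
  set X := 1 + ‖x - z‖ with hX
  have hX1 : 1 ≤ X := by rw [hX]; linarith [norm_nonneg (x - z)]
  set M : ℝ := C * lam ^ n * (4 * σ / (lam * X)) ^ L' with hM
  have hker : ∀ ρ : ℝ, 1 / 2 ≤ ρ → ρ ≤ 2 → ∀ y, ‖f (σ • y)‖ₑ * ‖spKer b m lam ρ (σ⁻¹ • x - y)‖ₑ ≤
      ‖f (σ • y)‖ₑ * ofReal M := by
    intro ρ hρ hρ2 y
    by_cases hy : d < ‖σ • y - z‖
    · simp [h0 _ hy]
    push Not at hy
    refine mul_le_mul' le_rfl ?_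
    rw [← ofReal_norm]
    refine ofReal_le_ofReal ((h lam hl ρ (by linarith) hρ2 _).trans ?_)
    rw [hM]
    refine mul_le_mul_of_nonneg_left ?_ (by positivity)
    rw [← inv_pow]
    refine pow_le_pow_left₀ (by positivity) ?_ _
    rw [inv_le_comm₀ (by positivity) (by positivity), inv_div]
    have e1 : σ⁻¹ • x - y = σ⁻¹ • (x - σ • y) := by rw [smul_sub, inv_smul_smul₀ hσ0.ne']
    have e2 : ‖x - z‖ - d ≤ ‖x - σ • y‖ := by
      have := norm_sub_le_norm_sub_add_norm_sub x (σ • y) z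
      linarith
    have e3 : X / (4 * σ) ≤ ‖σ⁻¹ • x - y‖ - 2 := by
      rw [e1, norm_smul, norm_inv, norm_of_nonneg hσ0.le]
      have : X / (4 * σ) = σ⁻¹ * (X / 4) := by field_simp
      rw [this]
      have h5 : (2 : ℝ) ≤ σ⁻¹ * 2 := by
        have := one_le_inv₀ hσ0 |>.2 hσ1
        linarith
      have h6 : σ⁻¹ * (X / 4 + 2) ≤ σ⁻¹ * ‖x - σ • y‖ := by
        refine mul_le_mul_of_nonneg_left ?_ (by positivity)
        rw [hX]; linarith
      linarith
    calc lam * X / (4 * σ) = lam * (X / (4 * σ)) := by ring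
      _ ≤ lam * max 0 (‖σ⁻¹ • x - y‖ - 2) :=
        mul_le_mul_of_nonneg_left (e3.trans (le_max_right _ _)) hl.le
      _ ≤ _ := by linarith
  have hsq : sqS b m lam s f x ≤ 2 * (ofReal ((σ ^ n)⁻¹ * M) * ∫⁻ y, ‖f y‖ₑ) ^ 2 := by
    rw [sqS, zpow_neg, ← hσ]
    refine sqFn_le_of_bound b m hb lam fun ρ hρ hρ2 => (enorm_spConv_le _ _ _ _ _ _).trans ?_
    refine (lintegral_mono (hker ρ hρ hρ2)).trans (le_of_eq ?_)
    rw [lintegral_mul_const' _ _ ofReal_ne_top, lintegral_comp_smul_pos (fun y => ‖f y‖ₑ) hσ0,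
      ofReal_mul (q := M) (by positivity)]
    exact mul_right_comm _ _ _
  refine hsq.trans ?_
  rw [mul_pow]
  refine (mul_le_mul' le_rfl (mul_le_mul' le_rfl (lintegral_enorm_sq_le_of_ball hf h0))).trans ?_
  rw [← hV, ← ofReal_toReal hVt, ← ofReal_pow (by positivity), ← mul_assoc, ← mul_assoc]
  refine mul_le_mul' ?_ le_rfl
  rw [show (2 : ℝ≥0∞) = ofReal 2 by simp, ← ofReal_mul (by norm_num),
    ← ofReal_mul (by positivity)]
  refine ofReal_le_ofReal ?_
  rw [toReal_ofReal toReal_nonneg]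
  have key : ((σ ^ n)⁻¹ * M) ^ 2 ≤ (C * 4 ^ L') ^ 2 * 2 ^ (n + 2 * L + 2) * σ * (lam ^ n)⁻¹ * (X ^ L)⁻¹ := by
    have e : ((σ ^ n)⁻¹ * M) ^ 2 = (C * 4 ^ L') ^ 2 * (σ ^ (2 * L + 2 * n + 2)) * ((lam⁻¹) ^ (n + 2 * L + 2) * (lam ^ n)⁻¹)
        * (X ^ (2 * L'))⁻¹ := by
      rw [hM, hL', div_pow, mul_pow, mul_pow]
      simp only [inv_pow]
      field_simp
      ring
    rw [e]
    have hli : lam⁻¹ ≤ 2 := by rw [inv_le_comm₀ hl (by norm_num)]; linarith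
    have h1 : σ ^ (2 * L + 2 * n + 2) ≤ σ := by
      have := pow_le_pow_of_le_one hσ0.le hσ1 (show 1 ≤ 2 * L + 2 * n + 2 by omega)
      simpa using this
    have h3 : (X ^ (2 * L'))⁻¹ ≤ (X ^ L)⁻¹ := by
      apply inv_anti₀ (by positivity)
      exact pow_le_pow_right₀ hX1 (by omega)
    calc _ ≤ (C * 4 ^ L') ^ 2 * σ * (2 ^ (n + 2 * L + 2) * (lam ^ n)⁻¹) * (X ^ L)⁻¹ := by gcongr
      _ = _ := by ring
  calc _ ≤ 2 * ((C * 4 ^ L') ^ 2 * 2 ^ (n + 2 * L + 2) * σ * (lam ^ n)⁻¹ * (X ^ L)⁻¹) * (V.toReal + 1) := by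
        gcongr; linarith
    _ = _ := by ring

end SquareFn

section Cubes
variable {n : ℕ}

/-- The unit cube with lower corner `z`. -/
def cube (z : Fin n → ℤ) : Set (Rn n) := {y | ∀ i, ⌊y i⌋ = z i}

/-- The lower corner of a unit cube. -/
def cubePt (z : Fin n → ℤ) : Rn n := WithLp.toLp 2 fun i => (z i : ℝ)

theorem measurableSet_cube (z : Fin n → ℤ) : MeasurableSet (cube z) := by
  have : cube z = ⋂ i, {y : Rn n | ⌊y i⌋ = z i} := by ext; simp [cube]
  rw [this]
  refine MeasurableSet.iInter fun i => ?_
  have h : Measurable fun y : Rn n => ⌊y i⌋ := Int.measurable_floor.comp (by fun_prop)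
  exact h (measurableSet_singleton (z i))

theorem pairwise_disjoint_cube : Pairwise (Function.onFun Disjoint (cube (n := n))) := by
  intro z w hzw
  refine Set.disjoint_left.2 fun y hy hy' => hzw (funext fun i => ?_)
  rw [← hy i, ← hy' i]

theorem iUnion_cube : ⋃ z, cube (n := n) z = univ :=
  eq_univ_of_forall fun y => mem_iUnion.2 ⟨fun i => ⌊y i⌋, fun _ => rfl⟩

theorem norm_sub_cubePt_le {z : Fin n → ℤ} {y : Rn n} (hy : y ∈ cube z) : ‖y - cubePt z‖ ≤ √n := by
  rw [EuclideanSpace.norm_eq]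
  refine Real.sqrt_le_sqrt ?_
  calc ∑ i, ‖(y - cubePt z) i‖ ^ 2 ≤ ∑ _i : Fin n, (1 : ℝ) := by
        refine sum_le_sum fun i _ => ?_
        have e : (y - cubePt z) i = Int.fract (y i) := by
          rw [← Int.self_sub_floor, hy i]; rfl
        rw [e, norm_of_nonneg (Int.fract_nonneg _)]
        exact pow_le_one₀ (Int.fract_nonneg _) (Int.fract_lt_one _).le
    _ = n := by simp

theorem volume_cube (z : Fin n → ℤ) : volume (cube z) = 1 := by
  have h := (EuclideanSpace.volume_preserving_symm_measurableEquiv_toLp (Fin n)).symm.measure_preimage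
    (measurableSet_cube z).nullMeasurableSet
  have e : (⇑(MeasurableEquiv.toLp 2 (Fin n → ℝ)).symm.symm ⁻¹' cube z) =
      Set.pi univ fun i => Ico (z i : ℝ) (z i + 1) := by
    ext y
    simp [cube, Int.floor_eq_iff, Set.mem_pi]
  rw [e, Real.volume_pi_Ico] at h
  rw [← h]
  simp

theorem lintegral_eq_tsum_cube (g : Rn n → ℝ≥0∞) : ∫⁻ x, g x = ∑' z, ∫⁻ x in cube z, g x := by
  rw [← lintegral_iUnion measurableSet_cube pairwise_disjoint_cube, iUnion_cube, Measure.restrict_univ]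

theorem lintegral_enorm_indicator_cube_sq (f : Rn n → ℂ) (z : Fin n → ℤ) :
    ∫⁻ y, ‖(cube z).indicator f y‖ₑ ^ 2 = ∫⁻ y in cube z, ‖f y‖ₑ ^ 2 := by
  rw [← lintegral_indicator (measurableSet_cube z)]
  refine lintegral_congr fun y => ?_
  by_cases hy : y ∈ cube z <;> simp [hy]

theorem one_add_norm_sub_le (x y z : Rn n) : 1 + ‖x - z‖ ≤ (1 + ‖x - y‖) * (1 + ‖y - z‖) := by
  have := norm_sub_le_norm_sub_add_norm_sub x y z
  nlinarith [mul_nonneg (norm_nonneg (x - y)) (norm_nonneg (y - z))]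

theorem exists_tsum_cube_weight_le : ∃ C : ℝ, 0 < C ∧ ∀ x : Rn n,
    ∑' z, ofReal ((1 + ‖x - cubePt z‖) ^ (n + 1))⁻¹ ≤ ofReal C := by
  have hI := integrable_inv_one_add_pow (volume : Measure (Rn n)) (L := n + 1) (by simp)
  set I := ∫⁻ x : Rn n, ofReal ((1 + ‖x‖) ^ (n + 1))⁻¹ with hIdef
  have hIt : I ≠ ∞ := by
    refine ne_top_of_le_ne_top hI.2.ne (lintegral_mono fun x => ?_)
    rw [← ofReal_norm, norm_of_nonneg (by positivity)]
  set A : ℝ := (1 + √n) ^ (n + 1) with hA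
  have hA0 : 0 < A := by positivity
  refine ⟨A * (I.toReal + 1), by positivity, fun x => ?_⟩
  calc _ ≤ ∑' z, ∫⁻ y in cube z, ofReal A * ofReal ((1 + ‖x - y‖) ^ (n + 1))⁻¹ := by
        refine tsum_le_tsum fun z => ?_
        calc _ = ∫⁻ _y in cube z, ofReal ((1 + ‖x - cubePt z‖) ^ (n + 1))⁻¹ := by
              simp [volume_cube]
          _ ≤ _ := by
              refine setLIntegral_mono' (measurableSet_cube z) fun y hy => ?_
              rw [← ofReal_mul hA0.le]
              refine ofReal_le_ofReal ?_
              rw [← div_eq_mul_inv, inv_le_comm₀ (by positivity) (by positivity), inv_div, div_le_iff₀ hA0, hA,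
                ← mul_pow]
              refine pow_le_pow_left₀ (by positivity) ?_ _
              refine (one_add_norm_sub_le x (cubePt z) y).trans ?_
              gcongr
              rw [norm_sub_rev]
              exact norm_sub_cubePt_le hy
    _ = ofReal A * I := by
        rw [← lintegral_eq_tsum_cube, lintegral_ofReal_mul, hIdef,
          lintegral_sub_left_eq_self (fun y : Rn n => ofReal ((1 + ‖y‖) ^ (n + 1))⁻¹) x]
    _ ≤ _ := by
        rw [ofReal_mul hA0.le]
        refine mul_le_mul' le_rfl ?_
        rw [← ofReal_toReal hIt]
        refine ofReal_le_ofReal ?_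
        rw [toReal_ofReal toReal_nonneg]; linarith

/-- Weighted Cauchy–Schwarz for the sum over cubes. -/
theorem exists_sq_tsum_cube_le : ∃ C : ℝ, 0 < C ∧ ∀ (x : Rn n) (c : (Fin n → ℤ) → ℝ≥0∞),
    (∑' z, c z) ^ 2 ≤ ofReal C * ∑' z, ofReal ((1 + ‖x - cubePt z‖) ^ (n + 1)) * c z ^ 2 := by
  obtain ⟨C, hC, h⟩ := exists_tsum_cube_weight_le (n := n)
  refine ⟨C, hC, fun x c => ?_⟩
  set w : (Fin n → ℤ) → ℝ := fun z => (1 + ‖x - cubePt z‖) ^ (n + 1) with hw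
  have hw0 : ∀ z, 0 < w z := fun z => by simp only [hw]; positivity
  have h1 := lintegral_mul_sq_le_weight (μ := (Measure.count : Measure (Fin n → ℤ)))
    (f := fun z => ofReal (w z)⁻¹) (g := fun z => ofReal (w z) * c z)
    (Measurable.of_discrete).aemeasurable (Measurable.of_discrete).aemeasurable
  simp only [lintegral_count, ← mul_assoc, mul_pow] at h1
  have e : ∀ z, ofReal (w z)⁻¹ * ofReal (w z) = 1 := fun z => by
    rw [← ofReal_mul (inv_pos.2 (hw0 z)).le, inv_mul_cancel₀ (hw0 z).ne', ofReal_one]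
  have e' : ∀ z, ofReal (w z)⁻¹ * ofReal (w z) ^ 2 = ofReal (w z) := fun z => by
    rw [sq, ← mul_assoc, e, one_mul]
  simp only [e, e', one_mul] at h1
  exact h1.trans (mul_le_mul' (h x) le_rfl)

variable [Fact (2 ≤ n)]

theorem enorm_spConv_le_tsum_cube (b m : 𝓢(Rn n, ℂ)) (hb : AnnulusSupported b) {lam : ℝ} (hl : 0 < lam) (s : ℤ) {f : Rn n → ℂ}
    (hf : Integrable f) {ρ : ℝ} (hρ : 0 < ρ) (x : Rn n) : ‖spConv b m lam (fun y => f ((2 : ℝ) ^ s • y)) ρ x‖ₑ ≤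
      ∑' z, ‖spConv b m lam (fun y => (cube z).indicator f ((2 : ℝ) ^ s • y)) ρ x‖ₑ := by
  by_cases hρ2 : ρ ≤ 2
  swap
  · rw [spConv_eq_zero hb m lam _ hρ (fun h => hρ2 h.2)]; simp
  set A : (Fin n → ℤ) → Set (Rn n) := fun z => (fun y => (2 : ℝ) ^ s • y) ⁻¹' cube z with hA
  have hAm : ∀ z, MeasurableSet (A z) := fun z => (measurable_const_smul _) (measurableSet_cube z)
  have hAd : Pairwise (Function.onFun Disjoint A) := fun z w h =>
    (pairwise_disjoint_cube h).preimage _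
  have hAu : ⋃ z, A z = univ := by rw [hA, ← preimage_iUnion, iUnion_cube, preimage_univ]
  obtain ⟨M, hM, hMb⟩ := exists_norm_spKer_le b m hl
  have hint : Integrable (fun y => f ((2 : ℝ) ^ s • y) * spKer b m lam ρ (x - y)) :=
    (integrable_dil hf s).mul_bdd (c := M)
      (((continuous_spKer_right b m lam ρ).comp (by fun_prop)).aestronglyMeasurable) (.of_forall fun y => hMb ρ hρ hρ2 _)
  have h := hasSum_integral_iUnion hAm hAd (hint.integrableOn (s := ⋃ z, A z))
  rw [hAu, Measure.restrict_univ] at h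
  have e : ∀ z, ∫ y in A z, f ((2 : ℝ) ^ s • y) * spKer b m lam ρ (x - y) =
      spConv b m lam (fun y => (cube z).indicator f ((2 : ℝ) ^ s • y)) ρ x := by
    intro z
    rw [← integral_indicator (hAm z), spConv]
    refine integral_congr_ae (.of_forall fun y => ?_)
    by_cases hy : (2 : ℝ) ^ s • y ∈ cube z <;> simp [indicator, hA, hy]
  simp only [e] at h
  rw [spConv, ← h.tsum_eq]
  exact enorm_tsum_le_tsum_enorm

theorem exists_sqS_le_tsum_cube (b m : 𝓢(Rn n, ℂ)) (hb : AnnulusSupported b) : ∃ C : ℝ, 0 < C ∧ ∀ lam : ℝ, 0 < lam →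
    ∀ s : ℤ, ∀ f : Rn n → ℂ, Integrable f → ∀ x, sqS b m lam s f x ≤ ofReal C *
      ∑' z, ofReal ((1 + ‖x - cubePt z‖) ^ (n + 1)) * sqS b m lam s ((cube z).indicator f) x := by
  obtain ⟨C, hC, h⟩ := exists_sq_tsum_cube_le (n := n)
  refine ⟨C, hC, fun lam hl s f hf x => ?_⟩
  simp only [sqS, sqFn]
  have hm : ∀ z, Measurable fun ρ => ‖spConv b m lam (fun y => (cube z).indicator f ((2 : ℝ) ^ s • y)) ρ
      ((2 : ℝ) ^ (-s) • x)‖ₑ ^ 2 := fun z => by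
    have h0 := (stronglyMeasurable_spConv b m lam
      (integrable_dil (hf.indicator (measurableSet_cube z)) s)).measurable.enorm.pow_const 2
    have h1 := h0.comp (by fun_prop : Measurable fun ρ : ℝ => (ρ, (2 : ℝ) ^ (-s) • x))
    simp only [comp_def] at h1
    exact h1
  calc _ ≤ ∫⁻ ρ in Ioi (0 : ℝ), ofReal C * ∑' z, ofReal ((1 + ‖x - cubePt z‖) ^ (n + 1)) *
        ‖spConv b m lam (fun y => (cube z).indicator f ((2 : ℝ) ^ s • y)) ρ ((2 : ℝ) ^ (-s) • x)‖ₑ ^ 2 :=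
        setLIntegral_mono' measurableSet_Ioi fun ρ hρ => (pow_le_pow_left₀ zero_le
          (enorm_spConv_le_tsum_cube b m hb hl s hf hρ _) 2).trans (h x _)
    _ = _ := by
        rw [lintegral_ofReal_mul, lintegral_tsum fun z => ((hm z).const_mul _).aemeasurable]
        simp only [lintegral_ofReal_mul]

theorem lintegral_inv_one_add_norm_ne_top :
    ∫⁻ x : Rn n, ofReal ((1 + ‖x‖) ^ (n + 1))⁻¹ ≠ ∞ := by
  have hI := integrable_inv_one_add_pow (volume : Measure (Rn n)) (L := n + 1) (by simp)
  refine ne_top_of_le_ne_top hI.2.ne (lintegral_mono fun x => ?_)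
  rw [← ofReal_norm, norm_of_nonneg (by positivity)]

/-- Localised functions have square functions that decay away from the support. -/
theorem exists_weight_sqS_le (b m : 𝓢(Rn n, ℂ)) (hb : AnnulusSupported b)
    {d : ℝ} (hd : 0 ≤ d) (e : ℕ) : ∃ C : ℝ, 0 < C ∧ ∀ lam : ℝ, 1 / 2 ≤ lam → ∀ s : ℤ, s ≤ 0 →
    ∀ f : Rn n → ℂ, AEStronglyMeasurable f volume → ∀ z : Rn n, (∀ y, d < ‖y - z‖ → f y = 0) →
    ∀ x, ofReal ((1 + ‖x - z‖) ^ e) * sqS b m lam s f x ≤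
      ofReal C * (sqS b m lam s f x + ofReal ((2 : ℝ) ^ s * (lam ^ n)⁻¹) *
        ofReal ((1 + ‖x - z‖) ^ (n + 1))⁻¹ * ∫⁻ y, ‖f y‖ₑ ^ 2) := by
  obtain ⟨C, hC, h⟩ := exists_sqS_far_le b m hb hd (e + (n + 1))
  refine ⟨C + (2 * d + 5) ^ e, by positivity, fun lam hlam s hs f hf z h0 x => ?_⟩
  rcases le_or_gt (2 * d + 4) ‖x - z‖ with hx | hx
  · refine (mul_le_mul' le_rfl (h lam hlam s hs f hf z h0 x hx)).trans ?_
    rw [← mul_assoc, ← ofReal_mul (by positivity), mul_add]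
    refine le_add_left ?_
    rw [← ofReal_mul (p := _ * _) (by positivity), ← mul_assoc (ofReal (C + _))]
    refine mul_le_mul' ?_ le_rfl
    rw [← ofReal_mul (by positivity)]
    refine ofReal_le_ofReal ?_
    have e1 : (1 + ‖x - z‖) ^ e * (C * 2 ^ s * (lam ^ n)⁻¹ * ((1 + ‖x - z‖) ^ (e + (n + 1)))⁻¹) =
        C * (2 ^ s * (lam ^ n)⁻¹ * ((1 + ‖x - z‖) ^ (n + 1))⁻¹) := by
      rw [pow_add]; field_simp
    rw [e1]
    gcongr
    have : 0 ≤ (2 * d + 5) ^ e := by positivity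
    linarith
  · refine le_trans ?_ (mul_le_mul' le_rfl le_self_add)
    refine mul_le_mul' (ofReal_le_ofReal ?_) le_rfl
    calc (1 + ‖x - z‖) ^ e ≤ (2 * d + 5) ^ e := pow_le_pow_left₀ (by positivity) (by linarith) _
      _ ≤ _ := by linarith

theorem tsum_two_zpow_neg_nat : ∑' t : ℕ, ofReal ((2 : ℝ) ^ (-(t : ℤ))) = 2 := by
  have h : ∀ t : ℕ, ofReal ((2 : ℝ) ^ (-(t : ℤ))) = 2⁻¹ ^ t := fun t => by
    rw [zpow_neg, zpow_natCast, ENNReal.ofReal_inv_of_pos (by positivity), ofReal_pow (by norm_num),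
      ENNReal.inv_pow]
    simp
  simp only [h, ENNReal.tsum_geometric]
  norm_num

theorem exists_tsum_lintegral_weight_sqS_le (b m : 𝓢(Rn n, ℂ)) (hb : AnnulusSupported b)
    (hm : AnnulusSupported m) (hm1 : ∀ ξ, ‖m ξ‖ ≤ 1) {d : ℝ} (hd : 0 ≤ d) (e : ℕ) :
    ∃ C : ℝ, 0 < C ∧ ∀ lam : ℝ, 1 / 2 ≤ lam → ∀ f : Rn n → ℂ, Integrable f → ∀ z : Rn n,
    (∀ y, d < ‖y - z‖ → f y = 0) →
    ∑' t : ℕ, ∫⁻ x, ofReal ((1 + ‖x - z‖) ^ e) * sqS b m lam (-(t : ℤ)) f x ≤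
      ofReal (C * (lam ^ (n - 1))⁻¹) * ∫⁻ y, ‖f y‖ₑ ^ 2 := by
  obtain ⟨C1, hC1, h1⟩ := exists_weight_sqS_le b m hb hd e
  obtain ⟨C2, hC2, h2⟩ := exists_tsum_lintegral_sqS_le b m hb hm hm1
  set I := ∫⁻ x : Rn n, ofReal ((1 + ‖x‖) ^ (n + 1))⁻¹ with hI
  have hIt : I ≠ ∞ := lintegral_inv_one_add_norm_ne_top
  refine ⟨C1 * (C2 + 4 * (I.toReal + 1)), by positivity, fun lam hlam f hf z h0 => ?_⟩
  have hl : 0 < lam := by linarith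
  set Q := ∫⁻ y, ‖f y‖ₑ ^ 2 with hQ
  have hmeas := fun t : ℕ => measurable_sqS b m lam (-(t : ℤ)) hf
  calc _ ≤ ∑' t : ℕ, ∫⁻ x, ofReal C1 * (sqS b m lam (-(t : ℤ)) f x +
        ofReal ((2 : ℝ) ^ (-(t : ℤ)) * (lam ^ n)⁻¹) *
        ofReal ((1 + ‖x - z‖) ^ (n + 1))⁻¹ * Q) :=
        tsum_le_tsum fun t => lintegral_mono fun x => h1 lam hlam _ (by omega) f hf.1 z h0 x
    _ = ofReal C1 * ((∑' t : ℕ, ∫⁻ x, sqS b m lam (-(t : ℤ)) f x) +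
        2 * ofReal (lam ^ n)⁻¹ * I * Q) := by
        rw [show 2 * ofReal (lam ^ n)⁻¹ * I * Q =
          (∑' t : ℕ, ofReal ((2 : ℝ) ^ (-(t : ℤ)))) * (ofReal (lam ^ n)⁻¹ * I * Q) by
          rw [tsum_two_zpow_neg_nat]; ring, ← tsum_mul_right, ← ENNReal.tsum_add,
          ← tsum_mul_left]
        refine tsum_congr fun t => ?_
        rw [lintegral_ofReal_mul, lintegral_add_left (hmeas t)]
        rw [lintegral_mul_const _ (by fun_prop), lintegral_ofReal_mul,
          lintegral_sub_right_eq_self (fun y : Rn n => ofReal ((1 + ‖y‖) ^ (n + 1))⁻¹) z, ← hI,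
          ofReal_mul (by positivity)]
        ring
    _ ≤ ofReal C1 * (ofReal (C2 * (lam ^ (n - 1))⁻¹) * Q +
        ofReal (4 * (I.toReal + 1) * (lam ^ (n - 1))⁻¹) * Q) := by
        refine mul_le_mul' le_rfl (add_le_add ?_ (mul_le_mul' ?_ le_rfl))
        · refine le_trans ?_ (h2 lam hlam f hf)
          exact ENNReal.tsum_comp_le_tsum_of_injective (f := fun t : ℕ => -(t : ℤ))
            (fun a b h => by simpa using h) (fun s => ∫⁻ x, sqS b m lam s f x)
        · rw [← ofReal_toReal hIt, show (2 : ℝ≥0∞) = ofReal 2 by simp,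
            ← ofReal_mul (by norm_num), ← ofReal_mul (by positivity)]
          refine ofReal_le_ofReal ?_
          rw [toReal_ofReal toReal_nonneg]
          have h5 : (lam ^ n)⁻¹ ≤ 2 * (lam ^ (n - 1))⁻¹ := by
            have hn : n = n - 1 + 1 := by have := (Fact.out : 2 ≤ n); omega
            conv_lhs => rw [hn, pow_succ, mul_inv]
            have : lam⁻¹ ≤ 2 := by rw [inv_le_comm₀ hl (by norm_num)]; linarith
            rw [mul_comm]
            gcongr
          calc 2 * (lam ^ n)⁻¹ * I.toReal ≤ 2 * (2 * (lam ^ (n - 1))⁻¹) * (I.toReal + 1) := by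
                gcongr; linarith
            _ = _ := by ring
    _ = _ := by
        rw [← add_mul, ← mul_assoc, ← ofReal_add (by positivity) (by positivity),
          ← ofReal_mul hC1.le]
        congr 2; ring

/-- Multi-scale weighted `L²` bound with a slowly varying weight. -/
theorem exists_tsum_lintegral_slow_sqS_le (b m : 𝓢(Rn n, ℂ))
    (hb : AnnulusSupported b)
    (hm : AnnulusSupported m) (hm1 : ∀ ξ, ‖m ξ‖ ≤ 1) (e : ℕ) :
    ∃ C : ℝ, 0 < C ∧ ∀ lam : ℝ, 1 / 2 ≤ lam → ∀ h : ℤ, ∀ A : ℝ≥0∞, A ≠ ∞ → ∀ D : Rn n → ℝ≥0∞, Measurable D →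
    (∀ x y, D x ≤ A * ofReal ((1 + (2 : ℝ) ^ (-h) * ‖x - y‖) ^ e) * D y) →
    ∀ f : Rn n → ℂ, Integrable f →
    ∑' t : ℕ, ∫⁻ x, D x * sqS b m lam (h - t) f x ≤
      ofReal (C * (lam ^ (n - 1))⁻¹) * A ^ 2 * ∫⁻ y, D y * ‖f y‖ₑ ^ 2 := by
  obtain ⟨C1, hC1, h1⟩ := exists_sqS_le_tsum_cube b m hb
  obtain ⟨C2, hC2, h2⟩ := exists_tsum_lintegral_weight_sqS_le b m hb hm hm1 (Real.sqrt_nonneg n) (e + (n + 1))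
  refine ⟨C1 * C2 * (1 + √n) ^ e, by positivity, fun lam hlam => ?_⟩
  have hl : 0 < lam := by linarith
  have main : ∀ A : ℝ≥0∞, A ≠ ∞ → ∀ D : Rn n → ℝ≥0∞, Measurable D →
      (∀ x y, D x ≤ A * ofReal ((1 + ‖x - y‖) ^ e) * D y) → ∀ f : Rn n → ℂ, Integrable f →
      ∑' t : ℕ, ∫⁻ x, D x * sqS b m lam (-(t : ℤ)) f x ≤
      ofReal (C1 * C2 * (1 + √n) ^ e * (lam ^ (n - 1))⁻¹) * A ^ 2 * ∫⁻ y, D y * ‖f y‖ₑ ^ 2 := by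
    intro A hA D hD hDs f hf
    have hfz := fun z => hf.indicator (measurableSet_cube (n := n) z)
    calc _ ≤ ∑' t : ℕ, ∫⁻ x, ofReal C1 * ∑' z, (A * D (cubePt z)) *
          (ofReal ((1 + ‖x - cubePt z‖) ^ (e + (n + 1))) *
            sqS b m lam (-(t : ℤ)) ((cube z).indicator f) x) := by
          refine tsum_le_tsum fun t => lintegral_mono fun x => ?_
          refine (mul_le_mul' le_rfl (h1 lam hl _ f hf x)).trans ?_
          rw [mul_left_comm, ← tsum_mul_left]
          refine mul_le_mul' le_rfl (tsum_le_tsum fun z => ?_)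
          refine (mul_le_mul' (hDs x (cubePt z)) le_rfl).trans (le_of_eq ?_)
          rw [pow_add _ e (n + 1), ofReal_mul (by positivity)]
          ring
      _ = ofReal C1 * ∑' z, (A * D (cubePt z)) * ∑' t : ℕ, ∫⁻ x,
          (ofReal ((1 + ‖x - cubePt z‖) ^ (e + (n + 1))) *
            sqS b m lam (-(t : ℤ)) ((cube z).indicator f) x) := by
          simp only [← tsum_mul_left]
          rw [ENNReal.tsum_comm]
          refine tsum_congr fun t => ?_
          have hmz : ∀ z, Measurable fun x => ofReal ((1 + ‖x - cubePt z‖) ^ (e + (n + 1))) *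
            sqS b m lam (-(t : ℤ)) ((cube z).indicator f) x := fun z =>
            Measurable.fun_mul (by fun_prop) (measurable_sqS b m lam _ (hfz z))
          rw [lintegral_tsum fun z => (((hmz z).const_mul _).const_mul _).aemeasurable]
          refine tsum_congr fun z => ?_
          rw [lintegral_const_mul _ ((hmz z).const_mul _), lintegral_const_mul _ (hmz z)]
      _ ≤ ofReal C1 * ∑' z, (A * D (cubePt z)) * (ofReal (C2 * (lam ^ (n - 1))⁻¹) *
          ∫⁻ y in cube z, ‖f y‖ₑ ^ 2) := by
          refine mul_le_mul' le_rfl (tsum_le_tsum fun z => mul_le_mul' le_rfl ?_)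
          rw [← lintegral_enorm_indicator_cube_sq]
          refine h2 lam hlam _ (hfz z) _ fun y hy => indicator_of_notMem (fun hmem => ?_) _
          exact absurd (norm_sub_cubePt_le hmem) (by linarith)
      _ ≤ ofReal C1 * ∑' z, ofReal (C2 * (lam ^ (n - 1))⁻¹) * A ^ 2 *
          ofReal ((1 + √n) ^ e) * ∫⁻ y in cube z, D y * ‖f y‖ₑ ^ 2 := by
          refine mul_le_mul' le_rfl (tsum_le_tsum fun z => ?_)
          have h5 : D (cubePt z) * ∫⁻ y in cube z, ‖f y‖ₑ ^ 2 ≤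
              A * ofReal ((1 + √n) ^ e) * ∫⁻ y in cube z, D y * ‖f y‖ₑ ^ 2 := by
            rw [← lintegral_const_mul' _ _ (mul_ne_top hA ofReal_ne_top)]
            refine (lintegral_const_mul_le _ _).trans ?_
            refine setLIntegral_mono' (measurableSet_cube z) fun y hy => ?_
            rw [← mul_assoc]
            refine mul_le_mul' ((hDs _ y).trans ?_) le_rfl
            refine mul_le_mul' (mul_le_mul' le_rfl (ofReal_le_ofReal ?_)) le_rfl
            gcongr
            rw [norm_sub_rev]; exact norm_sub_cubePt_le hy
          calc _ = A * ofReal (C2 * (lam ^ (n - 1))⁻¹) *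
                (D (cubePt z) * ∫⁻ y in cube z, ‖f y‖ₑ ^ 2) := by ring
            _ ≤ _ := mul_le_mul' le_rfl h5
            _ = _ := by ring
      _ = _ := by
          rw [tsum_mul_left, ← lintegral_eq_tsum_cube, ← mul_assoc]
          congr 1
          rw [show C1 * C2 * (1 + √n) ^ e * (lam ^ (n - 1))⁻¹ = C1 * ((C2 * (lam ^ (n - 1))⁻¹) * (1 + √n) ^ e) by
            ring, ofReal_mul hC1.le, ofReal_mul (q := (1 + √n) ^ e) (by positivity)]
          ring
  intro h A hA D hD hDs f hf
  set c : ℝ := (2 : ℝ) ^ h with hc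
  have hc0 : 0 < c := by positivity
  have hsc : ∀ F : Rn n → ℝ≥0∞, ∫⁻ x, F x = ofReal (c ^ n) * ∫⁻ x, F (c • x) := by
    intro F
    rw [lintegral_comp_smul_pos F hc0, ← mul_assoc, ← ofReal_mul (by positivity),
      mul_inv_cancel₀ (by positivity), ofReal_one, one_mul]
  have h6 := main A hA (fun x => D (c • x)) (hD.comp (measurable_const_smul c)) (fun x y => by
    refine (hDs (c • x) (c • y)).trans (le_of_eq ?_)
    rw [← smul_sub, norm_smul, norm_of_nonneg hc0.le, ← mul_assoc, zpow_neg, ← hc,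
      inv_mul_cancel₀ hc0.ne', one_mul]) (fun y => f (c • y)) (hf.comp_smul hc0.ne')
  rw [hsc fun y => D y * ‖f y‖ₑ ^ 2]
  have e1 : ∀ t : ℕ, ∫⁻ x, D x * sqS b m lam (h - t) f x = ofReal (c ^ n) *
      ∫⁻ x, D (c • x) * sqS b m lam (-(t : ℤ)) (fun y => f (c • y)) x := fun t => by
    rw [hsc]
    simp only [hc, sqS_dil]
    rw [show h - (t : ℤ) - h = -(t : ℤ) by ring]
  simp only [e1]
  rw [tsum_mul_left]
  exact (mul_le_mul' le_rfl h6).trans (le_of_eq (by ring))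

end Cubes

section LayerCake

theorem lintegral_layer {q : ℝ} (hq : 0 < q) (T : ℝ≥0∞) :
    ∫⁻ α in Ioi (0 : ℝ), {α : ℝ | ofReal α < T}.indicator (fun α => ofReal (q * α ^ (q - 1))) α =
      T ^ q := by
  have hm : MeasurableSet {α : ℝ | ofReal α < T} :=
    measurableSet_lt (by fun_prop) measurable_const
  have hfin : ∀ t : ℝ, 0 ≤ t → ∫⁻ α in Ioo 0 t, ofReal (q * α ^ (q - 1)) = ofReal t ^ q := by
    intro t ht
    have hint : IntervalIntegrable (fun α : ℝ => q * α ^ (q - 1)) volume 0 t :=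
      (intervalIntegral.intervalIntegrable_rpow' (by linarith)).const_mul q
    rw [← Measure.restrict_congr_set Ioo_ae_eq_Ioc.symm, ← ofReal_integral_eq_lintegral_ofReal hint.1
      ((ae_restrict_iff' measurableSet_Ioc).2 (.of_forall fun α hα => by have := hα.1; positivity)),
      ← intervalIntegral.integral_of_le ht, intervalIntegral.integral_const_mul, integral_rpow (Or.inl (by linarith)),
      ofReal_rpow_of_nonneg ht hq.le]
    congr 1
    rw [sub_add_cancel, Real.zero_rpow hq.ne', sub_zero]
    field_simp
  rw [lintegral_indicator hm, Measure.restrict_restrict hm]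
  by_cases hT : T = ∞
  · subst hT
    rw [ENNReal.top_rpow_of_pos hq]
    refine eq_top_iff.2 (ENNReal.le_of_forall_nnreal_lt fun r _ => ?_)
    have h1 := hfin ((r : ℝ) ^ q⁻¹) (by positivity)
    rw [ofReal_rpow_of_nonneg (by positivity) hq.le, ← Real.rpow_mul r.coe_nonneg, inv_mul_cancel₀ hq.ne',
      Real.rpow_one, ENNReal.ofReal_coe_nnreal] at h1
    rw [← h1]
    exact lintegral_mono_set fun α hα => ⟨by simp, hα.1⟩
  · have e : {α : ℝ | ofReal α < T} ∩ Ioi 0 = Ioo 0 T.toReal := by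
      ext α
      simp only [mem_inter_iff, mem_ofPred_eq, mem_Ioi, mem_Ioo]
      constructor
      · rintro ⟨h1, h2⟩
        exact ⟨h2, (ENNReal.ofReal_lt_iff_lt_toReal h2.le hT).1 h1⟩
      · rintro ⟨h1, h2⟩
        exact ⟨(ENNReal.ofReal_lt_iff_lt_toReal h1.le hT).2 h2, h1⟩
    rw [e, hfin _ toReal_nonneg, ofReal_toReal hT]

variable {X Y : Type*} [MeasurableSpace X] [MeasurableSpace Y] {μ : Measure X} {ν : Measure Y}
  [SFinite μ] [SFinite ν]

theorem lintegral_rpow_eq_layer {q : ℝ} (hq : 0 < q) {T : X → ℝ≥0∞} (hT : Measurable T) :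
    ∫⁻ x, T x ^ q ∂μ = ∫⁻ α in Ioi (0 : ℝ), ofReal (q * α ^ (q - 1)) * μ {x | ofReal α < T x} := by
  simp only [← lintegral_layer hq]
  have hS : MeasurableSet {p : X × ℝ | ofReal p.2 < T p.1} := measurableSet_lt (by fun_prop) (by fun_prop)
  have e : ∀ (x : X) (α : ℝ), {α : ℝ | ofReal α < T x}.indicator (fun α => ofReal (q * α ^ (q - 1))) α =
      {p : X × ℝ | ofReal p.2 < T p.1}.indicator (fun p => ofReal (q * p.2 ^ (q - 1))) (x, α) := by
    intro x α; simp [indicator]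
  simp only [e]
  have hm : Measurable fun p : X × ℝ =>
      {p : X × ℝ | ofReal p.2 < T p.1}.indicator (fun p => ofReal (q * p.2 ^ (q - 1))) p :=
    Measurable.indicator (by fun_prop) hS
  rw [lintegral_lintegral_swap hm.aemeasurable]
  refine lintegral_congr fun α => ?_
  have e2 : ∀ x, {p : X × ℝ | ofReal p.2 < T p.1}.indicator (fun p => ofReal (q * p.2 ^ (q - 1))) (x, α) =
      {x | ofReal α < T x}.indicator (fun _ => ofReal (q * α ^ (q - 1))) x := by
    intro x; simp [indicator]
  simp only [e2]
  rw [lintegral_indicator_const (measurableSet_lt measurable_const hT)]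

/-- Weak-type bounds with truncated right-hand sides imply strong-type bounds. -/
theorem tsum_lintegral_rpow_le_of_weak {ι : Type*} [Countable ι] {q₀ q c : ℝ} (hq₀ : 0 < q₀) (hq : q₀ < q)
    (hc : 0 < c) {A : ℝ≥0∞} {T : ι → X → ℝ≥0∞} (hT : ∀ i, Measurable (T i)) {g : Y → ℝ≥0∞} (hg : Measurable g)
    (h : ∀ α : ℝ, 0 < α → ∑' i, μ {x | ofReal α < T i x} ≤
      A * ofReal (α ^ (-q₀)) * ∫⁻ y, {y | ofReal α < ofReal c * g y}.indicator (fun y => g y ^ q₀) y ∂ν) :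
    ∑' i, ∫⁻ x, T i x ^ q ∂μ ≤ A * ofReal (q / (q - q₀) * c ^ (q - q₀)) * ∫⁻ y, g y ^ q ∂ν := by
  have hq' : 0 < q - q₀ := by linarith
  have hq0 : 0 < q := by linarith
  have hS : MeasurableSet {p : ℝ × Y | ofReal p.1 < ofReal c * g p.2} :=
    measurableSet_lt (by fun_prop) (by fun_prop)
  have hmeas : Measurable fun p : ℝ × Y =>
      {p : ℝ × Y | ofReal p.1 < ofReal c * g p.2}.indicator (fun p => g p.2 ^ q₀) p :=
    Measurable.indicator (by fun_prop) hS
  have hmeas2 : ∀ α : ℝ, Measurable fun y =>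
      {y | ofReal α < ofReal c * g y}.indicator (fun y => g y ^ q₀) y := fun α =>
    Measurable.indicator (by fun_prop) (measurableSet_lt (by fun_prop) (by fun_prop))
  have hmm : ∀ i, Measurable fun α : ℝ => μ {x | ofReal α < T i x} := fun i => by
    refine Antitone.measurable fun a b hab => measure_mono fun x hx => ?_
    exact (ofReal_le_ofReal hab).trans_lt hx
  simp only [lintegral_rpow_eq_layer hq0 (hT _)]
  rw [← lintegral_tsum fun i => (Measurable.fun_mul (by fun_prop) (hmm i)).aemeasurable]
  simp only [tsum_mul_left]
  calc _ ≤ ∫⁻ α in Ioi (0 : ℝ), A * ofReal (q / (q - q₀)) * ∫⁻ y, ofReal ((q - q₀) * α ^ (q - q₀ - 1)) *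
        {y | ofReal α < ofReal c * g y}.indicator (fun y => g y ^ q₀) y ∂ν := by
        refine setLIntegral_mono' measurableSet_Ioi fun α hα => ?_
        have hα : 0 < α := hα
        refine (mul_le_mul' le_rfl (h α hα)).trans (le_of_eq ?_)
        rw [lintegral_const_mul _ (hmeas2 α)]
        have e : ofReal (q * α ^ (q - 1)) * ofReal (α ^ (-q₀)) =
            ofReal (q / (q - q₀)) * ofReal ((q - q₀) * α ^ (q - q₀ - 1)) := by
          rw [← ofReal_mul (by positivity), ← ofReal_mul (by positivity), mul_assoc,
            ← Real.rpow_add hα, show q - 1 + -q₀ = q - q₀ - 1 by ring]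
          congr 1; field_simp
        generalize lintegral ν _ = J
        calc _ = A * (ofReal (q * α ^ (q - 1)) * ofReal (α ^ (-q₀))) * J := by ring
          _ = _ := by rw [e]; ring
    _ = A * ofReal (q / (q - q₀)) * ∫⁻ y, g y ^ q₀ * (ofReal c * g y) ^ (q - q₀) ∂ν := by
        have hm3 : Measurable fun p : ℝ × Y => ofReal ((q - q₀) * p.1 ^ (q - q₀ - 1)) *
            {p : ℝ × Y | ofReal p.1 < ofReal c * g p.2}.indicator (fun p => g p.2 ^ q₀) p :=
          Measurable.fun_mul (by fun_prop) hmeas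
        have e : ∀ (α : ℝ) (y : Y), {y | ofReal α < ofReal c * g y}.indicator (fun y => g y ^ q₀) y =
          {p : ℝ × Y | ofReal p.1 < ofReal c * g p.2}.indicator (fun p => g p.2 ^ q₀) (α, y) := by
          intro α y; simp [indicator]
        simp only [e]
        rw [lintegral_const_mul _ (Measurable.lintegral_prod_right' hm3),
          lintegral_lintegral_swap hm3.aemeasurable]
        congr 1
        refine lintegral_congr fun y => ?_
        rw [← lintegral_layer hq' (ofReal c * g y), ← lintegral_const_mul]
        · refine lintegral_congr fun α => ?_
          simp only [indicator, mem_ofPred_eq]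
          split_ifs
          · rw [mul_comm]
          · simp
        · exact Measurable.indicator (by fun_prop) (measurableSet_lt (by fun_prop) measurable_const)
    _ = _ := by
        rw [ofReal_mul (by positivity), mul_assoc, mul_assoc, mul_assoc,
          ← lintegral_const_mul' _ (fun y => g y ^ q) ofReal_ne_top]
        congr 2
        refine lintegral_congr fun y => ?_
        rw [mul_rpow_of_nonneg _ _ hq'.le, ofReal_rpow_of_pos hc, mul_left_comm,
          ← rpow_add_of_nonneg _ _ hq₀.le hq'.le, add_sub_cancel]

/-- Weak-type bounds for a bounded function imply strong-type bounds. -/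
theorem lintegral_rpow_le_of_weak_of_le {q₀ q : ℝ} (hq₀ : 0 < q₀) (hq : q₀ < q) {A S : ℝ≥0∞} {T : X → ℝ≥0∞}
    (hT : Measurable T) (hS : ∀ x, T x ≤ S)
    (h : ∀ α : ℝ, 0 < α → μ {x | ofReal α < T x} ≤ A * ofReal (α ^ (-q₀))) :
    ∫⁻ x, T x ^ q ∂μ ≤ A * ofReal (q / (q - q₀)) * S ^ (q - q₀) := by
  have hq' : 0 < q - q₀ := by linarith
  have hq0 : 0 < q := by linarith
  rw [lintegral_rpow_eq_layer hq0 hT, ← lintegral_layer hq' S, ← lintegral_const_mul _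
    (Measurable.indicator (by fun_prop) (measurableSet_lt (by fun_prop) measurable_const))]
  refine setLIntegral_mono' measurableSet_Ioi fun α hα => ?_
  have hα : 0 < α := hα
  by_cases hS' : ofReal α < S
  · refine (mul_le_mul' le_rfl (h α hα)).trans (le_of_eq ?_)
    rw [indicator_of_mem (by exact hS')]
    have e : ofReal (q * α ^ (q - 1)) * ofReal (α ^ (-q₀)) =
        ofReal (q / (q - q₀)) * ofReal ((q - q₀) * α ^ (q - q₀ - 1)) := by
      rw [← ofReal_mul (by positivity), ← ofReal_mul (by positivity), mul_assoc,
        ← Real.rpow_add hα, show q - 1 + -q₀ = q - q₀ - 1 by ring]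
      congr 1; field_simp
    rw [mul_left_comm, e]; ring
  · have : {x | ofReal α < T x} = ∅ := by
      ext x
      simp only [mem_ofPred_eq, mem_empty_iff_false, iff_false, not_lt]
      exact (hS x).trans (not_lt.1 hS')
    rw [this]; simp

end LayerCake

section Averages
variable {n : ℕ} [Fact (2 ≤ n)]

/-- The `L¹`-normalised polynomially decaying kernel at scale `κ⁻¹`. -/
def om (L : ℕ) (κ : ℝ) (z : Rn n) : ℝ≥0∞ := ofReal (κ ^ n * ((1 + κ * ‖z‖) ^ L)⁻¹)

/-- Averaging against `om`. -/
def avg (L : ℕ) (κ : ℝ) (a : Rn n → ℝ≥0∞) (x : Rn n) : ℝ≥0∞ := ∫⁻ z, om L κ z * a (x - z)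

/-- The mass of `om`. -/
def omI (n L : ℕ) : ℝ≥0∞ := ∫⁻ z : Rn n, ofReal ((1 + ‖z‖) ^ L)⁻¹

theorem measurable_om (L : ℕ) (κ : ℝ) : Measurable (om (n := n) L κ) := by unfold om; fun_prop

theorem omI_ne_top {L : ℕ} (hL : n + 1 ≤ L) : omI n L ≠ ∞ := by
  refine ne_top_of_le_ne_top (lintegral_inv_one_add_norm_ne_top (n := n)) (lintegral_mono fun x => ?_)
  refine ofReal_le_ofReal (inv_anti₀ (by positivity) (pow_le_pow_right₀ ?_ hL))
  linarith [norm_nonneg x]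

theorem omI_ne_zero (L : ℕ) : omI n L ≠ 0 := by
  intro h
  rw [omI, lintegral_eq_zero_iff (by fun_prop)] at h
  obtain ⟨x, hx⟩ := h.exists
  simp only [Pi.zero_apply, ENNReal.ofReal_eq_zero] at hx
  have : 0 < ((1 + ‖x‖) ^ L)⁻¹ := by positivity
  linarith

theorem om_scale (L : ℕ) (κ : ℝ) {c : ℝ} (hc : 0 < c) (z : Rn n) :
    ofReal (c ^ n) * om L κ (c • z) = om L (κ * c) z := by
  rw [om, om, ← ofReal_mul (by positivity), norm_smul, norm_of_nonneg hc.le, mul_pow, ← mul_assoc κ]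
  congr 1; ring

theorem lintegral_scale (F : Rn n → ℝ≥0∞) {c : ℝ} (hc : 0 < c) :
    ∫⁻ x, F x = ofReal (c ^ n) * ∫⁻ x, F (c • x) := by
  rw [lintegral_comp_smul_pos F hc, ← mul_assoc, ← ofReal_mul (by positivity),
    mul_inv_cancel₀ (by positivity), ofReal_one, one_mul]

theorem lintegral_om (L : ℕ) {κ : ℝ} (hκ : 0 < κ) : ∫⁻ z : Rn n, om L κ z = omI n L := by
  have h := om_scale (n := n) L 1 hκ
  simp only [one_mul] at h
  simp only [← h]
  rw [lintegral_ofReal_mul, ← lintegral_scale (om L 1) hκ]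
  simp [om, omI]

theorem avg_scale (L : ℕ) (κ : ℝ) {c : ℝ} (hc : 0 < c) (a : Rn n → ℝ≥0∞) (x : Rn n) :
    avg L κ a (c • x) = avg L (κ * c) (fun y => a (c • y)) x := by
  rw [avg, avg, lintegral_scale _ hc, ← lintegral_ofReal_mul]
  refine lintegral_congr fun z => ?_
  rw [← mul_assoc, om_scale L κ hc, smul_sub]

theorem avg_eq (L : ℕ) (κ : ℝ) (a : Rn n → ℝ≥0∞) (x : Rn n) : avg L κ a x = ∫⁻ y, om L κ (x - y) * a y := by
  rw [avg, ← lintegral_sub_left_eq_self _ x]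
  simp

theorem measurable_avg (L : ℕ) (κ : ℝ) {a : Rn n → ℝ≥0∞} (ha : Measurable a) : Measurable (avg L κ a) := by
  have h : Measurable fun q : Rn n × Rn n => om L κ q.2 * a (q.1 - q.2) :=
    ((measurable_om L κ).comp measurable_snd).mul (ha.comp (by fun_prop))
  exact h.lintegral_prod_right'

theorem avg_mono {L : ℕ} {κ : ℝ} {a a' : Rn n → ℝ≥0∞} (h : ∀ x, a x ≤ a' x) (x : Rn n) :
    avg L κ a x ≤ avg L κ a' x := lintegral_mono fun _ => mul_le_mul' le_rfl (h _)

theorem avg_const_mul (L : ℕ) (κ : ℝ) {c : ℝ≥0∞} (hc : c ≠ ∞) (a : Rn n → ℝ≥0∞) (x : Rn n) :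
    avg L κ (fun y => c * a y) x = c * avg L κ a x := by
  rw [avg, avg, ← lintegral_const_mul' _ _ hc]
  exact lintegral_congr fun _ => mul_left_comm _ _ _

theorem avg_add (L : ℕ) (κ : ℝ) {a a' : Rn n → ℝ≥0∞} (ha : Measurable a) (x : Rn n) :
    avg L κ (fun y => a y + a' y) x = avg L κ a x + avg L κ a' x := by
  rw [avg, avg, avg, ← lintegral_add_left]
  · simp only [mul_add]
  · exact (measurable_om L κ).mul (ha.comp (by fun_prop))

theorem avg_const (L : ℕ) {κ : ℝ} (hκ : 0 < κ) (c : ℝ≥0∞) (x : Rn n) :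
    avg L κ (fun _ => c) x = omI n L * c := by
  rw [avg, lintegral_mul_const _ (measurable_om L κ), lintegral_om L hκ]

theorem avg_slow (L : ℕ) {κ : ℝ} (hκ : 0 < κ) (a : Rn n → ℝ≥0∞) (x y : Rn n) :
    avg L κ a x ≤ ofReal ((1 + κ * ‖x - y‖) ^ L) * avg L κ a y := by
  rw [avg_eq, avg_eq, ← lintegral_ofReal_mul]
  refine lintegral_mono fun w => ?_
  rw [← mul_assoc]
  refine mul_le_mul' ?_ le_rfl
  rw [om, om, ← ofReal_mul (by positivity)]
  refine ofReal_le_ofReal ?_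
  rw [mul_left_comm]
  refine mul_le_mul_of_nonneg_left ?_ (by positivity)
  rw [← div_eq_mul_inv, inv_le_comm₀ (by positivity) (by positivity), inv_div, div_le_iff₀ (by positivity), ← mul_pow]
  refine pow_le_pow_left₀ (by positivity) ?_ _
  have h1 := norm_sub_le_norm_sub_add_norm_sub y x w
  rw [norm_sub_rev y x] at h1
  have h3 : 0 ≤ κ * ‖x - y‖ * (κ * ‖x - w‖) := by positivity
  nlinarith

theorem lintegral_mul_avg (L : ℕ) (κ : ℝ) {g a : Rn n → ℝ≥0∞} (hg : Measurable g) (ha : Measurable a) :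
    ∫⁻ x, g x * avg L κ a x = ∫⁻ x, avg L κ g x * a x := by
  have hm : Measurable fun q : Rn n × Rn n => om L κ (q.1 - q.2) :=
    (measurable_om L κ).comp (by fun_prop)
  have h1 : ∀ x, g x * avg L κ a x = ∫⁻ y, g x * (om L κ (x - y) * a y) := fun x => by
    rw [avg_eq, lintegral_const_mul]
    exact ((measurable_om L κ).comp (by fun_prop)).mul ha
  have h2 : ∀ y, avg L κ g y * a y = ∫⁻ x, om L κ (y - x) * g x * a y := fun y => by
    rw [avg_eq, lintegral_mul_const]
    exact ((measurable_om L κ).comp (by fun_prop)).mul hg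
  simp only [h1, h2]
  rw [lintegral_lintegral_swap ((hg.comp measurable_fst).mul (hm.mul (ha.comp measurable_snd))).aemeasurable]
  refine lintegral_congr fun y => lintegral_congr fun x => ?_
  have : om L κ (x - y) = om L κ (y - x) := by rw [om, om, norm_sub_rev]
  rw [this]; ring

theorem lintegral_avg (L : ℕ) {κ : ℝ} (hκ : 0 < κ) {a : Rn n → ℝ≥0∞} (ha : Measurable a) :
    ∫⁻ x, avg L κ a x = omI n L * ∫⁻ x, a x := by
  have h := lintegral_mul_avg L κ (g := fun _ => (1 : ℝ≥0∞)) measurable_const ha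
  simp only [one_mul, avg_const L hκ, mul_one] at h
  rw [h, lintegral_const_mul _ ha]

theorem avg_le_sup (L : ℕ) {κ : ℝ} (hκ : 0 < κ) (a : Rn n → ℝ≥0∞) (x : Rn n) :
    avg L κ a x ≤ ofReal (κ ^ n) * ∫⁻ y, a y := by
  rw [avg_eq, ← lintegral_ofReal_mul]
  refine lintegral_mono fun y => mul_le_mul' (ofReal_le_ofReal ?_) le_rfl
  refine mul_le_of_le_one_right (by positivity) (inv_le_one_of_one_le₀ (one_le_pow₀ ?_))
  have : 0 ≤ κ * ‖x - y‖ := by positivity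
  linarith

/-- Slowly varying functions are dominated by their averages. -/
theorem le_avg_of_slow (L e : ℕ) {κ : ℝ} (hκ : 0 < κ) {A : ℝ≥0∞} (hA : A ≠ ∞) {D : Rn n → ℝ≥0∞}
    (hD : ∀ x y, D x ≤ A * ofReal ((1 + κ * ‖x - y‖) ^ e) * D y) (x : Rn n) :
    omI n (L + e) * D x ≤ A * avg L κ D x := by
  rw [← lintegral_om (L + e) hκ, avg, ← lintegral_mul_const _ (measurable_om _ _), ← lintegral_const_mul' _ _ hA]
  refine lintegral_mono fun z => ?_
  refine (mul_le_mul' le_rfl (hD x (x - z))).trans ?_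
  rw [sub_sub_cancel, show om (L + e) κ z * (A * ofReal ((1 + κ * ‖z‖) ^ e) * D (x - z)) =
    A * (om (L + e) κ z * ofReal ((1 + κ * ‖z‖) ^ e) * D (x - z)) by ring]
  refine mul_le_mul' le_rfl (mul_le_mul' (le_of_eq ?_) le_rfl)
  rw [om, om, ← ofReal_mul (by positivity), pow_add]
  congr 1
  field_simp

/-- The covering estimate behind the weak type `(1,1)` bound for averages over balls. -/
theorem exists_volume_ball_large_le : ∃ C : ℝ, 0 < C ∧ ∀ β : ℝ, 0 < β → ∀ g : Rn n → ℝ≥0∞, Measurable g →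
    volume {x : Rn n | ∃ r : ℝ, 0 < r ∧ ofReal (β * r ^ n) < ∫⁻ y in closedBall x r, g y} ≤
      ofReal (C / β) * ∫⁻ y, g y := by
  have hn : 2 ≤ n := Fact.out
  have hω : volume (closedBall (0 : Rn n) 1) ≠ ∞ := measure_closedBall_lt_top.ne
  set ω := (volume (closedBall (0 : Rn n) 1)).toReal with hωd
  have hω0 : 0 < ω := toReal_pos (Metric.measure_closedBall_pos _ _ one_pos).ne' hω
  refine ⟨4 ^ n * ω, by positivity, fun β hβ g hg => ?_⟩
  by_cases hM : ∫⁻ y, g y = ∞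
  · rw [hM, ENNReal.mul_top (by simp; positivity)]; exact le_top
  set M := (∫⁻ y, g y).toReal
  set t := {x : Rn n | ∃ r : ℝ, 0 < r ∧ ofReal (β * r ^ n) < ∫⁻ y in closedBall x r, g y}
  choose! r hr0 hr using (fun x (hx : x ∈ t) => hx)
  have hR : ∀ a ∈ t, r a ≤ 1 + M / β := fun a ha => by
    have h1 : ofReal (β * r a ^ n) ≤ ofReal M := by
      rw [ofReal_toReal hM]
      exact (hr a ha).le.trans (setLIntegral_le_lintegral _ _)
    rw [ENNReal.ofReal_le_ofReal_iff toReal_nonneg] at h1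
    have h2 : r a ^ n ≤ M / β := by rw [le_div_iff₀ hβ]; linarith
    have h3 : 0 ≤ M / β := div_nonneg toReal_nonneg hβ.le
    rcases le_total (r a) 1 with h | h
    · linarith
    · have := le_self_pow₀ h (by omega : n ≠ 0)
      linarith
  obtain ⟨u, hut, hdis, hcov⟩ := Vitali.exists_disjoint_subfamily_covering_enlargement_closedBall t id r _ hR 4 (by norm_num)
  have huc : u.Countable := hdis.countable_of_nonempty_interior fun a ha =>
    ⟨a, Metric.ball_subset_interior_closedBall (Metric.mem_ball_self (hr0 a (hut ha)))⟩
  have hsub : t ⊆ ⋃ b ∈ u, closedBall b (4 * r b) := fun a ha => by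
    obtain ⟨b, hb, h⟩ := hcov a ha
    exact mem_biUnion hb (h (Metric.mem_closedBall_self (hr0 a ha).le))
  have : Countable u := huc.to_subtype
  calc volume t ≤ ∑' b : u, volume (closedBall (b : Rn n) (4 * r b)) :=
        (measure_mono hsub).trans (measure_biUnion_le _ huc _)
    _ ≤ ∑' b : u, ofReal (4 ^ n * ω / β) * ∫⁻ y in closedBall (b : Rn n) (r b), g y := by
        refine tsum_le_tsum fun b => ?_
        have hb := hut b.2
        rw [Measure.addHaar_closedBall _ _ (by have := hr0 b hb; positivity), finrank_euclideanSpace_fin,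
          ← Measure.addHaar_unitClosedBall_eq_addHaar_unitBall, ← ofReal_toReal hω, ← ofReal_mul (by have := hr0 b hb; positivity)]
        refine le_trans (le_of_eq ?_) (mul_le_mul' le_rfl (hr b hb).le)
        rw [← ofReal_mul (by positivity)]
        congr 1; field_simp
        rw [mul_pow]; ring
    _ = ofReal (4 ^ n * ω / β) * ∫⁻ y in ⋃ b : u, closedBall (b : Rn n) (r b), g y := by
        rw [tsum_mul_left, lintegral_iUnion (fun _ => measurableSet_closedBall)]
        exact fun a b hab => hdis a.2 b.2 (Subtype.coe_injective.ne hab)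
    _ ≤ _ := mul_le_mul' le_rfl (setLIntegral_le_lintegral _ _)

theorem avg_le_of_ball {L : ℕ} (hL : n + 1 ≤ L) {κ : ℝ} (hκ : 0 < κ) {β : ℝ} (hβ : 0 < β) {g : Rn n → ℝ≥0∞} (hg : Measurable g)
    {x : Rn n} (h : ∀ r : ℝ, 0 < r → ∫⁻ y in closedBall x r, g y ≤ ofReal (β * r ^ n)) :
    avg L κ g x ≤ ofReal (2 ^ (n + 1) * β) := by
  have hpt : ∀ y, om L κ (x - y) * g y ≤ ∑' i : ℕ, ofReal (κ ^ n * ((2 : ℝ) ^ (i * (n + 1)))⁻¹) *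
      (closedBall x (2 ^ (i + 1) / κ)).indicator g y := fun y => by
    have h0 : 0 ≤ κ * ‖x - y‖ := by positivity
    obtain ⟨i, h1, h2⟩ := exists_nat_pow_near (by linarith : 1 ≤ 1 + κ * ‖x - y‖) (one_lt_two)
    refine le_trans ?_ (ENNReal.le_tsum i)
    rw [indicator_of_mem]
    · refine mul_le_mul' (ofReal_le_ofReal ?_) le_rfl
      rw [pow_mul]
      have : ((2 : ℝ) ^ i) ^ (n + 1) ≤ (1 + κ * ‖x - y‖) ^ L :=
        (pow_le_pow_left₀ (by positivity) h1 _).trans (pow_le_pow_right₀ (by linarith) hL)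
      gcongr
    · rw [Metric.mem_closedBall, dist_comm, dist_eq_norm, le_div_iff₀ hκ]
      linarith
  rw [avg_eq]
  refine (lintegral_mono hpt).trans ?_
  rw [lintegral_tsum fun i => ((hg.indicator measurableSet_closedBall).const_mul _).aemeasurable]
  calc _ ≤ ∑' i : ℕ, ofReal (2 ^ n * β) * ofReal ((1 / 2) ^ i) := by
        refine tsum_le_tsum fun i => ?_
        rw [lintegral_ofReal_mul, lintegral_indicator measurableSet_closedBall]
        refine (mul_le_mul' le_rfl (h _ (by positivity))).trans (le_of_eq ?_)
        rw [← ofReal_mul (by positivity), ← ofReal_mul (by positivity)]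
        congr 1
        rw [div_pow, pow_mul, pow_succ, pow_succ, mul_pow, one_div, inv_pow]
        field_simp
    _ = _ := by
        rw [tsum_mul_left, ← ENNReal.ofReal_tsum_of_nonneg (fun i => by positivity) summable_geometric_two,
          tsum_geometric_two, ← ofReal_mul (by positivity)]
        congr 1; ring

/-- The maximal theorem for the averages `avg`. -/
theorem exists_lintegral_iSup_avg_le {L : ℕ} (hL : n + 1 ≤ L) {q : ℝ} (hq : 1 < q) : ∃ C : ℝ, 0 < C ∧
    ∀ κ : ℕ → ℝ, (∀ i, 0 < κ i) → ∀ g : Rn n → ℝ≥0∞, Measurable g →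
    ∫⁻ x, (⨆ i, avg L (κ i) g x) ^ q ≤ ofReal C * ∫⁻ x, g x ^ q := by
  obtain ⟨C, hC, hw⟩ := exists_volume_ball_large_le (n := n)
  have hI := omI_ne_top hL
  set I := (omI n L).toReal with hId
  have hI0 : 0 < I := toReal_pos (omI_ne_zero L) hI
  refine ⟨C * 2 ^ (n + 2) * (q / (q - 1) * (2 * I) ^ (q - 1)), ?_, fun κ hκ g hg => ?_⟩
  · have : 0 < q - 1 := by linarith
    positivity
  have key := tsum_lintegral_rpow_le_of_weak (μ := (volume : Measure (Rn n))) (ν := (volume : Measure (Rn n))) (ι := Unit) one_pos hq (by positivity : 0 < 2 * I)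
    (A := ofReal (C * 2 ^ (n + 2)))
    (T := fun _ x => ⨆ i, avg L (κ i) g x) (fun _ => Measurable.iSup fun i => measurable_avg _ _ hg) hg ?_
  · rw [tsum_fintype, Finset.univ_unique, Finset.sum_singleton, ← ofReal_mul (by positivity)] at key
    exact key
  intro α hα
  rw [tsum_fintype, Finset.univ_unique, Finset.sum_singleton]
  set S := {y | ofReal α < ofReal (2 * I) * g y}
  have hS : MeasurableSet S := measurableSet_lt measurable_const (hg.const_mul _)
  have hgS : Measurable (S.indicator g) := hg.indicator hS
  set β := α / 2 ^ (n + 2) with hβd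
  have hβ : 0 < β := by positivity
  have hle : ∀ y, g y ≤ S.indicator g y + ofReal (α / (2 * I)) := fun y => by
    by_cases hy : y ∈ S
    · rw [indicator_of_mem hy]; exact le_self_add
    · rw [indicator_of_notMem hy, zero_add, ENNReal.ofReal_div_of_pos (by positivity),
        ENNReal.le_div_iff_mul_le (by left; simp; positivity) (by left; exact ofReal_ne_top), mul_comm]
      exact not_lt.1 hy
  refine (measure_mono (t := {x : Rn n | ∃ r : ℝ, 0 < r ∧ ofReal (β * r ^ n) < ∫⁻ y in closedBall x r, S.indicator g y}) fun x hx => ?_).trans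
    ((hw β hβ _ hgS).trans (le_of_eq ?_))
  · by_contra hcon
    have hb : ∀ r : ℝ, 0 < r → ∫⁻ y in closedBall x r, S.indicator g y ≤ ofReal (β * r ^ n) := fun r hr => by
      by_contra h
      exact hcon ⟨r, hr, not_le.1 h⟩
    refine absurd (show ofReal α < _ from hx) (not_lt.2 (iSup_le fun i => ?_))
    refine (avg_mono hle x).trans ?_
    rw [avg_add _ _ hgS, avg_const _ (hκ i), ← ofReal_toReal hI, ← hId, ← ofReal_mul hI0.le]
    refine (add_le_add (avg_le_of_ball hL (hκ i) hβ hgS hb) le_rfl).trans (le_of_eq ?_)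
    rw [← ofReal_add (by positivity) (by positivity)]
    congr 1
    rw [hβd, pow_succ 2 (n + 1)]; field_simp; norm_num
  · rw [← ofReal_mul (by positivity), hβd, Real.rpow_neg_one]
    congr 1
    · congr 1; field_simp
    · refine lintegral_congr fun y => ?_
      simp only [rpow_one]

/-- Band-limited square functions are dominated by their own averages. -/
theorem exists_sqS_le_avg (b : 𝓢(Rn n, ℂ)) (hb : AnnulusSupported b)
    {m m' : 𝓢(Rn n, ℂ)} (hmm : ∀ ξ, m ξ ≠ 0 → m' ξ = 1) {L : ℕ} (hL : n + 1 ≤ L) : ∃ C : ℝ, 0 < C ∧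
    ∀ lam : ℝ, 0 < lam → ∀ s : ℤ, ∀ f : Rn n → ℂ, Integrable f → ∀ x,
      sqS b m lam s f x ≤ ofReal C * avg L (lam * (2 : ℝ) ^ (-s)) (sqS b m lam s f) x := by
  obtain ⟨C, hC, hd⟩ := exists_lpKer_decay m' L
  have hI := omI_ne_top hL
  have hI0 : 0 < (omI n L).toReal := toReal_pos (omI_ne_zero L) hI
  refine ⟨C * (omI n L).toReal * C, by positivity, fun lam hl s f hf x => ?_⟩
  have h1 : ∀ z, ‖lpKer m' lam z‖ₑ ≤ ofReal C * om L lam z := fun z => by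
    rw [om, ← ofReal_mul hC.le, ← ofReal_norm, ← mul_assoc]
    exact ofReal_le_ofReal (hd lam hl z)
  have h2 : ∫⁻ z, ‖lpKer m' lam z‖ₑ ≤ ofReal (C * (omI n L).toReal) := by
    refine (lintegral_mono h1).trans (le_of_eq ?_)
    rw [lintegral_ofReal_mul, lintegral_om L hl, ofReal_mul hC.le, ofReal_toReal hI]
  have h3 := avg_scale L lam (c := (2 : ℝ) ^ (-s)) (by positivity) (sqFn b m lam fun y => f ((2 : ℝ) ^ s • y)) x
  unfold sqS
  rw [← h3, ofReal_mul (p := C * _) (by positivity), mul_assoc]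
  refine (sqFn_le_reproducing b hb hmm hl (integrable_dil hf s) _).trans (mul_le_mul' h2 ?_)
  rw [avg, ← lintegral_ofReal_mul]
  refine lintegral_mono fun z => ?_
  rw [← mul_assoc]
  exact mul_le_mul' (h1 z) le_rfl

end Averages

/-- Jensen's inequality with a weight bounded by one. -/
theorem lintegral_mul_rpow_le {X : Type*} [MeasurableSpace X] (μ : Measure X) {P : ℝ} (hP : 1 < P) {w h : X → ℝ≥0∞}
    (hw : Measurable w) (hh : Measurable h) (hw1 : ∀ x, w x ≤ 1) :
    (∫⁻ x, w x * h x ∂μ) ^ P ≤ (∫⁻ x, w x ∂μ) ^ (P - 1) * ∫⁻ x, h x ^ P ∂μ := by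
  have hpq : (P.conjExponent).HolderConjugate P := (Real.HolderConjugate.conjExponent hP).symm
  have h1 := ENNReal.lintegral_mul_le_Lp_mul_Lq μ hpq hw.aemeasurable hh.aemeasurable
  have hP0 : 0 < P := by linarith
  refine (rpow_le_rpow h1 hP0.le).trans ?_
  rw [mul_rpow_of_nonneg _ _ hP0.le, ← rpow_mul, ← rpow_mul, one_div_mul_cancel hP0.ne', rpow_one]
  have h2 : 1 / P.conjExponent * P = P - 1 := by
    rw [Real.conjExponent]
    field_simp
  rw [h2]
  refine mul_le_mul' (rpow_le_rpow (lintegral_mono fun x => ?_) (by linarith)) le_rfl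
  conv_rhs => rw [← rpow_one (w x)]
  exact ENNReal.rpow_le_rpow_of_exponent_ge (hw1 x) hpq.lt.le

section LocalDecay
variable {n : ℕ} [Fact (2 ≤ n)]

/-- The weighted bounds satisfied by a square function whose input lives on a unit cube. -/
def WeightBound (B lam : ℝ) (Q : ℝ≥0∞) (a : Rn n → ℝ≥0∞) : Prop :=
  ∀ R : ℝ, 1 ≤ R → ∀ w : Rn n → ℝ≥0∞, Measurable w → (∀ x, w x ≤ 1) → ∫⁻ x, w x ≠ ∞ →
    ∫⁻ x, w x * a x ≤ ofReal (B * (lam ^ n)⁻¹) * (ofReal R +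
        ofReal (√(R ^ (n - 1))⁻¹ * lam ^ n) * ∫⁻ x, w x) * Q

theorem sqrt_sq_pow_inv {t : ℝ} (ht : 0 < t) (k : ℕ) : √((t ^ 2) ^ k)⁻¹ = (t ^ k)⁻¹ := by
  rw [← pow_mul, mul_comm, pow_mul, ← inv_pow, Real.sqrt_sq (by positivity)]

/-- Averaging gains a power of the ratio of the scales. -/
theorem WeightBound.avg_le {L : ℕ} (hL : n + 1 ≤ L) {B κ lam : ℝ} (hB : 0 < B) (hκ : 0 < κ) (hl : κ ≤ lam)
    {Q : ℝ≥0∞} {a : Rn n → ℝ≥0∞} (h : WeightBound B lam Q a) (x : Rn n) :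
    avg L κ a x ≤ ofReal (B * (1 + (omI n L).toReal) * (lam / κ) ^ (-(n * (n - 1) / (n + 1) : ℝ))) * Q := by
  have hI := omI_ne_top hL
  have hl0 : 0 < lam := hκ.trans_le hl
  set I := (omI n L).toReal with hId
  have hμ : 1 ≤ lam / κ := (one_le_div hκ).2 hl
  have hμ0 : 0 < lam / κ := by positivity
  have hom : ∀ y, om L κ (x - y) = ofReal (κ ^ n) * ofReal ((1 + κ * ‖x - y‖) ^ L)⁻¹ := fun y => by
    rw [om, ofReal_mul (by positivity)]
  have hwI : ofReal (κ ^ n) * ∫⁻ y : Rn n, ofReal ((1 + κ * ‖x - y‖) ^ L)⁻¹ = ofReal I := by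
    rw [← lintegral_ofReal_mul, ofReal_toReal hI, ← lintegral_om L hκ,
      ← lintegral_sub_left_eq_self (om L κ) x]
    exact lintegral_congr fun y => (hom y).symm
  set t := (lam / κ) ^ ((n : ℝ) / (n + 1)) with ht
  have ht0 : 0 < t := by positivity
  have ht1 : 1 ≤ t := Real.one_le_rpow hμ (by positivity)
  have hne : ∫⁻ y : Rn n, ofReal ((1 + κ * ‖x - y‖) ^ L)⁻¹ ≠ ∞ := fun h0 => by
    rw [h0, ENNReal.mul_top (by simp; positivity)] at hwI
    exact ofReal_ne_top hwI.symm
  have key := h (t ^ 2) (one_le_pow₀ ht1) (fun y => ofReal ((1 + κ * ‖x - y‖) ^ L)⁻¹) (by fun_prop)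
    (fun y => ?_) hne
  · have e1 : avg L κ a x = ofReal (κ ^ n) * ∫⁻ y, ofReal ((1 + κ * ‖x - y‖) ^ L)⁻¹ * a y := by
      rw [avg_eq, ← lintegral_ofReal_mul]
      exact lintegral_congr fun y => by rw [hom, mul_assoc]
    rw [e1]
    refine (mul_le_mul' le_rfl key).trans ?_
    have e2 : ∫⁻ y : Rn n, ofReal ((1 + κ * ‖x - y‖) ^ L)⁻¹ = ofReal (I * (κ ^ n)⁻¹) := by
      rw [ofReal_mul toReal_nonneg, ← hwI, mul_comm, ← mul_assoc, ← ofReal_mul (by positivity),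
        inv_mul_cancel₀ (by positivity), ofReal_one, one_mul]
    rw [e2, sqrt_sq_pow_inv ht0, ← ofReal_mul (by positivity), ← ofReal_add (by positivity) (by positivity),
      ← mul_assoc, ← ofReal_mul (by positivity), ← mul_assoc, ← ofReal_mul (by positivity)]
    refine mul_le_mul' (ofReal_le_ofReal (le_of_eq ?_)) le_rfl
    have hn : 2 ≤ n := Fact.out
    have e3 : (t ^ (n - 1))⁻¹ * (lam / κ) ^ n = t ^ 2 := by
      rw [inv_mul_eq_iff_eq_mul₀ (by positivity), ← pow_add, show n - 1 + 2 = n + 1 by omega, ht, ← rpow_natCast (_ ^ _), ← Real.rpow_mul hμ0.le,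
        ← rpow_natCast]
      congr 1; push_cast; field_simp
    have e4 : t ^ 2 * ((lam / κ) ^ n)⁻¹ = (lam / κ) ^ (-(n * (n - 1) / (n + 1) : ℝ)) := by
      rw [ht, ← rpow_natCast (_ ^ _), ← Real.rpow_mul hμ0.le, ← rpow_natCast _ n, ← Real.rpow_neg hμ0.le, ← Real.rpow_add hμ0]
      congr 1; push_cast; field_simp; ring
    rw [← e4]
    calc _ = B * ((lam / κ) ^ n)⁻¹ * (t ^ 2 + I * ((t ^ (n - 1))⁻¹ * (lam / κ) ^ n)) := by
          rw [div_pow]; field_simp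
      _ = _ := by rw [e3]; ring
  · have : 0 ≤ κ * ‖x - y‖ := by positivity
    exact ENNReal.ofReal_le_one.2 (inv_le_one_of_one_le₀ (one_le_pow₀ (by linarith)))

theorem WeightBound.volume_le {L : ℕ} (hL : n + 1 ≤ L) {B κ lam : ℝ} (hB : 0 < B) (hκ : 0 < κ) (hl : κ ≤ lam)
    {Q : ℝ} (hQ : 0 ≤ Q) {a : Rn n → ℝ≥0∞} (ha : Measurable a) (h : WeightBound B lam (ofReal Q) a) {α : ℝ} (hα : 0 < α) :
    volume {x | ofReal α < avg L κ a x} ≤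
      ofReal ((lam ^ n)⁻¹ * (2 * (1 + (omI n L).toReal) * B * Q) ^ ((n + 1) / (n - 1) : ℝ)) *
        ofReal (α ^ (-((n + 1) / (n - 1) : ℝ))) := by
  have hn : 2 ≤ n := Fact.out
  have hn' : (2 : ℝ) ≤ n := by exact_mod_cast hn
  have hI := omI_ne_top hL
  have hl0 : 0 < lam := hκ.trans_le hl
  set I := (omI n L).toReal with hId
  have hI0 : 0 < I := toReal_pos (omI_ne_zero L) hI
  set E := {x | ofReal α < avg L κ a x} with hE
  have hEm : MeasurableSet E := measurableSet_lt measurable_const (measurable_avg _ _ ha)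
  have hμ : 1 ≤ lam / κ := (one_le_div hκ).2 hl
  set M := 2 * (1 + I) * B * Q / α with hM
  rcases lt_or_ge M 1 with hM1 | hM1
  · have : E = ∅ := eq_empty_of_forall_notMem fun x hx => by
      refine absurd (show ofReal α < _ from hx) (not_lt.2 ((h.avg_le hL hB hκ hl x).trans ?_))
      rw [← ofReal_mul (by positivity)]
      refine ofReal_le_ofReal ?_
      have h1 : (lam / κ) ^ (-(n * (n - 1) / (n + 1) : ℝ)) ≤ 1 := by
        refine Real.rpow_le_one_of_one_le_of_nonpos hμ ?_
        rw [neg_nonpos]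
        have : (0 : ℝ) ≤ n - 1 := by linarith
        positivity
      rw [hM, div_lt_one hα] at hM1
      have h2 : 0 ≤ B * (1 + I) * Q := by positivity
      calc _ = (B * (1 + I) * Q) * (lam / κ) ^ (-(n * (n - 1) / (n + 1) : ℝ)) := by ring
        _ ≤ (B * (1 + I) * Q) * 1 := by gcongr
        _ ≤ α := by nlinarith
    rw [this]; simp
  have hM0 : 0 < M := by linarith
  set t := M ^ (1 / (n - 1) : ℝ) with ht
  have ht0 : 0 < t := by positivity
  have hn1 : (0 : ℝ) < n - 1 := by linarith
  have ht1 : 1 ≤ t := Real.one_le_rpow hM1 (by positivity)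
  have htM : t ^ (n - 1) = M := by
    rw [ht, ← rpow_natCast, ← Real.rpow_mul hM0.le, Nat.cast_sub (by omega), Nat.cast_one, one_div_mul_cancel hn1.ne', Real.rpow_one]
  have htM2 : t ^ 2 * M = M ^ ((n + 1) / (n - 1) : ℝ) := by
    rw [ht, ← rpow_natCast (_ ^ _), ← Real.rpow_mul hM0.le]
    nth_rw 2 [← Real.rpow_one M]
    rw [← Real.rpow_add hM0]
    congr 1; field_simp; push_cast; ring
  have hfin : ∀ E' ⊆ E, MeasurableSet E' → volume E' ≠ ∞ → volume E' ≤ ofReal ((lam ^ n)⁻¹ * (t ^ 2 * M)) := by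
    intro E' hE' hE'm hE'f
    set w : Rn n → ℝ≥0∞ := fun y => ofReal I⁻¹ * avg L κ (E'.indicator 1) y with hw
    have h1m : Measurable (E'.indicator (1 : Rn n → ℝ≥0∞)) := measurable_one.indicator hE'm
    have hIi : ofReal I⁻¹ * ofReal I = 1 := by
      rw [← ofReal_mul (by positivity), inv_mul_cancel₀ hI0.ne', ofReal_one]
    have hwi : ∫⁻ y, w y = volume E' := by
      rw [hw, lintegral_ofReal_mul, lintegral_avg _ hκ h1m, lintegral_indicator_one hE'm,
        ← ofReal_toReal hI, ← mul_assoc, hIi, one_mul]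
    have h1 := h (t ^ 2) (one_le_pow₀ ht1) w ((measurable_avg _ _ h1m).const_mul _) (fun y => ?_) (hwi ▸ hE'f)
    · have h2 : ofReal (α / I) * volume E' ≤ ∫⁻ x, w x * a x := by
        have : ∀ x, w x * a x = ofReal I⁻¹ * (avg L κ (E'.indicator 1) x * a x) := fun x => mul_assoc _ _ _
        simp only [this]
        rw [lintegral_ofReal_mul, ← lintegral_mul_avg L κ h1m ha, ← lintegral_indicator_one hE'm,
          div_eq_mul_inv, mul_comm α, ofReal_mul (by positivity), mul_assoc, ← lintegral_ofReal_mul]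
        refine mul_le_mul' le_rfl (lintegral_mono fun x => ?_)
        by_cases hx : x ∈ E'
        · simp only [indicator_of_mem hx, Pi.one_apply, mul_one, one_mul]
          exact (show ofReal α < _ from hE' hx).le
        · simp [indicator_of_notMem hx]
      rw [hwi, sqrt_sq_pow_inv ht0, htM, ← ofReal_toReal hE'f] at h1
      rw [← ofReal_toReal hE'f] at h2 ⊢
      set v := (volume E').toReal
      have h3 := h2.trans h1
      rw [← ofReal_mul (by positivity), ← ofReal_mul (by positivity), ← ofReal_add (by positivity) (by positivity),
        ← ofReal_mul (by positivity), ← ofReal_mul (by positivity), ENNReal.ofReal_le_ofReal_iff (by positivity)] at h3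
      refine ofReal_le_ofReal ?_
      have hQM : B * Q = M * α / (2 * (1 + I)) := by rw [hM]; field_simp
      have h4 : α / I * v ≤ (lam ^ n)⁻¹ * t ^ 2 * (M * α / (2 * (1 + I))) + α / (2 * (1 + I)) * v := by
        refine h3.trans (le_of_eq ?_)
        calc _ = (B * Q) * ((lam ^ n)⁻¹ * t ^ 2 + M⁻¹ * ((lam ^ n)⁻¹ * lam ^ n) * v) := by ring
          _ = _ := by rw [hQM, inv_mul_cancel₀ (by positivity)]; field_simp
      have h5 : α / (2 * (1 + I)) * v ≤ α / (2 * I) * v := by gcongr; linarith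
      have h6 : (lam ^ n)⁻¹ * t ^ 2 * (M * α / (2 * (1 + I))) ≤ (lam ^ n)⁻¹ * t ^ 2 * (M * α / (2 * I)) := by gcongr; linarith
      have h7 : α / I * v = α / (2 * I) * v + α / (2 * I) * v := by field_simp; ring
      have h8 : α / (2 * I) * v ≤ α / (2 * I) * ((lam ^ n)⁻¹ * (t ^ 2 * M)) := by
        have : (lam ^ n)⁻¹ * t ^ 2 * (M * α / (2 * I)) = α / (2 * I) * ((lam ^ n)⁻¹ * (t ^ 2 * M)) := by ring
        linarith
      exact le_of_mul_le_mul_left h8 (by positivity)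
    · rw [hw, ← hIi]
      refine mul_le_mul' le_rfl ?_
      rw [ofReal_toReal hI, ← mul_one (omI n L), ← avg_const L hκ 1 y]
      exact avg_mono (fun z => indicator_le_self' (fun _ _ => zero_le_one) z) y
  have hlim : volume E ≤ ofReal ((lam ^ n)⁻¹ * (t ^ 2 * M)) := by
    by_contra hcon
    obtain ⟨E', hm, hs, h1, h2⟩ := Measure.exists_subset_measure_lt_top hEm (not_le.1 hcon)
    exact absurd (hfin E' hs hm h2.ne) (not_le.2 h1)
  refine hlim.trans (le_of_eq ?_)
  rw [← ofReal_mul (by positivity), htM2, hM, Real.div_rpow (by positivity) hα.le, Real.rpow_neg hα.le]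
  congr 1; ring

theorem exists_lintegral_avg_rpow_le {P : ℝ} (hP : ((n : ℝ) + 1) / (n - 1) < P) {L : ℕ} (hL : n + 1 ≤ L) {B : ℝ} (hB : 0 < B) :
    ∃ C : ℝ, 0 < C ∧ ∃ δ : ℝ, 0 < δ ∧ ∀ κ lam : ℝ, 0 < κ → κ ≤ lam → ∀ a : Rn n → ℝ≥0∞, Measurable a →
    ∀ Q : ℝ≥0∞, Q ≠ ∞ → WeightBound B lam Q a →
    ∫⁻ x, avg L κ a x ^ P ≤ ofReal (C * (lam ^ n)⁻¹ * (lam / κ) ^ (-δ)) * Q ^ P := by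
  have hn := two_le_dim (n := n)
  have hn1 : (0 : ℝ) < n - 1 := by linarith
  set q₀ : ℝ := ((n : ℝ) + 1) / (n - 1) with hq₀
  have hq0 : 0 < q₀ := by positivity
  have hPq : 0 < P - q₀ := by linarith
  set I := (omI n L).toReal with hId
  set ε : ℝ := n * (n - 1) / (n + 1) with hε
  refine ⟨(2 * (1 + I) * B) ^ q₀ * (P / (P - q₀)) * (B * (1 + I)) ^ (P - q₀), ?_, ε * (P - q₀), by positivity,
    fun κ lam hκ hl a ha Q hQ h => ?_⟩
  · have : 0 < P := by linarith
    positivity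
  have hl0 : 0 < lam := hκ.trans_le hl
  have hP0 : 0 < P := by linarith
  set Q' := Q.toReal
  have hQ' : 0 ≤ Q' := toReal_nonneg
  have hQQ : Q = ofReal Q' := (ofReal_toReal hQ).symm
  rw [hQQ] at h ⊢
  refine (lintegral_rpow_le_of_weak_of_le hq0 hP (measurable_avg _ _ ha) (fun x => h.avg_le hL hB hκ hl x)
    fun α hα => h.volume_le hL hB hκ hl hQ' ha hα).trans (le_of_eq ?_)
  rw [← ofReal_mul (by positivity), ← ofReal_mul (p := B * _ * _) (by positivity), ofReal_rpow_of_nonneg (by positivity) hPq.le,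
    ofReal_rpow_of_nonneg hQ' hP0.le, ← ofReal_mul (by positivity), ← ofReal_mul (by positivity)]
  congr 1
  rw [Real.mul_rpow (x := 2 * _ * _) (by positivity) hQ', Real.mul_rpow (x := B * _ * _) (by positivity) hQ', Real.mul_rpow (x := B * _) (by positivity) (by positivity),
    ← Real.rpow_mul (by positivity), neg_mul, show Q' ^ P = Q' ^ q₀ * Q' ^ (P - q₀) by
      rw [← Real.rpow_add_of_nonneg hQ' hq0.le hPq.le]; congr 1; ring]
  ring

theorem tsum_mul_rpow_le {ι : Type*} [Countable ι] [MeasurableSpace ι] [DiscreteMeasurableSpace ι] {P : ℝ} (hP : 1 < P) {w h : ι → ℝ≥0∞} (hw1 : ∀ x, w x ≤ 1) :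
    (∑' x, w x * h x) ^ P ≤ (∑' x, w x) ^ (P - 1) * ∑' x, h x ^ P := by
  have := lintegral_mul_rpow_le (Measure.count : Measure ι) hP (Measurable.of_discrete (f := w)) (Measurable.of_discrete (f := h)) hw1
  simpa only [lintegral_count] using this

/-- The average of a square function, localised to cubes of the input. -/
theorem exists_weightBound_cube (b m : 𝓢(Rn n, ℂ)) (hb : AnnulusSupported b)
    (hm : AnnulusSupported m) (hm1 : ∀ ξ, ‖m ξ‖ ≤ 1) (e : ℕ) : ∃ B : ℝ, 0 < B ∧
    ∀ lam : ℝ, 1 / 2 ≤ lam → ∀ f : Rn n → ℂ, Integrable f → ∀ z,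
    WeightBound B lam (∫⁻ y in cube z, ‖f y‖ₑ ^ 2)
      (fun x => ofReal ((1 + ‖x - cubePt z‖) ^ e) * sqS b m lam 0 ((cube z).indicator f) x) := by
  obtain ⟨C₁, hC₁, h₁⟩ := exists_weight_sqS_le (n := n) b m hb (Real.sqrt_nonneg n) e
  obtain ⟨C₂, hC₂, h₂⟩ := exists_lintegral_weight_sqFn_le b m hb hm hm1
  set I := (∫⁻ x : Rn n, ofReal ((1 + ‖x‖) ^ (n + 1))⁻¹).toReal with hI
  have hI' : ofReal I = ∫⁻ x : Rn n, ofReal ((1 + ‖x‖) ^ (n + 1))⁻¹ := ofReal_toReal lintegral_inv_one_add_norm_ne_top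
  refine ⟨C₁ * (C₂ + I), by positivity, fun lam hlam f hf z R hR w hw hw1 hwi => ?_⟩
  have hfz := hf.indicator (measurableSet_cube z)
  set Q := ∫⁻ y in cube z, ‖f y‖ₑ ^ 2 with hQ
  have e0 : ∀ x, sqS b m lam 0 ((cube z).indicator f) x = sqFn b m lam ((cube z).indicator f) x := fun x => by simp [sqS]
  have h3 := h₂ lam hlam _ hfz R hR w hw hw1 hwi
  have h4 : ∫⁻ x, w x * (ofReal (lam ^ n)⁻¹ * ofReal ((1 + ‖x - cubePt z‖) ^ (n + 1))⁻¹ * Q) ≤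
      ofReal (lam ^ n)⁻¹ * ofReal I * Q := by
    rw [hI', ← lintegral_sub_right_eq_self (fun x : Rn n => ofReal ((1 + ‖x‖) ^ (n + 1))⁻¹) (cubePt z), ← lintegral_ofReal_mul,
      ← lintegral_mul_const _ (by fun_prop)]
    exact lintegral_mono fun x => mul_le_of_le_one_left zero_le (hw1 x)
  calc ∫⁻ x, w x * (ofReal ((1 + ‖x - cubePt z‖) ^ e) * sqS b m lam 0 ((cube z).indicator f) x)
      ≤ ∫⁻ x, ofReal C₁ * (w x * sqFn b m lam ((cube z).indicator f) x +
          w x * (ofReal (lam ^ n)⁻¹ * ofReal ((1 + ‖x - cubePt z‖) ^ (n + 1))⁻¹ * Q)) := by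
        refine lintegral_mono fun x => ?_
        have := h₁ lam hlam 0 le_rfl ((cube z).indicator f) hfz.1 (cubePt z) (fun y hy => indicator_of_notMem (fun hy' => absurd (norm_sub_cubePt_le hy') (not_le.2 hy)) _) x
        rw [lintegral_enorm_indicator_cube_sq, e0, zpow_zero, one_mul] at this
        rw [e0]
        refine (mul_le_mul' le_rfl this).trans (le_of_eq ?_)
        ring
    _ = ofReal C₁ * ((∫⁻ x, w x * sqFn b m lam ((cube z).indicator f) x) +
          ∫⁻ x, w x * (ofReal (lam ^ n)⁻¹ * ofReal ((1 + ‖x - cubePt z‖) ^ (n + 1))⁻¹ * Q)) := by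
        rw [lintegral_ofReal_mul, lintegral_add_left (hw.fun_mul (measurable_sqFn b m lam hfz))]
    _ ≤ ofReal C₁ * (ofReal (C₂ * (lam ^ n)⁻¹) * (ofReal R +
        ofReal (√(R ^ (n - 1))⁻¹ * lam ^ n) * ∫⁻ x, w x) * Q + ofReal (lam ^ n)⁻¹ * ofReal I * Q) := by
        rw [lintegral_enorm_indicator_cube_sq] at h3
        exact mul_le_mul' le_rfl (add_le_add h3 h4)
    _ ≤ _ := by
        set W := ofReal R + ofReal (√(R ^ (n - 1))⁻¹ * lam ^ n) * ∫⁻ x, w x with hW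
        have hW1 : 1 ≤ W := (ENNReal.one_le_ofReal.2 hR).trans le_self_add
        have h5 : ofReal (lam ^ n)⁻¹ * ofReal I * Q ≤ ofReal (lam ^ n)⁻¹ * ofReal I * W * Q :=
          mul_le_mul' (le_mul_of_one_le_right zero_le hW1) le_rfl
        refine (mul_le_mul' le_rfl (add_le_add le_rfl h5)).trans (le_of_eq ?_)
        rw [show C₁ * (C₂ + I) * (lam ^ n)⁻¹ = C₁ * (C₂ * (lam ^ n)⁻¹ + (lam ^ n)⁻¹ * I) by ring, ofReal_mul (p := C₁) hC₁.le,
          ofReal_add (by positivity) (by positivity), ofReal_mul (p := (lam ^ n)⁻¹) (by positivity)]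
        ring

theorem exists_lintegral_avg_sqFn_le (b m : 𝓢(Rn n, ℂ)) (hb : AnnulusSupported b)
    (hm : AnnulusSupported m) (hm1 : ∀ ξ, ‖m ξ‖ ≤ 1) {P : ℝ} (hP : ((n : ℝ) + 1) / (n - 1) < P) :
    ∃ C : ℝ, 0 < C ∧ ∃ δ : ℝ, 0 < δ ∧ ∀ κ lam : ℝ, 1 ≤ κ → κ ≤ lam → ∀ f : Rn n → ℂ, Integrable f →
    ∫⁻ x, avg (n + 1 + (n + 1)) κ (sqS b m lam 0 f) x ^ P ≤ ofReal (C * (lam ^ n)⁻¹ * (lam / κ) ^ (-δ)) * ∫⁻ x, ‖f x‖ₑ ^ (2 * P) := by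
  have hn := two_le_dim (n := n)
  have hP1 := one_lt_of_exponent_lt hP
  have hP0 : 0 < P := by linarith
  obtain ⟨B, hB, hWB⟩ := exists_weightBound_cube b m hb hm hm1 (n + 1 + (n + 1))
  obtain ⟨C₁, hC₁, δ, hδ, h₁⟩ := exists_lintegral_avg_rpow_le hP le_rfl hB
  obtain ⟨C₂, hC₂, h₂⟩ := exists_sqS_le_tsum_cube b m hb
  obtain ⟨C₃, hC₃, h₃⟩ := exists_tsum_cube_weight_le (n := n)
  refine ⟨C₂ ^ P * C₃ ^ (P - 1) * C₁, by positivity, δ, hδ, fun κ lam hκ hl f hf => ?_⟩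
  have hκ0 : 0 < κ := by linarith
  have hl0 : 0 < lam := by linarith
  have hfz := fun z => hf.indicator (measurableSet_cube z)
  set a : (Fin n → ℤ) → Rn n → ℝ≥0∞ := fun z x => ofReal ((1 + ‖x - cubePt z‖) ^ (n + 1 + (n + 1))) * sqS b m lam 0 ((cube z).indicator f) x with ha
  have ham : ∀ z, Measurable (a z) := fun z => by
    refine Measurable.mul (by fun_prop) (measurable_sqS b m lam 0 (hfz z))
  have hpt : ∀ x, avg (n + 1 + (n + 1)) κ (sqS b m lam 0 f) x ≤ ofReal C₂ * ∑' z,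
      ofReal ((1 + ‖x - cubePt z‖) ^ (n + 1))⁻¹ * avg (n + 1) κ (a z) x := fun x => by
    refine (avg_mono (h₂ lam hl0 0 f hf) x).trans ?_
    rw [avg_const_mul _ _ ofReal_ne_top, avg_eq]
    refine mul_le_mul' le_rfl ?_
    simp only [← tsum_mul_left]
    have hmz : ∀ z, Measurable fun y => om (n + 1 + (n + 1)) κ (x - y) * (ofReal ((1 + ‖y - cubePt z‖) ^ (n + 1)) *
        sqS b m lam 0 ((cube z).indicator f) y) := fun z =>
      ((measurable_om _ κ).comp (by fun_prop)).mul (Measurable.mul (by fun_prop) (measurable_sqS b m lam 0 (hfz z)))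
    rw [lintegral_tsum fun z => (hmz z).aemeasurable]
    refine tsum_le_tsum fun z => ?_
    rw [avg_eq, ← lintegral_ofReal_mul]
    refine lintegral_mono fun y => ?_
    rw [ha, ← mul_assoc, ← mul_assoc, ← mul_assoc]
    refine mul_le_mul' ?_ le_rfl
    rw [om, om, ← ofReal_mul (by positivity), ← ofReal_mul (by positivity), ← ofReal_mul (by positivity)]
    refine ofReal_le_ofReal ?_
    have k1 : 1 + ‖x - cubePt z‖ ≤ (1 + κ * ‖x - y‖) * (1 + ‖y - cubePt z‖) := by
      refine (one_add_norm_sub_le x y _).trans ?_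
      gcongr
      exact le_mul_of_one_le_left (norm_nonneg _) hκ
    have k2 := pow_le_pow_left₀ (by positivity) k1 (n + 1)
    have k4 : 0 < 1 + ‖x - cubePt z‖ := by positivity
    rw [pow_add _ (n + 1) (n + 1), pow_add _ (n + 1) (n + 1)]
    generalize (1 + ‖x - cubePt z‖) = X at *
    rw [mul_pow] at k2
    generalize hY : (1 + κ * ‖x - y‖) ^ (n + 1) = Y at *
    have hY0 : 0 < Y := hY ▸ by positivity
    generalize hZ : (1 + ‖y - cubePt z‖) ^ (n + 1) = Z at *
    have hZ0 : 0 < Z := hZ ▸ by positivity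
    generalize hX : X ^ (n + 1) = W at *
    have hW0 : 0 < W := hX ▸ by positivity
    calc κ ^ n * (Y * Y)⁻¹ * Z = κ ^ n * Z * Y⁻¹ * (W⁻¹ * (Y⁻¹ * W)) := by field_simp
      _ ≤ κ ^ n * Z * Y⁻¹ * (W⁻¹ * Z) := by
        have : Y⁻¹ * W ≤ Z := by rw [inv_mul_le_iff₀ hY0]; exact k2
        gcongr
      _ = _ := by ring

  calc ∫⁻ x, avg (n + 1 + (n + 1)) κ (sqS b m lam 0 f) x ^ P
      ≤ ∫⁻ x, ofReal (C₂ ^ P * C₃ ^ (P - 1)) * ∑' z, avg (n + 1) κ (a z) x ^ P := by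
        refine lintegral_mono fun x => (rpow_le_rpow (hpt x) hP0.le).trans ?_
        rw [mul_rpow_of_nonneg _ _ hP0.le, ofReal_rpow_of_pos hC₂, ofReal_mul (by positivity), mul_assoc,
          ← ofReal_rpow_of_pos hC₃]
        refine mul_le_mul' le_rfl ((tsum_mul_rpow_le hP1 fun z => ?_).trans (mul_le_mul' (rpow_le_rpow (h₃ x) (by linarith)) le_rfl))
        exact ENNReal.ofReal_le_one.2 (inv_le_one_of_one_le₀ (one_le_pow₀ (by linarith [norm_nonneg (x - cubePt z)])))
    _ = ofReal (C₂ ^ P * C₃ ^ (P - 1)) * ∑' z, ∫⁻ x, avg (n + 1) κ (a z) x ^ P := by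
        rw [lintegral_ofReal_mul, lintegral_tsum fun z => ((measurable_avg _ _ (ham z)).pow_const _).aemeasurable]
    _ ≤ ofReal (C₂ ^ P * C₃ ^ (P - 1)) * ∑' z, ofReal (C₁ * (lam ^ n)⁻¹ * (lam / κ) ^ (-δ)) * ∫⁻ x in cube z, ‖f x‖ₑ ^ (2 * P) := by
        refine mul_le_mul' le_rfl (tsum_le_tsum fun z => ?_)
        have hJ := lintegral_mul_rpow_le (volume.restrict (cube z)) hP1 (w := fun _ => 1) (h := fun y => ‖(hf.1.mk f) y‖ₑ ^ 2) measurable_const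
          (hf.1.stronglyMeasurable_mk.measurable.enorm.pow_const 2) (fun _ => le_rfl)
        have hae : ∀ᵐ y ∂volume.restrict (cube z), ‖(hf.1.mk f) y‖ₑ = ‖f y‖ₑ := by
          filter_upwards [ae_restrict_of_ae hf.1.ae_eq_mk] with y hy
          rw [hy]
        simp only [one_mul, lintegral_const, Measure.restrict_apply_univ, volume_cube, ENNReal.one_rpow] at hJ
        have i1 : ∫⁻ y in cube z, ‖(hf.1.mk f) y‖ₑ ^ 2 = ∫⁻ y in cube z, ‖f y‖ₑ ^ 2 :=
          lintegral_congr_ae (by filter_upwards [hae] with y hy; rw [hy])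
        have i2 : ∫⁻ y in cube z, (‖(hf.1.mk f) y‖ₑ ^ 2) ^ P = ∫⁻ y in cube z, ‖f y‖ₑ ^ (2 * P) :=
          lintegral_congr_ae (by filter_upwards [hae] with y hy; rw [hy, rpow_mul, ENNReal.rpow_two])
        rw [i1, i2] at hJ
        by_cases hfin : ∫⁻ y in cube z, ‖f y‖ₑ ^ 2 = ∞
        · rw [hfin, ENNReal.top_rpow_of_pos hP0, top_le_iff] at hJ
          rw [hJ, ENNReal.mul_top (by simp only [ne_eq, ENNReal.ofReal_eq_zero, not_le]; positivity)]; exact le_top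
        · exact (h₁ κ lam hκ0 hl _ (ham z) _ hfin (hWB lam (by linarith) f hf z)).trans (mul_le_mul' le_rfl hJ)
    _ = _ := by
        rw [tsum_mul_left, ← lintegral_eq_tsum_cube, ← mul_assoc, ← ofReal_mul (by positivity)]
        congr 2; ring

theorem exists_lintegral_avg_sqS_le (b m : 𝓢(Rn n, ℂ)) (hb : AnnulusSupported b)
    (hm : AnnulusSupported m) (hm1 : ∀ ξ, ‖m ξ‖ ≤ 1) {P : ℝ} (hP : ((n : ℝ) + 1) / (n - 1) < P) :
    ∃ C : ℝ, 0 < C ∧ ∃ δ : ℝ, 0 < δ ∧ ∀ κ lam : ℝ, 1 ≤ κ → κ ≤ lam → ∀ s : ℤ, ∀ f : Rn n → ℂ, Integrable f →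
    ∫⁻ x, avg (n + 1 + (n + 1)) (κ * (2 : ℝ) ^ (-s)) (sqS b m lam s f) x ^ P ≤
      ofReal (C * (lam ^ n)⁻¹ * (lam / κ) ^ (-δ)) * ∫⁻ x, ‖f x‖ₑ ^ (2 * P) := by
  obtain ⟨C, hC, δ, hδ, h⟩ := exists_lintegral_avg_sqFn_le b m hb hm hm1 hP
  refine ⟨C, hC, δ, hδ, fun κ lam hκ hl s f hf => ?_⟩
  have hs : (0 : ℝ) < (2 : ℝ) ^ s := by positivity
  rw [lintegral_scale _ hs, lintegral_scale (fun x => ‖f x‖ₑ ^ (2 * P)) hs, mul_left_comm]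
  refine mul_le_mul' le_rfl (le_trans (le_of_eq (lintegral_congr fun x => ?_)) (h κ lam hκ hl _ (integrable_dil hf s)))
  rw [avg_scale _ _ hs, mul_assoc, ← zpow_add₀ (by norm_num), neg_add_cancel, zpow_zero, mul_one]
  simp only [sqS_dil, sub_self]

/-- A Schwartz symbol equal to one on the annulus `1/2 ≤ ‖ξ‖ ≤ 2`. -/
theorem exists_annulus_symbol : ∃ m' : 𝓢(Rn n, ℂ), (∀ ξ, 1 / 2 ≤ ‖ξ‖ → ‖ξ‖ ≤ 2 → m' ξ = 1) ∧
    (∀ ξ, m' ξ ≠ 0 → 1 / 4 ≤ ‖ξ‖ ∧ ‖ξ‖ ≤ 4) ∧ ∀ ξ, ‖m' ξ‖ ≤ 2 := by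
  obtain ⟨Φ, h1, h2, h3⟩ := exists_schwartz_bump (E := Rn n) 2 4 (by norm_num) (by norm_num)
  obtain ⟨Ψ, k1, k2, k3⟩ := exists_schwartz_bump (E := Rn n) (1 / 4) (1 / 2) (by norm_num) (by norm_num)
  refine ⟨Φ - Ψ, fun ξ ha hb => ?_, fun ξ hξ => ⟨?_, ?_⟩, fun ξ => ?_⟩
  · rw [sub_apply, h1 ξ hb, k2 ξ ha, sub_zero]
  · by_contra! h
    exact hξ (by rw [sub_apply, h1 ξ (by linarith), k1 ξ h.le, sub_self])
  · by_contra! h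
    exact hξ (by rw [sub_apply, h2 ξ h.le, k2 ξ (by linarith), sub_self])
  · rw [sub_apply]
    exact (norm_sub_le _ _).trans (by linarith [h3 ξ, k3 ξ])

theorem tsum_symbol_sq_le {m' : 𝓢(Rn n, ℂ)} (h : ∀ ξ, m' ξ ≠ 0 → 1 / 4 ≤ ‖ξ‖ ∧ ‖ξ‖ ≤ 4) (h2 : ∀ ξ, ‖m' ξ‖ ≤ 2)
    {lam : ℝ} (hl : 0 < lam) (ξ : Rn n) :
    ∑' s : ℤ, ‖m' ((lam * (2 : ℝ) ^ (-s))⁻¹ • ξ)‖ₑ ^ 2 ≤ 32 := by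
  have hnorm : ∀ s : ℤ, ‖(lam * (2 : ℝ) ^ (-s))⁻¹ • ξ‖ = (2 : ℝ) ^ s * (‖ξ‖ / lam) := fun s => by
    rw [norm_smul, norm_of_nonneg (by positivity), zpow_neg]
    field_simp
  set S : ℝ → Set ℤ := fun a => {s : ℤ | 1 / 2 ≤ (2 : ℝ) ^ s * a ∧ (2 : ℝ) ^ s * a ≤ 2} with hS
  set A : ℝ → ℤ → ℝ≥0∞ := fun a => (S a).indicator 1 with hA
  have hA4 : ∀ a, ∑' s, A a s ≤ 4 := fun a => tsum_dyadic_le (a := a) (fun s => indicator_le_self' (fun _ _ => zero_le_one) s) fun s hs => by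
    by_contra hcon
    exact hs (indicator_of_notMem (s := S a) hcon _)
  calc _ ≤ ∑' s : ℤ, 4 * (A (2 * (‖ξ‖ / lam)) s + A (‖ξ‖ / lam / 2) s) := by
        refine tsum_le_tsum fun s => ?_
        by_cases h0 : m' ((lam * (2 : ℝ) ^ (-s))⁻¹ • ξ) = 0
        · rw [h0]; simp
        have hr := h _ h0
        rw [hnorm] at hr
        have hle : ‖m' ((lam * (2 : ℝ) ^ (-s))⁻¹ • ξ)‖ₑ ^ 2 ≤ 4 := by
          have : ‖m' ((lam * (2 : ℝ) ^ (-s))⁻¹ • ξ)‖ₑ ≤ 2 := by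
            rw [← ofReal_norm]
            exact (ofReal_le_ofReal (h2 _)).trans (by simp)
          refine (pow_le_pow_left' this 2).trans (by norm_num)
        refine hle.trans (le_mul_of_one_le_right zero_le ?_)
        rcases le_total ((2 : ℝ) ^ s * (‖ξ‖ / lam)) 1 with h1 | h1
        · refine le_trans (le_of_eq ?_) le_self_add
          have hm : s ∈ S (2 * (‖ξ‖ / lam)) := ⟨by linarith, by linarith⟩
          simp only [hA, indicator_of_mem hm, Pi.one_apply]
        · refine le_trans (le_of_eq ?_) le_add_self
          have hm : s ∈ S (‖ξ‖ / lam / 2) := ⟨by linarith, by linarith⟩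
          simp only [hA, indicator_of_mem hm, Pi.one_apply]
    _ ≤ 4 * (4 + 4) := by
        rw [tsum_mul_left, ENNReal.tsum_add]
        exact mul_le_mul' le_rfl (add_le_add (hA4 _) (hA4 _))
    _ = 32 := by norm_num

theorem integrable_symbol_mul_fourier (m : 𝓢(Rn n, ℂ)) {lam : ℝ} (hl : 0 < lam) {f : Rn n → ℂ} (hf : Integrable f) :
    Integrable fun ξ => m (lam⁻¹ • ξ) * 𝓕 f ξ := by
  refine (integrable_symbol_mul m hl).mul_bdd (c := ∫ x, ‖f x‖) (continuous_fourier_of_integrable hf).aestronglyMeasurable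
    (ae_of_all _ fun ξ => ?_)
  exact VectorFourier.norm_fourierIntegral_le_integral_norm _ _ _ _ _

theorem tsum_lintegral_lpConv_sq_le {m' : 𝓢(Rn n, ℂ)} (h : ∀ ξ, m' ξ ≠ 0 → 1 / 4 ≤ ‖ξ‖ ∧ ‖ξ‖ ≤ 4) (h2 : ∀ ξ, ‖m' ξ‖ ≤ 2)
    {lam : ℝ} (hl : 0 < lam) {f : Rn n → ℂ} (hf : Integrable f) :
    ∑' s : ℤ, ∫⁻ x, ‖lpConv m' (lam * (2 : ℝ) ^ (-s)) f x‖ₑ ^ 2 ≤ 32 * ∫⁻ x, ‖f x‖ₑ ^ 2 := by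
  have hls : ∀ s : ℤ, 0 < lam * (2 : ℝ) ^ (-s) := fun s => by positivity
  calc _ ≤ ∑' s : ℤ, ∫⁻ ξ, ‖m' ((lam * (2 : ℝ) ^ (-s))⁻¹ • ξ)‖ₑ ^ 2 * ‖𝓕 f ξ‖ₑ ^ 2 := by
        refine tsum_le_tsum fun s => ?_
        simp only [lpConv_eq_fourierInv m' (hls s) hf]
        refine (lintegral_fourierInv_sq_le (integrable_symbol_mul_fourier m' (hls s) hf)).trans (le_of_eq ?_)
        exact lintegral_congr fun ξ => by rw [enorm_mul, mul_pow]
    _ = ∫⁻ ξ, (∑' s : ℤ, ‖m' ((lam * (2 : ℝ) ^ (-s))⁻¹ • ξ)‖ₑ ^ 2) * ‖𝓕 f ξ‖ₑ ^ 2 := by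
        simp only [← tsum_mul_right]
        rw [lintegral_tsum fun s => ?_]
        have c1 : Continuous fun ξ => m' ((lam * (2 : ℝ) ^ (-s))⁻¹ • ξ) := m'.continuous.comp (by fun_prop)
        exact ((c1.measurable.enorm.pow_const 2).mul ((continuous_fourier_of_integrable hf).measurable.enorm.pow_const 2)).aemeasurable
    _ ≤ ∫⁻ ξ, 32 * ‖𝓕 f ξ‖ₑ ^ 2 := lintegral_mono fun ξ => mul_le_mul' (tsum_symbol_sq_le h h2 hl ξ) le_rfl
    _ ≤ _ := by
        rw [lintegral_const_mul' _ _ (by simp)]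
        exact mul_le_mul' le_rfl (lintegral_fourier_sq_le hf)

theorem exists_lintegral_lpKer_le (m' : 𝓢(Rn n, ℂ)) : ∃ C : ℝ, 0 < C ∧ ∀ lam : ℝ, 0 < lam →
    ∫⁻ x, ‖lpKer m' lam x‖ₑ ≤ ofReal C := by
  obtain ⟨C, hC, h⟩ := exists_lpKer_decay m' (n + 1)
  have hI := omI_ne_top (n := n) le_rfl
  refine ⟨C * (omI n (n + 1)).toReal, mul_pos hC (toReal_pos (omI_ne_zero _) hI), fun lam hl => ?_⟩
  rw [ofReal_mul hC.le, ofReal_toReal hI, ← lintegral_om (n + 1) hl, ← lintegral_ofReal_mul]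
  refine lintegral_mono fun x => ?_
  rw [om, ← ofReal_mul hC.le, ← ofReal_norm, ← mul_assoc]
  exact ofReal_le_ofReal (h lam hl x)

/-- The `ℓ^q(L^q)` bound for Littlewood–Paley pieces, `q > 2`. -/
theorem exists_tsum_lintegral_lpConv_rpow_le {m' : 𝓢(Rn n, ℂ)} (h : ∀ ξ, m' ξ ≠ 0 → 1 / 4 ≤ ‖ξ‖ ∧ ‖ξ‖ ≤ 4) (h2 : ∀ ξ, ‖m' ξ‖ ≤ 2)
    {q : ℝ} (hq : 2 < q) : ∃ C : ℝ, 0 < C ∧ ∀ lam : ℝ, 0 < lam → ∀ f : Rn n → ℂ, Integrable f → Measurable f →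
    ∑' s : ℤ, ∫⁻ x, ‖lpConv m' (lam * (2 : ℝ) ^ (-s)) f x‖ₑ ^ q ≤ ofReal C * ∫⁻ x, ‖f x‖ₑ ^ q := by
  obtain ⟨C, hC, hk⟩ := exists_lintegral_lpKer_le m'
  refine ⟨128 * (q / (q - 2) * (2 * C) ^ (q - 2)), ?_, fun lam hl f hf hfm => ?_⟩
  · have : 0 < q - 2 := by linarith
    positivity
  have hls : ∀ s : ℤ, 0 < lam * (2 : ℝ) ^ (-s) := fun s => by positivity
  rw [ofReal_mul (by norm_num)]
  refine tsum_lintegral_rpow_le_of_weak (T := fun (s : ℤ) x => ‖lpConv m' (lam * (2 : ℝ) ^ (-s)) f x‖ₑ) (g := fun x => ‖f x‖ₑ)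
    two_pos hq (by positivity : 0 < 2 * C) (fun s => (continuous_lpConv m' _ hf).measurable.enorm) hfm.enorm fun α hα => ?_
  set S := {y | ofReal α < ofReal (2 * C) * ‖f y‖ₑ}
  have hS : MeasurableSet S := measurableSet_lt measurable_const (hfm.enorm.const_mul _)
  have hfS := hf.indicator hS
  have hpt : ∀ (s : ℤ) x, ‖lpConv m' (lam * (2 : ℝ) ^ (-s)) f x‖ₑ ≤ ‖lpConv m' (lam * (2 : ℝ) ^ (-s)) (S.indicator f) x‖ₑ + ofReal (α / 2) := by
    intro s x
    have hfS' := hf.indicator hS.compl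
    obtain ⟨M, hM, hMk⟩ := exists_norm_lpKer_le m' (lam * (2 : ℝ) ^ (-s))
    have hint : ∀ g : Rn n → ℂ, Integrable g → Integrable fun y => g y * lpKer m' (lam * (2 : ℝ) ^ (-s)) (x - y) := fun g hg =>
      hg.mul_bdd (c := M) ((continuous_lpKer m' _).comp (by fun_prop)).aestronglyMeasurable (ae_of_all _ fun y => hMk _)
    have e : lpConv m' (lam * (2 : ℝ) ^ (-s)) f x = lpConv m' (lam * (2 : ℝ) ^ (-s)) (S.indicator f) x + lpConv m' (lam * (2 : ℝ) ^ (-s)) (Sᶜ.indicator f) x := by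
      rw [lpConv, lpConv, lpConv, ← integral_add (hint _ hfS) (hint _ hfS')]
      refine integral_congr_ae (ae_of_all _ fun y => ?_)
      simp only [← add_mul]
      rw [← Pi.add_apply (S.indicator f), indicator_self_add_compl]
    rw [e]
    refine (enorm_add_le _ _).trans (add_le_add le_rfl ((enorm_integral_le_lintegral_enorm _).trans ?_))
    calc _ ≤ ∫⁻ y, ofReal (α / (2 * C)) * ‖lpKer m' (lam * (2 : ℝ) ^ (-s)) (x - y)‖ₑ := by
          refine lintegral_mono fun y => ?_
          rw [enorm_mul]
          refine mul_le_mul' ?_ le_rfl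
          by_cases hy : y ∈ S
          · rw [indicator_of_notMem (by simpa using hy)]; simp
          · rw [indicator_of_mem (by simpa using hy), ENNReal.ofReal_div_of_pos (by positivity),
              ENNReal.le_div_iff_mul_le (by left; simpa using hC) (by left; exact ofReal_ne_top), mul_comm]
            exact not_lt.1 hy
      _ ≤ _ := by
          rw [lintegral_ofReal_mul, lintegral_sub_left_eq_self (fun y => ‖lpKer m' (lam * (2 : ℝ) ^ (-s)) y‖ₑ) x]
          refine (mul_le_mul' le_rfl (hk _ (hls s))).trans (le_of_eq ?_)
          rw [← ofReal_mul (by positivity)]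
          congr 1; field_simp
  have hcheb : ∀ s : ℤ, volume {x | ofReal α < ‖lpConv m' (lam * (2 : ℝ) ^ (-s)) f x‖ₑ} ≤
      ofReal (4 / α ^ 2) * ∫⁻ x, ‖lpConv m' (lam * (2 : ℝ) ^ (-s)) (S.indicator f) x‖ₑ ^ 2 := fun s => by
    have h1 := mul_meas_ge_le_lintegral (μ := (volume : Measure (Rn n))) ((continuous_lpConv m' (lam * (2 : ℝ) ^ (-s)) hfS).measurable.enorm.pow_const 2) (ofReal (α ^ 2 / 4))
    have h2 : volume {x | ofReal α < ‖lpConv m' (lam * (2 : ℝ) ^ (-s)) f x‖ₑ} ≤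
        volume {x | ofReal (α ^ 2 / 4) ≤ ‖lpConv m' (lam * (2 : ℝ) ^ (-s)) (S.indicator f) x‖ₑ ^ 2} := by
      refine measure_mono fun x hx => ?_
      have hx : ofReal α < ‖lpConv m' (lam * (2 : ℝ) ^ (-s)) f x‖ₑ := hx
      have h3 := hx.le.trans (hpt s x)
      have h4 : ofReal (α / 2) ≤ ‖lpConv m' (lam * (2 : ℝ) ^ (-s)) (S.indicator f) x‖ₑ := by
        rw [show α = α / 2 + α / 2 by ring, ofReal_add (by positivity) (by positivity)] at h3
        simp only [add_halves] at h3
        exact (ENNReal.add_le_add_iff_right ofReal_ne_top).1 h3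
      show ofReal (α ^ 2 / 4) ≤ _
      rw [show α ^ 2 / 4 = (α / 2) ^ 2 by ring, ofReal_pow (by positivity)]
      exact pow_le_pow_left' h4 2
    calc _ = ofReal (4 / α ^ 2) * (ofReal (α ^ 2 / 4) * volume {x | ofReal α < ‖lpConv m' (lam * (2 : ℝ) ^ (-s)) f x‖ₑ}) := by
          rw [← mul_assoc, ← ofReal_mul (by positivity)]
          field_simp; simp
      _ ≤ _ := mul_le_mul' le_rfl ((mul_le_mul' le_rfl h2).trans h1)
  refine (tsum_le_tsum hcheb).trans ?_
  rw [tsum_mul_left]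
  refine (mul_le_mul' le_rfl (tsum_lintegral_lpConv_sq_le h h2 hl hfS)).trans (le_of_eq ?_)
  rw [← mul_assoc, ← ofReal_mul (by norm_num), show (32 : ℝ≥0∞) = ofReal 32 by simp, ← ofReal_mul (by positivity)]
  congr 1
  · congr 1
    rw [Real.rpow_neg hα.le, Real.rpow_two]; field_simp; norm_num
  · refine lintegral_congr fun y => ?_
    by_cases hy : y ∈ S
    · rw [indicator_of_mem hy, indicator_of_mem hy, ENNReal.rpow_two]
    · rw [indicator_of_notMem hy, indicator_of_notMem hy]; simp

theorem lpConv_dil (m : 𝓢(Rn n, ℂ)) (lam : ℝ) (s : ℤ) (f : Rn n → ℂ) (x : Rn n) :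
    lpConv m lam (fun y => f ((2 : ℝ) ^ s • y)) x = lpConv m (lam * (2 : ℝ) ^ (-s)) f ((2 : ℝ) ^ s • x) := by
  have hs : (0 : ℝ) < (2 : ℝ) ^ s := by positivity
  have h := Measure.integral_comp_smul (volume : Measure (Rn n))
    (fun y => f y * lpKer m (lam * (2 : ℝ) ^ (-s)) ((2 : ℝ) ^ s • x - y)) ((2 : ℝ) ^ s)
  rw [finrank_euclideanSpace_fin, abs_of_pos (by positivity)] at h
  rw [lpConv, lpConv, ← inv_smul_smul₀ (by positivity : (((2 : ℝ) ^ s) ^ n)⁻¹ ≠ 0) (∫ y, f y * _), ← h, ← integral_smul]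
  refine integral_congr_ae (ae_of_all _ fun y => ?_)
  simp only [lpKer, ← smul_sub, smul_smul, real_smul]
  rw [mul_assoc lam, ← zpow_add₀ (by norm_num), neg_add_cancel, zpow_zero, mul_one, mul_pow, inv_inv, zpow_neg]
  push_cast
  have : (((2 : ℝ) ^ s : ℝ) : ℂ) ≠ 0 := by exact_mod_cast hs.ne'
  push_cast at this
  have h2 : ((2 : ℂ) ^ s) ^ n * ((2 ^ s)⁻¹) ^ n = 1 := by rw [← mul_pow, mul_inv_cancel₀ this, one_pow]
  linear_combination (-(f ((2 : ℝ) ^ s • y) * (lam : ℂ) ^ n * 𝓕⁻ (⇑m) (lam • (x - y)))) * h2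

theorem sqS_lpConv (b : 𝓢(Rn n, ℂ)) (hb : AnnulusSupported b)
    {m m' : 𝓢(Rn n, ℂ)} (hmm : ∀ ξ, m ξ ≠ 0 → m' ξ = 1) {lam : ℝ} (hl : 0 < lam) (s : ℤ) {f : Rn n → ℂ} (hf : Integrable f) :
    sqS b m lam s (lpConv m' (lam * (2 : ℝ) ^ (-s)) f) = sqS b m lam s f := by
  ext x
  simp only [sqS, ← lpConv_dil]
  rw [sqFn_lpConv b hb hmm hl (integrable_dil hf s)]

/-- The scale-localised decay estimate summed over all scales. -/
theorem exists_tsum_lintegral_avg_sqS_le (b m : 𝓢(Rn n, ℂ)) (hb : AnnulusSupported b)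
    (hm : AnnulusSupported m) (hm1 : ∀ ξ, ‖m ξ‖ ≤ 1) {P : ℝ} (hP : ((n : ℝ) + 1) / (n - 1) < P) :
    ∃ C : ℝ, 0 < C ∧ ∃ δ : ℝ, 0 < δ ∧ ∀ κ lam : ℝ, 1 ≤ κ → κ ≤ lam → ∀ f : Rn n → ℂ, Integrable f → Measurable f →
    ∑' s : ℤ, ∫⁻ x, avg (n + 1 + (n + 1)) (κ * (2 : ℝ) ^ (-s)) (sqS b m lam s f) x ^ P ≤
      ofReal (C * (lam ^ n)⁻¹ * (lam / κ) ^ (-δ)) * ∫⁻ x, ‖f x‖ₑ ^ (2 * P) := by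
  have hn := two_le_dim (n := n)
  have hP1 := one_lt_of_exponent_lt hP
  obtain ⟨m', h1, h2, h3⟩ := exists_annulus_symbol (n := n)
  obtain ⟨C₁, hC₁, δ, hδ, k1⟩ := exists_lintegral_avg_sqS_le b m hb hm hm1 hP
  obtain ⟨C₂, hC₂, k2⟩ := exists_tsum_lintegral_lpConv_rpow_le h2 h3 (by linarith : 2 < 2 * P)
  refine ⟨C₁ * C₂, by positivity, δ, hδ, fun κ lam hκ hl f hf hfm => ?_⟩
  have hl0 : 0 < lam := by linarith
  calc _ ≤ ∑' s : ℤ, ofReal (C₁ * (lam ^ n)⁻¹ * (lam / κ) ^ (-δ)) * ∫⁻ x, ‖lpConv m' (lam * (2 : ℝ) ^ (-s)) f x‖ₑ ^ (2 * P) := by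
        refine tsum_le_tsum fun s => ?_
        have := k1 κ lam hκ hl s _ (integrable_lpConv m' (by positivity : 0 < lam * (2 : ℝ) ^ (-s)) hf)
        rwa [sqS_lpConv b hb (fun ξ hξ => h1 ξ (hm ξ hξ).1 (hm ξ hξ).2) hl0 s hf] at this
    _ ≤ _ := by
        rw [tsum_mul_left]
        refine (mul_le_mul' le_rfl (k2 lam hl0 f hf hfm)).trans (le_of_eq ?_)
        rw [← mul_assoc, ← ofReal_mul (by positivity)]
        congr 2; ring

end LocalDecay

section Telescoping

theorem rpow_telescope_le {q β α : ℝ} (hq : 0 < q) (hβ : 0 ≤ β) (hα : 0 ≤ α) (h : 0 < β + α) :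
    (β + α) ^ q ≤ β ^ q + max 1 q * (α * (β + α) ^ (q - 1)) ∧
      β ^ q + min 1 q * (α * (β + α) ^ (q - 1)) ≤ (β + α) ^ q := by
  have hs : (β + α) ^ q = (β + α) ^ (q - 1) * (β + α) := by
    rw [← Real.rpow_add_one h.ne']; simp
  have hβ' : β ^ q = (β + α) ^ q * (1 + -(α / (β + α))) ^ q := by
    rw [← Real.mul_rpow h.le (by rw [← sub_eq_add_neg, sub_nonneg, div_le_one h]; linarith)]
    congr 1; field_simp; ring
  have hr : -1 ≤ -(α / (β + α)) := by rw [neg_le_neg_iff, div_le_one h]; linarith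
  have hqp : 0 < (β + α) ^ q := Real.rpow_pos_of_pos h _
  have hα' : α * (β + α) ^ (q - 1) = (β + α) ^ q * (α / (β + α)) := by rw [hs]; field_simp
  rcases le_total 1 q with h1 | h1
  · rw [max_eq_right h1, min_eq_left h1]
    constructor
    · have := one_add_mul_self_le_rpow_one_add hr h1
      rw [hβ', hα']; nlinarith
    · have : β ^ q ≤ (β + α) ^ (q - 1) * β := by
        rcases hβ.eq_or_lt with h0 | h0
        · rw [← h0, Real.zero_rpow hq.ne']; simp
        · rw [show β ^ q = β ^ (q - 1) * β by rw [← Real.rpow_add_one h0.ne']; simp]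
          gcongr <;> linarith
      rw [hs]; linarith
  · rw [max_eq_left h1, min_eq_right h1]
    constructor
    · have : (β + α) ^ (q - 1) * β ≤ β ^ q := by
        rcases hβ.eq_or_lt with h0 | h0
        · rw [← h0, Real.zero_rpow hq.ne']; simp
        · rw [show β ^ q = β ^ (q - 1) * β by rw [← Real.rpow_add_one h0.ne']; simp]
          refine mul_le_mul_of_nonneg_right (Real.rpow_le_rpow_of_nonpos h0 (by linarith) (by linarith)) hβ
      rw [hs]; linarith
    · have := rpow_one_add_le_one_add_mul_self hr hq.le h1
      rw [hβ', hα']; nlinarith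

theorem ennreal_rpow_telescope_le {q : ℝ} (hq : 0 < q) {b a : ℝ≥0∞} (hb : b ≠ ∞) (ha : a ≠ ∞) :
    (b + a) ^ q ≤ b ^ q + ofReal (max 1 q) * (a * (b + a) ^ (q - 1)) ∧
      b ^ q + ofReal (min 1 q) * (a * (b + a) ^ (q - 1)) ≤ (b + a) ^ q := by
  by_cases h0 : b + a = 0
  · obtain ⟨h1, h2⟩ := add_eq_zero.1 h0
    simp [h1, h2, zero_rpow_of_pos hq]
  lift b to ℝ≥0 using hb
  lift a to ℝ≥0 using ha
  have hpos : (0 : ℝ) < b + a := by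
    have : b + a ≠ 0 := by exact_mod_cast h0
    exact_mod_cast pos_iff_ne_zero.2 this
  obtain ⟨h1, h2⟩ := rpow_telescope_le hq b.coe_nonneg a.coe_nonneg hpos
  have e0 : (b : ℝ≥0∞) + a = ofReal (b + a) := by rw [ofReal_add (by simp) (by simp)]; simp
  have e1 : (b : ℝ≥0∞) ^ q = ofReal ((b : ℝ) ^ q) := by
    rw [← ofReal_rpow_of_nonneg (by simp) hq.le]; simp
  have e2 : ∀ c : ℝ, 0 ≤ c → ofReal c * (a * ((b : ℝ≥0∞) + a) ^ (q - 1)) = ofReal (c * (a * ((b : ℝ) + a) ^ (q - 1))) := fun c hc => by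
    rw [e0, ofReal_rpow_of_pos hpos, ofReal_mul hc, ofReal_mul (by simp)]; simp
  rw [e2 _ (by positivity), e2 _ (by positivity), e0, e1, ofReal_rpow_of_pos hpos, ← ofReal_add (by positivity) (by positivity),
    ← ofReal_add (by positivity) (by positivity)]
  exact ⟨ofReal_le_ofReal h1, ofReal_le_ofReal h2⟩

theorem sum_rpow_telescope {q : ℝ} (hq : 0 < q) {a : ℕ → ℝ≥0∞} (ha : ∀ t, a t ≠ ∞) (T : ℕ) :
    (∑ t ∈ Finset.range T, a t) ^ q ≤
        ofReal (max 1 q) * ∑ t ∈ Finset.range T, a t * (∑ i ∈ Finset.range (t + 1), a i) ^ (q - 1) ∧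
      ofReal (min 1 q) * ∑ t ∈ Finset.range T, a t * (∑ i ∈ Finset.range (t + 1), a i) ^ (q - 1) ≤
        (∑ t ∈ Finset.range T, a t) ^ q := by
  induction T with
  | zero => simp [zero_rpow_of_pos hq]
  | succ T ih =>
    have h := ennreal_rpow_telescope_le hq (b := ∑ t ∈ Finset.range T, a t) (ENNReal.sum_ne_top.2 fun t _ => ha t) (ha T)
    rw [← Finset.sum_range_succ a T] at h
    rw [Finset.sum_range_succ (fun t => a t * _) T, mul_add, mul_add]
    exact ⟨h.1.trans (add_le_add ih.1 le_rfl), (add_le_add ih.2 le_rfl).trans h.2⟩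

theorem mul_rpow_slow {α β B B' W : ℝ≥0∞} {q : ℝ} (hW : 1 ≤ W) (hW' : W ≠ ∞) (hB : B ≠ ∞) (h1 : α ≤ W * β) (h2 : B ≤ W * B') (h3 : B' ≤ W * B) :
    α * B ^ (q - 1) ≤ W ^ (1 + |q - 1|) * (β * B' ^ (q - 1)) := by
  have hW0 : W ≠ 0 := (zero_lt_one.trans_le hW).ne'
  have key : B ^ (q - 1) ≤ W ^ |q - 1| * B' ^ (q - 1) := by
    rcases le_total 0 (q - 1) with h | h
    · rw [abs_of_nonneg h, ← mul_rpow_of_nonneg _ _ h]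
      exact rpow_le_rpow h2 h
    · have : (W * B) ^ (q - 1) ≤ B' ^ (q - 1) := by
        have hh := ENNReal.inv_le_inv.2 (rpow_le_rpow h3 (neg_nonneg.2 h))
        rwa [← ENNReal.rpow_neg, ← ENNReal.rpow_neg, neg_neg] at hh
      rw [ENNReal.mul_rpow_of_ne_top hW' hB] at this
      calc B ^ (q - 1) = W ^ |q - 1| * (W ^ (q - 1) * B ^ (q - 1)) := by
            rw [← mul_assoc, ← ENNReal.rpow_add _ _ hW0 hW', abs_of_nonpos h]; simp
        _ ≤ _ := by gcongr
  rw [ENNReal.rpow_add _ _ hW0 hW', rpow_one]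
  exact (mul_le_mul' h1 key).trans (le_of_eq (by ring))

/-- Absorbing a fractional power of a finite quantity. -/
theorem le_rpow_mul_of_le_mul_rpow {Z K W : ℝ≥0∞} {P : ℝ} (hP : 0 < P) (hZ : Z ≠ ∞)
    (h : Z ≤ K * Z ^ (1 - 1 / P) * W ^ (1 / P)) : Z ≤ K ^ P * W := by
  by_cases h0 : Z = 0
  · simp [h0]
  have hz : Z = Z ^ (1 - 1 / P) * Z ^ (1 / P) := by
    rw [← ENNReal.rpow_add _ _ h0 hZ]; simp
  have h1 : Z ^ (1 / P) ≤ K * W ^ (1 / P) := by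
    have h2 : Z ^ (1 - 1 / P) * Z ^ (1 / P) ≤ Z ^ (1 - 1 / P) * (K * W ^ (1 / P)) := by
      rw [← hz]; exact h.trans (le_of_eq (by ring))
    rwa [ENNReal.mul_le_mul_iff_right (ENNReal.rpow_pos (pos_iff_ne_zero.2 h0) hZ).ne' (ENNReal.rpow_ne_top_of_ne_zero h0 hZ)] at h2
  have := rpow_le_rpow h1 hP.le
  rwa [mul_rpow_of_nonneg _ _ hP.le, ← rpow_mul, ← rpow_mul, one_div_mul_cancel hP.ne', rpow_one, rpow_one] at this

end Telescoping

section SquareFunction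
variable {n : ℕ} [Fact (2 ≤ n)]

theorem lintegral_sum_rpow_ne_top {P : ℝ} (hP : 1 < P) {a : ℕ → Rn n → ℝ≥0∞} (ha : ∀ t, Measurable (a t))
    (hfin : ∀ t, ∫⁻ x, a t x ^ P ≠ ∞) (T : ℕ) : ∫⁻ x, (∑ t ∈ Finset.range T, a t x) ^ P ≠ ∞ := by
  have h : ∀ x, (∑ t ∈ Finset.range T, a t x) ^ P ≤ (T : ℝ≥0∞) ^ (P - 1) * ∑ t ∈ Finset.range T, a t x ^ P := fun x => by
    simpa using ENNReal.rpow_sum_le_const_mul_sum_rpow (Finset.range T) (fun t => a t x) hP.le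
  refine ne_top_of_le_ne_top ?_ (lintegral_mono h)
  rw [lintegral_const_mul' _ _ (rpow_ne_top_of_nonneg (by linarith) (by simp)), lintegral_finsetSum _ fun t _ => (ha t).pow_const P]
  exact mul_ne_top (rpow_ne_top_of_nonneg (by linarith) (by simp)) (ENNReal.sum_ne_top.2 fun t _ => hfin t)

/-- The sum of averages is controlled by the sum, by duality with the maximal function. -/
theorem exists_lintegral_sum_avg_le {P : ℝ} (hP : 1 < P) : ∃ C : ℝ, 0 < C ∧ ∀ κ : ℕ → ℝ, (∀ t, 0 < κ t) → ∀ a : ℕ → Rn n → ℝ≥0∞,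
    (∀ t, Measurable (a t)) → (∀ t, ∫⁻ x, a t x ^ P ≠ ∞) → ∀ T : ℕ,
      ∫⁻ x, (∑ t ∈ Finset.range T, avg (n + 1) (κ t) (a t) x) ^ P ≠ ∞ ∧
      ∫⁻ x, (∑ t ∈ Finset.range T, avg (n + 1) (κ t) (a t) x) ^ P ≤ ofReal C * ∫⁻ x, (∑ t ∈ Finset.range T, a t x) ^ P := by
  obtain ⟨C, hC, hHL⟩ := exists_lintegral_iSup_avg_le (n := n) (L := n + 1) le_rfl hP
  have hpq : P.HolderConjugate (P / (P - 1)) := Real.HolderConjugate.conjExponent hP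
  obtain ⟨C', hC', hHL'⟩ := exists_lintegral_iSup_avg_le (n := n) (L := n + 1) le_rfl hpq.symm.lt
  have hP0 : 0 < P := by linarith
  refine ⟨(C' ^ (1 - 1 / P)) ^ P, by positivity, fun κ hκ a ha hfin T => ?_⟩
  have hav : ∀ t, Measurable (avg (n + 1) (κ t) (a t)) := fun t => measurable_avg _ _ (ha t)
  set S : Rn n → ℝ≥0∞ := fun x => ∑ t ∈ Finset.range T, avg (n + 1) (κ t) (a t) x with hS
  have hSm : Measurable S := Finset.measurable_sum _ fun t _ => hav t
  have hX : ∫⁻ x, S x ^ P ≠ ∞ := lintegral_sum_rpow_ne_top hP hav (fun t => by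
    refine ne_top_of_le_ne_top (mul_ne_top ofReal_ne_top (hfin t)) ((lintegral_mono fun x => ?_).trans (hHL (fun _ => κ t) (fun _ => hκ t) (a t) (ha t)))
    simp) T
  refine ⟨hX, ?_⟩
  have hqm : Measurable fun x => S x ^ (P - 1) := hSm.pow_const _
  have hpow : ∀ x, (S x ^ (P - 1)) ^ (P / (P - 1)) = S x ^ P := fun x => by
    rw [← rpow_mul]; congr 1; field_simp [(by linarith : P - 1 ≠ 0)]
  have key : ∫⁻ x, S x ^ P ≤ ofReal C' ^ (1 - 1 / P) * (∫⁻ x, S x ^ P) ^ (1 - 1 / P) * (∫⁻ x, (∑ t ∈ Finset.range T, a t x) ^ P) ^ (1 / P) := by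
    calc ∫⁻ x, S x ^ P = ∫⁻ x, ∑ t ∈ Finset.range T, S x ^ (P - 1) * avg (n + 1) (κ t) (a t) x := by
          refine lintegral_congr fun x => ?_
          rw [← mul_sum]
          change _ = S x ^ (P - 1) * S x
          conv_lhs => rw [show P = (P - 1) + 1 by ring]
          rw [rpow_add_of_nonneg _ _ (by linarith) zero_le_one, rpow_one]
      _ = ∫⁻ x, ∑ t ∈ Finset.range T, avg (n + 1) (κ t) (fun x => S x ^ (P - 1)) x * a t x := by
          rw [lintegral_finsetSum _ fun t _ => hqm.fun_mul (hav t), lintegral_finsetSum _ fun t _ => (measurable_avg _ _ hqm).fun_mul (ha t)]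
          exact sum_congr rfl fun t _ => lintegral_mul_avg _ _ hqm (ha t)
      _ ≤ ∫⁻ x, (∑ t ∈ Finset.range T, a t x) * ⨆ t, avg (n + 1) (κ t) (fun x => S x ^ (P - 1)) x := by
          refine lintegral_mono fun x => ?_
          rw [sum_mul]
          exact sum_le_sum fun t _ => (mul_comm _ _).trans_le (mul_le_mul' le_rfl (le_iSup (fun t => avg (n + 1) (κ t) (fun x => S x ^ (P - 1)) x) t))
      _ ≤ (∫⁻ x, (∑ t ∈ Finset.range T, a t x) ^ P) ^ (1 / P) * (∫⁻ x, (⨆ t, avg (n + 1) (κ t) (fun x => S x ^ (P - 1)) x) ^ (P / (P - 1))) ^ (1 / (P / (P - 1))) :=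
          ENNReal.lintegral_mul_le_Lp_mul_Lq _ hpq (Finset.measurable_sum _ fun t _ => ha t).aemeasurable
            (Measurable.iSup fun t => measurable_avg _ _ hqm).aemeasurable
      _ ≤ (∫⁻ x, (∑ t ∈ Finset.range T, a t x) ^ P) ^ (1 / P) * (ofReal C' * ∫⁻ x, S x ^ P) ^ (1 - 1 / P) := by
          have e1 : 1 / (P / (P - 1)) = 1 - 1 / P := by field_simp
          have e2 := hHL' κ hκ _ hqm
          simp only [hpow] at e2
          rw [e1]
          exact mul_le_mul' le_rfl (rpow_le_rpow e2 (by rw [sub_nonneg, div_le_one hP0]; exact hP.le))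
      _ = _ := by
          rw [mul_rpow_of_nonneg _ _ (by rw [sub_nonneg, div_le_one hP0]; exact hP.le)]
          ring
  have := le_rpow_mul_of_le_mul_rpow hP0 hX key
  rwa [ofReal_rpow_of_pos hC', ofReal_rpow_of_pos (by positivity)] at this

theorem sum_range_filter_le_tsum (G : ℤ → ℝ≥0∞) (T : ℕ) (z : ℤ) :
    ∑ t ∈ Finset.range T, G t ≤ (∑' u : ℕ, G (z + u)) + ∑ t ∈ (Finset.range T).filter (fun t : ℕ => (t : ℤ) < z), G t := by
  rw [← Finset.sum_filter_add_sum_filter_not (Finset.range T) (fun t : ℕ => (t : ℤ) < z), add_comm]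
  refine add_le_add ?_ le_rfl
  set S := (Finset.range T).filter (fun t : ℕ => ¬(t : ℤ) < z)
  have hz : ∀ t ∈ S, z + (((t : ℤ) - z).toNat : ℤ) = t := fun t ht => by
    have := (Finset.mem_filter.1 ht).2
    omega
  have hinj : Set.InjOn (fun t : ℕ => ((t : ℤ) - z).toNat) S := fun t ht t' ht' h => by
    have h1 := hz t ht
    have h2 := hz t' ht'
    simp only at h
    omega
  calc ∑ t ∈ S, G t = ∑ t ∈ S, G (z + (((t : ℤ) - z).toNat : ℕ)) := sum_congr rfl fun t ht => by rw [hz t ht]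
    _ = ∑ u ∈ S.image (fun t : ℕ => ((t : ℤ) - z).toNat), G (z + u) :=
        (Finset.sum_image (f := fun u : ℕ => G (z + u)) hinj).symm
    _ ≤ _ := ENNReal.sum_le_tsum _

theorem sum_range_le_tsum_add (G : ℤ → ℝ≥0∞) (T t' : ℕ) (N : ℤ) :
    ∑ t ∈ (Finset.range T).filter (fun t => t' ≤ t), G t ≤
      (∑' u : ℕ, G (t' + N + u)) + ∑ i ∈ Finset.range N.toNat, G (t' + N - (i + 1)) := by
  have h := sum_range_filter_le_tsum (fun z => if (t' : ℤ) ≤ z then G z else 0) T (t' + N)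
  rw [Finset.sum_filter]
  simp only [Nat.cast_le] at h
  refine h.trans (add_le_add (tsum_le_tsum fun u => by split_ifs <;> simp) ?_)
  rw [← Finset.sum_filter]
  set S := ((Finset.range T).filter (fun t : ℕ => (t : ℤ) < t' + N)).filter (fun t => t' ≤ t) with hS
  have hz : ∀ t ∈ S, (t' : ℤ) + N - (((t' + N - 1 - t).toNat : ℤ) + 1) = t ∧ (t' + N - 1 - t).toNat ∈ Finset.range N.toNat := fun t ht => by
    simp only [hS, Finset.mem_filter, Finset.mem_range] at ht ⊢
    omega
  have hinj : Set.InjOn (fun t : ℕ => ((t' : ℤ) + N - 1 - t).toNat) S := fun t ht t₂ ht₂ h => by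
    have h1 := (hz t ht).1
    have h2 := (hz t₂ ht₂).1
    simp only at h
    omega
  calc ∑ t ∈ S, G t = ∑ t ∈ S, G (t' + N - (((t' + N - 1 - t).toNat : ℕ) + 1)) := sum_congr rfl fun t ht => by rw [(hz t ht).1]
    _ = ∑ u ∈ S.image (fun t : ℕ => ((t' : ℤ) + N - 1 - t).toNat), G (t' + N - (u + 1)) :=
        (Finset.sum_image (f := fun u : ℕ => G ((t' : ℤ) + N - (u + 1))) hinj).symm
    _ ≤ _ := Finset.sum_le_sum_of_subset (Finset.image_subset_iff.2 fun t ht => (hz t ht).2)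

theorem mul_rpow_avg_slow {q : ℝ} {κ : ℕ → ℝ} (hκ : ∀ t, 0 < κ t) (hmono : Monotone κ) (a : ℕ → Rn n → ℝ≥0∞)
    (hfin : ∀ t x, avg (n + 1) (κ t) (a t) x ≠ ∞) (t : ℕ) (x y : Rn n) :
    avg (n + 1) (κ t) (a t) x * (∑ i ∈ Finset.range (t + 1), avg (n + 1) (κ i) (a i) x) ^ (q - 1) ≤
      1 * ofReal ((1 + κ t * ‖x - y‖) ^ ⌈((n : ℝ) + 1) * (1 + |q - 1|)⌉₊) *
        (avg (n + 1) (κ t) (a t) y * (∑ i ∈ Finset.range (t + 1), avg (n + 1) (κ i) (a i) y) ^ (q - 1)) := by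
  have h1 : 1 ≤ 1 + κ t * ‖x - y‖ := by
    have := hκ t
    have : 0 ≤ κ t * ‖x - y‖ := by positivity
    linarith
  have hsum : ∀ x y, ∑ i ∈ Finset.range (t + 1), avg (n + 1) (κ i) (a i) x ≤
      ofReal ((1 + κ t * ‖x - y‖) ^ (n + 1)) * ∑ i ∈ Finset.range (t + 1), avg (n + 1) (κ i) (a i) y := fun x y => by
    rw [mul_sum]
    refine sum_le_sum fun i hi => (avg_slow (n + 1) (hκ i) (a i) x y).trans (mul_le_mul' (ofReal_le_ofReal ?_) le_rfl)
    have := hmono (Nat.lt_succ_iff.1 (Finset.mem_range.1 hi))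
    have := hκ i
    gcongr
  have hs := hsum y x
  rw [norm_sub_rev] at hs
  refine (mul_rpow_slow (by rw [← ofReal_one]; exact ofReal_le_ofReal (one_le_pow₀ h1)) ofReal_ne_top
    (ENNReal.sum_ne_top.2 fun i _ => hfin i x) (avg_slow (n + 1) (hκ t) (a t) x y) (hsum x y) hs).trans (mul_le_mul' ?_ le_rfl)
  rw [one_mul, ofReal_rpow_of_pos (by positivity), ← rpow_natCast, ← Real.rpow_mul (by linarith), ← rpow_natCast]
  refine ofReal_le_ofReal (Real.rpow_le_rpow_of_exponent_le h1 ?_)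
  push_cast
  exact Nat.le_ceil _

theorem sum_lintegral_mul_le {ι : Type*} [Countable ι] {P : ℝ} (hP : 1 < P) {g : ι → Rn n → ℝ≥0∞} (hg : ∀ s, Measurable (g s)) {D : ℕ → Rn n → ℝ≥0∞} {S : Rn n → ℝ≥0∞}
    (hD : ∀ t, Measurable (D t)) (hS : Measurable S) {c : ℝ≥0∞} (hc : c ≠ ∞) (T : ℕ) (hDS : ∀ x, ∑ t ∈ Finset.range T, D t x ≤ c * S x ^ (P - 1)) (φ : ℕ → ι) :
    ∑ t ∈ Finset.range T, ∫⁻ x, D t x * g (φ t) x ≤ c * (∫⁻ x, S x ^ P) ^ (1 - 1 / P) * (∑' s, ∫⁻ x, g s x ^ P) ^ (1 / P) := by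
  have hP0 : 0 < P := by linarith
  have hpq : (P / (P - 1)).HolderConjugate P := (Real.HolderConjugate.conjExponent hP).symm
  have hGm : Measurable fun x => (∑' s, g s x ^ P) ^ (1 / P) := (Measurable.tsum fun s => (hg s).pow_const P).pow_const _
  have hle : ∀ s x, g s x ≤ (∑' s, g s x ^ P) ^ (1 / P) := fun s x => by
    calc g s x = (g s x ^ P) ^ (1 / P) := by rw [← rpow_mul, mul_one_div_cancel hP0.ne', rpow_one]
      _ ≤ _ := rpow_le_rpow (ENNReal.le_tsum s) (by positivity)
  rw [← lintegral_finsetSum _ fun t _ => (hD t).fun_mul (hg _)]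
  calc _ ≤ ∫⁻ x, c * (S x ^ (P - 1) * (∑' s, g s x ^ P) ^ (1 / P)) := by
        refine lintegral_mono fun x => ?_
        rw [← mul_assoc]
        refine le_trans ?_ (mul_le_mul' (hDS x) le_rfl)
        rw [sum_mul]
        exact sum_le_sum fun t _ => mul_le_mul' le_rfl (hle _ x)
    _ ≤ c * ((∫⁻ x, (S x ^ (P - 1)) ^ (P / (P - 1))) ^ (1 / (P / (P - 1))) * (∫⁻ x, ((∑' s, g s x ^ P) ^ (1 / P)) ^ P) ^ (1 / P)) := by
        rw [lintegral_const_mul' _ _ hc]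
        exact mul_le_mul' le_rfl (ENNReal.lintegral_mul_le_Lp_mul_Lq _ hpq (hS.pow_const _).aemeasurable hGm.aemeasurable)
    _ = _ := by
        have e1 : 1 / (P / (P - 1)) = 1 - 1 / P := by field_simp
        have e2 : ∀ x, (S x ^ (P - 1)) ^ (P / (P - 1)) = S x ^ P := fun x => by
          rw [← rpow_mul]; congr 1; field_simp [(by linarith : P - 1 ≠ 0)]
        have e3 : ∀ x, ((∑' s, g s x ^ P) ^ (1 / P)) ^ P = ∑' s, g s x ^ P := fun x => by
          rw [← rpow_mul, one_div_mul_cancel hP0.ne', rpow_one]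
        simp only [e1, e2, e3]
        rw [lintegral_tsum fun s => ((hg s).pow_const P).aemeasurable, mul_assoc]

theorem sum_range_ofReal_geom_le {ρ : ℝ} (h0 : 0 < ρ) (h1 : ρ < 1) (M : ℕ) :
    ∑ i ∈ Finset.range M, ofReal (ρ ^ (M - 1 - i)) ≤ ofReal (1 - ρ)⁻¹ := by
  rw [Finset.sum_range_reflect (fun i => ofReal (ρ ^ i)) M, ← ENNReal.ofReal_sum_of_nonneg fun i _ => by positivity]
  refine ofReal_le_ofReal ?_
  rw [← tsum_geometric_of_lt_one h0.le h1]
  exact (summable_geometric_of_lt_one h0.le h1).sum_le_tsum _ fun i _ => by positivity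

theorem sum_lintegral_rpow_le_of_le {P c1 : ℝ} (hP : 1 < P) (hc1 : 0 < c1) {a α : ℕ → Rn n → ℝ≥0∞} (ha : ∀ t, Measurable (a t)) (hα : ∀ t, Measurable (α t))
    (hafin : ∀ t x, a t x ≠ ∞) (hαfin : ∀ t x, α t x ≠ ∞) (h : ∀ t x, a t x ≤ ofReal c1 * α t x) (T : ℕ) :
    ∫⁻ x, (∑ t ∈ Finset.range T, a t x) ^ P ≤ (ofReal P * ofReal c1 ^ (P - 1) * ofReal (max 1 (P - 1))) *
      ∑ t' ∈ Finset.range T, ∑ t ∈ (Finset.range T).filter (fun t => t' ≤ t),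
        ∫⁻ x, (α t' x * (∑ i ∈ Finset.range (t' + 1), α i x) ^ (P - 1 - 1)) * a t x := by
  have hq : 0 < P - 1 := by linarith
  set D : ℕ → Rn n → ℝ≥0∞ := fun t' x => α t' x * (∑ i ∈ Finset.range (t' + 1), α i x) ^ (P - 1 - 1) with hD
  have hDm : ∀ t, Measurable (D t) := fun t => (hα t).mul ((measurable_fun_sum _ fun i _ => hα i).pow_const _)
  have hpt : ∀ x, (∑ t ∈ Finset.range T, a t x) ^ P ≤ (ofReal P * ofReal c1 ^ (P - 1) * ofReal (max 1 (P - 1))) *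
      ∑ t ∈ Finset.range T, ∑ t' ∈ Finset.range (t + 1), D t' x * a t x := fun x => by
    refine (sum_rpow_telescope (by linarith : 0 < P) (fun t => hafin t x) T).1.trans ?_
    rw [max_eq_right hP.le, mul_assoc, mul_assoc]
    refine mul_le_mul' le_rfl ?_
    rw [mul_sum, mul_sum]
    refine sum_le_sum fun t _ => ?_
    rw [← sum_mul, ← mul_assoc, ← mul_assoc, mul_comm (a t x)]
    refine mul_le_mul' ?_ le_rfl
    calc _ ≤ (ofReal c1 * ∑ i ∈ Finset.range (t + 1), α i x) ^ (P - 1) := by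
          refine rpow_le_rpow ?_ hq.le
          rw [mul_sum]
          exact sum_le_sum fun i _ => h i x
      _ ≤ _ := by
          rw [mul_rpow_of_nonneg _ _ hq.le, mul_assoc]
          exact mul_le_mul' le_rfl (sum_rpow_telescope hq (fun t => hαfin t x) (t + 1)).1
  refine (lintegral_mono hpt).trans (le_of_eq ?_)
  have hm : ∀ t t', Measurable fun x => D t' x * a t x := fun t t' => (hDm t').mul (ha t)
  rw [lintegral_const_mul' _ _ (mul_ne_top (mul_ne_top ofReal_ne_top
    (rpow_ne_top_of_nonneg hq.le ofReal_ne_top)) ofReal_ne_top),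
    lintegral_finsetSum _ fun t _ => measurable_fun_sum _ fun t' _ => hm t t']
  simp only [lintegral_finsetSum _ fun t' _ => hm _ t']
  congr 1
  refine Finset.sum_comm' fun t t' => ?_
  simp only [Finset.mem_range, Finset.mem_filter]
  omega

theorem rpow_decay_eq {P δ C3 : ℝ} (hP : 0 < P) (hC3 : 0 < C3) {lam : ℝ} {N : ℤ} (hlam : lam = (2 : ℝ) ^ N) {i : ℕ} (hi : i < N.toNat) (Y : ℝ≥0∞) :
    (ofReal (C3 * (lam ^ n)⁻¹ * (lam / 2 ^ (i + 1)) ^ (-δ)) * Y) ^ (1 / P) =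
      ofReal C3 ^ (1 / P) * (ofReal (lam ^ n)⁻¹ * Y) ^ (1 / P) * ofReal (((2 : ℝ) ^ (-δ / P)) ^ (N.toNat - 1 - i)) := by
  have hl : 0 < lam := by rw [hlam]; positivity
  have h1 : lam / 2 ^ (i + 1) = (2 : ℝ) ^ (((N.toNat - 1 - i : ℕ) : ℝ)) := by
    rw [hlam, rpow_natCast, div_eq_iff (by positivity), ← pow_add, ← zpow_natCast]
    congr 1; omega
  have hP' : 0 ≤ 1 / P := by positivity
  rw [h1, ← Real.rpow_mul (by norm_num), ofReal_mul (by positivity), ofReal_mul hC3.le, mul_rpow_of_nonneg _ _ hP',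
    mul_rpow_of_nonneg _ _ hP', mul_rpow_of_nonneg _ _ hP', mul_rpow_of_nonneg _ _ hP',
    ofReal_rpow_of_pos (p := 1 / P) (x := (2 : ℝ) ^ _) (by positivity), ← rpow_natCast ((2 : ℝ) ^ (-δ / P)), ← Real.rpow_mul (by norm_num), ← Real.rpow_mul (by norm_num),
    show ((N.toNat - 1 - i : ℕ) : ℝ) * -δ * (1 / P) = -δ / P * ((N.toNat - 1 - i : ℕ) : ℝ) by ring]
  ring

theorem rpow_coarse_le {P : ℝ} (hP : ((n : ℝ) + 1) / (n - 1) < P) {lam : ℝ} (hl : 1 / 2 ≤ lam) :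
    (lam ^ (n - 1))⁻¹ ≤ 2 ^ n * ((lam ^ n)⁻¹) ^ (1 / P) := by
  have hn2 : 2 ≤ n := Fact.out
  have hn : (2 : ℝ) ≤ n := by exact_mod_cast hn2
  have hP1 := one_lt_of_exponent_lt hP
  have hl0 : 0 < lam := by linarith
  have h1 : (n : ℝ) / P ≤ n - 1 := by
    rw [div_lt_iff₀ (by linarith)] at hP
    rw [div_le_iff₀ (by linarith)]
    nlinarith
  have h2 : (0 : ℝ) ≤ n / P := by positivity
  have e1 : ((lam ^ n)⁻¹) ^ (1 / P) = lam ^ (-((n : ℝ) / P)) := by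
    rw [← rpow_natCast, ← Real.rpow_neg hl0.le, ← Real.rpow_mul hl0.le]; congr 1; ring
  have e2 : (lam ^ (n - 1))⁻¹ = lam ^ (-((n : ℝ) - 1 - n / P)) * lam ^ (-((n : ℝ) / P)) := by
    rw [← Real.rpow_add hl0, ← rpow_natCast, ← Real.rpow_neg hl0.le, Nat.cast_sub (by omega)]; congr 1; push_cast; ring
  rw [e1, e2]
  refine mul_le_mul_of_nonneg_right ?_ (by positivity)
  calc lam ^ (-((n : ℝ) - 1 - n / P)) ≤ (1 / 2 : ℝ) ^ (-((n : ℝ) - 1 - n / P)) :=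
        Real.rpow_le_rpow_of_nonpos (by norm_num) hl (by linarith)
    _ = 2 ^ ((n : ℝ) - 1 - n / P) := by rw [one_div, Real.inv_rpow (by norm_num), ← Real.rpow_neg (by norm_num), neg_neg]
    _ ≤ 2 ^ (n : ℝ) := Real.rpow_le_rpow_of_exponent_le (by norm_num) (by linarith)
    _ = _ := rpow_natCast _ _

theorem exists_lintegral_sum_sqS_le (b m : 𝓢(Rn n, ℂ)) (hb : AnnulusSupported b)
    (hm : AnnulusSupported m) (hm1 : ∀ ξ, ‖m ξ‖ ≤ 1) {P : ℝ} (hP : ((n : ℝ) + 1) / (n - 1) < P) :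
    ∃ C : ℝ≥0∞, C ≠ ∞ ∧ ∀ N : ℤ, -1 ≤ N → ∀ lam : ℝ, lam = (2 : ℝ) ^ N → ∀ f : Rn n → ℂ, Integrable f → Measurable f → ∫⁻ x, ‖f x‖ₑ ^ 2 ≠ ∞ → ∀ (s1 : ℤ) (T : ℕ),
    ∫⁻ x, (∑ t ∈ Finset.range T, sqS b m lam (s1 - t) f x) ^ P ≤ C * (ofReal (lam ^ n)⁻¹ * ∫⁻ x, ‖f x‖ₑ ^ (2 * P)) := by
  have hn := two_le_dim (n := n)
  have hP1 := one_lt_of_exponent_lt hP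
  have hP0 : 0 < P := by linarith
  have hq : 0 < P - 1 := by linarith
  have hPle : 0 ≤ 1 - 1 / P := by rw [sub_nonneg, div_le_one hP0]; exact hP1.le
  obtain ⟨m', hm'1, -, -⟩ := exists_annulus_symbol (n := n)
  obtain ⟨C1, hC1, h1⟩ := exists_sqS_le_avg b hb (m := m) (m' := m') (fun ξ hξ => hm'1 ξ (hm ξ hξ).1 (hm ξ hξ).2) (L := n + 1) le_rfl
  obtain ⟨C2, hC2, h2⟩ := exists_lintegral_sum_avg_le (n := n) hP1
  set e : ℕ := ⌈((n : ℝ) + 1) * (1 + |P - 1 - 1|)⌉₊ with he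
  obtain ⟨C4, hC4, h4⟩ := exists_tsum_lintegral_slow_sqS_le b m hb hm hm1 e
  obtain ⟨C3, hC3, δ, hδ, h3⟩ := exists_tsum_lintegral_avg_sqS_le b m hb hm hm1 hP
  obtain ⟨C5, -, h5⟩ := exists_tsum_lintegral_sqS_le b m hb hm hm1
  set c0 : ℝ≥0∞ := ofReal P * ofReal C1 ^ (P - 1) * ofReal (max 1 (P - 1)) with hc0
  set c3 : ℝ≥0∞ := ofReal (min 1 (P - 1))⁻¹ with hc3
  set I := omI n (n + 1 + (n + 1) + e) with hI
  set ρ : ℝ := (2 : ℝ) ^ (-δ / P) with hρ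
  have hI0 : I ≠ 0 := omI_ne_zero _
  have hIt : I ≠ ∞ := omI_ne_top (by omega)
  have hρ0 : 0 < ρ := by positivity
  have hρ1 : ρ < 1 := Real.rpow_lt_one_of_one_lt_of_neg (by norm_num) (div_neg_of_neg_of_pos (by linarith) hP0)
  set K : ℝ≥0∞ := c0 * (c3 * (ofReal (C4 * 2 ^ n) + I⁻¹ * (ofReal C3 ^ (1 / P) * ofReal (1 - ρ)⁻¹))) with hK
  have hc0t : c0 ≠ ∞ := mul_ne_top (mul_ne_top ofReal_ne_top
    (rpow_ne_top_of_nonneg hq.le ofReal_ne_top)) ofReal_ne_top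
  have hKt : K ≠ ∞ := mul_ne_top hc0t (mul_ne_top ofReal_ne_top (ENNReal.add_ne_top.2 ⟨ofReal_ne_top,
    mul_ne_top (ENNReal.inv_ne_top.2 hI0) (mul_ne_top (rpow_ne_top_of_nonneg (by positivity) ofReal_ne_top) ofReal_ne_top)⟩))
  refine ⟨(K * ofReal C2 ^ (1 - 1 / P)) ^ P, rpow_ne_top_of_nonneg hP0.le
    (mul_ne_top hKt (rpow_ne_top_of_nonneg hPle ofReal_ne_top)), fun N hN lam hlamN f hf hfm hf2 s1 T => ?_⟩
  have hl0 : 0 < lam := by rw [hlamN]; positivity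
  have hl : 1 / 2 ≤ lam := by
    rw [hlamN]; exact le_trans (by norm_num) (zpow_le_zpow_right₀ (by norm_num : (1 : ℝ) ≤ 2) hN)
  set Y := ∫⁻ x, ‖f x‖ₑ ^ (2 * P) with hY
  set κ : ℕ → ℝ := fun t => lam * (2 : ℝ) ^ (-(s1 - t : ℤ)) with hκdef
  have hκN : ∀ t, κ t = (2 : ℝ) ^ (N - s1 + t) := fun t => by
    simp only [hκdef]
    rw [hlamN, ← zpow_add₀ (by norm_num)]; congr 1; ring
  have hκ : ∀ t, 0 < κ t := fun t => by positivity
  have hmono : Monotone κ := fun t t' h => mul_le_mul_of_nonneg_left (zpow_le_zpow_right₀ (by norm_num) (by omega)) hl0.le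
  set a : ℕ → Rn n → ℝ≥0∞ := fun t => sqS b m lam (s1 - t) f with hadef
  have ha : ∀ t, Measurable (a t) := fun t => measurable_sqS b m lam _ hf
  have hasum : ∀ t, ∫⁻ x, a t x ≠ ∞ := fun t => ne_top_of_le_ne_top (mul_ne_top ofReal_ne_top hf2)
    ((ENNReal.le_tsum (f := fun s : ℤ => ∫⁻ x, sqS b m lam s f x) (s1 - t)).trans (h5 lam hl f hf))
  have hafin : ∀ t x, a t x ≠ ∞ := fun t x => by
    obtain ⟨M, hM, h⟩ := exists_sqS_bound b m hb hl0 (s1 - t) hf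
    exact ne_top_of_le_ne_top hM (h x)
  have haP : ∀ t, ∫⁻ x, a t x ^ P ≠ ∞ := fun t => by
    obtain ⟨M, hM, h⟩ := exists_sqS_bound b m hb hl0 (s1 - t) hf
    refine ne_top_of_le_ne_top (mul_ne_top (rpow_ne_top_of_nonneg hq.le hM) (hasum t)) ?_
    rw [← lintegral_const_mul' _ _ (rpow_ne_top_of_nonneg hq.le hM)]
    refine lintegral_mono fun x => ?_
    calc a t x ^ P = a t x ^ (P - 1) * a t x := by
          conv_lhs => rw [show P = (P - 1) + 1 by ring]
          rw [rpow_add_of_nonneg _ _ hq.le zero_le_one, rpow_one]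
      _ ≤ _ := mul_le_mul' (rpow_le_rpow (h x) hq.le) le_rfl
  set α : ℕ → Rn n → ℝ≥0∞ := fun t => avg (n + 1) (κ t) (a t) with hαdef
  have hα : ∀ t, Measurable (α t) := fun t => measurable_avg _ _ (ha t)
  have hαfin : ∀ t x, α t x ≠ ∞ := fun t x => ne_top_of_le_ne_top (mul_ne_top ofReal_ne_top (hasum t)) (avg_le_sup _ (hκ t) _ x)
  obtain ⟨hXt, hXZ⟩ := h2 κ hκ a ha haP T
  have hZt := lintegral_sum_rpow_ne_top hP1 ha haP T
  change ∫⁻ x, (∑ t ∈ Finset.range T, a t x) ^ P ≤ _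
  set Z := ∫⁻ x, (∑ t ∈ Finset.range T, a t x) ^ P with hZ
  set X := ∫⁻ x, (∑ t ∈ Finset.range T, avg (n + 1) (κ t) (a t) x) ^ P with hX
  set W := ofReal (lam ^ n)⁻¹ * Y with hW
  set D : ℕ → Rn n → ℝ≥0∞ := fun t' x => α t' x * (∑ i ∈ Finset.range (t' + 1), α i x) ^ (P - 1 - 1) with hD
  have hDm : ∀ t, Measurable (D t) := fun t => (hα t).mul ((measurable_fun_sum _ fun i _ => hα i).pow_const _)
  have hDslow : ∀ t x y, D t x ≤ 1 * ofReal ((1 + κ t * ‖x - y‖) ^ e) * D t y := fun t x y =>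
    mul_rpow_avg_slow (q := P - 1) hκ hmono a hαfin t x y
  have hSm : Measurable fun x => ∑ t ∈ Finset.range T, α t x := measurable_fun_sum _ fun t _ => hα t
  have hDS : ∀ x, ∑ t ∈ Finset.range T, D t x ≤ c3 * (∑ t ∈ Finset.range T, α t x) ^ (P - 1) := fun x => by
    have h := (sum_rpow_telescope hq (fun t => hαfin t x) T).2
    have hmin : 0 < min 1 (P - 1) := lt_min zero_lt_one hq
    calc _ = c3 * (ofReal (min 1 (P - 1)) * ∑ t ∈ Finset.range T, D t x) := by
          rw [← mul_assoc, hc3, ← ofReal_mul (by positivity), inv_mul_cancel₀ hmin.ne', ofReal_one, one_mul]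
      _ ≤ _ := mul_le_mul' le_rfl h
  have hcoarse : ∑ t' ∈ Finset.range T, ∑' u : ℕ, ∫⁻ x, D t' x * sqS b m lam (s1 - (t' + N + u)) f x ≤
      ofReal (C4 * 2 ^ n) * (c3 * X ^ (1 - 1 / P) * W ^ (1 / P)) := by
    have hh : ∀ t' ∈ Finset.range T, ∑' u : ℕ, ∫⁻ x, D t' x * sqS b m lam (s1 - (t' + N + u)) f x ≤
        ofReal (C4 * (lam ^ (n - 1))⁻¹) * ∫⁻ x, D t' x * ‖f x‖ₑ ^ 2 := fun t' _ => by
      have := h4 lam hl (s1 - t' - N) 1 ENNReal.one_ne_top (D t') (hDm t') (fun x y => by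
        rw [show (2 : ℝ) ^ (-(s1 - t' - N)) = κ t' by rw [hκN]; congr 1; ring]
        exact hDslow t' x y) f hf
      rw [one_pow, mul_one] at this
      refine le_trans (le_of_eq (tsum_congr fun u => ?_)) this
      rw [show s1 - (t' + N + u) = s1 - t' - N - u by ring]
    refine (sum_le_sum hh).trans ?_
    rw [← mul_sum]
    have h6 := sum_lintegral_mul_le hP1 (g := fun (_ : Unit) x => ‖f x‖ₑ ^ 2) (fun _ => hfm.enorm.pow_const 2) hDm hSm ofReal_ne_top T hDS (fun _ => ())
    have h7 : ∀ x, (‖f x‖ₑ ^ 2) ^ P = ‖f x‖ₑ ^ (2 * P) := fun x => by rw [rpow_mul, ENNReal.rpow_two]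
    simp only [tsum_fintype, Finset.univ_unique, Finset.sum_singleton, h7] at h6
    calc _ ≤ ofReal (C4 * (2 ^ n * ((lam ^ n)⁻¹) ^ (1 / P))) * (c3 * X ^ (1 - 1 / P) * Y ^ (1 / P)) :=
          mul_le_mul' (ofReal_le_ofReal (mul_le_mul_of_nonneg_left (rpow_coarse_le hP hl) hC4.le)) h6
      _ = _ := by
          rw [hW, mul_rpow_of_nonneg _ _ (by positivity), ofReal_rpow_of_pos (by positivity), ← mul_assoc C4, ofReal_mul (by positivity)]
          ring
  have hfine : ∀ i ∈ Finset.range N.toNat, ∑ t' ∈ Finset.range T, ∫⁻ x, D t' x * sqS b m lam (s1 - (t' + N - (i + 1))) f x ≤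
      (I⁻¹ * (c3 * X ^ (1 - 1 / P) * (ofReal C3 ^ (1 / P) * W ^ (1 / P)))) * ofReal (ρ ^ (N.toNat - 1 - i)) := fun i hi => by
    have hiN := Finset.mem_range.1 hi
    have hh : ∀ t' ∈ Finset.range T, ∫⁻ x, D t' x * sqS b m lam (s1 - (t' + N - (i + 1))) f x ≤
        I⁻¹ * ∫⁻ x, D t' x * avg (n + 1 + (n + 1)) ((2 : ℝ) ^ (i + 1) * (2 : ℝ) ^ (-(s1 - (t' + N - (i + 1))))) (sqS b m lam (s1 - (t' + N - (i + 1))) f) x := fun t' _ => by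
      have hk : (2 : ℝ) ^ (i + 1) * (2 : ℝ) ^ (-(s1 - (t' + N - (i + 1)))) = κ t' := by
        rw [hκN, ← zpow_natCast, ← zpow_add₀ (by norm_num)]; congr 1; push_cast; ring
      rw [hk, lintegral_mul_avg _ _ (hDm t') (measurable_sqS b m lam _ hf), ← lintegral_const_mul' _ _ (ENNReal.inv_ne_top.2 hI0)]
      refine lintegral_mono fun x => ?_
      rw [← mul_assoc]
      refine mul_le_mul' ?_ le_rfl
      have := le_avg_of_slow (n + 1 + (n + 1)) e (hκ t') ENNReal.one_ne_top (hDslow t') x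
      rw [one_mul] at this
      rwa [mul_comm, ← div_eq_mul_inv, ENNReal.le_div_iff_mul_le (Or.inl hI0) (Or.inl hIt), mul_comm]
    refine (sum_le_sum hh).trans ?_
    rw [← mul_sum, mul_assoc I⁻¹]
    refine mul_le_mul' le_rfl ?_
    have h6 := sum_lintegral_mul_le hP1 (g := fun s : ℤ => avg (n + 1 + (n + 1)) ((2 : ℝ) ^ (i + 1) * (2 : ℝ) ^ (-s)) (sqS b m lam s f))
      (fun s => measurable_avg _ _ (measurable_sqS b m lam s hf)) hDm hSm ofReal_ne_top T hDS (fun t' => s1 - (t' + N - (i + 1)))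
    refine h6.trans ?_
    rw [mul_assoc (c3 * _)]
    refine mul_le_mul' le_rfl ?_
    rw [← rpow_decay_eq hP0 hC3 hlamN hiN]
    refine rpow_le_rpow (h3 _ lam (one_le_pow₀ (by norm_num)) ?_ f hf hfm) (by positivity)
    rw [hlamN, ← zpow_natCast]
    exact zpow_le_zpow_right₀ (by norm_num) (by omega)
  have key : Z ≤ (K * ofReal C2 ^ (1 - 1 / P)) * Z ^ (1 - 1 / P) * W ^ (1 / P) := by
    have hX' : X ^ (1 - 1 / P) ≤ ofReal C2 ^ (1 - 1 / P) * Z ^ (1 - 1 / P) := by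
      rw [← mul_rpow_of_nonneg _ _ hPle]
      exact rpow_le_rpow hXZ hPle
    calc Z ≤ c0 * ∑ t' ∈ Finset.range T, ∑ t ∈ (Finset.range T).filter (fun t => t' ≤ t), ∫⁻ x, D t' x * a t x :=
          sum_lintegral_rpow_le_of_le hP1 hC1 ha hα hafin hαfin (fun t x => h1 lam hl0 _ f hf x) T
      _ ≤ c0 * ∑ t' ∈ Finset.range T, ((∑' u : ℕ, ∫⁻ x, D t' x * sqS b m lam (s1 - (t' + N + u)) f x) +
            ∑ i ∈ Finset.range N.toNat, ∫⁻ x, D t' x * sqS b m lam (s1 - (t' + N - (i + 1))) f x) :=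
          mul_le_mul' le_rfl (sum_le_sum fun t' _ => sum_range_le_tsum_add (fun z => ∫⁻ x, D t' x * sqS b m lam (s1 - z) f x) T t' N)
      _ ≤ c0 * (ofReal (C4 * 2 ^ n) * (c3 * X ^ (1 - 1 / P) * W ^ (1 / P)) +
            (I⁻¹ * (c3 * X ^ (1 - 1 / P) * (ofReal C3 ^ (1 / P) * W ^ (1 / P)))) * ofReal (1 - ρ)⁻¹) := by
          rw [Finset.sum_add_distrib, Finset.sum_comm (t := Finset.range N.toNat)]
          refine mul_le_mul' le_rfl (add_le_add hcoarse ((sum_le_sum hfine).trans ?_))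
          rw [← mul_sum]
          exact mul_le_mul' le_rfl (sum_range_ofReal_geom_le hρ0 hρ1 _)
      _ = K * X ^ (1 - 1 / P) * W ^ (1 / P) := by rw [hK]; ring
      _ ≤ _ := by
          rw [mul_assoc K (ofReal C2 ^ _)]
          gcongr
  exact le_rpow_mul_of_le_mul_rpow hP0 hZt key

theorem exists_lintegral_tsum_sqS_le (b m : 𝓢(Rn n, ℂ)) (hb : AnnulusSupported b)
    (hm : AnnulusSupported m) (hm1 : ∀ ξ, ‖m ξ‖ ≤ 1) {P : ℝ} (hP : ((n : ℝ) + 1) / (n - 1) < P) :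
    ∃ C : ℝ≥0∞, C ≠ ∞ ∧ ∀ N : ℤ, -1 ≤ N → ∀ lam : ℝ, lam = (2 : ℝ) ^ N → ∀ f : Rn n → ℂ, Integrable f → Measurable f → ∫⁻ x, ‖f x‖ₑ ^ 2 ≠ ∞ →
    ∫⁻ x, (∑' s : ℤ, sqS b m lam s f x) ^ P ≤ C * (ofReal (lam ^ n)⁻¹ * ∫⁻ x, ‖f x‖ₑ ^ (2 * P)) := by
  have hn := two_le_dim (n := n)
  have hP0 : 0 < P := lt_of_le_of_lt (by apply div_nonneg <;> linarith) hP
  obtain ⟨C, hC, h⟩ := exists_lintegral_sum_sqS_le b m hb hm hm1 hP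
  refine ⟨C, hC, fun N hN lam hl f hf hfm hf2 => ?_⟩
  have hinj : ∀ M : ℕ, Function.Injective fun t : ℕ => (M : ℤ) - t := fun M t t' ht => by
    simp only at ht; omega
  set S : ℕ → Finset ℤ := fun M => Finset.Icc (-(M : ℤ)) M with hS
  have hSe : ∀ M, S M = (Finset.range (2 * M + 1)).image fun t : ℕ => (M : ℤ) - t := fun M => by
    ext z
    simp only [hS, Finset.mem_Icc, Finset.mem_image, Finset.mem_range]
    exact ⟨fun hz => ⟨((M : ℤ) - z).toNat, by omega, by omega⟩, by rintro ⟨t, ht, rfl⟩; omega⟩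
  have hmonoS : Monotone S := fun M M' hM => Finset.Icc_subset_Icc (by omega) (by omega)
  have htsum : ∀ x, (∑' s : ℤ, sqS b m lam s f x) ^ P = ⨆ M, (∑ s ∈ S M, sqS b m lam s f x) ^ P := fun x => by
    rw [ENNReal.tsum_eq_iSup_sum' S fun t => ?_]
    · exact (ENNReal.orderIsoRpow P hP0).map_iSup _
    · refine ⟨t.sup Int.natAbs, fun z hz => ?_⟩
      have := Finset.le_sup (f := Int.natAbs) hz
      simp only [hS, Finset.mem_Icc]
      omega
  simp only [htsum]
  rw [lintegral_iSup (fun M => (measurable_fun_sum _ fun s _ => measurable_sqS b m lam s hf).pow_const P)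
    (fun M M' hM x => rpow_le_rpow (Finset.sum_le_sum_of_subset (hmonoS hM)) hP0.le)]
  refine iSup_le fun M => ?_
  have := h N hN lam hl f hf hfm hf2 M (2 * M + 1)
  simp only [hSe, Finset.sum_image (hinj M).injOn]
  exact this

end SquareFunction

section Besov

theorem IsLPCutoff.zero {ψ : ℝ → ℝ} (hψ : IsLPCutoff ψ) : ψ 0 = 0 := by
  by_contra h
  have := (hψ.2.2.1 0 h).1
  norm_num at this

/-- A Bernstein inequality for functions with compactly supported Fourier transform. -/
theorem eLpNorm_fourierInv_le {r : ℝ} (hr : 2 ≤ r) {R : ℝ} (hR : 1 ≤ R) {h : ℝ → ℂ} (hh : Integrable h) (hs : ∀ τ, h τ ≠ 0 → |τ| ≤ R) :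
    eLpNorm (𝓕⁻ h) (ofReal r) volume ≤ ofReal (2 * R ^ (1 / 2 - 1 / r)) * (∫⁻ τ, ‖h τ‖ₑ ^ 2) ^ (1 / 2 : ℝ) := by
  have hr0 : 0 < r := by linarith
  have hr1 : 0 < 1 / r := by positivity
  set Q := ∫⁻ τ, ‖h τ‖ₑ ^ 2 with hQ
  have hsup : ∀ x, ‖𝓕⁻ h x‖ₑ ^ 2 ≤ ofReal (2 * R) * Q := fun x => by
    have h1 : ‖𝓕⁻ h x‖ₑ ≤ ∫⁻ τ, (Icc (-R) R).indicator 1 τ * ‖h τ‖ₑ := by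
      rw [fourierInv_eq']
      refine (enorm_integral_le_lintegral_enorm _).trans (lintegral_mono fun τ => ?_)
      rw [enorm_smul, ← ofReal_norm, norm_exp_ofReal_mul_I, ofReal_one, one_mul]
      by_cases h0 : h τ = 0
      · simp [h0]
      · rw [indicator_of_mem (show τ ∈ Icc (-R) R from abs_le.1 (hs τ h0)), Pi.one_apply, one_mul]
    refine (pow_le_pow_left' h1 2).trans ((lintegral_mul_sq_le (by fun_prop (disch := measurability)) hh.1.enorm).trans (mul_le_mul' ?_ le_rfl))
    have e : ∀ τ, (Icc (-R) R).indicator (1 : ℝ → ℝ≥0∞) τ ^ 2 = (Icc (-R) R).indicator 1 τ := fun τ => by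
      by_cases h0 : τ ∈ Icc (-R) R
      · rw [indicator_of_mem h0]; simp
      · rw [indicator_of_notMem h0]; simp
    simp only [e]
    rw [lintegral_indicator_one measurableSet_Icc, Real.volume_Icc]
    exact ofReal_le_ofReal (by linarith)
  rw [eLpNorm_eq_lintegral_rpow_enorm_toReal (by simpa using hr0) ofReal_ne_top, toReal_ofReal hr0.le]
  have hpt : ∀ x, ‖𝓕⁻ h x‖ₑ ^ r ≤ (ofReal (2 * R) * Q) ^ ((r - 2) / 2) * ‖𝓕⁻ h x‖ₑ ^ 2 := fun x => by
    calc ‖𝓕⁻ h x‖ₑ ^ r = (‖𝓕⁻ h x‖ₑ ^ 2) ^ ((r - 2) / 2) * ‖𝓕⁻ h x‖ₑ ^ 2 := by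
          rw [← ENNReal.rpow_two, ← rpow_mul, ← rpow_add_of_nonneg _ _ (by linarith) (by norm_num)]; congr 1; ring
      _ ≤ _ := mul_le_mul' (rpow_le_rpow (hsup x) (by linarith)) le_rfl
  by_cases hQt : Q = ∞
  · rw [hQt, ENNReal.top_rpow_of_pos (by norm_num), ENNReal.mul_top (by rw [Ne, ENNReal.ofReal_eq_zero, not_le]; positivity)]; exact le_top
  calc (∫⁻ x, ‖𝓕⁻ h x‖ₑ ^ r) ^ (1 / r) ≤ ((ofReal (2 * R) * Q) ^ ((r - 2) / 2) * Q) ^ (1 / r) := by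
        refine rpow_le_rpow ((lintegral_mono hpt).trans ?_) (by positivity)
        rw [lintegral_const_mul' _ _ (rpow_ne_top_of_nonneg (by linarith) (mul_ne_top ofReal_ne_top hQt))]
        exact mul_le_mul' le_rfl (lintegral_fourierInv_sq_le hh)
    _ = ofReal ((2 * R) ^ (1 / 2 - 1 / r)) * Q ^ (1 / 2 : ℝ) := by
        have e1 : (r - 2) / 2 * (1 / r) = 1 / 2 - 1 / r := by field_simp
        have e2 : 0 ≤ 1 / 2 - 1 / r := e1 ▸ mul_nonneg (by linarith) hr1.le
        rw [mul_rpow_of_nonneg _ _ hr1.le, ← rpow_mul, e1, mul_rpow_of_nonneg _ _ e2,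
          ofReal_rpow_of_pos (by positivity), mul_assoc, ← rpow_add_of_nonneg _ _ e2 hr1.le, sub_add_cancel]
    _ ≤ _ := by
        refine mul_le_mul' (ofReal_le_ofReal ?_) le_rfl
        rw [Real.mul_rpow (by norm_num) (by linarith)]
        refine mul_le_mul_of_nonneg_right ?_ (by positivity)
        calc (2 : ℝ) ^ (1 / 2 - 1 / r) ≤ 2 ^ (1 : ℝ) := Real.rpow_le_rpow_of_exponent_le (by norm_num) (by linarith)
          _ = 2 := Real.rpow_one 2

theorem lowSymbol_props {ψ : ℝ → ℝ} (hψ : IsLPCutoff ψ) : Measurable (fun τ : ℝ => 1 - ∑' i : ℕ, ψ ((2 : ℝ) ^ (-(i : ℤ)) * |τ|)) ∧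
    (∀ τ : ℝ, |1 - ∑' i : ℕ, ψ ((2 : ℝ) ^ (-(i : ℤ)) * |τ|)| ≤ 1) ∧
    ∀ τ : ℝ, 1 - ∑' i : ℕ, ψ ((2 : ℝ) ^ (-(i : ℤ)) * |τ|) ≠ 0 → |τ| ≤ 1 := by
  have hinj : Function.Injective (fun i : ℕ => (i : ℤ)) := fun i j h => by simpa using h
  have hsum : ∀ τ : ℝ, Summable fun i : ℕ => ψ ((2 : ℝ) ^ (-(i : ℤ)) * |τ|) := fun τ => by
    by_cases h0 : τ = 0
    · simp [h0, hψ.zero]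
    · exact (hψ.2.2.2 |τ| (abs_ne_zero.2 h0)).summable.comp_injective hinj
  refine ⟨?_, fun τ => ?_, fun τ h => ?_⟩
  · refine measurable_const.sub (measurable_of_tendsto_metrizable (fun M => ?_) (tendsto_pi_nhds.2 fun τ => (hsum τ).hasSum.tendsto_sum_nat))
    refine measurable_fun_sum _ fun i _ => ?_
    exact (hψ.1.continuous.comp (by fun_prop)).measurable
  · have h0 : 0 ≤ ∑' i : ℕ, ψ ((2 : ℝ) ^ (-(i : ℤ)) * |τ|) := tsum_nonneg fun i => (hψ.2.1 _).1
    have h1 : ∑' i : ℕ, ψ ((2 : ℝ) ^ (-(i : ℤ)) * |τ|) ≤ 1 := by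
      by_cases ht : τ = 0
      · simp [ht, hψ.zero]
      · have hz := hψ.2.2.2 |τ| (abs_ne_zero.2 ht)
        rw [← hz.tsum_eq]
        exact tsum_comp_le_tsum_of_inj hz.summable (fun _ => (hψ.2.1 _).1) hinj
    rw [abs_le]; constructor <;> linarith
  · by_contra! hτ
    apply h
    have hz := hψ.2.2.2 |τ| (by positivity)
    have : HasSum (fun i : ℕ => ψ ((2 : ℝ) ^ (-(i : ℤ)) * |τ|)) 1 := by
      refine (hinj.hasSum_iff (f := fun l : ℤ => ψ ((2 : ℝ) ^ (-l) * |τ|)) fun l hl => ?_).2 hz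
      by_contra hne
      have h2 := (hψ.2.2.1 _ hne).2
      have hl0 : l ≤ -1 := by
        by_contra! hcon
        exact hl ⟨l.toNat, by simp only; omega⟩
      have h3 : (2 : ℝ) ^ (1 : ℤ) ≤ 2 ^ (-l) := zpow_le_zpow_right₀ (by norm_num) (by omega)
      rw [abs_of_nonneg (by positivity)] at h2
      rw [zpow_one] at h3
      nlinarith
    rw [this.tsum_eq, sub_self]

end Besov

theorem tsum_int_pow_natAbs_ne_top {q : ℝ≥0∞} (hq : q < 1) : ∑' z : ℤ, q ^ z.natAbs ≠ ∞ := by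
  have hg : ∑' k : ℕ, q ^ k ≠ ∞ := by
    rw [ENNReal.tsum_geometric]; exact ENNReal.inv_ne_top.2 (tsub_pos_of_lt hq).ne'
  rw [tsum_of_nat_of_neg_add_one ENNReal.summable ENNReal.summable]
  refine ENNReal.add_ne_top.2 ⟨by simpa using hg, ne_top_of_le_ne_top hg (tsum_le_tsum fun k => ?_)⟩
  exact pow_le_pow_right_of_le_one' hq.le (by omega)

/-- The Besov norm is controlled by the geometric mean of the `L²` norms of a function and of its
derivative, at any dyadic scale `2 ^ N ≳ 1`. -/
theorem exists_besovNorm_le {ψ : ℝ → ℝ} (hψ : IsLPCutoff ψ) {r : ℝ} (hr : 2 ≤ r) :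
    ∃ C : ℝ≥0∞, C ≠ ∞ ∧ ∀ N : ℤ, -1 ≤ N → ∀ g : ℝ → ℂ, Integrable g → Differentiable ℝ g → Integrable (deriv g) →
    besovNorm ψ r g ≤ C * (ofReal (2 ^ N) * (∫⁻ u, ‖g u‖ₑ ^ 2) + ofReal (2 ^ (-N)) * ∫⁻ u, ‖deriv g u‖ₑ ^ 2) ^ (1 / 2 : ℝ) := by
  set q : ℝ≥0∞ := (2⁻¹ : ℝ≥0∞) ^ (1 / 2 : ℝ) with hq
  have hq1 : q < 1 := ENNReal.rpow_lt_one (by simp) (by norm_num)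
  refine ⟨4 + 8 * ∑' z : ℤ, q ^ z.natAbs, ENNReal.add_ne_top.2 ⟨by simp, mul_ne_top (by simp) (tsum_int_pow_natAbs_ne_top hq1)⟩, ?_⟩
  intro N hN g hg hgd hg'
  set G0 := ∫⁻ u, ‖g u‖ₑ ^ 2
  set G1 := ∫⁻ u, ‖deriv g u‖ₑ ^ 2
  set S := ofReal (2 ^ N) * G0 + ofReal (2 ^ (-N)) * G1 with hS
  have hc := continuous_fourier_of_integrable hg
  have hint : ∀ (w : ℝ → ℝ) (R : ℝ), Measurable w → (∀ τ, |w τ| ≤ 1) → (∀ τ, w τ ≠ 0 → |τ| ≤ R) →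
      Integrable (fun τ => (w τ : ℂ) * 𝓕 g τ) := fun w R hw h1 hs => by
    refine ((hc.continuousOn.integrableOn_Icc (a := -R) (b := R)).integrable_indicator measurableSet_Icc).mono
      ((Complex.measurable_ofReal.comp hw).mul hc.measurable).aestronglyMeasurable (.of_forall fun τ => ?_)
    by_cases h0 : w τ = 0
    · simp [h0]
    · rw [indicator_of_mem (show τ ∈ Icc (-R) R from abs_le.1 (hs τ h0)), norm_mul, norm_real]
      exact mul_le_of_le_one_left (norm_nonneg _) (h1 τ)
  have hle : ∀ (w : ℝ → ℝ), (∀ τ, |w τ| ≤ 1) → ∫⁻ τ, ‖(w τ : ℂ) * 𝓕 g τ‖ₑ ^ 2 ≤ G0 := fun w h1 => by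
    refine (lintegral_mono fun τ => pow_le_pow_left' (?_ : _ ≤ ‖𝓕 g τ‖ₑ) 2).trans (lintegral_fourier_sq_le hg)
    rw [enorm_le_iff_norm_le, norm_mul, norm_real]
    exact mul_le_of_le_one_left (norm_nonneg _) (h1 τ)
  have hsc : ∀ A : ℝ≥0∞, ∀ a b : ℤ, ofReal (2 ^ a) * (ofReal (2 ^ b) * A) = ofReal (2 ^ (a + b)) * A := fun A a b => by
    rw [← mul_assoc, ← ofReal_mul (by positivity), ← zpow_add₀ two_ne_zero]
  have hlow : eLpNorm (deltaLow ψ g) (ofReal r) volume ≤ 4 * S ^ (1 / 2 : ℝ) := by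
    obtain ⟨h1, h2, h3⟩ := lowSymbol_props hψ
    refine (eLpNorm_fourierInv_le hr le_rfl (hint _ 1 h1 h2 h3) fun τ hτ => h3 τ fun h0 => hτ (by rw [h0]; simp)).trans ?_
    rw [Real.one_rpow, mul_one, ofReal_ofNat, show (4 : ℝ≥0∞) = 2 * 4 ^ (1 / 2 : ℝ) by
      rw [show (4 : ℝ≥0∞) = 2 ^ (2 : ℝ) by norm_num, ← rpow_mul]; norm_num, mul_assoc, ← mul_rpow_of_nonneg _ _ (by norm_num)]
    refine mul_le_mul' le_rfl (rpow_le_rpow ((hle _ h2).trans ?_) (by norm_num))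
    calc G0 = ofReal (2 ^ (-N)) * (ofReal (2 ^ N) * G0) := by rw [hsc, neg_add_cancel, zpow_zero, ofReal_one, one_mul]
      _ ≤ _ := mul_le_mul' ?_ le_self_add
    rw [← ofReal_ofNat]
    refine ofReal_le_ofReal ((zpow_le_zpow_right₀ (by norm_num) (by omega : -N ≤ 2)).trans (by norm_num))
  have hhigh : ∀ i : ℕ, ofReal ((2 : ℝ) ^ ((i : ℝ) / r)) * eLpNorm (deltaHigh ψ i g) (ofReal r) volume ≤
      8 * q ^ ((i : ℤ) - N).natAbs * S ^ (1 / 2 : ℝ) := fun i => by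
    set w : ℝ → ℝ := fun τ => ψ ((2 : ℝ) ^ (-(i : ℤ)) * |τ|) with hw
    have h1 : ∀ τ, |w τ| ≤ 1 := fun τ => by rw [abs_of_nonneg (hψ.2.1 _).1]; exact (hψ.2.1 _).2
    have hws : ∀ τ, w τ ≠ 0 → 1 / 2 ≤ (2 : ℝ) ^ (-(i : ℤ)) * |τ| ∧ |τ| ≤ 2 ^ (i + 1) := fun τ h0 => by
      have h := hψ.2.2.1 _ h0
      rw [abs_of_nonneg (by positivity)] at h
      refine ⟨h.1, ?_⟩
      have := h.2
      rw [zpow_neg, zpow_natCast, inv_mul_le_iff₀ (by positivity)] at this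
      rwa [pow_succ]
    have hwm : Measurable w := (hψ.1.continuous.comp (by fun_prop)).measurable
    set Q := ∫⁻ τ, ‖(w τ : ℂ) * 𝓕 g τ‖ₑ ^ 2 with hQ
    have hB : eLpNorm (deltaHigh ψ i g) (ofReal r) volume ≤ ofReal (2 * ((2 : ℝ) ^ (i + 1)) ^ (1 / 2 - 1 / r)) * Q ^ (1 / 2 : ℝ) :=
      eLpNorm_fourierInv_le hr (one_le_pow₀ one_le_two) (hint w _ hwm h1 fun τ h => (hws τ h).2) fun τ hτ => (hws τ fun h0 => hτ (by change (w τ : ℂ) * _ = 0; rw [h0, Complex.ofReal_zero, zero_mul])).2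
    have hQ1 : Q ≤ ofReal ((2 * 2 ^ (-(i : ℤ))) ^ 2) * G1 := by
      refine le_trans ?_ (mul_le_mul' le_rfl (lintegral_fourier_sq_le hg'))
      rw [← lintegral_ofReal_mul]
      refine lintegral_mono fun τ => ?_
      rw [ofReal_pow (by positivity), ← mul_pow]
      refine pow_le_pow_left' ?_ 2
      rw [← ofReal_norm, ← ofReal_norm, ← ofReal_mul (by positivity)]
      refine ofReal_le_ofReal ?_
      rw [Real.fourier_deriv hg hgd hg', norm_mul, norm_smul, norm_real]
      by_cases h0 : w τ = 0
      · rw [h0, norm_zero, zero_mul]; positivity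
      · have h2 := (hws τ h0).1
        rw [← mul_assoc]
        refine mul_le_mul_of_nonneg_right ((h1 τ).trans ?_) (norm_nonneg _)
        have : ‖(2 * π * I * τ : ℂ)‖ = 2 * π * |τ| := by simp [abs_of_pos pi_pos]
        rw [this]
        nlinarith [pi_gt_three]
    have hQS : ofReal (2 ^ (i : ℤ)) * Q ≤ 4 * (2⁻¹ ^ ((i : ℤ) - N).natAbs * S) := by
      have hz : ∀ a : ℕ, (2⁻¹ : ℝ≥0∞) ^ a = ofReal (2 ^ (-(a : ℤ))) := fun a => by
        rw [zpow_neg, ENNReal.ofReal_inv_of_pos (by positivity), zpow_natCast, ofReal_pow (by norm_num), ofReal_ofNat, ENNReal.inv_pow]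
      rw [hz]
      rcases le_total N i with h | h
      · rw [show -((((i : ℤ) - N).natAbs : ℕ) : ℤ) = N - i by omega]
        calc _ ≤ ofReal (2 ^ (i : ℤ)) * (ofReal ((2 * 2 ^ (-(i : ℤ))) ^ 2) * G1) := mul_le_mul' le_rfl hQ1
          _ = 4 * (ofReal (2 ^ (N - i)) * (ofReal (2 ^ (-N)) * G1)) := by
            rw [mul_pow, sq ((2 : ℝ) ^ (-(i : ℤ))), ofReal_mul (by norm_num), ← zpow_add₀ two_ne_zero, mul_assoc, mul_left_comm, hsc, hsc]
            congr 1 <;> [norm_num; (congr 3; ring)]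
          _ ≤ _ := mul_le_mul' le_rfl (mul_le_mul' le_rfl le_add_self)
      · rw [show -((((i : ℤ) - N).natAbs : ℕ) : ℤ) = i - N by omega]
        calc _ ≤ ofReal (2 ^ (i : ℤ)) * G0 := mul_le_mul' le_rfl (hle w h1)
          _ = 1 * (ofReal (2 ^ (i - N)) * (ofReal (2 ^ N) * G0)) := by
            rw [hsc, sub_add_cancel, one_mul]
          _ ≤ _ := mul_le_mul' (by norm_num) (mul_le_mul' le_rfl le_self_add)
    calc _ ≤ ofReal ((2 : ℝ) ^ ((i : ℝ) / r)) * (ofReal (2 * ((2 : ℝ) ^ (i + 1)) ^ (1 / 2 - 1 / r)) * Q ^ (1 / 2 : ℝ)) := mul_le_mul' le_rfl hB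
      _ ≤ ofReal (4 * (2 ^ (i : ℤ)) ^ (1 / 2 : ℝ)) * Q ^ (1 / 2 : ℝ) := by
        rw [← mul_assoc, ← ofReal_mul (by positivity)]
        refine mul_le_mul' (ofReal_le_ofReal ?_) le_rfl
        rw [zpow_natCast, ← rpow_natCast 2 i, ← rpow_natCast 2 (i + 1), ← Real.rpow_mul (by norm_num), ← Real.rpow_mul (by norm_num),
          show (2 : ℝ) ^ ((i : ℝ) / r) * (2 * 2 ^ (((i + 1 : ℕ) : ℝ) * (1 / 2 - 1 / r))) = 2 * 2 ^ ((i : ℝ) / r + ((i + 1 : ℕ) : ℝ) * (1 / 2 - 1 / r)) by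
            rw [Real.rpow_add (by norm_num)]; ring]
        have : (2 : ℝ) ^ ((i : ℝ) / r + ((i + 1 : ℕ) : ℝ) * (1 / 2 - 1 / r)) ≤ 2 ^ (1 + (i : ℝ) * (1 / 2)) := by
          refine Real.rpow_le_rpow_of_exponent_le (by norm_num) ?_
          have : 0 < 1 / r := by positivity
          push_cast
          rw [div_eq_mul_one_div]
          linarith
        rw [Real.rpow_add (by norm_num) 1, Real.rpow_one] at this
        linarith
      _ = 4 * (ofReal (2 ^ (i : ℤ)) * Q) ^ (1 / 2 : ℝ) := by
        rw [ofReal_mul (by norm_num), ofReal_ofNat, ← ofReal_rpow_of_pos (by positivity), mul_assoc, ← mul_rpow_of_nonneg _ _ (by norm_num)]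
      _ ≤ 4 * (4 * (2⁻¹ ^ ((i : ℤ) - N).natAbs * S)) ^ (1 / 2 : ℝ) := mul_le_mul' le_rfl (rpow_le_rpow hQS (by norm_num))
      _ = _ := by
        rw [mul_rpow_of_nonneg _ _ (by norm_num), mul_rpow_of_nonneg _ _ (by norm_num), hq, ← ENNReal.rpow_natCast, ← ENNReal.rpow_natCast,
          ← rpow_mul, ← rpow_mul, mul_comm (1 / 2 : ℝ), show (4 : ℝ≥0∞) ^ (1 / 2 : ℝ) = 2 by
            rw [show (4 : ℝ≥0∞) = 2 ^ (2 : ℝ) by norm_num, ← rpow_mul]; norm_num]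
        ring
  calc _ ≤ 4 * S ^ (1 / 2 : ℝ) + ∑' i : ℕ, 8 * q ^ ((i : ℤ) - N).natAbs * S ^ (1 / 2 : ℝ) := add_le_add hlow (tsum_le_tsum hhigh)
    _ ≤ _ := by
      rw [tsum_mul_right, tsum_mul_left, add_mul]
      gcongr
      exact ENNReal.tsum_comp_le_tsum_of_injective (f := fun i : ℕ => (i : ℤ) - N) (fun i j h => by simp only at h; omega) fun z => q ^ z.natAbs

section Phase
variable {Γ : ℝ → ℝ}

theorem IsGammaU.strictMonoOn (hΓ : IsGammaU Γ) : StrictMonoOn Γ (Ici 0) :=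
  strictMonoOn_of_deriv_pos (convex_Ici 0) hΓ.continuousOn fun s hs => hΓ.deriv_pos s (by simpa using hs)

theorem IsGammaU.pos (hΓ : IsGammaU Γ) {s : ℝ} (hs : 0 < s) : 0 < Γ s :=
  hΓ.map_zero ▸ hΓ.strictMonoOn (show (0 : ℝ) ≤ 0 from le_rfl) hs.le hs

theorem IsGammaU.hasDerivAt (hΓ : IsGammaU Γ) {s : ℝ} (hs : 0 < s) : HasDerivAt Γ (deriv Γ s) s :=
  (differentiableAt_of_deriv_ne_zero (hΓ.deriv_pos s hs).ne').hasDerivAt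

theorem IsGammaU.exists_doubling (hΓ : IsGammaU Γ) : ∃ c > (0 : ℝ), ∃ q > (1 : ℝ), ∃ D > (1 : ℝ), ∀ s > 0,
    c * Γ s ≤ s * deriv Γ s ∧ q * Γ s ≤ Γ (2 * s) ∧ Γ (2 * s) ≤ D * Γ s := by
  obtain ⟨c, hc, h1⟩ := hΓ.lower 1 (by simp)
  obtain ⟨C, hC, h2⟩ := hΓ.upper 1 le_rfl
  have hb : ∀ s > 0, c * Γ s ≤ s * deriv Γ s ∧ s * deriv Γ s ≤ C * Γ s := fun s hs => by
    have h1 := h1 s hs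
    have h2 := h2 s hs
    have h3 := hΓ.pos hs
    rw [iteratedDeriv_one, pow_one, abs_of_pos (div_pos (mul_pos hs (hΓ.deriv_pos s hs)) h3)] at h1 h2
    exact ⟨(le_div_iff₀ h3).1 h1, (div_le_iff₀ h3).1 h2⟩
  have hd : ∀ a : ℝ, ∀ s > 0, HasDerivAt (fun s => Real.log (Γ s) - a * Real.log s) (deriv Γ s / Γ s - a * s⁻¹) s := fun a s hs =>
    ((hΓ.hasDerivAt hs).log (hΓ.pos hs).ne').sub ((Real.hasDerivAt_log hs.ne').const_mul a)
  have hsign : ∀ a s : ℝ, 0 < s → deriv Γ s / Γ s - a * s⁻¹ = (s * deriv Γ s - a * Γ s) / (s * Γ s) := fun a s hs => by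
    have := hΓ.pos hs
    field_simp
  have hm : MonotoneOn (fun s => Real.log (Γ s) - c * Real.log s) (Ioi 0) :=
    monotoneOn_of_deriv_nonneg (convex_Ioi 0) (fun s hs => (hd c s hs).continuousAt.continuousWithinAt)
      (fun s hs => (hd c s (interior_subset hs)).differentiableAt.differentiableWithinAt) fun s hs => by
        have hs : 0 < s := interior_subset hs
        have := hΓ.pos hs
        rw [(hd c s hs).deriv, hsign c s hs]
        exact div_nonneg (sub_nonneg.2 (hb s hs).1) (by positivity)
  have ha : AntitoneOn (fun s => Real.log (Γ s) - C * Real.log s) (Ioi 0) :=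
    antitoneOn_of_deriv_nonpos (convex_Ioi 0) (fun s hs => (hd C s hs).continuousAt.continuousWithinAt)
      (fun s hs => (hd C s (interior_subset hs)).differentiableAt.differentiableWithinAt) fun s hs => by
        have hs : 0 < s := interior_subset hs
        have := hΓ.pos hs
        rw [(hd C s hs).deriv, hsign C s hs]
        exact div_nonpos_of_nonpos_of_nonneg (sub_nonpos.2 (hb s hs).2) (by positivity)
  refine ⟨c, hc, Real.exp (c * Real.log 2), Real.one_lt_exp_iff.2 (by positivity), Real.exp (C * Real.log 2), Real.one_lt_exp_iff.2 (by positivity),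
    fun s hs => ⟨(hb s hs).1, ?_⟩⟩
  have hs2 : (0 : ℝ) < 2 * s := by positivity
  have h1 := hm hs hs2 (by linarith)
  have h2 := ha hs hs2 (by linarith)
  simp only [Real.log_mul two_ne_zero hs.ne'] at h1 h2
  constructor
  · rw [← Real.exp_log (hΓ.pos hs), ← Real.exp_add, ← Real.le_log_iff_exp_le (hΓ.pos hs2)]; linarith
  · rw [← Real.exp_log (hΓ.pos hs), ← Real.exp_add, ← Real.log_le_iff_le_exp (hΓ.pos hs2)]; linarith

theorem IsGammaU.exists_kstar (hΓ : IsGammaU Γ) : ∃ D > (1 : ℝ), ∀ j : ℤ,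
    (2 : ℝ) ^ j * Γ (2 ^ kstar Γ j) ≤ 1 ∧ 1 < D * ((2 : ℝ) ^ j * Γ (2 ^ kstar Γ j)) := by
  obtain ⟨c, -, q, hq, D, hD, h⟩ := hΓ.exists_doubling
  refine ⟨D, hD, fun j => ?_⟩
  have hit : ∀ (k : ℕ) (s : ℝ), 0 < s → q ^ k * Γ s ≤ Γ (2 ^ k * s) := fun k => by
    induction k with
    | zero => simp
    | succ k ih =>
        intro s hs
        have h1 := (h (2 ^ k * s) (by positivity)).2.1
        rw [← mul_assoc, ← pow_succ'] at h1
        rw [pow_succ', mul_assoc]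
        exact (mul_le_mul_of_nonneg_left (ih s hs) (by linarith)).trans h1
  set A := {m : ℤ | (2 : ℝ) ^ j * Γ ((2 : ℝ) ^ m) ≤ 1} with hA
  have hne : A.Nonempty := by
    obtain ⟨k, hk⟩ := pow_unbounded_of_one_lt ((2 : ℝ) ^ j * Γ 1) hq
    refine ⟨-k, ?_⟩
    have h1 := hit k (2 ^ (-k : ℤ)) (by positivity)
    rw [← zpow_natCast (2 : ℝ) k, ← zpow_add₀ two_ne_zero, add_neg_cancel, zpow_zero] at h1
    refine le_of_mul_le_mul_left ?_ (pow_pos (zero_lt_one.trans hq) k)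
    rw [mul_left_comm]
    exact (mul_le_mul_of_nonneg_left h1 (by positivity)).trans (by linarith)
  have hbd : BddAbove A := by
    obtain ⟨k, hk⟩ := pow_unbounded_of_one_lt (((2 : ℝ) ^ j * Γ 1)⁻¹) hq
    refine ⟨k, fun m hm => ?_⟩
    by_contra! hlt
    have h0 : (0 : ℝ) < 2 ^ j * Γ 1 := mul_pos (by positivity) (hΓ.pos one_pos)
    have h1 := hit k 1 one_pos
    have h2 : Γ ((2 : ℝ) ^ k * 1) ≤ Γ (2 ^ m) := by
      refine hΓ.strictMonoOn.monotoneOn (show (0 : ℝ) ≤ _ by positivity) (show (0 : ℝ) ≤ _ by positivity) ?_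
      rw [mul_one, ← zpow_natCast]
      exact zpow_le_zpow_right₀ one_le_two hlt.le
    rw [inv_lt_iff_one_lt_mul₀ h0] at hk
    have h3 := mul_le_mul_of_nonneg_left (h1.trans h2) (by positivity : (0 : ℝ) ≤ 2 ^ j)
    have h4 : (2 : ℝ) ^ j * Γ (2 ^ m) ≤ 1 := hm
    linarith
  refine ⟨Int.csSup_mem hne hbd, ?_⟩
  have h1 : kstar Γ j + 1 ∉ A := fun hmem => by
    have : kstar Γ j + 1 ≤ kstar Γ j := le_csSup hbd hmem
    omega
  have h2 : (1 : ℝ) < 2 ^ j * Γ (2 ^ (kstar Γ j + 1)) := not_le.1 h1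
  rw [zpow_add₀ two_ne_zero, zpow_one, mul_comm _ (2 : ℝ)] at h2
  have := mul_le_mul_of_nonneg_left (h (2 ^ kstar Γ j) (by positivity)).2.2 (by positivity : (0 : ℝ) ≤ 2 ^ j)
  linarith

theorem IsGammaU.exists_tsum_kstar_le (hΓ : IsGammaU Γ) : ∃ M : ℕ, ∀ (S : Set ℤ) (l : ℤ) (F : ℤ → ℝ≥0∞),
    ∑' j : S, F (l + kstar Γ j) ≤ M * ∑' s, F s := by
  obtain ⟨D, hD, h⟩ := hΓ.exists_kstar
  obtain ⟨M, hM⟩ := pow_unbounded_of_one_lt D one_lt_two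
  refine ⟨M + 1, fun S l F => ?_⟩
  have hlt : ∀ i j : ℤ, kstar Γ i = kstar Γ j → i - j ≤ M := fun i j hij => by
    by_contra! hlt
    have h1 := (h i).1
    have h2 := (h j).2
    rw [hij] at h1
    have h3 : (2 : ℝ) ^ j * 2 ^ M ≤ 2 ^ i := by
      rw [← zpow_natCast, ← zpow_add₀ two_ne_zero]; exact zpow_le_zpow_right₀ one_le_two (by omega)
    have h4 := hΓ.pos (by positivity : (0 : ℝ) < 2 ^ kstar Γ j)
    have h5 : D * (2 ^ j * Γ (2 ^ kstar Γ j)) ≤ (2 ^ j * 2 ^ M) * Γ (2 ^ kstar Γ j) := by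
      nlinarith [mul_pos (by positivity : (0 : ℝ) < 2 ^ j) h4]
    linarith [mul_le_mul_of_nonneg_right h3 h4.le]
  have hinj : Function.Injective fun j : S => (l + kstar Γ j, ((j : ℤ) : ZMod (M + 1))) := fun i j hij => by
    simp only [Prod.mk.injEq, add_right_inj] at hij
    have h1 := hlt _ _ hij.1
    have h2 := hlt _ _ hij.1.symm
    have h3 := (ZMod.intCast_eq_intCast_iff_dvd_sub _ _ _).1 hij.2
    have := Int.eq_zero_of_abs_lt_dvd h3 (by rw [abs_lt]; push_cast; constructor <;> omega)
    exact Subtype.ext (by omega)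
  refine (ENNReal.tsum_comp_le_tsum_of_injective hinj fun z => F z.1).trans_eq ?_
  rw [ENNReal.tsum_prod', ← tsum_mul_left]
  simp [tsum_fintype, ZMod.card]

theorem IsGammaU.exists_Slm_bounds (hΓ : IsGammaU Γ) : ∃ B > (0 : ℝ), ∀ l m j : ℤ, 1 ≤ l → j ∈ Slm Γ l m → 0 ≤ m + l ∧
    ∀ ρ : ℝ, 1 / 2 ≤ ρ → ρ ≤ 2 → 2 ^ j * Γ (2 ^ (l + kstar Γ j) * ρ) ≤ B * 2 ^ (m + l) ∧
      2 ^ (m + l) ≤ B * (2 ^ j * (2 ^ (l + kstar Γ j) * deriv Γ (2 ^ (l + kstar Γ j) * ρ))) := by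
  obtain ⟨c, hc, q, -, D, hD, hdb⟩ := hΓ.exists_doubling
  obtain ⟨D', hD', hk⟩ := hΓ.exists_kstar
  refine ⟨2 * D + 2 * D * D' / c, by positivity, fun l m j hl hj => ?_⟩
  set s := l + kstar Γ j
  obtain ⟨hk1, hk2⟩ := hk j
  have hG := hΓ.pos (by positivity : (0 : ℝ) < 2 ^ kstar Γ j)
  obtain ⟨hj1, hj2⟩ := hj
  rw [le_div_iff₀ hG] at hj1
  rw [div_lt_iff₀ hG] at hj2
  have hmono := hΓ.strictMonoOn.monotoneOn
  have h2j : (0 : ℝ) < 2 ^ j := by positivity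
  have h2s : (0 : ℝ) < 2 ^ s := by positivity
  rw [zpow_add_one₀ two_ne_zero] at hj2
  have hpos : 0 ≤ m + l := by
    have h1 : Γ ((2 : ℝ) ^ kstar Γ j) ≤ Γ (2 ^ s) := hmono (show (0 : ℝ) ≤ _ by positivity) h2s.le (zpow_le_zpow_right₀ one_le_two (by omega))
    have h2 : (1 : ℝ) < 2 ^ (m + l) * 2 := by
      by_contra! h; exact absurd (hj2.trans_le (mul_le_of_le_one_left hG.le h)) (not_lt.2 h1)
    rw [← zpow_add_one₀ two_ne_zero, one_lt_zpow_iff_right₀ one_lt_two] at h2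
    omega
  refine ⟨hpos, fun ρ h1 h2 => ?_⟩
  have hρ : (0 : ℝ) < 2 ^ s * ρ := by positivity
  have hup : Γ (2 ^ s * ρ) ≤ D * Γ (2 ^ s) :=
    (hmono hρ.le (show (0 : ℝ) ≤ 2 * 2 ^ s by positivity) (by nlinarith)).trans (hdb _ h2s).2.2
  have hlo : Γ (2 ^ s) ≤ D * Γ (2 ^ s * ρ) :=
    (hmono h2s.le (show (0 : ℝ) ≤ 2 * (2 ^ s * ρ) by positivity) (by nlinarith)).trans (hdb _ hρ).2.2
  have hA1 : 2 ^ j * Γ (2 ^ s) ≤ 2 ^ (m + l) * 2 := by nlinarith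
  have hA2 : 2 ^ (m + l) ≤ D' * (2 ^ j * Γ (2 ^ s)) := by nlinarith
  have hd := (hdb _ hρ).1
  have hd0 := hΓ.deriv_pos _ hρ
  constructor
  · have : 0 ≤ 2 * D * D' / c * 2 ^ (m + l) := by positivity
    nlinarith
  · have h3 : c * Γ (2 ^ s * ρ) ≤ 2 * (2 ^ s * deriv Γ (2 ^ s * ρ)) := by nlinarith [mul_pos h2s hd0]
    have h4 : c * (2 ^ j * Γ (2 ^ s)) ≤ 2 * D * (2 ^ j * (2 ^ s * deriv Γ (2 ^ s * ρ))) := by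
      have := mul_le_mul_of_nonneg_left h3 (by positivity : 0 ≤ D * 2 ^ j)
      have := mul_le_mul_of_nonneg_left hlo (by positivity : 0 ≤ c * 2 ^ j)
      linarith
    have h5 : c * 2 ^ (m + l) ≤ 2 * D * D' * (2 ^ j * (2 ^ s * deriv Γ (2 ^ s * ρ))) := by nlinarith
    rw [add_mul, div_mul_eq_mul_div]
    refine ((le_div_iff₀' hc).2 h5).trans (le_add_of_nonneg_left (by positivity))

end Phase

section PhaseIntegral
variable {n : ℕ}

/-- The oscillatory integral `u ↦ ∫ e^{iuγ(|t|)} h(t) dt`. -/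
def phaseInt (γ : ℝ → ℝ) (h : Rn n → ℂ) (u : ℝ) : ℂ :=
  ∫ t, exp (I * ((u * γ ‖t‖ : ℝ) : ℂ)) * h t

theorem hasDerivAt_phaseInt {γ : ℝ → ℝ} (hγ : Continuous γ) {h : Rn n → ℂ} (hh : Continuous h) (hc : HasCompactSupport h) (u : ℝ) :
    HasDerivAt (phaseInt γ h) (I * phaseInt γ (fun t => γ ‖t‖ * h t) u) u := by
  have hh' : Integrable fun t => (γ ‖t‖ : ℂ) * h t := Continuous.integrable_of_hasCompactSupport (by fun_prop) hc.mul_left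
  have := (hasDerivAt_integral_of_dominated_loc_of_deriv_le (μ := volume) (x₀ := u) (s := univ) univ_mem
    (F := fun u t => exp (I * ((u * γ ‖t‖ : ℝ) : ℂ)) * h t)
    (F' := fun u t => I * (exp (I * ((u * γ ‖t‖ : ℝ) : ℂ)) * (γ ‖t‖ * h t))) (bound := fun t => ‖(γ ‖t‖ : ℂ) * h t‖)
    (.of_forall fun u => by fun_prop)
    (Continuous.integrable_of_hasCompactSupport (by fun_prop) hc.mul_left) (by fun_prop)
    (.of_forall fun t u _ => by rw [norm_mul, norm_mul, Complex.norm_I, one_mul, norm_exp_I_mul_ofReal', one_mul]) hh'.norm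
    (.of_forall fun t u _ => ?_)).2
  · exact this.congr_deriv (integral_const_mul _ _)
  · have h1 : HasDerivAt (fun u : ℝ => ((u * γ ‖t‖ : ℝ) : ℂ)) ((1 * γ ‖t‖ : ℝ) : ℂ) u := ((hasDerivAt_id u).mul_const (γ ‖t‖)).ofReal_comp
    exact ((h1.const_mul I).cexp.mul_const (h t)).congr_deriv (by push_cast; ring)

variable [Fact (2 ≤ n)]

theorem lintegral_phaseInt_sq_le {b m : 𝓢(Rn n, ℂ)} (hb : AnnulusSupported b) {lam : ℝ} {f : Rn n → ℂ} (hf : Integrable f) (x : Rn n)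
    {γ γ' : ℝ → ℝ} (hγ : Continuous γ) (hd : ∀ ρ > 0, HasDerivAt γ (γ' ρ) ρ) (hpos : ∀ ρ > 0, 0 < γ' ρ) {w : ℝ → ℝ} {W κ : ℝ} (hκ : 0 < κ)
    (hw : ∀ ρ, 1 / 2 ≤ ρ → ρ ≤ 2 → |w ρ| ≤ W ∧ κ ≤ γ' ρ) {h : Rn n → ℂ} (hh : Integrable h) (hhw : ∀ y, h y = w ‖y‖ * (b y * lpConv m lam f (x - y))) :
    ∫⁻ u, ‖phaseInt γ h u‖ₑ ^ 2 ≤ ofReal (2 * π * (W ^ 2 / κ)) * sqFn b m lam f x := by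
  refine (lintegral_radial_phase_sq_le hd hpos hγ.measurable hh).trans ?_
  rw [ofReal_mul (p := 2 * π) (by positivity), mul_assoc]
  refine mul_le_mul' le_rfl ?_
  rw [sqFn, ← lintegral_ofReal_mul]
  refine (setLIntegral_mono' measurableSet_Ioi fun ρ (hρ : 0 < ρ) => ?_)
  have e : ((ρ ^ (n - 1) : ℝ) : ℂ) * ∫ ω, h (ρ • (ω : Rn n)) ∂(sph n) = w ρ * spConv b m lam f ρ x := by
    have : ∫ ω, h (ρ • (ω : Rn n)) ∂(sph n) = w ρ * ∫ ω, b (ρ • (ω : Rn n)) * lpConv m lam f (x - ρ • (ω : Rn n)) ∂(sph n) := by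
      rw [← integral_const_mul]
      refine integral_congr_ae (.of_forall fun ω => ?_)
      simp only
      rw [hhw, norm_smul, norm_eq_of_mem_sphere ω, mul_one, norm_of_nonneg hρ.le]
    rw [spConv_eq_sphere b m lam hf, this]
    push_cast
    ring
  rw [e]
  by_cases hr : 1 / 2 ≤ ρ ∧ ρ ≤ 2
  · obtain ⟨h1, h2⟩ := hw ρ hr.1 hr.2
    rw [enorm_mul, mul_pow, mul_right_comm]
    refine mul_le_mul' ?_ le_rfl
    rw [← ofReal_norm, ← ofReal_pow (norm_nonneg _), ← ofReal_mul (by positivity), norm_real, div_eq_mul_one_div (W ^ 2)]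
    refine ofReal_le_ofReal (mul_le_mul (pow_le_pow_left₀ (norm_nonneg _) h1 2) (one_div_le_one_div_of_le hκ h2) ?_ (sq_nonneg _))
    exact (one_div_pos.2 (hpos ρ hρ)).le
  · simp [spConv_eq_zero hb m lam f hρ hr x]

theorem exists_besovNorm_phaseInt_le {ψ χ : ℝ → ℝ} (hψ : IsLPCutoff ψ) (hχ : IsChiCutoff χ) {r : ℝ} (hr : 2 ≤ r) {b m : 𝓢(Rn n, ℂ)}
    (hb : AnnulusSupported b) {B : ℝ} (hB : 0 < B) :
    ∃ C : ℝ≥0∞, C ≠ ∞ ∧ ∀ N : ℤ, -1 ≤ N → ∀ f : Rn n → ℂ, Integrable f → ∀ (x : Rn n) (γ γ' : ℝ → ℝ), Continuous γ → (∀ ρ > 0, HasDerivAt γ (γ' ρ) ρ) →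
    (∀ ρ > 0, 0 < γ' ρ) → (∀ ρ, 1 / 2 ≤ ρ → ρ ≤ 2 → |γ ρ| ≤ B * 2 ^ N ∧ 2 ^ N / B ≤ γ' ρ) →
    besovNorm ψ r (fun u => χ u * phaseInt γ (fun y => b y * lpConv m (2 ^ N) f (x - y)) u) ≤ C * sqFn b m (2 ^ N) f x ^ (1 / 2 : ℝ) := by
  obtain ⟨C, hC, h⟩ := exists_besovNorm_le hψ hr
  have hχs : HasCompactSupport χ := HasCompactSupport.of_support_subset_isCompact (isCompact_Icc (a := 1 / 2) (b := 4)) fun u hu => hχ.2.2.1 u hu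
  have hχd : Continuous (deriv χ) := hχ.1.continuous_deriv (by simp)
  obtain ⟨X, hX⟩ := hχd.bounded_above_of_compact_support hχs.deriv
  have hX0 : 0 ≤ X := (norm_nonneg _).trans (hX 0)
  set A := 2 * π * B * (1 + 8 * X ^ 2 + 2 * B ^ 2) with hA
  refine ⟨C * ofReal A ^ (1 / 2 : ℝ), mul_ne_top hC (by simp), fun N hN f hf x γ γ' hγ hd hpos hbd => ?_⟩
  have hL : (0 : ℝ) < 2 ^ N := by positivity
  set a := sqFn b m (2 ^ N) f x
  set h₀ : Rn n → ℂ := fun y => b y * lpConv m (2 ^ N) f (x - y) with hh₀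
  have hc₀ : Continuous h₀ := b.continuous.mul ((continuous_lpConv m _ hf).comp (by fun_prop))
  have hs₀ : HasCompactSupport h₀ := (HasCompactSupport.of_support_subset_isCompact (isCompact_closedBall (0 : Rn n) 2) fun t ht => by
    simpa using (hb t ht).2).mul_right
  set h₁ : Rn n → ℂ := fun y => γ ‖y‖ * h₀ y with hh₁
  have hc₁ : Continuous h₁ := by fun_prop
  have hs₁ : HasCompactSupport h₁ := hs₀.mul_left
  have d₀ := hasDerivAt_phaseInt hγ hc₀ hs₀
  have d₁ := hasDerivAt_phaseInt hγ hc₁ hs₁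
  have i₀ := lintegral_phaseInt_sq_le (m := m) (lam := 2 ^ N) (w := 1) (W := 1) hb hf x hγ hd hpos (div_pos hL hB) (fun ρ h1 h2 => ⟨by simp, (hbd ρ h1 h2).2⟩)
    (hc₀.integrable_of_hasCompactSupport hs₀) fun y => by simp [hh₀]
  have i₁ := lintegral_phaseInt_sq_le (w := γ) hb hf x hγ hd hpos (div_pos hL hB) hbd (hc₁.integrable_of_hasCompactSupport hs₁) fun y => rfl
  have c₀ : Continuous (phaseInt γ h₀) := continuous_iff_continuousAt.2 fun u => (d₀ u).continuousAt
  have c₁ : Continuous (phaseInt γ h₁) := continuous_iff_continuousAt.2 fun u => (d₁ u).continuousAt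
  have hχc : Continuous χ := hχ.1.continuous
  have hχ' : ∀ u, HasDerivAt χ (deriv χ u) u := fun u => (hχ.1.differentiable (by simp) u).hasDerivAt
  have dg : ∀ u, HasDerivAt (fun u => (χ u : ℂ) * phaseInt γ h₀ u) (((deriv χ u : ℝ) : ℂ) * phaseInt γ h₀ u + χ u * (I * phaseInt γ h₁ u)) u := fun u =>
    (hχ' u).ofReal_comp.mul (d₀ u)
  have eg : deriv (fun u => (χ u : ℂ) * phaseInt γ h₀ u) = fun u => ((deriv χ u : ℝ) : ℂ) * phaseInt γ h₀ u + χ u * (I * phaseInt γ h₁ u) :=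
    funext fun u => (dg u).deriv
  have hsχ : HasCompactSupport fun u => (χ u : ℂ) := hχs.comp_left (g := fun t : ℝ => (t : ℂ)) Complex.ofReal_zero
  have hsχ' : HasCompactSupport fun u => ((deriv χ u : ℝ) : ℂ) := hχs.deriv.comp_left (g := fun t : ℝ => (t : ℂ)) Complex.ofReal_zero
  refine (h N hN _ (Continuous.integrable_of_hasCompactSupport (by fun_prop) hsχ.mul_right) (fun u => (dg u).differentiableAt)
    (eg ▸ Continuous.integrable_of_hasCompactSupport (by fun_prop) (hsχ'.mul_right.add hsχ.mul_right))).trans ?_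
  rw [mul_assoc, ← mul_rpow_of_nonneg _ _ (by norm_num)]
  refine mul_le_mul' le_rfl (rpow_le_rpow ?_ (by norm_num))
  have hχ1 : ∀ u, ‖(χ u : ℂ)‖ₑ ≤ 1 := fun u => by
    rw [← ofReal_norm, norm_real, norm_of_nonneg (hχ.2.1 u).1, ← ofReal_one]; exact ofReal_le_ofReal (hχ.2.1 u).2
  have j₀ : ∫⁻ u, ‖(χ u : ℂ) * phaseInt γ h₀ u‖ₑ ^ 2 ≤ ofReal (2 * π * (1 ^ 2 / (2 ^ N / B))) * a := by
    refine (lintegral_mono fun u => pow_le_pow_left' ?_ 2).trans i₀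
    rw [enorm_mul]
    exact mul_le_of_le_one_left' (hχ1 u)
  have j₁ : ∫⁻ u, ‖deriv (fun u => (χ u : ℂ) * phaseInt γ h₀ u) u‖ₑ ^ 2 ≤
      2 * (ofReal (X ^ 2) * (ofReal (2 * π * (1 ^ 2 / (2 ^ N / B))) * a) + ofReal (2 * π * ((B * 2 ^ N) ^ 2 / (2 ^ N / B))) * a) := by
    refine le_trans ?_ (mul_le_mul' le_rfl (add_le_add (mul_le_mul' le_rfl i₀) i₁))
    rw [← lintegral_ofReal_mul, ← lintegral_add_left (by fun_prop), ← lintegral_const_mul' _ _ (by simp), eg]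
    refine lintegral_mono fun u => ?_
    have h1 : ‖((deriv χ u : ℝ) : ℂ) * phaseInt γ h₀ u + χ u * (I * phaseInt γ h₁ u)‖ₑ ≤ ofReal X * ‖phaseInt γ h₀ u‖ₑ + ‖phaseInt γ h₁ u‖ₑ := by
      refine (enorm_add_le _ _).trans (add_le_add ?_ ?_)
      · rw [enorm_mul, ← ofReal_norm ((deriv χ u : ℝ) : ℂ), norm_real]
        exact mul_le_mul' (ofReal_le_ofReal (hX u)) le_rfl
      · rw [enorm_mul, enorm_mul, ← ofReal_norm I, Complex.norm_I, ofReal_one, one_mul]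
        exact mul_le_of_le_one_left' (hχ1 u)
    refine (pow_le_pow_left' h1 2).trans ?_
    rw [ofReal_pow hX0, ← mul_pow]
    have := ENNReal.rpow_add_le_mul_rpow_add_rpow (ofReal X * ‖phaseInt γ h₀ u‖ₑ) ‖phaseInt γ h₁ u‖ₑ one_le_two
    norm_num at this
    exact this
  calc _ ≤ ofReal (2 ^ N) * (ofReal (2 * π * (1 ^ 2 / (2 ^ N / B))) * a) + ofReal (2 ^ (-N)) *
        (2 * (ofReal (X ^ 2) * (ofReal (2 * π * (1 ^ 2 / (2 ^ N / B))) * a) + ofReal (2 * π * ((B * 2 ^ N) ^ 2 / (2 ^ N / B))) * a)) :=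
        add_le_add (mul_le_mul' le_rfl j₀) (mul_le_mul' le_rfl j₁)
    _ = ofReal (2 * π * B * (1 + 2 * X ^ 2 * (2 ^ (-N)) ^ 2 + 2 * B ^ 2)) * a := by
      rw [← ofReal_ofNat 2, ← mul_assoc, ← mul_assoc (ofReal (X ^ 2)), ← add_mul, ← mul_assoc, ← mul_assoc, ← add_mul, ← ofReal_mul hL.le,
        ← ofReal_mul (by positivity), ← ofReal_mul (by positivity), ← ofReal_add (by positivity) (by positivity),
        ← ofReal_mul (by positivity), ← ofReal_add (by positivity) (by positivity)]
      congr 2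
      rw [zpow_neg]
      field_simp
      ring
    _ ≤ _ := by
      refine mul_le_mul' (ofReal_le_ofReal ?_) le_rfl
      have : (2 : ℝ) ^ (-N) ≤ 2 := (zpow_le_zpow_right₀ one_le_two (by omega : -N ≤ 1)).trans_eq (zpow_one _)
      have : ((2 : ℝ) ^ (-N)) ^ 2 ≤ 2 ^ 2 := pow_le_pow_left₀ (by positivity) this 2
      rw [hA]
      refine mul_le_mul_of_nonneg_left ?_ (by positivity)
      nlinarith [mul_le_mul_of_nonneg_left this (sq_nonneg X)]

theorem exists_schwartz_cutoff_mul {ψ : ℝ → ℝ} (hψ : IsLPCutoff ψ) {A : Rn n → ℝ} (hA : ContDiffOn ℝ (⊤ : ℕ∞) A {x | x ≠ 0}) :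
    ∃ b : 𝓢(Rn n, ℂ), ∀ t, b t = ((ψ ‖t‖ * A t : ℝ) : ℂ) := by
  have hd : ContDiff ℝ (⊤ : ℕ∞) fun t => ((ψ ‖t‖ * A t : ℝ) : ℂ) := by
    refine Complex.ofRealCLM.contDiff.comp (contDiff_iff_contDiffAt.2 fun t => ?_)
    by_cases ht : t = 0
    · refine (contDiffAt_const (c := (0 : ℝ))).congr_of_eventuallyEq ?_
      filter_upwards [Metric.ball_mem_nhds t one_half_pos] with y hy
      rw [ht, mem_ball_zero_iff] at hy
      by_contra h
      have := (hψ.2.2.1 _ (left_ne_zero_of_mul h)).1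
      rw [abs_norm] at this
      linarith
    · exact (hψ.1.contDiffAt.comp t (contDiffAt_norm ℝ ht)).mul (hA.contDiffAt (isOpen_ne.mem_nhds ht))
  have hc : HasCompactSupport fun t => ((ψ ‖t‖ * A t : ℝ) : ℂ) :=
    HasCompactSupport.of_support_subset_isCompact (isCompact_closedBall (0 : Rn n) 2) fun t ht => by
      simpa using (hψ.2.2.1 _ (left_ne_zero_of_mul (Complex.ofReal_ne_zero.1 ht))).2
  exact ⟨hc.toSchwartzMap hd, fun t => rfl⟩

theorem LPproj_eq_lpConv {ψ : ℝ → ℝ} {m : 𝓢(Rn n, ℂ)} (hm : ∀ t, m t = (ψ ‖t‖ : ℂ)) {f : Rn n → ℂ} (hf : Integrable f) {i N s : ℤ} (hi : i = N - s) :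
    LPproj ψ i f = lpConv m (2 ^ N * 2 ^ (-s)) f := by
  funext x
  rw [lpConv_eq_fourierInv m (by positivity) hf, LPproj]
  refine congrFun (congrArg _ (funext fun ξ => ?_)) x
  rw [hm, norm_smul, hi, norm_of_nonneg (by positivity), ← zpow_add₀ two_ne_zero, ← zpow_neg]
  rfl

theorem Hloc_lpConv_eq_phaseInt {ψ : ℝ → ℝ} (hψ : IsLPCutoff ψ) {K A : Rn n → ℝ} {Γ : ℝ → ℝ} {b m : 𝓢(Rn n, ℂ)}
    (hb : ∀ t, b t = ((ψ ‖t‖ * A t : ℝ) : ℂ)) {s : ℤ} (hA : ∀ t ≠ 0, K ((2 : ℝ) ^ s • t) = A t / (2 ^ s) ^ n) (lam a u : ℝ) (f : Rn n → ℂ) (x : Rn n) :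
    Hloc Γ K ψ (a * u) s (lpConv m (lam * 2 ^ (-s)) f) x =
      phaseInt (fun ρ => a * Γ (2 ^ s * max ρ 0)) (fun y => b y * lpConv m lam (fun y => f ((2 : ℝ) ^ s • y)) ((2 : ℝ) ^ (-s) • x - y)) u := by
  have hs : (0 : ℝ) < 2 ^ s := by positivity
  have h := Measure.integral_comp_smul (volume : Measure (Rn n)) (fun t => lpConv m (lam * 2 ^ (-s)) f (x - t) *
    exp (I * Complex.ofReal (a * u * Γ ‖t‖)) * Complex.ofReal (ψ ((2 : ℝ) ^ (-s) * ‖t‖) * K t)) ((2 : ℝ) ^ s)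
  rw [finrank_euclideanSpace_fin, abs_of_pos (by positivity)] at h
  rw [Hloc, ← smul_inv_smul₀ (by positivity : (((2 : ℝ) ^ s) ^ n) ≠ 0) (∫ t, _), ← h, ← integral_smul, phaseInt]
  refine integral_congr_ae (ae_of_all _ fun y => ?_)
  simp only
  rw [lpConv_dil, smul_sub, smul_smul, ← zpow_add₀ two_ne_zero, add_neg_cancel, zpow_zero, one_smul, norm_smul, norm_of_nonneg hs.le,
    ← mul_assoc (2 ^ (-s) : ℝ), ← zpow_add₀ two_ne_zero, neg_add_cancel, zpow_zero, one_mul, max_eq_left (norm_nonneg y), hb]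
  by_cases hy : y = 0
  · simp [hy, hψ.zero]
  · rw [hA y hy, real_smul, show u * (a * Γ (2 ^ s * ‖y‖)) = a * u * Γ (2 ^ s * ‖y‖) by ring]
    have : (((2 : ℝ) ^ s) ^ n : ℂ) ≠ 0 := by exact_mod_cast (by positivity : (((2 : ℝ) ^ s) ^ n) ≠ 0)
    push_cast at this ⊢
    field_simp

theorem tsum_rpow_le_rpow_tsum {ι : Type*} (f : ι → ℝ≥0∞) {q : ℝ} (hq : 1 ≤ q) : ∑' i, f i ^ q ≤ (∑' i, f i) ^ q := by
  have h (x : ℝ≥0∞) : x ^ q = x * x ^ (q - 1) := by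
    conv_rhs => enter [1]; rw [← rpow_one x]
    rw [← rpow_add_of_nonneg _ _ zero_le_one (by linarith), add_sub_cancel]
  rw [h (∑' i, f i), ← tsum_mul_right]
  refine tsum_le_tsum fun i => ?_
  rw [h]
  exact mul_le_mul' le_rfl (rpow_le_rpow (ENNReal.le_tsum i) (by linarith))

theorem exists_besovNorm_Hloc_le {Γ : ℝ → ℝ} (hΓ : IsGammaU Γ) {K A : Rn n → ℝ} (hA : ∀ s : ℤ, ∀ t ≠ 0, K ((2 : ℝ) ^ s • t) = A t / (2 ^ s) ^ n)
    {ψ χ : ℝ → ℝ} (hψ : IsLPCutoff ψ) (hχ : IsChiCutoff χ) {r : ℝ} (hr : 2 ≤ r) {b m : 𝓢(Rn n, ℂ)}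
    (hb : ∀ t, b t = ((ψ ‖t‖ * A t : ℝ) : ℂ)) (hba : AnnulusSupported b) (hm : ∀ t, m t = (ψ ‖t‖ : ℂ)) :
    ∃ C : ℝ≥0∞, C ≠ ∞ ∧ ∀ l i k j : ℤ, 1 ≤ l → |k - i| ≤ 1 → j ∈ Slm Γ l i → -1 ≤ k + l ∧ ∀ f : Rn n → ℂ, Integrable f → ∀ x,
    besovNorm ψ r (fun u => Complex.ofReal (χ u) * Hloc Γ K ψ ((2 : ℝ) ^ j * u) (l + kstar Γ j) (LPproj ψ (k - kstar Γ j) f) x)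
      ≤ C * sqS b m (2 ^ (k + l)) (l + kstar Γ j) f x ^ (1 / 2 : ℝ) := by
  obtain ⟨B, hB, h⟩ := hΓ.exists_Slm_bounds
  obtain ⟨C, hC, hbn⟩ := exists_besovNorm_phaseInt_le hψ hχ hr (m := m) hba (B := 2 * B) (by positivity)
  refine ⟨C, hC, fun l i k j hl hk hj => ?_⟩
  obtain ⟨h0, h1⟩ := h l i j hl hj
  obtain ⟨hk1, hk2⟩ := abs_le.1 hk
  refine ⟨by omega, fun f hf x => ?_⟩
  set s := l + kstar Γ j with hs
  have hs0 : (0 : ℝ) < 2 ^ s := by positivity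
  have hN1 : (2 : ℝ) ^ (i + l) ≤ 2 * 2 ^ (k + l) := by
    rw [← zpow_one_add₀ two_ne_zero]
    exact zpow_le_zpow_right₀ one_le_two (by omega)
  have hN2 : (2 : ℝ) ^ (k + l) ≤ 2 * 2 ^ (i + l) := by
    rw [← zpow_one_add₀ two_ne_zero]
    exact zpow_le_zpow_right₀ one_le_two (by omega)
  rw [LPproj_eq_lpConv hm hf (show k - kstar Γ j = k + l - s by omega)]
  simp_rw [Hloc_lpConv_eq_phaseInt hψ hb (hA s)]
  have hcont : Continuous fun ρ : ℝ => (2 : ℝ) ^ j * Γ (2 ^ s * max ρ 0) :=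
    continuous_const.mul (hΓ.continuousOn.comp_continuous (by fun_prop) fun ρ => mem_Ici.2 (by positivity))
  refine hbn _ (by omega) _ (integrable_dil hf s) _ _ (fun ρ => 2 ^ j * (2 ^ s * deriv Γ (2 ^ s * ρ))) hcont (fun ρ hρ => ?_)
    (fun ρ hρ => mul_pos (by positivity) (mul_pos hs0 (hΓ.deriv_pos _ (by positivity)))) fun ρ h2 h3 => ?_
  · refine (HasDerivAt.const_mul _ ?_).congr_of_eventuallyEq (f := fun ρ => (2 : ℝ) ^ j * Γ (2 ^ s * ρ)) ?_
    · rw [mul_comm]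
      exact (hΓ.hasDerivAt (by positivity)).comp ρ (((hasDerivAt_id ρ).const_mul _).congr_deriv (mul_one _))
    · filter_upwards [Ioi_mem_nhds hρ] with y hy
      rw [max_eq_left (le_of_lt hy)]
  · obtain ⟨h4, h5⟩ := h1 ρ h2 h3
    have hρ : 0 < ρ := by linarith
    have := hΓ.pos (mul_pos hs0 hρ)
    rw [max_eq_left hρ.le, abs_of_pos (by positivity), div_le_iff₀ (by positivity)]
    constructor <;> nlinarith

end PhaseIntegral

/-- Lemma 6.7 (a building block for Proposition 6.2): the `W_{r,p}` estimate in the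
degenerate frequency range `|k − m| ≤ 𝒞`. -/
theorem Wrp_estimate_large_p (n : ℕ) (hn : 2 ≤ n) (Γ : ℝ → ℝ) (hΓ : IsGammaU Γ)
    (K : Rn n → ℝ) (hK : IsHomCZKernel n K) (ψ : ℝ → ℝ) (hψ : IsLPCutoff ψ)
    (χ : ℝ → ℝ) (hχ : IsChiCutoff χ) (p r : ℝ) (hr : 2 ≤ r)
    (hp : 2 * (n + 1) / (n - 1) < p) :
    ∃ 𝒞 : ℕ, 1 ≤ 𝒞 ∧ ∃ C > (0 : ℝ), ∀ l m k : ℤ, 1 ≤ l → |k - m| ≤ (𝒞 : ℤ) →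
      ∀ f : SchwartzMap (Rn n) ℂ,
      lpNormENN p
          (fun x => (∑' j : Slm Γ l m,
            besovNorm ψ r (fun u =>
              Complex.ofReal (χ u) *
                Hloc Γ K ψ ((2 : ℝ) ^ (j : ℤ) * u) (l + kstar Γ (j : ℤ))
                  (LPproj ψ (k - kstar Γ (j : ℤ)) (⇑f)) x) ^ r) ^ (1 / r)) volume
        ≤ ENNReal.ofReal (C * (2 : ℝ) ^ (-((n : ℝ) * ((m : ℝ) + (l : ℝ)) / p))) *
            eLpNorm (⇑f) (ENNReal.ofReal p) volume := by
  have : Fact (2 ≤ n) := ⟨hn⟩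
  obtain ⟨Ω, hΩ, hΩ1, -, hΩ2⟩ := hK
  have hn2 : (2 : ℝ) ≤ n := by exact_mod_cast hn
  have hp' : ((n : ℝ) + 1) / (n - 1) < p / 2 := by
    rw [lt_div_iff₀ two_pos]
    linarith [show ((n : ℝ) + 1) / (n - 1) * 2 = 2 * (n + 1) / (n - 1) by ring]
  have hp0 : 0 < p := by linarith [div_nonneg (by linarith : (0 : ℝ) ≤ n + 1) (by linarith : (0 : ℝ) ≤ n - 1)]
  have hA (s : ℤ) (t : Rn n) (ht : t ≠ 0) : K ((2 : ℝ) ^ s • t) = Ω t / ‖t‖ ^ n / (2 ^ s) ^ n := by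
    rw [hΩ2 _ (smul_ne_zero (by positivity) ht), hΩ1 _ (by positivity), norm_smul, norm_of_nonneg (by positivity), mul_pow, div_div, mul_comm]
  obtain ⟨b, hb⟩ := exists_schwartz_cutoff_mul hψ (A := fun t => Ω t / ‖t‖ ^ n)
    (hΩ.div (fun t ht => ((contDiffAt_norm ℝ ht).pow n).contDiffWithinAt) fun t ht => by simpa using fun h => absurd h ht)
  obtain ⟨m₀, hm₀⟩ := exists_schwartz_cutoff_mul (n := n) hψ (A := fun t => 1) contDiffOn_const
  simp only [mul_one] at hm₀
  have hba : AnnulusSupported b := fun t ht => by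
    rw [hb, Complex.ofReal_ne_zero] at ht
    simpa using hψ.2.2.1 _ (left_ne_zero_of_mul ht)
  have hma : AnnulusSupported m₀ := fun t ht => by
    rw [hm₀, Complex.ofReal_ne_zero] at ht
    simpa using hψ.2.2.1 _ ht
  have hm1 : ∀ t, ‖m₀ t‖ ≤ 1 := fun t => by
    rw [hm₀, norm_real, norm_of_nonneg (hψ.2.1 _).1]
    exact (hψ.2.1 _).2
  obtain ⟨C₁, hC₁, h₁⟩ := exists_besovNorm_Hloc_le hΓ hA hψ hχ hr hb hba hm₀
  obtain ⟨C₂, hC₂, h₂⟩ := exists_lintegral_tsum_sqS_le b m₀ hba hma hm1 hp'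
  obtain ⟨M, hM⟩ := hΓ.exists_tsum_kstar_le
  set D : ℝ≥0∞ := ((C₁ ^ 2 * M) ^ (p / 2) * C₂) ^ (1 / p) with hD
  have hDt : D ≠ ∞ := rpow_ne_top_of_nonneg (by positivity) (mul_ne_top
    (rpow_ne_top_of_nonneg (by positivity) (mul_ne_top (by simp [hC₁]) (by simp))) hC₂)
  refine ⟨1, le_rfl, D.toReal * 2 ^ (n / p) + 1, by positivity, fun l m k hl hk f => ?_⟩
  rcases (Slm Γ l m).eq_empty_or_nonempty with hS | ⟨j₀, hj₀⟩
  · have : IsEmpty (Slm Γ l m) := isEmpty_coe_sort.2 hS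
    simp only [lpNormENN, tsum_empty]
    rw [zero_rpow_of_pos (by positivity)]
    simp [zero_rpow_of_pos hp0, zero_rpow_of_pos (inv_pos.2 hp0)]
  push_cast at hk
  have hf : Integrable f := f.integrable
  have hf2 : ∫⁻ x, ‖f x‖ₑ ^ 2 ≠ ∞ := by
    have := (f.memLp 2 volume).eLpNorm_lt_top
    rw [eLpNorm_lt_top_iff_lintegral_rpow_enorm_lt_top (by simp) (by simp)] at this
    simpa using this.ne
  set a : ℤ → Rn n → ℝ≥0∞ := fun s => sqS b m₀ (2 ^ (k + l)) s f
  have hpt (x : Rn n) : (∑' j : Slm Γ l m, besovNorm ψ r (fun u => Complex.ofReal (χ u) * Hloc Γ K ψ ((2 : ℝ) ^ (j : ℤ) * u) (l + kstar Γ (j : ℤ))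
      (LPproj ψ (k - kstar Γ (j : ℤ)) (⇑f)) x) ^ r) ^ (1 / r) ≤ (C₁ ^ 2 * M * ∑' s, a s x) ^ (1 / 2 : ℝ) := by
    calc _ ≤ (∑' j : Slm Γ l m, (C₁ ^ 2 * a (l + kstar Γ j) x) ^ (r / 2)) ^ (1 / r) := by
          refine rpow_le_rpow (tsum_le_tsum fun j => ?_) (by positivity)
          refine (rpow_le_rpow ((h₁ l m k j hl hk j.2).2 f hf x) (by positivity)).trans_eq ?_
          rw [show r / 2 = 1 / 2 * r by ring, rpow_mul, mul_rpow_of_nonneg (C₁ ^ 2) _ (by norm_num), ← ENNReal.rpow_natCast C₁ 2,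
            ← rpow_mul]
          norm_num [a]
      _ ≤ ((∑' j : Slm Γ l m, C₁ ^ 2 * a (l + kstar Γ j) x) ^ (r / 2)) ^ (1 / r) :=
          rpow_le_rpow (tsum_rpow_le_rpow_tsum _ (by linarith)) (by positivity)
      _ = (∑' j : Slm Γ l m, C₁ ^ 2 * a (l + kstar Γ j) x) ^ (1 / 2 : ℝ) := by
          rw [← rpow_mul]
          congr 1
          field_simp
      _ ≤ _ := by
          rw [tsum_mul_left, mul_assoc]
          exact rpow_le_rpow (mul_le_mul' le_rfl (hM _ l fun s => a s x)) (by norm_num)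
  have hN : -1 ≤ k + l := (h₁ l m k j₀ hl hk hj₀).1
  have hsc : (ofReal (((2 : ℝ) ^ (k + l)) ^ n)⁻¹) ^ (1 / p) ≤ ofReal (2 ^ (n / p) * (2 : ℝ) ^ (-((n : ℝ) * ((m : ℝ) + (l : ℝ)) / p))) := by
    rw [ofReal_rpow_of_nonneg (by positivity) (by positivity), ← Real.rpow_intCast, ← rpow_natCast, ← Real.rpow_mul zero_le_two,
      ← Real.rpow_neg zero_le_two, ← Real.rpow_mul zero_le_two, ← Real.rpow_add two_pos]
    refine ofReal_le_ofReal (Real.rpow_le_rpow_of_exponent_le one_le_two ?_)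
    have : (m : ℝ) - 1 ≤ k := by exact_mod_cast (by linarith [(abs_le.1 hk).1] : m - 1 ≤ k)
    push_cast
    rw [← sub_nonneg, show (n : ℝ) / p + -(n * (m + l) / p) - -((k + l) * n) * (1 / p) = n / p * (k - (m - 1)) by ring]
    exact mul_nonneg (by positivity) (by linarith)
  have hL : eLpNorm (⇑f) (ofReal p) volume = (∫⁻ x, ‖f x‖ₑ ^ (2 * (p / 2))) ^ (1 / p) := by
    rw [eLpNorm_eq_lintegral_rpow_enorm_toReal (by simpa using hp0) ofReal_ne_top, toReal_ofReal hp0.le, mul_div_cancel₀ p two_ne_zero]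
  have hT : (C₁ ^ 2 * M) ^ (p / 2) ≠ ∞ := rpow_ne_top_of_nonneg (by positivity) (mul_ne_top (by simp [hC₁]) (by simp))
  calc _ ≤ (∫⁻ x, (C₁ ^ 2 * M) ^ (p / 2) * (∑' s, a s x) ^ (p / 2)) ^ (1 / p) := by
        refine rpow_le_rpow (lintegral_mono fun x => ?_) (by positivity)
        refine (rpow_le_rpow (hpt x) hp0.le).trans_eq ?_
        rw [← rpow_mul, ← mul_rpow_of_nonneg _ _ (by positivity)]
        congr 1
        ring
    _ ≤ ((C₁ ^ 2 * M) ^ (p / 2) * (C₂ * (ofReal (((2 : ℝ) ^ (k + l)) ^ n)⁻¹ * ∫⁻ x, ‖f x‖ₑ ^ (2 * (p / 2))))) ^ (1 / p) := by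
        rw [lintegral_const_mul' _ _ hT]
        exact rpow_le_rpow (mul_le_mul' le_rfl (h₂ _ hN _ rfl f hf f.continuous.measurable hf2)) (by positivity)
    _ = D * (ofReal (((2 : ℝ) ^ (k + l)) ^ n)⁻¹ ^ (1 / p) * eLpNorm (⇑f) (ofReal p) volume) := by
        rw [← mul_assoc, mul_rpow_of_nonneg _ _ (by positivity), mul_rpow_of_nonneg _ (∫⁻ x, _) (by positivity), hL]
    _ ≤ _ := by
        rw [← mul_assoc]
        refine mul_le_mul' ((mul_le_mul' le_rfl hsc).trans ?_) le_rfl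
        conv_lhs => rw [← ofReal_toReal hDt]
        rw [← ofReal_mul toReal_nonneg, ← mul_assoc]
        exact ofReal_le_ofReal (mul_le_mul_of_nonneg_right (by linarith) (by positivity))
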